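/- (Subanalytic cell decomposition.) Let X ⊆ ℚ_p^{m+1} be a subanalytic set and f_j : X → ℚ_p subanalytic functions for j = 1,…,r. Then there exists a finite partition of X into subanalytic cells A, each with some center γ : ℚ_p^m → ℚ_p and coset μP_n, such that for each (x,t) ∈ A and each j = 1,…,r, |f_j(x,t)| = |δ_j(x)| · |(t−γ(x))^{a_j} μ^{−a_j}|^{1/n}, where the a_j are integers and the δ_j : ℚ_p^m → ℚ_p are subanalytic functions (with the conventions a_j = 0 and 0^0 = 1 when μ = 0). -/

import Mathlib

open Filter MeasureTheory
open scoped ENNReal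

namespace PadicSub

variable (p : ℕ) [Fact p.Prime]

/-- The coefficients (indexed by multi-indices) of a restricted power series:
they tend to `0` along the cofinite filter. -/
def IsRestrictedCoeffs {m : ℕ} (a : (Fin m → ℕ) → ℚ_[p]) : Prop :=
  Filter.Tendsto a Filter.cofinite (nhds 0)

/-- The restricted analytic function associated to a family of coefficients:
the sum of the power series on `ℤ_p^m`, and `0` outside `ℤ_p^m`. -/
noncomputable def ranalFn {m : ℕ} (a : (Fin m → ℕ) → ℚ_[p]) (x : Fin m → ℚ_[p]) : ℚ_[p] :=
  if ∀ j, ‖x j‖ ≤ 1 then ∑' i : (Fin m → ℕ), a i * ∏ j, x j ^ i j else 0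

/-- `D`-functions: the functions obtained from restricted analytic functions, polynomial
maps, and the inverse function (with the convention `0⁻¹ = 0`) by repeated composition. -/
inductive IsDFunction : {m : ℕ} → ((Fin m → ℚ_[p]) → ℚ_[p]) → Prop where
  | ranal {m : ℕ} (a : (Fin m → ℕ) → ℚ_[p]) (ha : IsRestrictedCoeffs p a) :
      IsDFunction (ranalFn p a)
  | poly {m : ℕ} (q : MvPolynomial (Fin m) ℚ_[p]) :
      IsDFunction (fun x => MvPolynomial.eval x q)
  | inv : IsDFunction (fun x : Fin 1 → ℚ_[p] => (x 0)⁻¹)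
  | comp {m n : ℕ} (f : (Fin n → ℚ_[p]) → ℚ_[p]) (g : Fin n → (Fin m → ℚ_[p]) → ℚ_[p]) :
      IsDFunction f → (∀ i, IsDFunction (g i)) →
      IsDFunction (fun x => f (fun i => g i x))

/-- `P_n`: the set of nonzero `n`-th powers in `ℚ_p`. -/
def Pset (n : ℕ) : Set ℚ_[p] := {x | ∃ y : ℚ_[p], y ≠ 0 ∧ y ^ n = x}

/-- The coset `μ P_n`. -/
def cosetP (μ : ℚ_[p]) (n : ℕ) : Set ℚ_[p] := {x | ∃ y ∈ Pset p n, x = μ * y}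

/-- A (globally) subanalytic subset of `ℚ_p^m`: a finite union of finite intersections of
sets of the form `{x | f x = 0}` and `{x | f x ∈ P_n}`, `f` a `D`-function, `n > 0`. -/
def IsSubanalytic {m : ℕ} (X : Set (Fin m → ℚ_[p])) : Prop :=
  ∃ (r s : ℕ) (F : Fin r → Fin s → Set (Fin m → ℚ_[p])),
    (∀ i j, (∃ f, IsDFunction p f ∧ F i j = {x | f x = 0}) ∨
            (∃ f n, IsDFunction p f ∧ 0 < n ∧ F i j = {x | f x ∈ Pset p n})) ∧
    X = ⋃ i, ⋂ j, F i j

/-- A semialgebraic subset of `ℚ_p^m`: a finite union of finite intersections of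
sets of the form `{x | f x = 0}` and `{x | f x ∈ P_n}`, `f` a polynomial, `n > 0`. -/
def IsSemialgebraic {m : ℕ} (X : Set (Fin m → ℚ_[p])) : Prop :=
  ∃ (r s : ℕ) (F : Fin r → Fin s → Set (Fin m → ℚ_[p])),
    (∀ i j, (∃ f : MvPolynomial (Fin m) ℚ_[p], F i j = {x | MvPolynomial.eval x f = 0}) ∨
            (∃ (f : MvPolynomial (Fin m) ℚ_[p]) (n : ℕ), 0 < n ∧
              F i j = {x | MvPolynomial.eval x f ∈ Pset p n})) ∧
    X = ⋃ i, ⋂ j, F i j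

/-- The graph of the restriction to `X` of a map `ℚ_p^m → ℚ_p^n`, inside `ℚ_p^(m+n)`. -/
def graphMap {m n : ℕ} (X : Set (Fin m → ℚ_[p])) (F : (Fin m → ℚ_[p]) → (Fin n → ℚ_[p])) :
    Set (Fin (m + n) → ℚ_[p]) :=
  {z | (fun i => z (Fin.castAdd n i)) ∈ X ∧
    F (fun i => z (Fin.castAdd n i)) = fun j => z (Fin.natAdd m j)}

/-- The graph of the restriction to `X` of a function `ℚ_p^m → ℚ_p`, inside `ℚ_p^(m+1)`. -/
def graphFun {m : ℕ} (X : Set (Fin m → ℚ_[p])) (f : (Fin m → ℚ_[p]) → ℚ_[p]) :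
    Set (Fin (m + 1) → ℚ_[p]) :=
  {z | (fun i : Fin m => z i.castSucc) ∈ X ∧ f (fun i : Fin m => z i.castSucc) = z (Fin.last m)}

/-- A function `ℚ_p^m → ℚ_p` is subanalytic on `X` if its graph over `X` is subanalytic. -/
def IsSubanalyticFnOn {m : ℕ} (X : Set (Fin m → ℚ_[p])) (f : (Fin m → ℚ_[p]) → ℚ_[p]) : Prop :=
  IsSubanalytic p (graphFun p X f)

/-- A (totally defined) subanalytic function `ℚ_p^m → ℚ_p`. -/
def IsSubanalyticFn {m : ℕ} (f : (Fin m → ℚ_[p]) → ℚ_[p]) : Prop :=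
  IsSubanalyticFnOn p Set.univ f

/-- A function `ℚ_p^m → ℚ_p` is semialgebraic on `X` if its graph over `X` is
semialgebraic. -/
def IsSemialgebraicFnOn {m : ℕ} (X : Set (Fin m → ℚ_[p])) (f : (Fin m → ℚ_[p]) → ℚ_[p]) :
    Prop :=
  IsSemialgebraic p (graphFun p X f)

/-- A subanalytic subset of `ℚ_p` (one-variable version). -/
def IsSubanalytic1 (X : Set ℚ_[p]) : Prop :=
  IsSubanalytic p {z : Fin 1 → ℚ_[p] | z 0 ∈ X}

/-- A semialgebraic subset of `ℚ_p` (one-variable version). -/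
def IsSemialgebraic1 (X : Set ℚ_[p]) : Prop :=
  IsSemialgebraic p {z : Fin 1 → ℚ_[p] | z 0 ∈ X}

/-- A function `ℚ_p → ℚ_p` subanalytic on `X ⊆ ℚ_p`: its graph over `X` is a subanalytic
subset of `ℚ_p²`. -/
def IsSubanalyticFnOn1 (X : Set ℚ_[p]) (f : ℚ_[p] → ℚ_[p]) : Prop :=
  IsSubanalytic p {z : Fin 2 → ℚ_[p] | z 0 ∈ X ∧ f (z 0) = z 1}

/-- A function `ℚ_p → ℚ_p` semialgebraic on `X ⊆ ℚ_p`: its graph over `X` is a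
semialgebraic subset of `ℚ_p²`. -/
def IsSemialgebraicFnOn1 (X : Set ℚ_[p]) (f : ℚ_[p] → ℚ_[p]) : Prop :=
  IsSemialgebraic p {z : Fin 2 → ℚ_[p] | z 0 ∈ X ∧ f (z 0) = z 1}

/-- Interpretation of the symbols `□ᵢ` in the definition of cells: `true` means `<` and
`false` means "no condition". -/
def sqRel (b : Bool) (x y : ℝ) : Prop := b = true → x < y

/-- A cell in `ℚ_p`, presented with its center `γ` and coset data `μ`, `n`. -/
def IsCell1 (A : Set ℚ_[p]) (γ μ : ℚ_[p]) (n : ℕ) : Prop :=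
  0 < n ∧ A.Nonempty ∧
  ∃ (α β : ℚ_[p]) (b₁ b₂ : Bool), α ≠ 0 ∧ β ≠ 0 ∧
    A = {t | sqRel b₁ ‖α‖ ‖t - γ‖ ∧ sqRel b₂ ‖t - γ‖ ‖β‖ ∧ t - γ ∈ cosetP p μ n}

/-- Subanalytic cells in `ℚ_p^(m+1)`, defined inductively, presented with their center
`γ : ℚ_p^m → ℚ_p` and coset data `μ`, `n`.  The projection of the cell onto the first `m`
coordinates is required to be a cell. -/
inductive IsCell : {m : ℕ} → Set (Fin (m + 1) → ℚ_[p]) →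
    ((Fin m → ℚ_[p]) → ℚ_[p]) → ℚ_[p] → ℕ → Prop where
  | base (n : ℕ) (hn : 0 < n) (μ γ0 α β : ℚ_[p]) (hα : α ≠ 0) (hβ : β ≠ 0)
      (b₁ b₂ : Bool) (A : Set (Fin 1 → ℚ_[p])) (hne : A.Nonempty)
      (hA : A = {z | sqRel b₁ ‖α‖ ‖z 0 - γ0‖ ∧ sqRel b₂ ‖z 0 - γ0‖ ‖β‖ ∧
        z 0 - γ0 ∈ cosetP p μ n}) :
      IsCell A (fun _ => γ0) μ n
  | succ {m : ℕ} {D : Set (Fin (m + 1) → ℚ_[p])} {γD : (Fin m → ℚ_[p]) → ℚ_[p]}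
      {μD : ℚ_[p]} {nD : ℕ} (hD : IsCell D γD μD nD)
      (n : ℕ) (hn : 0 < n) (μ : ℚ_[p]) (α β γ : (Fin (m + 1) → ℚ_[p]) → ℚ_[p])
      (hα : IsSubanalyticFn p α) (hβ : IsSubanalyticFn p β) (hγ : IsSubanalyticFn p γ)
      (hα0 : ∀ x, α x ≠ 0) (hβ0 : ∀ x, β x ≠ 0)
      (b₁ b₂ : Bool) (A : Set (Fin (m + 2) → ℚ_[p]))
      (hA : A = {z | (fun i : Fin (m + 1) => z i.castSucc) ∈ D ∧
          sqRel b₁ ‖α (fun i : Fin (m + 1) => z i.castSucc)‖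
            ‖z (Fin.last (m + 1)) - γ (fun i : Fin (m + 1) => z i.castSucc)‖ ∧
          sqRel b₂ ‖z (Fin.last (m + 1)) - γ (fun i : Fin (m + 1) => z i.castSucc)‖
            ‖β (fun i : Fin (m + 1) => z i.castSucc)‖ ∧
          z (Fin.last (m + 1)) - γ (fun i : Fin (m + 1) => z i.castSucc) ∈ cosetP p μ n})
      (hproj : (fun (z : Fin (m + 2) → ℚ_[p]) (i : Fin (m + 1)) => z i.castSucc) '' A = D) :
      IsCell A γ μ n

/-- Analytic cells in `ℚ_p^(m+1)`: as subanalytic cells, but at each stage of the inductive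
definition the functions `α`, `β`, `γ` are moreover analytic on the projection of the cell. -/
inductive IsAnalyticCell : {m : ℕ} → Set (Fin (m + 1) → ℚ_[p]) →
    ((Fin m → ℚ_[p]) → ℚ_[p]) → ℚ_[p] → ℕ → Prop where
  | base (n : ℕ) (hn : 0 < n) (μ γ0 α β : ℚ_[p]) (hα : α ≠ 0) (hβ : β ≠ 0)
      (b₁ b₂ : Bool) (A : Set (Fin 1 → ℚ_[p])) (hne : A.Nonempty)
      (hA : A = {z | sqRel b₁ ‖α‖ ‖z 0 - γ0‖ ∧ sqRel b₂ ‖z 0 - γ0‖ ‖β‖ ∧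
        z 0 - γ0 ∈ cosetP p μ n}) :
      IsAnalyticCell A (fun _ => γ0) μ n
  | succ {m : ℕ} {D : Set (Fin (m + 1) → ℚ_[p])} {γD : (Fin m → ℚ_[p]) → ℚ_[p]}
      {μD : ℚ_[p]} {nD : ℕ} (hD : IsAnalyticCell D γD μD nD)
      (n : ℕ) (hn : 0 < n) (μ : ℚ_[p]) (α β γ : (Fin (m + 1) → ℚ_[p]) → ℚ_[p])
      (hα : IsSubanalyticFn p α) (hβ : IsSubanalyticFn p β) (hγ : IsSubanalyticFn p γ)
      (hαan : AnalyticOn ℚ_[p] α D) (hβan : AnalyticOn ℚ_[p] β D)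
      (hγan : AnalyticOn ℚ_[p] γ D)
      (hα0 : ∀ x, α x ≠ 0) (hβ0 : ∀ x, β x ≠ 0)
      (b₁ b₂ : Bool) (A : Set (Fin (m + 2) → ℚ_[p]))
      (hA : A = {z | (fun i : Fin (m + 1) => z i.castSucc) ∈ D ∧
          sqRel b₁ ‖α (fun i : Fin (m + 1) => z i.castSucc)‖
            ‖z (Fin.last (m + 1)) - γ (fun i : Fin (m + 1) => z i.castSucc)‖ ∧
          sqRel b₂ ‖z (Fin.last (m + 1)) - γ (fun i : Fin (m + 1) => z i.castSucc)‖
            ‖β (fun i : Fin (m + 1) => z i.castSucc)‖ ∧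
          z (Fin.last (m + 1)) - γ (fun i : Fin (m + 1) => z i.castSucc) ∈ cosetP p μ n})
      (hproj : (fun (z : Fin (m + 2) → ℚ_[p]) (i : Fin (m + 1)) => z i.castSucc) '' A = D) :
      IsAnalyticCell A γ μ n

/-- Generators of the algebra of subanalytic constructible functions on `ℚ_p^m`:
`ℤ`-valued valuations of nonvanishing subanalytic functions, and (`ℚ`-valued) norms of
subanalytic functions. -/
def constructibleGens (m : ℕ) : Set ((Fin m → ℚ_[p]) → ℚ) :=
  {g | ∃ h : (Fin m → ℚ_[p]) → ℚ_[p], IsSubanalyticFn p h ∧ (∀ x, h x ≠ 0) ∧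
        g = fun x => ((h x).valuation : ℚ)} ∪
  {g | ∃ h : (Fin m → ℚ_[p]) → ℚ_[p], IsSubanalyticFn p h ∧
        g = fun x => (padicNormE (h x) : ℚ)}

/-- The `ℚ`-algebra `C(ℚ_p^m)` of subanalytic constructible functions on `ℚ_p^m`. -/
noncomputable def ConstructibleAlg (m : ℕ) : Subalgebra ℚ ((Fin m → ℚ_[p]) → ℚ) :=
  Algebra.adjoin ℚ (constructibleGens p m)

/-- `ℤ_p^m` as a subset of `ℚ_p^m`. -/
def ZpSet (m : ℕ) : Set (Fin m → ℚ_[p]) := {x | ∀ j, ‖x j‖ ≤ 1}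

/-- A simple subset of `ℤ^n × ℚ_p^m`. -/
def IsSimpleSet (n m : ℕ) (A : Set ((Fin n → ℤ) × (Fin m → ℚ_[p]))) : Prop :=
  IsSubanalytic p {z : Fin (n + m) → ℚ_[p] |
    (∀ i : Fin n, z (Fin.castAdd m i) ≠ 0) ∧
    ((fun i : Fin n => (z (Fin.castAdd m i)).valuation),
      fun j : Fin m => z (Fin.natAdd n j)) ∈ A}

/-- A simple function `ℤ^n × ℚ_p^m → ℤ`: one whose graph is a simple set. -/
def IsSimpleFn (n m : ℕ) (h : (Fin n → ℤ) × (Fin m → ℚ_[p]) → ℤ) : Prop :=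
  IsSimpleSet p (n + 1) m
    {w | w.1 (Fin.last n) = h (fun i : Fin n => w.1 i.castSucc, w.2)}

/-- Generators of `C_simple(ℤ^n × ℚ_p^m)`: simple functions, and `p^h` for `h` simple. -/
def simpleGens (n m : ℕ) : Set ((Fin n → ℤ) × (Fin m → ℚ_[p]) → ℚ) :=
  {g | ∃ h, IsSimpleFn p n m h ∧ g = fun w => (h w : ℚ)} ∪
  {g | ∃ h, IsSimpleFn p n m h ∧ g = fun w => (p : ℚ) ^ (h w)}

/-- The `ℚ`-algebra `C_simple(ℤ^n × ℚ_p^m)`. -/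
noncomputable def SimpleAlg (n m : ℕ) : Subalgebra ℚ ((Fin n → ℤ) × (Fin m → ℚ_[p]) → ℚ) :=
  Algebra.adjoin ℚ (simpleGens p n m)

noncomputable instance : MeasurableSpace ℚ_[p] := borel _
instance : BorelSpace ℚ_[p] := ⟨rfl⟩

end PadicSub

namespace PadicSub

section Basics

variable {p : ℕ} [hp : Fact p.Prime]

theorem norm_p_lt_one' : ‖(p : ℚ_[p])‖ < 1 := by
  exact Padic.norm_p_lt_one

theorem nadd_le {a b : ℚ_[p]} {c : ℝ} (ha : ‖a‖ ≤ c) (hb : ‖b‖ ≤ c) : ‖a + b‖ ≤ c :=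
  (Padic.nonarchimedean _ _).trans (max_le ha hb)

theorem nsub_le {a b : ℚ_[p]} {c : ℝ} (ha : ‖a‖ ≤ c) (hb : ‖b‖ ≤ c) : ‖a - b‖ ≤ c := by
  rw [sub_eq_add_neg]
  exact nadd_le ha (by rwa [norm_neg])

theorem nadd_eq {a b : ℚ_[p]} (h : ‖b‖ < ‖a‖) : ‖a + b‖ = ‖a‖ := by
  rw [IsUltrametricDist.norm_add_eq_max_of_norm_ne_norm h.ne']
  exact max_eq_left h.le

theorem nsub_eq {a b : ℚ_[p]} (h : ‖b‖ < ‖a‖) : ‖a - b‖ = ‖a‖ := by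
  rw [sub_eq_add_neg]
  exact nadd_eq (by rwa [norm_neg])

theorem norm_p_pow_eq (M : ℕ) : ‖(p : ℚ_[p])‖ ^ M = (p : ℝ) ^ (-(M : ℤ)) := by
  rw [Padic.norm_p, inv_pow, ← zpow_natCast, ← zpow_neg]

theorem nsum_le {ι : Type*} {s : Finset ι} {f : ι → ℚ_[p]} {c : ℝ} (hc : 0 ≤ c)
    (h : ∀ i ∈ s, ‖f i‖ ≤ c) : ‖∑ i ∈ s, f i‖ ≤ c :=
  IsUltrametricDist.norm_sum_le_of_forall_le_of_nonneg hc h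

theorem norm_nat_le_one' (n : ℕ) : ‖(n : ℚ_[p])‖ ≤ 1 := by
  simpa using Padic.norm_int_le_one (p := p) (n : ℤ)

theorem p_ne_zero' : (p : ℚ_[p]) ≠ 0 := by
  exact_mod_cast hp.out.ne_zero

theorem norm_p_pos : 0 < ‖(p : ℚ_[p])‖ := norm_pos_iff.2 p_ne_zero'

theorem exists_pow_lt {ε : ℝ} (hε : 0 < ε) : ∃ M : ℕ, ‖(p : ℚ_[p])‖ ^ M < ε :=
  exists_pow_lt_of_lt_one hε norm_p_lt_one'

theorem norm_lt_iff_le_p_mul (x y : ℚ_[p]) : ‖x‖ < ‖y‖ ↔ y ≠ 0 ∧ ‖x‖ ≤ ‖(p : ℚ_[p])‖ * ‖y‖ := by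
  constructor
  · intro h
    have hy : y ≠ 0 := by
      rintro rfl
      simp at h
      exact absurd h (not_lt.2 (norm_nonneg _))
    refine ⟨hy, ?_⟩
    by_cases hx : x = 0
    · simp [hx]
      positivity
    rw [Padic.norm_eq_zpow_neg_valuation hx, Padic.norm_eq_zpow_neg_valuation hy] at *
    have hp1 : (1 : ℝ) < p := by exact_mod_cast hp.out.one_lt
    rw [zpow_lt_zpow_iff_right₀ hp1] at h
    rw [Padic.norm_p, ← zpow_neg_one, ← zpow_add₀ (by positivity), zpow_le_zpow_iff_right₀ hp1]
    omega
  · rintro ⟨hy, h⟩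
    refine lt_of_le_of_lt h ?_
    have := norm_pos_iff.2 hy
    nlinarith [norm_p_lt_one' (p := p)]

/-- norms of nonzero elements are integer powers of the norm of `p` -/
theorem norm_eq_zpow (x : ℚ_[p]) (hx : x ≠ 0) : ∃ k : ℤ, ‖x‖ = ‖(p : ℚ_[p]) ^ k‖ := by
  refine ⟨x.valuation, ?_⟩
  rw [Padic.norm_eq_zpow_neg_valuation hx, norm_zpow, Padic.norm_p, inv_zpow, zpow_neg]

theorem Pset_ne_zero {n : ℕ} {x : ℚ_[p]} (h : x ∈ Pset p n) : x ≠ 0 := by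
  obtain ⟨y, hy, rfl⟩ := h
  exact pow_ne_zero _ hy

theorem Pset_mul {n : ℕ} {x y : ℚ_[p]} (hx : x ∈ Pset p n) (hy : y ∈ Pset p n) :
    x * y ∈ Pset p n := by
  obtain ⟨a, ha, rfl⟩ := hx
  obtain ⟨b, hb, rfl⟩ := hy
  exact ⟨a * b, mul_ne_zero ha hb, mul_pow _ _ _⟩

theorem Pset_inv {n : ℕ} {x : ℚ_[p]} (hx : x ∈ Pset p n) : x⁻¹ ∈ Pset p n := by
  obtain ⟨a, ha, rfl⟩ := hx
  exact ⟨a⁻¹, inv_ne_zero ha, inv_pow _ _⟩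

theorem Pset_one (n : ℕ) : (1 : ℚ_[p]) ∈ Pset p n := ⟨1, one_ne_zero, one_pow _⟩

theorem Pset_pow {n k : ℕ} {x : ℚ_[p]} (hx : x ∈ Pset p n) : x ^ k ∈ Pset p n := by
  obtain ⟨a, ha, rfl⟩ := hx
  exact ⟨a ^ k, pow_ne_zero _ ha, by rw [← pow_mul, ← pow_mul, mul_comm]⟩

theorem Pset_zpow {n : ℕ} {k : ℤ} {x : ℚ_[p]} (hx : x ∈ Pset p n) : x ^ k ∈ Pset p n := by
  obtain ⟨k, rfl | rfl⟩ := k.eq_nat_or_neg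
  · simpa using Pset_pow hx
  · simpa using Pset_inv (Pset_pow hx)

theorem Pset_dvd {n N : ℕ} (h : n ∣ N) {x : ℚ_[p]} (hx : x ∈ Pset p N) : x ∈ Pset p n := by
  obtain ⟨k, rfl⟩ := h
  obtain ⟨a, ha, rfl⟩ := hx
  exact ⟨a ^ k, pow_ne_zero _ ha, by rw [← pow_mul, mul_comm]⟩

theorem Pset_powmul {n N : ℕ} {x : ℚ_[p]} (hx : x ∈ Pset p N) : x ^ n ∈ Pset p (n * N) := by
  obtain ⟨a, ha, rfl⟩ := hx
  exact ⟨a, ha, by rw [← pow_mul, mul_comm]⟩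

theorem mem_cosetP_iff {μ x : ℚ_[p]} (hμ : μ ≠ 0) {n : ℕ} :
    x ∈ cosetP p μ n ↔ x / μ ∈ Pset p n := by
  constructor
  · rintro ⟨y, hy, rfl⟩
    rwa [mul_div_cancel_left₀ _ hμ]
  · intro h
    exact ⟨_, h, by field_simp⟩

theorem mem_cosetP_zero {x : ℚ_[p]} {n : ℕ} : x ∈ cosetP p 0 n ↔ x = 0 := by
  constructor
  · rintro ⟨y, hy, rfl⟩
    simp
  · rintro rfl
    exact ⟨1, Pset_one n, by simp⟩

theorem mem_cosetP_one {x : ℚ_[p]} {n : ℕ} : x ∈ cosetP p 1 n ↔ x ∈ Pset p n := by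
  rw [mem_cosetP_iff one_ne_zero, div_one]

theorem mem_cosetP_self (x : ℚ_[p]) (n : ℕ) : x ∈ cosetP p x n := ⟨1, Pset_one n, by simp⟩

theorem cosetP_ne_zero {μ x : ℚ_[p]} (hμ : μ ≠ 0) {n : ℕ} (h : x ∈ cosetP p μ n) : x ≠ 0 := by
  obtain ⟨y, hy, rfl⟩ := h
  exact mul_ne_zero hμ (Pset_ne_zero hy)

theorem cosetP_eq_zero_iff {μ x : ℚ_[p]} {n : ℕ} (h : x ∈ cosetP p μ n) : x = 0 ↔ μ = 0 := by
  obtain ⟨y, hy, rfl⟩ := h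
  simp [Pset_ne_zero hy]

theorem cosetP_mul {μ ν x y : ℚ_[p]} {n : ℕ} (hx : x ∈ cosetP p μ n) (hy : y ∈ cosetP p ν n) :
    x * y ∈ cosetP p (μ * ν) n := by
  obtain ⟨a, ha, rfl⟩ := hx
  obtain ⟨b, hb, rfl⟩ := hy
  exact ⟨a * b, Pset_mul ha hb, by ring⟩

theorem cosetP_inv {μ x : ℚ_[p]} {n : ℕ} (hx : x ∈ cosetP p μ n) :
    x⁻¹ ∈ cosetP p μ⁻¹ n := by
  obtain ⟨a, ha, rfl⟩ := hx
  exact ⟨a⁻¹, Pset_inv ha, by rw [mul_inv]⟩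

theorem cosetP_zpow {μ x : ℚ_[p]} {n : ℕ} (k : ℤ) (hx : x ∈ cosetP p μ n) :
    x ^ k ∈ cosetP p (μ ^ k) n := by
  obtain ⟨a, ha, rfl⟩ := hx
  exact ⟨a ^ k, Pset_zpow ha, by rw [mul_zpow]⟩

theorem cosetP_dvd {n N : ℕ} (h : n ∣ N) {μ x : ℚ_[p]} (hx : x ∈ cosetP p μ N) :
    x ∈ cosetP p μ n := by
  obtain ⟨a, ha, rfl⟩ := hx
  exact ⟨a, Pset_dvd h ha, rfl⟩

theorem cosetP_trans {μ ν x : ℚ_[p]} {n : ℕ} (h1 : x ∈ cosetP p μ n) (h2 : μ ∈ cosetP p ν n) :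
    x ∈ cosetP p ν n := by
  obtain ⟨a, ha, rfl⟩ := h1
  obtain ⟨b, hb, rfl⟩ := h2
  exact ⟨b * a, Pset_mul hb ha, by ring⟩

theorem cosetP_symm {μ x : ℚ_[p]} {n : ℕ} (h1 : x ∈ cosetP p μ n) : μ ∈ cosetP p x n := by
  obtain ⟨a, ha, rfl⟩ := h1
  exact ⟨a⁻¹, Pset_inv ha, by field_simp [Pset_ne_zero ha]⟩

/-- Hensel: elements close to `1` are `n`-th powers, of an element close to `1`. -/
theorem exists_near_one_pow (n : ℕ) (hn : 0 < n) :
    ∃ M : ℕ, ∀ x : ℚ_[p], ‖x - 1‖ ≤ ‖(p : ℚ_[p])‖ ^ M → x ∈ Pset p n := by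
  have hn0 : (n : ℚ_[p]) ≠ 0 := by exact_mod_cast hn.ne'
  obtain ⟨M, hM⟩ := exists_pow_lt (p := p) (ε := ‖(n : ℚ_[p])‖ ^ 2) (by positivity)
  refine ⟨M, fun x hx => ?_⟩
  have hx1 : ‖x‖ ≤ 1 := by
    have : x = (x - 1) + 1 := by ring
    rw [this]
    refine (Padic.nonarchimedean _ _).trans (max_le (hx.trans (pow_le_one₀ (norm_nonneg _) norm_p_lt_one'.le)) (by simp))
  let x' : ℤ_[p] := ⟨x, hx1⟩
  have h := hensels_lemma (p := p) (R := ℤ_[p]) (F := (Polynomial.X ^ n - Polynomial.C x')) (a := (1 : ℤ_[p]))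
  have h1 : ‖(1 : ℤ_[p]) - x'‖ < ‖(n : ℤ_[p])‖ ^ 2 := by
    have e1 : ‖(1 : ℤ_[p]) - x'‖ = ‖x - 1‖ := by
      rw [PadicInt.norm_def, norm_sub_rev x]; rfl
    have e2 : ‖(n : ℤ_[p])‖ = ‖(n : ℚ_[p])‖ := by rw [PadicInt.norm_def]; simp
    rw [e1, e2]
    exact lt_of_le_of_lt hx hM
  obtain ⟨z, hz, -⟩ := h (by simpa [Polynomial.derivative_X_pow] using h1)
  refine ⟨(z : ℚ_[p]), ?_, ?_⟩
  · rintro hz0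
    have : z = 0 := Subtype.ext hz0
    have hx0 : x = 0 := by
      simp [this, hn.ne'] at hz
      have := congrArg (fun y : ℤ_[p] => (y : ℚ_[p])) hz
      simpa [x'] using this
    rw [hx0] at hx
    simp at hx
    have h3 : ‖(n : ℚ_[p])‖ ^ 2 ≤ 1 := pow_le_one₀ (norm_nonneg _) (norm_nat_le_one' n)
    rw [Padic.norm_p, inv_pow] at hM
    linarith
  · have : z ^ n = x' := by
      simp at hz
      linear_combination hz
    have := congrArg (fun y : ℤ_[p] => (y : ℚ_[p])) this
    simpa [x'] using this

/-- units that are `N`-th powers are close to `1` for suitable `N`. -/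
theorem exists_pow_near_one (M : ℕ) :
    ∃ N : ℕ, 0 < N ∧ ∀ x ∈ Pset p N, ‖x‖ = 1 → ‖x - 1‖ ≤ ‖(p : ℚ_[p])‖ ^ M := by
  have : NeZero (p ^ M) := ⟨pow_ne_zero _ hp.out.ne_zero⟩
  refine ⟨Fintype.card (ZMod (p ^ M))ˣ, Fintype.card_pos, ?_⟩
  rintro x ⟨y, hy, rfl⟩ hx
  set N := Fintype.card (ZMod (p ^ M))ˣ with hN
  have hN0 : N ≠ 0 := Fintype.card_ne_zero
  have hy1 : ‖y‖ = 1 := by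
    rw [norm_pow] at hx
    exact (pow_eq_one_iff_of_nonneg (norm_nonneg _) hN0).1 hx
  let y' : ℤ_[p] := ⟨y, hy1.le⟩
  have hu : IsUnit y' := PadicInt.isUnit_iff.2 hy1
  have hu2 := hu.map (PadicInt.toZModPow (p := p) M)
  have h3 : (PadicInt.toZModPow (p := p) M y') ^ N = 1 := by
    obtain ⟨u, hu'⟩ := hu2
    rw [← hu', ← Units.val_pow_eq_pow_val, pow_card_eq_one]; rfl
  have h4 : y' ^ N - 1 ∈ RingHom.ker (PadicInt.toZModPow (p := p) M) := by
    rw [RingHom.mem_ker]; simp [h3]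
  rw [PadicInt.ker_toZModPow, ← PadicInt.norm_le_pow_iff_mem_span_pow] at h4
  rw [norm_p_pow_eq]
  exact h4

theorem exists_root_unique (n : ℕ) (hn : 0 < n) :
    ∃ N : ℕ, 0 < N ∧ ∀ y ∈ Pset p N, y ^ n = 1 → y = 1 := by
  have hn0 : (n : ℚ_[p]) ≠ 0 := by exact_mod_cast hn.ne'
  obtain ⟨M, hM⟩ := exists_pow_lt (p := p) (ε := ‖(n : ℚ_[p])‖) (by positivity)
  obtain ⟨N, hN, h⟩ := exists_pow_near_one (p := p) M
  refine ⟨N, hN, fun y hy hyn => ?_⟩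
  have hy1 : ‖y‖ = 1 := by
    have := congrArg norm hyn
    rw [norm_pow, norm_one] at this
    exact (pow_eq_one_iff_of_nonneg (norm_nonneg _) hn.ne').1 this
  have h1 := h y hy hy1
  by_contra hne
  have hs : ∑ i ∈ Finset.range n, y ^ i = 0 := by
    have := geom_sum_mul y n
    rw [hyn, sub_self] at this
    exact (mul_eq_zero.1 this).resolve_right (sub_ne_zero.2 hne)
  have h2 : (n : ℚ_[p]) = - ∑ i ∈ Finset.range n, (y ^ i - 1) := by
    rw [Finset.sum_sub_distrib, hs]; simp
  have h3 : ‖(n : ℚ_[p])‖ ≤ ‖(p : ℚ_[p])‖ ^ M := by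
    rw [h2, norm_neg]
    refine IsUltrametricDist.norm_sum_le_of_forall_le_of_nonneg (by positivity) ?_
    intro i _
    refine le_trans ?_ h1
    rw [← mul_geom_sum, norm_mul]
    refine mul_le_of_le_one_right (norm_nonneg _) ?_
    refine IsUltrametricDist.norm_sum_le_of_forall_le_of_nonneg zero_le_one ?_
    intro i _
    simp [hy1]
  linarith

/-- Elements of norm `≤ 1` are congruent to a natural number below `p ^ M`. -/
theorem exists_nat_near (M : ℕ) (x : ℚ_[p]) (hx : ‖x‖ ≤ 1) :
    ∃ j < p ^ M, ‖x - (j : ℚ_[p])‖ ≤ ‖(p : ℚ_[p])‖ ^ M := by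
  let x' : ℤ_[p] := ⟨x, hx⟩
  refine ⟨PadicInt.appr x' M, PadicInt.appr_lt _ _, ?_⟩
  have h4 := PadicInt.appr_spec M x'
  rw [← PadicInt.norm_le_pow_iff_mem_span_pow] at h4
  rw [norm_p_pow_eq]
  rw [PadicInt.norm_def, PadicInt.coe_sub, PadicInt.coe_natCast] at h4
  exact h4

/-- finitely many cosets of `P_n` cover `ℚ_p` -/
theorem exists_finite_cosets (n : ℕ) (hn : 0 < n) :
    ∃ S : Finset ℚ_[p], ∀ x : ℚ_[p], ∃ μ ∈ S, x ∈ cosetP p μ n := by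
  classical
  obtain ⟨M, hM⟩ := exists_near_one_pow (p := p) n hn
  refine ⟨insert 0 ((Finset.range n ×ˢ Finset.range (p ^ (M + 1))).image
    fun q : ℕ × ℕ => (p : ℚ_[p]) ^ q.1 * (q.2 : ℚ_[p])), fun x => ?_⟩
  by_cases hx : x = 0
  · exact ⟨0, by simp, by rw [mem_cosetP_zero, hx]⟩
  obtain ⟨k, hk⟩ := norm_eq_zpow x hx
  have hpne := p_ne_zero' (p := p)
  set u := x * (p : ℚ_[p]) ^ (-k) with hu
  have hu1 : ‖u‖ = 1 := by
    rw [hu, norm_mul, hk, ← norm_mul, ← zpow_add₀ hpne]; simp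
  obtain ⟨j, hj, hj2⟩ := exists_nat_near (M + 1) u hu1.le
  have hj1 : ‖(j : ℚ_[p])‖ = 1 := by
    have : (j : ℚ_[p]) = u - (u - j) := by ring
    rw [this, nsub_eq, hu1]
    rw [hu1]
    refine lt_of_le_of_lt hj2 (pow_lt_one₀ (norm_nonneg _) norm_p_lt_one' (by omega))
  have hj0 : (j : ℚ_[p]) ≠ 0 := by rw [← norm_pos_iff, hj1]; norm_num
  have huj : u / j ∈ Pset p n := by
    apply hM
    have : u / j - 1 = (u - j) / j := by field_simp
    rw [this, norm_div, hj1, div_one]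
    exact hj2.trans (pow_le_pow_of_le_one (norm_nonneg _) norm_p_lt_one'.le (by omega))
  have hn' : (0 : ℤ) < n := by exact_mod_cast hn
  have hmod := Int.emod_nonneg k hn'.ne'
  refine ⟨(p : ℚ_[p]) ^ (k % n).toNat * j, ?_, (p : ℚ_[p]) ^ (n * (k / n) : ℤ) * (u / j), ?_, ?_⟩
  · apply Finset.mem_insert_of_mem
    apply Finset.mem_image.2
    refine ⟨((k % n).toNat, j), ?_, rfl⟩
    simp only [Finset.mem_product, Finset.mem_range]
    refine ⟨?_, hj⟩
    have := Int.emod_lt_of_pos k hn'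
    omega
  · refine Pset_mul ⟨(p : ℚ_[p]) ^ (k / n), zpow_ne_zero _ hpne, ?_⟩ huj
    rw [← zpow_natCast, ← zpow_mul, mul_comm]
  · rw [← zpow_natCast, Int.toNat_of_nonneg hmod]
    have : x = u * (p : ℚ_[p]) ^ k := by
      rw [hu, mul_assoc, ← zpow_add₀ hpne]; simp
    rw [this]
    have h5 : (p : ℚ_[p]) ^ k = (p : ℚ_[p]) ^ (k % n) * (p : ℚ_[p]) ^ (n * (k / n) : ℤ) := by
      rw [← zpow_add₀ hpne, Int.emod_add_mul_ediv]
    rw [h5]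
    field_simp

end Basics

end PadicSub

namespace PadicSub

section DFun

variable {p : ℕ} [hp : Fact p.Prime] {m : ℕ}

theorem IsDFunction.const (c : ℚ_[p]) : IsDFunction p (fun _ : Fin m → ℚ_[p] => c) := by
  simpa using IsDFunction.poly (p := p) (m := m) (MvPolynomial.C c)

theorem IsDFunction.proj (i : Fin m) : IsDFunction p (fun x : Fin m → ℚ_[p] => x i) := by
  simpa using IsDFunction.poly (p := p) (m := m) (MvPolynomial.X i)

/-- A subring of functions closed under composition with `D`-functions. -/
structure DClosed {Z : Type*} (𝔎 : Set (Z → ℚ_[p])) : Prop where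
  comp : ∀ {n : ℕ} (F : (Fin n → ℚ_[p]) → ℚ_[p]), IsDFunction p F →
    ∀ g : Fin n → Z → ℚ_[p], (∀ i, g i ∈ 𝔎) → (fun z => F (fun i => g i z)) ∈ 𝔎

namespace DClosed

variable {Z : Type*} {𝔎 : Set (Z → ℚ_[p])}

theorem const (h𝔎 : DClosed 𝔎) (c : ℚ_[p]) : (fun _ => c) ∈ 𝔎 :=
  h𝔎.comp (n := 0) _ (IsDFunction.const c) Fin.elim0 (fun i => i.elim0)

theorem add (h𝔎 : DClosed 𝔎) {f g : Z → ℚ_[p]} (hf : f ∈ 𝔎) (hg : g ∈ 𝔎) : (fun z => f z + g z) ∈ 𝔎 := by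
  have := h𝔎.comp (n := 2) _ (IsDFunction.poly (MvPolynomial.X 0 + MvPolynomial.X 1)) ![f, g]
    (by intro i; fin_cases i <;> simpa)
  simpa using this

theorem mul (h𝔎 : DClosed 𝔎) {f g : Z → ℚ_[p]} (hf : f ∈ 𝔎) (hg : g ∈ 𝔎) : (fun z => f z * g z) ∈ 𝔎 := by
  have := h𝔎.comp (n := 2) _ (IsDFunction.poly (MvPolynomial.X 0 * MvPolynomial.X 1)) ![f, g]
    (by intro i; fin_cases i <;> simpa)
  simpa using this

theorem inv (h𝔎 : DClosed 𝔎) {f : Z → ℚ_[p]} (hf : f ∈ 𝔎) : (fun z => (f z)⁻¹) ∈ 𝔎 :=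
  h𝔎.comp (n := 1) _ IsDFunction.inv (fun _ => f) (fun _ => hf)

theorem neg (h𝔎 : DClosed 𝔎) {f : Z → ℚ_[p]} (hf : f ∈ 𝔎) : (fun z => - f z) ∈ 𝔎 := by
  simpa using h𝔎.mul (h𝔎.const (-1)) hf

theorem sub (h𝔎 : DClosed 𝔎) {f g : Z → ℚ_[p]} (hf : f ∈ 𝔎) (hg : g ∈ 𝔎) : (fun z => f z - g z) ∈ 𝔎 := by
  simpa [sub_eq_add_neg] using h𝔎.add hf (h𝔎.neg hg)

theorem div (h𝔎 : DClosed 𝔎) {f g : Z → ℚ_[p]} (hf : f ∈ 𝔎) (hg : g ∈ 𝔎) : (fun z => f z / g z) ∈ 𝔎 := by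
  simpa [div_eq_mul_inv] using h𝔎.mul hf (h𝔎.inv hg)

theorem pow (h𝔎 : DClosed 𝔎) {f : Z → ℚ_[p]} (hf : f ∈ 𝔎) (k : ℕ) : (fun z => f z ^ k) ∈ 𝔎 := by
  induction k with
  | zero => simpa using h𝔎.const 1
  | succ k ih => simpa [pow_succ] using h𝔎.mul ih hf

theorem zpow (h𝔎 : DClosed 𝔎) {f : Z → ℚ_[p]} (hf : f ∈ 𝔎) (k : ℤ) : (fun z => f z ^ k) ∈ 𝔎 := by
  obtain ⟨k, rfl | rfl⟩ := k.eq_nat_or_neg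
  · simpa using h𝔎.pow hf k
  · simpa using h𝔎.inv (h𝔎.pow hf k)

theorem sum (h𝔎 : DClosed 𝔎) {ι : Type*} (s : Finset ι) (f : ι → Z → ℚ_[p]) (hf : ∀ i ∈ s, f i ∈ 𝔎) :
    (fun z => ∑ i ∈ s, f i z) ∈ 𝔎 := by
  classical
  induction s using Finset.induction_on with
  | empty => simpa using h𝔎.const 0
  | insert a s ha ih =>
    simp only [Finset.sum_insert ha]
    exact h𝔎.add (hf a (by simp)) (ih fun i hi => hf i (by simp [hi]))

theorem prod (h𝔎 : DClosed 𝔎) {ι : Type*} (s : Finset ι) (f : ι → Z → ℚ_[p]) (hf : ∀ i ∈ s, f i ∈ 𝔎) :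
    (fun z => ∏ i ∈ s, f i z) ∈ 𝔎 := by
  classical
  induction s using Finset.induction_on with
  | empty => simpa using h𝔎.const 1
  | insert a s ha ih =>
    simp only [Finset.prod_insert ha]
    exact h𝔎.mul (hf a (by simp)) (ih fun i hi => hf i (by simp [hi]))

/-- indicator of the integers -/
theorem indInt (h𝔎 : DClosed 𝔎) {f : Z → ℚ_[p]} (hf : f ∈ 𝔎) : (fun z => if ‖f z‖ ≤ 1 then (1 : ℚ_[p]) else 0) ∈ 𝔎 := by
  classical
  have h1 : IsRestrictedCoeffs p (fun i : Fin 1 → ℕ => if i = 0 then (1 : ℚ_[p]) else 0) := by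
    unfold IsRestrictedCoeffs
    apply tendsto_nhds_of_eventually_eq
    rw [Filter.eventually_cofinite]
    refine (Set.finite_singleton (0 : Fin 1 → ℕ)).subset ?_
    intro i hi
    by_contra hne
    simp only [Set.mem_singleton_iff] at hne
    simp [hne] at hi
  have := h𝔎.comp (n := 1) _ (IsDFunction.ranal _ h1) (fun _ => f) (fun _ => hf)
  convert this using 2 with z
  simp [ranalFn]

theorem indLe (h𝔎 : DClosed 𝔎) {f g : Z → ℚ_[p]} (hf : f ∈ 𝔎) (hg : g ∈ 𝔎) :
    (fun z => if ‖f z‖ ≤ ‖g z‖ then (1 : ℚ_[p]) else 0) ∈ 𝔎 := by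
  -- `(f / g) integral and (g ≠ 0 or f = 0)`
  have h1 := h𝔎.indInt (h𝔎.div hf hg)
  have h2 := h𝔎.mul hg (h𝔎.inv hg)
  have h3 := h𝔎.mul hf (h𝔎.inv hf)
  have h4 := h𝔎.mul h1 (h𝔎.sub (h𝔎.const 1) (h𝔎.mul h3 (h𝔎.sub (h𝔎.const 1) h2)))
  convert h4 using 2 with z
  by_cases hg0 : g z = 0
  · by_cases hf0 : f z = 0
    · simp [hg0, hf0]
    · simp [hg0, hf0]
  · have : ‖f z / g z‖ ≤ 1 ↔ ‖f z‖ ≤ ‖g z‖ := by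
      rw [norm_div, div_le_one (norm_pos_iff.2 hg0)]
    simp only [this, mul_inv_cancel₀ hg0]
    simp

open Classical in
theorem indEq (h𝔎 : DClosed 𝔎) {f : Z → ℚ_[p]} (hf : f ∈ 𝔎) :
    (fun z => if f z = 0 then (1 : ℚ_[p]) else 0) ∈ 𝔎 := by
  convert h𝔎.sub (h𝔎.const 1) (h𝔎.mul hf (h𝔎.inv hf)) using 2 with z
  by_cases hf0 : f z = 0 <;> simp [hf0]

end DClosed

theorem dclosed_D (m : ℕ) : DClosed {f : (Fin m → ℚ_[p]) → ℚ_[p] | IsDFunction p f} :=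
  ⟨fun F hF g hg => IsDFunction.comp F g hF hg⟩

/-- the `D`-closure of a set of functions -/
inductive Dcl {Z : Type*} (S : Set (Z → ℚ_[p])) : (Z → ℚ_[p]) → Prop where
  | base (f) (hf : f ∈ S) : Dcl S f
  | comp {n : ℕ} (F : (Fin n → ℚ_[p]) → ℚ_[p]) (hF : IsDFunction p F) (g : Fin n → Z → ℚ_[p])
      (hg : ∀ i, Dcl S (g i)) : Dcl S (fun z => F (fun i => g i z))

theorem dclosed_Dcl {Z : Type*} (S : Set (Z → ℚ_[p])) : DClosed {f | Dcl S f} :=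
  ⟨fun F hF g hg => Dcl.comp F hF g hg⟩

/-- a set of functions closed under the basic operations, up to equality, is `D`-closed -/
theorem DClosed.of_basic {Z : Type*} {𝔎 : Set (Z → ℚ_[p])}
    (hpoly : ∀ {n : ℕ} (q : MvPolynomial (Fin n) ℚ_[p]) (g : Fin n → Z → ℚ_[p]), (∀ i, g i ∈ 𝔎) →
      (fun z => MvPolynomial.eval (fun i => g i z) q) ∈ 𝔎)
    (hran : ∀ {n : ℕ} (a : (Fin n → ℕ) → ℚ_[p]), IsRestrictedCoeffs p a →
      ∀ (g : Fin n → Z → ℚ_[p]), (∀ i, g i ∈ 𝔎) → (fun z => ranalFn p a (fun i => g i z)) ∈ 𝔎)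
    (hinv : ∀ g ∈ 𝔎, (fun z => (g z)⁻¹) ∈ 𝔎) : DClosed 𝔎 := by
  refine ⟨fun F hF => ?_⟩
  induction hF with
  | ranal a ha => exact fun g hg => hran a ha g hg
  | poly q => exact fun g hg => hpoly q g hg
  | inv => exact fun g hg => hinv _ (hg 0)
  | comp f g' _ _ ihf ihg =>
    intro g hg
    exact ihf (fun i z => g' i (fun j => g j z)) (fun i => ihg i g hg)

end DFun

section Sub

variable {p : ℕ} [hp : Fact p.Prime] {m : ℕ}

/-- basic constructible sets -/
def IsBasicS (X : Set (Fin m → ℚ_[p])) : Prop :=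
  (∃ f, IsDFunction p f ∧ X = {x | f x = 0}) ∨
    (∃ f n, IsDFunction p f ∧ 0 < n ∧ X = {x | f x ∈ Pset p n})

theorem isBasicS_univ : IsBasicS (p := p) (Set.univ : Set (Fin m → ℚ_[p])) :=
  Or.inl ⟨fun _ => 0, IsDFunction.const 0, by simp⟩

theorem isBasicS_empty : IsBasicS (p := p) (∅ : Set (Fin m → ℚ_[p])) :=
  Or.inl ⟨fun _ => 1, IsDFunction.const 1, by simp⟩

/-- finite intersections of basic sets -/
inductive IsConjS : Set (Fin m → ℚ_[p]) → Prop where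
  | univ : IsConjS Set.univ
  | inter {X Y} (hX : IsBasicS (p := p) X) (hY : IsConjS Y) : IsConjS (X ∩ Y)

theorem IsConjS.inter' {X Y : Set (Fin m → ℚ_[p])} (hX : IsConjS X) (hY : IsConjS Y) :
    IsConjS (X ∩ Y) := by
  induction hX with
  | univ => simpa
  | inter h1 _ ih => rw [Set.inter_assoc]; exact IsConjS.inter h1 ih

theorem IsConjS.exists_fin {X : Set (Fin m → ℚ_[p])} (hX : IsConjS X) :
    ∃ s : ℕ, ∀ s' ≥ s, ∃ F : Fin s' → Set (Fin m → ℚ_[p]), (∀ j, IsBasicS (F j)) ∧ X = ⋂ j, F j := by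
  induction hX with
  | univ => exact ⟨0, fun s' _ => ⟨fun _ => Set.univ, fun _ => isBasicS_univ, by simp⟩⟩
  | @inter X Y h1 _ ih =>
    obtain ⟨s, hs⟩ := ih
    refine ⟨s + 1, fun s' hs' => ?_⟩
    obtain ⟨s', rfl⟩ : ∃ k, s' = k + 1 := ⟨s' - 1, by omega⟩
    obtain ⟨F, hF, rfl⟩ := hs s' (by omega)
    refine ⟨Fin.cons X F, ?_, ?_⟩
    · intro j
      refine Fin.cases ?_ ?_ j
      · simpa
      · intro i; simpa using hF i
    · ext x
      simp [Fin.forall_fin_succ]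

/-- finite unions of finite intersections of basic sets -/
inductive IsDisjS : Set (Fin m → ℚ_[p]) → Prop where
  | empty : IsDisjS ∅
  | union {X Y} (hX : IsConjS (p := p) X) (hY : IsDisjS Y) : IsDisjS (X ∪ Y)

theorem IsDisjS.exists_fin {X : Set (Fin m → ℚ_[p])} (hX : IsDisjS X) :
    ∃ r s : ℕ, ∀ s' ≥ s, ∃ F : Fin r → Fin s' → Set (Fin m → ℚ_[p]), (∀ i j, IsBasicS (F i j)) ∧
      X = ⋃ i, ⋂ j, F i j := by
  induction hX with
  | empty => exact ⟨0, 0, fun s' _ => ⟨fun i => i.elim0, fun i => i.elim0, by simp⟩⟩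
  | @union X Y h1 _ ih =>
    obtain ⟨r, s, hs⟩ := ih
    obtain ⟨s1, hs1⟩ := h1.exists_fin
    refine ⟨r + 1, max s s1, fun s' hs' => ?_⟩
    obtain ⟨F, hF, rfl⟩ := hs s' (le_trans (le_max_left _ _) hs')
    obtain ⟨G, hG, rfl⟩ := hs1 s' (le_trans (le_max_right _ _) hs')
    refine ⟨Fin.cons G F, ?_, ?_⟩
    · intro i
      refine Fin.cases ?_ ?_ i
      · simpa
      · intro i; simpa using hF i
    · ext x
      simp [Fin.exists_fin_succ]

theorem isDisjS_iff {X : Set (Fin m → ℚ_[p])} : IsSubanalytic p X ↔ IsDisjS X := by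
  constructor
  · rintro ⟨r, s, F, hF, rfl⟩
    have hc : ∀ i, IsConjS (⋂ j, F i j) := by
      intro i
      have : ∀ (s : ℕ) (G : Fin s → Set (Fin m → ℚ_[p])), (∀ j, IsBasicS (G j)) →
          IsConjS (⋂ j, G j) := by
        intro s
        induction s with
        | zero => intro G _; simpa using IsConjS.univ
        | succ s ih =>
          intro G hG
          have e : (⋂ j, G j) = G 0 ∩ ⋂ j : Fin s, G j.succ := by
            ext x; simp [Fin.forall_fin_succ]
          rw [e]
          exact IsConjS.inter (hG 0) (ih _ fun j => hG _)
      exact this s (F i) (hF i)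
    have : ∀ (r : ℕ) (G : Fin r → Set (Fin m → ℚ_[p])), (∀ j, IsConjS (G j)) →
          IsDisjS (⋃ j, G j) := by
        intro s
        induction s with
        | zero => intro G _; simpa using IsDisjS.empty
        | succ s ih =>
          intro G hG
          have e : (⋃ j, G j) = G 0 ∪ ⋃ j : Fin s, G j.succ := by
            ext x; simp [Fin.exists_fin_succ]
          rw [e]
          exact IsDisjS.union (hG 0) (ih _ fun j => hG _)
    exact this r _ hc
  · intro h
    obtain ⟨r, s, h⟩ := h.exists_fin
    obtain ⟨F, hF, hX⟩ := h s le_rfl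
    exact ⟨r, s, F, hF, hX⟩

theorem IsDisjS.of_conj {X : Set (Fin m → ℚ_[p])} (h : IsConjS X) : IsDisjS X := by
  simpa using IsDisjS.union h IsDisjS.empty

theorem IsDisjS.union' {X Y : Set (Fin m → ℚ_[p])} (hX : IsDisjS X) (hY : IsDisjS Y) :
    IsDisjS (X ∪ Y) := by
  induction hX with
  | empty => simpa
  | union h1 _ ih => rw [Set.union_assoc]; exact IsDisjS.union h1 ih

theorem IsDisjS.inter {X Y : Set (Fin m → ℚ_[p])} (hX : IsDisjS X) (hY : IsDisjS Y) :
    IsDisjS (X ∩ Y) := by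
  induction hX with
  | empty => simpa using IsDisjS.empty
  | @union X X' h1 _ ih =>
    rw [Set.union_inter_distrib_right]
    refine IsDisjS.union' ?_ ih
    clear ih
    induction hY with
    | empty => simpa using IsDisjS.empty
    | union h2 _ ih2 =>
      rw [Set.inter_union_distrib_left]
      exact IsDisjS.union (h1.inter' h2) ih2

theorem IsSubanalytic.of_basic {X : Set (Fin m → ℚ_[p])} (h : IsBasicS X) : IsSubanalytic p X := by
  rw [isDisjS_iff]
  simpa using IsDisjS.of_conj (IsConjS.inter h IsConjS.univ)

theorem IsSubanalytic.union {X Y : Set (Fin m → ℚ_[p])} (hX : IsSubanalytic p X)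
    (hY : IsSubanalytic p Y) : IsSubanalytic p (X ∪ Y) := by
  rw [isDisjS_iff] at *
  exact hX.union' hY

theorem IsSubanalytic.inter {X Y : Set (Fin m → ℚ_[p])} (hX : IsSubanalytic p X)
    (hY : IsSubanalytic p Y) : IsSubanalytic p (X ∩ Y) := by
  rw [isDisjS_iff] at *
  exact hX.inter hY

theorem isSubanalytic_univ : IsSubanalytic p (Set.univ : Set (Fin m → ℚ_[p])) :=
  IsSubanalytic.of_basic isBasicS_univ

theorem isSubanalytic_empty : IsSubanalytic p (∅ : Set (Fin m → ℚ_[p])) :=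
  IsSubanalytic.of_basic isBasicS_empty

theorem IsSubanalytic.biUnion {ι : Type*} (s : Finset ι) (F : ι → Set (Fin m → ℚ_[p]))
    (h : ∀ i ∈ s, IsSubanalytic p (F i)) : IsSubanalytic p (⋃ i ∈ s, F i) := by
  classical
  induction s using Finset.induction_on with
  | empty => simpa using isSubanalytic_empty
  | insert a s _ ih =>
    rw [Finset.set_biUnion_insert]
    exact (h a (by simp)).union (ih fun i hi => h i (by simp [hi]))

theorem isSubanalytic_eqZero {f : (Fin m → ℚ_[p]) → ℚ_[p]} (hf : IsDFunction p f) :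
    IsSubanalytic p {x | f x = 0} := IsSubanalytic.of_basic (Or.inl ⟨f, hf, rfl⟩)

theorem isSubanalytic_Pset {f : (Fin m → ℚ_[p]) → ℚ_[p]} (hf : IsDFunction p f) {n : ℕ}
    (hn : 0 < n) : IsSubanalytic p {x | f x ∈ Pset p n} :=
  IsSubanalytic.of_basic (Or.inr ⟨f, n, hf, hn, rfl⟩)

theorem isSubanalytic_coset {f : (Fin m → ℚ_[p]) → ℚ_[p]} (hf : IsDFunction p f) {n : ℕ}
    (hn : 0 < n) (μ : ℚ_[p]) : IsSubanalytic p {x | f x ∈ cosetP p μ n} := by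
  by_cases hμ : μ = 0
  · subst hμ
    simp only [mem_cosetP_zero]
    exact isSubanalytic_eqZero hf
  · simp only [mem_cosetP_iff hμ]
    exact isSubanalytic_Pset ((dclosed_D m).div hf (IsDFunction.const μ)) hn

theorem IsBasicS.compl {X : Set (Fin m → ℚ_[p])} (h : IsBasicS X) : IsSubanalytic p Xᶜ := by
  obtain ⟨f, hf, rfl⟩ | ⟨f, n, hf, hn, rfl⟩ := h
  · have h2 := isSubanalytic_eqZero ((dclosed_D m).sub (IsDFunction.const 1)
      ((dclosed_D m).mul hf ((dclosed_D m).inv hf)))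
    convert h2 using 1
    ext x
    by_cases h : f x = 0 <;> simp [h]
  · classical
    obtain ⟨S, hS⟩ := exists_finite_cosets (p := p) n hn
    have h2 := IsSubanalytic.biUnion (S.filter fun μ => μ ∉ Pset p n)
      (fun μ => {x | f x ∈ cosetP p μ n}) (fun μ _ => isSubanalytic_coset hf hn μ)
    convert h2 using 1
    ext x
    simp only [Set.mem_compl_iff, Set.mem_ofPred_eq, Finset.mem_filter, Set.mem_iUnion, exists_prop]
    constructor
    · intro h
      obtain ⟨μ, hμ, hx⟩ := hS (f x)
      refine ⟨μ, ⟨hμ, fun hμ' => h ?_⟩, hx⟩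
      rw [← mem_cosetP_one] at hμ' ⊢
      exact cosetP_trans hx hμ'
    · rintro ⟨μ, ⟨hμ, hμ'⟩, hx⟩ h
      apply hμ'
      rw [← mem_cosetP_one] at h ⊢
      exact cosetP_trans (cosetP_symm hx) h

theorem IsSubanalytic.compl {X : Set (Fin m → ℚ_[p])} (h : IsSubanalytic p X) :
    IsSubanalytic p Xᶜ := by
  rw [isDisjS_iff] at h
  induction h with
  | empty => simpa using isSubanalytic_univ
  | @union X Y h1 _ ih =>
    rw [Set.compl_union]
    refine IsSubanalytic.inter ?_ ih
    clear ih
    induction h1 with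
    | univ => simpa using isSubanalytic_empty
    | inter h2 _ ih2 =>
      rw [Set.compl_inter]
      exact h2.compl.union ih2

theorem IsSubanalytic.biInter {ι : Type*} (s : Finset ι) (F : ι → Set (Fin m → ℚ_[p]))
    (h : ∀ i ∈ s, IsSubanalytic p (F i)) : IsSubanalytic p (⋂ i ∈ s, F i) := by
  have := (IsSubanalytic.biUnion s (fun i => (F i)ᶜ) (fun i hi => (h i hi).compl)).compl
  simpa using this

theorem IsSubanalytic.preimage {n : ℕ} {X : Set (Fin m → ℚ_[p])} (h : IsSubanalytic p X)
    (g : Fin m → (Fin n → ℚ_[p]) → ℚ_[p]) (hg : ∀ i, IsDFunction p (g i)) :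
    IsSubanalytic p {x | (fun i => g i x) ∈ X} := by
  obtain ⟨r, s, F, hF, rfl⟩ := h
  refine ⟨r, s, fun i j => {x | (fun i => g i x) ∈ F i j}, ?_, ?_⟩
  · intro i j
    obtain ⟨f, hf, h⟩ | ⟨f, n, hf, hn, h⟩ := hF i j
    · exact Or.inl ⟨_, IsDFunction.comp f g hf hg, by ext x; simp [h]⟩
    · exact Or.inr ⟨_, n, IsDFunction.comp f g hf hg, hn, by ext x; simp [h]⟩
  · ext x; simp

/-- compactness -/
theorem compact_cover {Z : Type*} (X : Set Z) (𝒬 : Set (Set Z))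
    (h : ∀ 𝒰 : Ultrafilter Z, X ∈ 𝒰 → ∃ I ∈ 𝒬, I ∈ 𝒰) :
    ∃ s : Finset (Set Z), (∀ I ∈ s, I ∈ 𝒬) ∧ X ⊆ ⋃ I ∈ s, I := by
  classical
  by_contra hcon
  push Not at hcon
  have : ∃ F : Ultrafilter Z, insert X (compl '' 𝒬) ⊆ F.sets := by
    apply Ultrafilter.exists_ultrafilter_of_finite_inter_nonempty
    intro T hT
    have hT2 := hcon ((T.image compl).filter (· ∈ 𝒬)) (by simp)
    rw [Set.not_subset] at hT2
    obtain ⟨x, hx, hx2⟩ := hT2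
    refine ⟨x, ?_⟩
    rw [Set.mem_sInter]
    intro A hA
    obtain rfl | ⟨B, hB, rfl⟩ := hT hA
    · exact hx
    · intro hxB
      apply hx2
      simp only [Set.mem_iUnion]
      refine ⟨B, ?_, hxB⟩
      simp only [Finset.mem_filter, Finset.mem_image]
      exact ⟨⟨_, hA, compl_compl B⟩, hB⟩
  obtain ⟨F, hF⟩ := this
  obtain ⟨I, hI, hIF⟩ := h F (hF (by simp))
  exact Ultrafilter.compl_notMem_iff.2 hIF (hF (by right; exact ⟨I, hI, rfl⟩))

/-- a set locally (on ultrafilters) decided by subanalytic sets is subanalytic -/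
theorem subanalytic_of_decided (S : Set (Fin m → ℚ_[p]))
    (h : ∀ 𝒰 : Ultrafilter (Fin m → ℚ_[p]), ∃ I ∈ 𝒰, IsSubanalytic p I ∧ (I ⊆ S ∨ I ⊆ Sᶜ)) :
    IsSubanalytic p S := by
  obtain ⟨s, hs, hcov⟩ := compact_cover S {I | IsSubanalytic p I ∧ I ⊆ S} (by
    intro 𝒰 hS
    obtain ⟨I, hI, hI2, hI3 | hI3⟩ := h 𝒰
    · exact ⟨I, ⟨hI2, hI3⟩, hI⟩
    · exact absurd (𝒰.mem_of_superset hI hI3) (Ultrafilter.compl_notMem_iff.2 hS))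
  have e : S = ⋃ I ∈ s, I := by
    apply Set.Subset.antisymm hcov
    exact Set.iUnion₂_subset fun I hI => (hs I hI).2
  rw [e]
  exact IsSubanalytic.biUnion s _ fun I hI => (hs I hI).1

end Sub

end PadicSub

namespace PadicSub

section An

variable {p : ℕ} [hp : Fact p.Prime]

theorem evp_summable (f : PowerSeries ℤ_[p]) :
    Summable fun n => ‖PowerSeries.coeff n f * (p : ℤ_[p]) ^ n‖ := by
  have hp1 : (1 : ℝ) < p := by exact_mod_cast hp.out.one_lt
  refine Summable.of_nonneg_of_le (fun _ => norm_nonneg _) (f := fun n : ℕ => ((p : ℝ)⁻¹) ^ n) ?_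
    (summable_geometric_of_lt_one (by positivity) (inv_lt_one_of_one_lt₀ hp1))
  intro n
  rw [norm_mul, norm_pow, PadicInt.norm_p]
  exact mul_le_of_le_one_left (by positivity) (PadicInt.norm_le_one _)

theorem evp_summable' (f : PowerSeries ℤ_[p]) :
    Summable fun n => PowerSeries.coeff n f * (p : ℤ_[p]) ^ n :=
  (evp_summable f).of_norm

/-- evaluation of a power series at `p` -/
noncomputable def evp : PowerSeries ℤ_[p] →+* ℤ_[p] where
  toFun f := ∑' n, PowerSeries.coeff n f * (p : ℤ_[p]) ^ n
  map_one' := by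
    rw [tsum_eq_single 0]
    · simp
    · intro n hn
      simp [PowerSeries.coeff_one, hn]
  map_zero' := by simp
  map_add' f g := by
    rw [← (evp_summable' f).tsum_add (evp_summable' g)]
    simp [add_mul]
  map_mul' f g := by
    rw [tsum_mul_tsum_eq_tsum_sum_antidiagonal_of_summable_norm (evp_summable f) (evp_summable g)]
    refine tsum_congr fun n => ?_
    rw [PowerSeries.coeff_mul, Finset.sum_mul]
    refine Finset.sum_congr rfl fun kl hkl => ?_
    rw [Finset.HasAntidiagonal.mem_antidiagonal] at hkl
    rw [← hkl, pow_add]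
    ring

theorem evp_X : evp (p := p) PowerSeries.X = p := by
  change ∑' n, _ = _
  rw [tsum_eq_single 1]
  · simp
  · intro n hn
    simp [PowerSeries.coeff_X, hn]

theorem evp_C (a : ℤ_[p]) : evp (p := p) (PowerSeries.C a) = a := by
  change ∑' n, _ = _
  rw [tsum_eq_single 0]
  · simp
  · intro n hn
    simp [PowerSeries.coeff_C, hn]

theorem eq_of_pow_dvd {a b : ℤ_[p]} (h : ∀ N : ℕ, (p : ℤ_[p]) ^ N ∣ a - b) : a = b := by
  by_contra hne
  have h0 : a - b ≠ 0 := sub_ne_zero.2 hne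
  have h1 := h ((a - b).valuation + 1)
  rw [← Ideal.mem_span_singleton, ← PadicInt.norm_le_pow_iff_mem_span_pow,
    PadicInt.norm_le_pow_iff_le_valuation _ h0] at h1
  omega

section PS

variable {R : Type*} [CommRing R]

theorem ps_eq_of_dvd {f g : PowerSeries R} (h : ∀ N : ℕ, PowerSeries.X ^ N ∣ f - g) : f = g := by
  ext n
  have := PowerSeries.X_pow_dvd_iff.1 (h (n + 1)) n (by omega)
  rw [map_sub, sub_eq_zero] at this
  exact this

/-- `∑ Tⁿ bₙ` -/
noncomputable def psum (b : ℕ → PowerSeries R) : PowerSeries R :=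
  PowerSeries.mk fun n => ∑ i ∈ Finset.range (n + 1), PowerSeries.coeff (n - i) (b i)

theorem psum_dvd (b : ℕ → PowerSeries R) (N : ℕ) :
    PowerSeries.X ^ N ∣ psum b - ∑ i ∈ Finset.range N, PowerSeries.X ^ i * b i := by
  rw [PowerSeries.X_pow_dvd_iff]
  intro n hn
  simp only [psum, map_sub, PowerSeries.coeff_mk, map_sum, PowerSeries.coeff_X_pow_mul']
  rw [sub_eq_zero, Finset.sum_ite, Finset.sum_const_zero, add_zero]
  refine Finset.sum_congr ?_ fun _ _ => rfl
  ext i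
  simp
  omega

theorem ps_trunc_dvd (f : PowerSeries R) (N : ℕ) :
    PowerSeries.X ^ N ∣ f - ∑ i ∈ Finset.range N, PowerSeries.X ^ i * PowerSeries.C (PowerSeries.coeff i f) := by
  rw [PowerSeries.X_pow_dvd_iff]
  intro n hn
  simp only [map_sub, map_sum, PowerSeries.coeff_X_pow_mul', PowerSeries.coeff_C]
  rw [sub_eq_zero, Finset.sum_eq_single n]
  · simp
  · intro b _ hb
    split_ifs <;> first | rfl | (exfalso; omega)
  · simp [hn]

end PS

variable {σ τ : Type*}

/-- evaluation of a `T`-adic series of polynomials at `x` and `T = p`. -/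
noncomputable def theta (x : σ → ℤ_[p]) : PowerSeries (MvPolynomial σ ℤ_[p]) →+* ℤ_[p] :=
  evp.comp (PowerSeries.map (MvPolynomial.eval x))

theorem theta_X (x : σ → ℤ_[p]) : theta x PowerSeries.X = p := by
  simp [theta, evp_X]

theorem theta_C (x : σ → ℤ_[p]) (q : MvPolynomial σ ℤ_[p]) :
    theta x (PowerSeries.C q) = MvPolynomial.eval x q := by
  simp [theta, evp_C]

theorem theta_trunc (x : σ → ℤ_[p]) (G : PowerSeries (MvPolynomial σ ℤ_[p])) (N : ℕ) :
    (p : ℤ_[p]) ^ N ∣ theta x G - ∑ i ∈ Finset.range N,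
      (p : ℤ_[p]) ^ i * MvPolynomial.eval x (PowerSeries.coeff i G) := by
  have := map_dvd (theta x) (ps_trunc_dvd G N)
  simpa [theta_X, theta_C] using this

theorem theta_psum (x : σ → ℤ_[p]) (b : ℕ → PowerSeries (MvPolynomial σ ℤ_[p])) (N : ℕ) :
    (p : ℤ_[p]) ^ N ∣ theta x (psum b) - ∑ i ∈ Finset.range N, (p : ℤ_[p]) ^ i * theta x (b i) := by
  have := map_dvd (theta x) (psum_dvd b N)
  simpa [theta_X, theta_C] using this

/-- integral analytic functions -/
def An (F : (σ → ℤ_[p]) → ℤ_[p]) : Prop :=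
  ∃ G : PowerSeries (MvPolynomial σ ℤ_[p]), ∀ x, F x = theta x G

theorem An.const (c : ℤ_[p]) : An (fun _ : σ → ℤ_[p] => c) :=
  ⟨PowerSeries.C (MvPolynomial.C c), fun x => by simp [theta_C]⟩

theorem An.proj (i : σ) : An (fun x : σ → ℤ_[p] => x i) :=
  ⟨PowerSeries.C (MvPolynomial.X i), fun x => by simp [theta_C]⟩

theorem An.add {F G : (σ → ℤ_[p]) → ℤ_[p]} (hF : An F) (hG : An G) : An fun x => F x + G x := by
  obtain ⟨f, hf⟩ := hF
  obtain ⟨g, hg⟩ := hG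
  exact ⟨f + g, fun x => by beta_reduce; rw [map_add, hf, hg]⟩

theorem An.mul {F G : (σ → ℤ_[p]) → ℤ_[p]} (hF : An F) (hG : An G) : An fun x => F x * G x := by
  obtain ⟨f, hf⟩ := hF
  obtain ⟨g, hg⟩ := hG
  exact ⟨f * g, fun x => by beta_reduce; rw [map_mul, hf, hg]⟩

theorem An.neg {F : (σ → ℤ_[p]) → ℤ_[p]} (hF : An F) : An fun x => - F x := by
  obtain ⟨f, hf⟩ := hF
  exact ⟨- f, fun x => by beta_reduce; rw [map_neg, hf]⟩

theorem An.sub {F G : (σ → ℤ_[p]) → ℤ_[p]} (hF : An F) (hG : An G) : An fun x => F x - G x := by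
  simpa [sub_eq_add_neg] using hF.add hG.neg

theorem An.pow {F : (σ → ℤ_[p]) → ℤ_[p]} (hF : An F) (k : ℕ) : An fun x => F x ^ k := by
  obtain ⟨f, hf⟩ := hF
  exact ⟨f ^ k, fun x => by beta_reduce; rw [map_pow, hf]⟩

theorem An.sum {ι : Type*} (s : Finset ι) {F : ι → (σ → ℤ_[p]) → ℤ_[p]} (hF : ∀ i ∈ s, An (F i)) :
    An fun x => ∑ i ∈ s, F i x := by
  classical
  induction s using Finset.induction_on with
  | empty => simpa using An.const 0
  | insert a s ha ih =>
    simp only [Finset.sum_insert ha]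
    exact (hF a (by simp)).add (ih fun i hi => hF i (by simp [hi]))

theorem An.prod {ι : Type*} (s : Finset ι) {F : ι → (σ → ℤ_[p]) → ℤ_[p]} (hF : ∀ i ∈ s, An (F i)) :
    An fun x => ∏ i ∈ s, F i x := by
  classical
  induction s using Finset.induction_on with
  | empty => simpa using An.const 1
  | insert a s ha ih =>
    simp only [Finset.prod_insert ha]
    exact (hF a (by simp)).mul (ih fun i hi => hF i (by simp [hi]))

theorem theta_aeval (x : σ → ℤ_[p]) (g : τ → PowerSeries (MvPolynomial σ ℤ_[p]))
    (q : MvPolynomial τ ℤ_[p]) :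
    theta x (MvPolynomial.eval₂ (PowerSeries.C.comp MvPolynomial.C) g q) =
      MvPolynomial.eval (fun i => theta x (g i)) q := by
  rw [← MvPolynomial.coe_eval₂Hom, ← RingHom.comp_apply]
  congr 1
  apply MvPolynomial.ringHom_ext
  · intro r; simp [theta_C]
  · intro i; simp

theorem An.comp {F : (τ → ℤ_[p]) → ℤ_[p]} (hF : An F) {g : τ → (σ → ℤ_[p]) → ℤ_[p]}
    (hg : ∀ i, An (g i)) : An fun x => F (fun i => g i x) := by
  obtain ⟨f, hf⟩ := hF
  choose g' hg' using hg
  refine ⟨psum fun n => MvPolynomial.eval₂ (PowerSeries.C.comp MvPolynomial.C) g' (PowerSeries.coeff n f),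
    fun x => ?_⟩
  beta_reduce
  rw [hf]
  apply eq_of_pow_dvd
  intro N
  have h1 := theta_trunc (fun i => g i x) f N
  have h2 := theta_psum x (fun n => MvPolynomial.eval₂ (PowerSeries.C.comp MvPolynomial.C) g' (PowerSeries.coeff n f)) N
  simp only [theta_aeval, ← hg'] at h2
  have := dvd_sub h1 h2
  simpa using this

theorem An.inv {F : (σ → ℤ_[p]) → ℤ_[p]} (hF : An F) :
    ∃ F' : (σ → ℤ_[p]) → ℤ_[p], An F' ∧ ∀ x, (1 + p * F x) * (1 + p * F' x) = 1 := by
  obtain ⟨f, hf⟩ := hF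
  have hu : IsUnit (1 + PowerSeries.X * f) := by
    rw [PowerSeries.isUnit_iff_constantCoeff]; simp
  obtain ⟨g, hg⟩ := hu.exists_right_inv
  have hg0 : PowerSeries.constantCoeff (g - 1) = 0 := by
    have := congrArg PowerSeries.constantCoeff hg
    simp at this
    simp [this]
  obtain ⟨g', hg'⟩ := PowerSeries.X_dvd_iff.2 hg0
  refine ⟨fun x => theta x g', ⟨g', fun _ => rfl⟩, fun x => ?_⟩
  have h1 := congrArg (theta x) hg
  have h2 : g = 1 + PowerSeries.X * g' := by rw [← hg']; ring
  rw [h2] at h1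
  simpa [theta_X, ← hf] using h1

/-- `An` in one distinguished variable plus parameters -/
def oc {R : Type*} (z : R) (x : σ → R) : Option σ → R := fun o => o.elim z x

@[simp] theorem oc_none {R : Type*} (z : R) (x : σ → R) : oc z x none = z := rfl
@[simp] theorem oc_some {R : Type*} (z : R) (x : σ → R) (i : σ) : oc z x (some i) = x i := rfl
theorem oc_eta {R : Type*} (y : Option σ → R) : oc (y none) (fun i => y (some i)) = y := by
  funext o; cases o <;> rfl

/-- evaluation for series of polynomials in a distinguished variable. -/
noncomputable def theta2 (x : σ → ℤ_[p]) (z : ℤ_[p]) :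
    PowerSeries (Polynomial (MvPolynomial σ ℤ_[p])) →+* ℤ_[p] :=
  evp.comp (PowerSeries.map (Polynomial.eval₂RingHom (MvPolynomial.eval x) z))

theorem theta2_X (x : σ → ℤ_[p]) (z : ℤ_[p]) : theta2 x z PowerSeries.X = p := by
  simp [theta2, evp_X]

theorem theta2_C (x : σ → ℤ_[p]) (z : ℤ_[p]) (q : Polynomial (MvPolynomial σ ℤ_[p])) :
    theta2 x z (PowerSeries.C q) = Polynomial.eval₂ (MvPolynomial.eval x) z q := by
  simp [theta2, evp_C]

theorem theta2_map (x : σ → ℤ_[p]) (z : ℤ_[p]) (a : PowerSeries (MvPolynomial σ ℤ_[p])) :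
    theta2 x z (PowerSeries.map Polynomial.C a) = theta x a := by
  simp only [theta2, theta, RingHom.comp_apply]
  congr 1
  ext n
  simp

theorem theta2_equiv (x : σ → ℤ_[p]) (z : ℤ_[p]) (G : PowerSeries (MvPolynomial (Option σ) ℤ_[p])) :
    theta2 x z (PowerSeries.map (MvPolynomial.optionEquivLeft ℤ_[p] σ : _ →+* _) G) =
      theta (oc z x) G := by
  simp only [theta2, theta, RingHom.comp_apply]
  congr 1
  ext n
  simp only [PowerSeries.coeff_map]
  rw [← RingHom.comp_apply]
  congr 1
  apply MvPolynomial.ringHom_ext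
  · intro r; simp [MvPolynomial.optionEquivLeft_apply]
  · intro o; cases o <;> simp

theorem An.exists2 {F : (Option σ → ℤ_[p]) → ℤ_[p]} (hF : An F) :
    ∃ G : PowerSeries (Polynomial (MvPolynomial σ ℤ_[p])), ∀ x z, F (oc z x) = theta2 x z G := by
  obtain ⟨f, hf⟩ := hF
  exact ⟨_, fun x z => by rw [theta2_equiv, hf]⟩

theorem An.of2 (G : PowerSeries (Polynomial (MvPolynomial σ ℤ_[p]))) :
    An (fun y : Option σ → ℤ_[p] => theta2 (fun i => y (some i)) (y none) G) := by
  refine ⟨PowerSeries.map ((MvPolynomial.optionEquivLeft ℤ_[p] σ).symm : _ →+* _) G, fun y => ?_⟩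
  conv_rhs => rw [← oc_eta y]
  rw [← theta2_equiv]
  have : PowerSeries.map (MvPolynomial.optionEquivLeft ℤ_[p] σ : _ →+* _)
      (PowerSeries.map ((MvPolynomial.optionEquivLeft ℤ_[p] σ).symm :
        Polynomial (MvPolynomial σ ℤ_[p]) →+* MvPolynomial (Option σ) ℤ_[p]) G) = G := by
    ext n : 1
    simp
  rw [this]

end An

end PadicSub

namespace PadicSub

section AnD

variable {p : ℕ} [hp : Fact p.Prime] {σ τ : Type*}

theorem An.lincomb {ι : Type*} [Fintype ι] {τ : ι → Type*} (φ : ∀ k, (σ → ℤ_[p]) → (τ k → ℤ_[p]))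
    (w : ι → (σ → ℤ_[p]) → ℤ_[p])
    (h : ∀ s : σ →₀ ℕ, ∃ q : ∀ k, MvPolynomial (τ k) ℤ_[p], ∀ x,
      (s.prod fun i e => x i ^ e) = ∑ k, w k x * MvPolynomial.eval (φ k x) (q k))
    {F : (σ → ℤ_[p]) → ℤ_[p]} (hF : An F) :
    ∃ G : ∀ k, (τ k → ℤ_[p]) → ℤ_[p], (∀ k, An (G k)) ∧ ∀ x, F x = ∑ k, w k x * G k (φ k x) := by
  have hq : ∀ q : MvPolynomial σ ℤ_[p], ∃ q' : ∀ k, MvPolynomial (τ k) ℤ_[p], ∀ x,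
      MvPolynomial.eval x q = ∑ k, w k x * MvPolynomial.eval (φ k x) (q' k) := by
    intro q
    induction q using MvPolynomial.induction_on' with
    | monomial s c =>
      obtain ⟨q', hq'⟩ := h s
      refine ⟨fun k => MvPolynomial.C c * q' k, fun x => ?_⟩
      rw [MvPolynomial.eval_monomial, hq', Finset.mul_sum]
      refine Finset.sum_congr rfl fun k _ => ?_
      simp
      ring
    | add f g hf hg =>
      obtain ⟨f', hf'⟩ := hf
      obtain ⟨g', hg'⟩ := hg
      refine ⟨fun k => f' k + g' k, fun x => ?_⟩
      simp [hf', hg', mul_add, Finset.sum_add_distrib]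
  obtain ⟨f, hf⟩ := hF
  choose q hq using fun n => hq (PowerSeries.coeff n f)
  refine ⟨fun k x => theta x (PowerSeries.mk fun n => q n k), fun k => ⟨_, fun _ => rfl⟩, fun x => ?_⟩
  rw [hf]
  apply eq_of_pow_dvd
  intro N
  have h1 := theta_trunc x f N
  have h2 := fun k => theta_trunc (φ k x) (PowerSeries.mk fun n => q n k) N
  have h3 : (p : ℤ_[p]) ^ N ∣ ∑ k, w k x * (theta (φ k x) (PowerSeries.mk fun n => q n k) -
      ∑ i ∈ Finset.range N, (p : ℤ_[p]) ^ i * MvPolynomial.eval (φ k x)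
        (PowerSeries.coeff i (PowerSeries.mk fun n => q n k))) :=
    Finset.dvd_sum fun k _ => Dvd.dvd.mul_left (h2 k) _
  convert dvd_sub h1 h3 using 1
  simp only [mul_sub, Finset.sum_sub_distrib, PowerSeries.coeff_mk, hq, Finset.mul_sum]
  rw [Finset.sum_comm]
  have : ∑ y : ι, ∑ x_1 ∈ Finset.range N, (p : ℤ_[p]) ^ x_1 * (w y x * MvPolynomial.eval (φ y x) (q x_1 y))
    = ∑ y : ι, ∑ x_1 ∈ Finset.range N, w y x * ((p : ℤ_[p]) ^ x_1 * MvPolynomial.eval (φ y x) (q x_1 y)) :=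
    Finset.sum_congr rfl fun _ _ => Finset.sum_congr rfl fun _ _ => by ring
  rw [this]
  ring

/-- truncation to the integers -/
noncomputable def trc (x : ℚ_[p]) : ℤ_[p] := if h : ‖x‖ ≤ 1 then ⟨x, h⟩ else 0

theorem trc_coe {x : ℚ_[p]} (h : ‖x‖ ≤ 1) : ((trc x : ℤ_[p]) : ℚ_[p]) = x := by
  simp [trc, h]

theorem trc_of_coe (x : ℤ_[p]) : trc (x : ℚ_[p]) = x := by
  apply PadicInt.ext
  rw [trc_coe]
  exact x.2

theorem coe_prod' {ι : Type*} (s : Finset ι) (f : ι → ℤ_[p]) :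
    ((∏ i ∈ s, f i : ℤ_[p]) : ℚ_[p]) = ∏ i ∈ s, (f i : ℚ_[p]) :=
  map_prod (PadicInt.Coe.ringHom (p := p)) f s

theorem coe_sum' {ι : Type*} (s : Finset ι) (f : ι → ℤ_[p]) :
    ((∑ i ∈ s, f i : ℤ_[p]) : ℚ_[p]) = ∑ i ∈ s, (f i : ℚ_[p]) :=
  map_sum (PadicInt.Coe.ringHom (p := p)) f s

theorem norm_le_of_dvd {a b : ℤ_[p]} {N : ℕ} (h : (p : ℤ_[p]) ^ N ∣ a - b) :
    ‖(a : ℚ_[p]) - b‖ ≤ ‖(p : ℚ_[p])‖ ^ N := by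
  rw [← PadicInt.coe_sub, PadicInt.padic_norm_e_of_padicInt, norm_p_pow_eq,
    PadicInt.norm_le_pow_iff_mem_span_pow, Ideal.mem_span_singleton]
  exact h

theorem hasSum_of_dvd {ι : Type*} {f : ι → ℤ_[p]} {c : ℤ_[p]}
    (h : ∀ N : ℕ, ∃ s : Finset ι, ∀ t : Finset ι, s ⊆ t → (p : ℤ_[p]) ^ N ∣ (∑ i ∈ t, f i) - c) :
    HasSum (fun i => (f i : ℚ_[p])) (c : ℚ_[p]) := by
  rw [HasSum, SummationFilter.unconditional_filter, Metric.tendsto_nhds]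
  intro ε hε
  obtain ⟨N, hN⟩ := exists_pow_lt (p := p) hε
  obtain ⟨s, hs⟩ := h N
  filter_upwards [eventually_ge_atTop s] with t ht
  rw [dist_eq_norm]
  refine lt_of_le_of_lt ?_ hN
  have := norm_le_of_dvd (hs t ht)
  simpa using this

theorem ranal_of_an {n : ℕ} {F : (Fin n → ℤ_[p]) → ℤ_[p]} (hF : An F) :
    ∃ a : (Fin n → ℕ) → ℚ_[p], IsRestrictedCoeffs p a ∧
      ∀ x : Fin n → ℚ_[p], ranalFn p a x = if ∀ i, ‖x i‖ ≤ 1 then (F (fun i => trc (x i)) : ℚ_[p]) else 0 := by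
  classical
  obtain ⟨G, hG⟩ := hF
  let c : (Fin n → ℕ) → PowerSeries ℤ_[p] := fun i =>
    PowerSeries.mk fun k => MvPolynomial.coeff (Finsupp.equivFunOnFinite.symm i) (PowerSeries.coeff k G)
  let S : ℕ → Finset (Fin n → ℕ) := fun N => (Finset.range N).biUnion fun k =>
    (PowerSeries.coeff k G).support.image Finsupp.equivFunOnFinite
  have hS : ∀ N i, i ∉ S N → (p : ℤ_[p]) ^ N ∣ evp (c i) := by
    intro N i hi
    have : PowerSeries.X ^ N ∣ c i := by
      rw [PowerSeries.X_pow_dvd_iff]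
      intro k hk
      simp only [c, PowerSeries.coeff_mk]
      by_contra hne
      apply hi
      simp only [S, Finset.mem_biUnion, Finset.mem_range, Finset.mem_image]
      exact ⟨k, hk, _, MvPolynomial.mem_support_iff.2 hne, by simp⟩
    simpa [evp_X] using map_dvd evp this
  refine ⟨fun i => (evp (c i) : ℤ_[p]), ?_, ?_⟩
  · rw [IsRestrictedCoeffs, Metric.tendsto_nhds]
    intro ε hε
    obtain ⟨N, hN⟩ := exists_pow_lt (p := p) hε
    rw [Filter.eventually_cofinite]
    refine (S N).finite_toSet.subset fun i hi => ?_
    by_contra hi'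
    apply hi
    have := norm_le_of_dvd (b := 0) (by simpa using hS N i hi')
    rw [dist_eq_norm]
    refine lt_of_le_of_lt ?_ hN
    simpa using this
  · intro x
    unfold ranalFn
    split_ifs with hx
    · obtain ⟨y, rfl⟩ : ∃ y : Fin n → ℤ_[p], x = fun i => (y i : ℚ_[p]) :=
        ⟨fun i => ⟨x i, hx i⟩, rfl⟩
      simp only [trc_of_coe]
      have key : HasSum (fun i : Fin n → ℕ => ((evp (c i) * ∏ j, y j ^ i j : ℤ_[p]) : ℚ_[p])) (F y : ℚ_[p]) := by
        apply hasSum_of_dvd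
        intro N
        refine ⟨S N, fun t ht => ?_⟩
        rw [hG, theta, RingHom.comp_apply]
        have h1 : ∑ i ∈ t, evp (c i) * ∏ j, y j ^ i j =
            evp (∑ i ∈ t, c i * PowerSeries.C (∏ j, y j ^ i j)) := by
          rw [map_sum]
          refine Finset.sum_congr rfl fun i _ => ?_
          rw [map_mul, evp_C]
        rw [h1, ← map_sub]
        have h2 : PowerSeries.X ^ N ∣ (∑ i ∈ t, c i * PowerSeries.C (∏ j, y j ^ i j)) -
            PowerSeries.map (MvPolynomial.eval y) G := by
          rw [PowerSeries.X_pow_dvd_iff]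
          intro k hk
          simp only [map_sub, map_sum, PowerSeries.coeff_mul_C, PowerSeries.coeff_map, c, PowerSeries.coeff_mk]
          rw [sub_eq_zero, MvPolynomial.eval_eq']
          symm
          have h3 : ((PowerSeries.coeff k G).support.image Finsupp.equivFunOnFinite) ⊆ t := by
            refine Finset.Subset.trans ?_ ht
            exact Finset.subset_biUnion_of_mem (fun k => (PowerSeries.coeff k G).support.image
              Finsupp.equivFunOnFinite) (Finset.mem_range.2 hk)
          rw [← Finset.sum_subset h3, Finset.sum_image]
          · refine Finset.sum_congr rfl fun i _ => ?_
            simp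
          · intro a _ b _ hab
            exact Finsupp.equivFunOnFinite.injective hab
          · intro i _ hi
            have : MvPolynomial.coeff (Finsupp.equivFunOnFinite.symm i) (PowerSeries.coeff k G) = 0 := by
              by_contra hne
              exact hi (Finset.mem_image.2 ⟨_, MvPolynomial.mem_support_iff.2 hne, by simp⟩)
            rw [this, zero_mul]
        simpa [evp_X] using map_dvd evp h2
      rw [← key.tsum_eq]
      simp only [PadicInt.coe_mul, coe_prod', PadicInt.coe_pow]
    · rfl

theorem an_of_ranal {n : ℕ} (a : (Fin n → ℕ) → ℚ_[p]) (ha : IsRestrictedCoeffs p a) :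
    ∃ (F : (Fin n → ℤ_[p]) → ℤ_[p]) (c : ℚ_[p]), An F ∧
      ∀ x : Fin n → ℚ_[p], ranalFn p a x = if ∀ i, ‖x i‖ ≤ 1 then c * (F (fun i => trc (x i)) : ℚ_[p]) else 0 := by
  classical
  rw [IsRestrictedCoeffs, Metric.tendsto_nhds] at ha
  have hfin : ∀ ε > 0, {i | ε ≤ ‖a i‖}.Finite := by
    intro ε hε
    have := ha ε hε
    rw [Filter.eventually_cofinite] at this
    simpa using this
  obtain ⟨M, hM⟩ : ∃ M : ℕ, ∀ i, ‖(p : ℚ_[p]) ^ M * a i‖ ≤ 1 := by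
    obtain ⟨B, hB⟩ := ((hfin 1 one_pos).image fun i => ‖a i‖).bddAbove
    obtain ⟨M, hM⟩ := exists_pow_lt (p := p) (ε := (max B 1)⁻¹) (by positivity)
    refine ⟨M, fun i => ?_⟩
    have h1 : ‖a i‖ ≤ max B 1 := by
      by_cases h : 1 ≤ ‖a i‖
      · exact le_max_of_le_left (hB ⟨i, h, rfl⟩)
      · exact le_max_of_le_right (not_le.1 h).le
    rw [norm_mul, norm_pow]
    calc _ ≤ (max B 1)⁻¹ * max B 1 := mul_le_mul hM.le h1 (norm_nonneg _) (by positivity)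
      _ = 1 := inv_mul_cancel₀ (by positivity)
  let b : (Fin n → ℕ) → ℤ_[p] := fun i => ⟨(p : ℚ_[p]) ^ M * a i, hM i⟩
  have hpM : (p : ℚ_[p]) ^ M ≠ 0 := pow_ne_zero _ p_ne_zero'
  have hSf : ∀ N : ℕ, {i | b i ≠ 0 ∧ (b i).valuation = N}.Finite := by
    intro N
    refine (hfin (‖(p : ℚ_[p])‖ ^ N) (pow_pos norm_p_pos _)).subset ?_
    rintro i ⟨h0, hN⟩
    have : ‖(b i : ℚ_[p])‖ = ‖(p : ℚ_[p])‖ ^ N := by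
      rw [PadicInt.padic_norm_e_of_padicInt, PadicInt.norm_eq_zpow_neg_valuation h0, hN, norm_p_pow_eq]
    rw [Set.mem_ofPred_eq]
    rw [← this]
    simp only [b, norm_mul, norm_pow]
    exact mul_le_of_le_one_left (norm_nonneg _) (pow_le_one₀ (norm_nonneg _) norm_p_lt_one'.le)
  let S : ℕ → Finset (Fin n → ℕ) := fun N => (hSf N).toFinset
  have hu : ∀ i, ∃ u : ℤ_[p], b i = u * (p : ℤ_[p]) ^ (b i).valuation := by
    intro i
    by_cases h0 : b i = 0
    · exact ⟨0, by simp [h0]⟩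
    · exact ⟨_, PadicInt.unitCoeff_spec h0⟩
  choose u hu using hu
  let G : PowerSeries (MvPolynomial (Fin n) ℤ_[p]) := PowerSeries.mk fun k =>
    ∑ i ∈ S k, MvPolynomial.monomial (Finsupp.equivFunOnFinite.symm i) (u i)
  refine ⟨fun x => theta x G, ((p : ℚ_[p]) ^ M)⁻¹, ⟨G, fun _ => rfl⟩, fun x => ?_⟩
  unfold ranalFn
  split_ifs with hx
  · obtain ⟨y, rfl⟩ : ∃ y : Fin n → ℤ_[p], x = fun i => (y i : ℚ_[p]) :=
      ⟨fun i => ⟨x i, hx i⟩, rfl⟩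
    simp only [trc_of_coe]
    have key : HasSum (fun i : Fin n → ℕ => ((b i * ∏ j, y j ^ i j : ℤ_[p]) : ℚ_[p])) (theta y G : ℚ_[p]) := by
      apply hasSum_of_dvd
      intro N
      refine ⟨(Finset.range N).biUnion S, fun t ht => ?_⟩
      have h1 := theta_trunc y G N
      have hdisj : ((Finset.range N : Finset ℕ) : Set ℕ).PairwiseDisjoint S := by
        intro k _ l _ hkl
        rw [Function.onFun, Finset.disjoint_left]
        intro i hi hi'
        simp only [S, Set.Finite.mem_toFinset, Set.mem_ofPred_eq] at hi hi'
        exact hkl (hi.2.symm.trans hi'.2)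
      have h2 : ∑ i ∈ Finset.range N, (p : ℤ_[p]) ^ i * MvPolynomial.eval y (PowerSeries.coeff i G) =
          ∑ i ∈ (Finset.range N).biUnion S, b i * ∏ j, y j ^ i j := by
        rw [Finset.sum_biUnion hdisj]
        refine Finset.sum_congr rfl fun k _ => ?_
        simp only [G, PowerSeries.coeff_mk, map_sum, Finset.mul_sum]
        refine Finset.sum_congr rfl fun i hi => ?_
        simp only [S, Set.Finite.mem_toFinset, Set.mem_ofPred_eq] at hi
        rw [MvPolynomial.eval_monomial, hu i, hi.2, Finsupp.prod_fintype _ _ (by simp)]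
        simp
        ring
      rw [h2] at h1
      have h3 : (p : ℤ_[p]) ^ N ∣ (∑ i ∈ t, b i * ∏ j, y j ^ i j) -
          ∑ i ∈ (Finset.range N).biUnion S, b i * ∏ j, y j ^ i j := by
        rw [← Finset.sum_sdiff ht, add_sub_cancel_right]
        refine Finset.dvd_sum fun i hi => Dvd.dvd.mul_right ?_ _
        by_cases h0 : b i = 0
        · simp [h0]
        rw [hu i]
        refine Dvd.dvd.mul_left (pow_dvd_pow _ ?_) _
        by_contra hlt
        rw [not_le] at hlt
        refine (Finset.mem_sdiff.1 hi).2 (Finset.mem_biUnion.2 ⟨_, Finset.mem_range.2 hlt, ?_⟩)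
        simp [S, h0]
      have := dvd_sub h3 h1
      simpa using this
    rw [← key.tsum_eq, ← tsum_mul_left]
    refine tsum_congr fun i => ?_
    rw [PadicInt.coe_mul, coe_prod']
    simp only [PadicInt.coe_pow]
    change _ = _ * ((p : ℚ_[p]) ^ M * a i * _)
    rw [← mul_assoc, ← mul_assoc, inv_mul_cancel₀ hpM, one_mul]
  · rfl

theorem DClosed.an {Z : Type*} {𝔎 : Set (Z → ℚ_[p])} (h𝔎 : DClosed 𝔎) [Finite σ]
    {F : (σ → ℤ_[p]) → ℤ_[p]} (hF : An F) (g : σ → Z → ℚ_[p]) (hg : ∀ i, g i ∈ 𝔎) :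
    ∃ f ∈ 𝔎, ∀ z, (∀ i, ‖g i z‖ ≤ 1) → f z = (F (fun i => trc (g i z)) : ℚ_[p]) := by
  obtain ⟨n, ⟨e⟩⟩ := Finite.exists_equiv_fin σ
  have hF' : An (fun x : Fin n → ℤ_[p] => F (fun i => x (e i))) :=
    hF.comp (g := fun i x => x (e i)) fun i => An.proj _
  obtain ⟨a, ha, h⟩ := ranal_of_an hF'
  refine ⟨_, h𝔎.comp _ (IsDFunction.ranal a ha) (fun i => g (e.symm i)) (fun i => hg _), fun z hz => ?_⟩
  rw [h, if_pos (fun i => hz _)]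
  simp

end AnD

end PadicSub

namespace PadicSub

section ZC

variable {A : Type*} [CommRing A]

/-- coefficient series of a series of polynomials -/
noncomputable def zc (i : ℕ) (P : PowerSeries (Polynomial A)) : PowerSeries A :=
  PowerSeries.mk fun n => (PowerSeries.coeff n P).coeff i

theorem zc_ext {P Q : PowerSeries (Polynomial A)} (h : ∀ i, zc i P = zc i Q) : P = Q := by
  ext n i
  have := congrArg (PowerSeries.coeff n) (h i)
  simpa [zc] using this

theorem zc_add (i : ℕ) (P Q : PowerSeries (Polynomial A)) : zc i (P + Q) = zc i P + zc i Q := by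
  ext n; simp [zc]

theorem zc_sum {ι : Type*} (i : ℕ) (s : Finset ι) (P : ι → PowerSeries (Polynomial A)) :
    zc i (∑ j ∈ s, P j) = ∑ j ∈ s, zc i (P j) := by
  ext n; simp [zc]

theorem zc_map_mul (i : ℕ) (a : PowerSeries A) (P : PowerSeries (Polynomial A)) :
    zc i (PowerSeries.map Polynomial.C a * P) = a * zc i P := by
  ext n; simp [zc, PowerSeries.coeff_mul]

theorem zc_Y_mul (i j : ℕ) (P : PowerSeries (Polynomial A)) :
    zc i (PowerSeries.C (Polynomial.X ^ j) * P) = if j ≤ i then zc (i - j) P else 0 := by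
  ext n
  split_ifs with h <;> simp [zc, Polynomial.coeff_X_pow_mul', h, -map_pow]

theorem zc_one (i : ℕ) : zc i (1 : PowerSeries (Polynomial A)) = if i = 0 then 1 else 0 := by
  ext n
  split_ifs with h
  · subst h
    simp [zc, PowerSeries.coeff_one]
    split_ifs <;> simp
  · simp [zc, PowerSeries.coeff_one]
    split_ifs <;> simp [Polynomial.coeff_one, h]

theorem zc_T_mul (i : ℕ) (P : PowerSeries (Polynomial A)) :
    zc i (PowerSeries.X * P) = PowerSeries.X * zc i P := by
  have := zc_map_mul i PowerSeries.X P
  simpa using this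

theorem zc_exists (b : ℕ → PowerSeries A) (hb : ∀ n, {i | PowerSeries.coeff n (b i) ≠ 0}.Finite) :
    ∃ P : PowerSeries (Polynomial A), ∀ i, zc i P = b i := by
  classical
  refine ⟨PowerSeries.mk fun n => ∑ i ∈ (hb n).toFinset,
    Polynomial.monomial i (PowerSeries.coeff n (b i)), fun i => ?_⟩
  ext n
  simp only [zc, PowerSeries.coeff_mk, Polynomial.finsetSum_coeff, Polynomial.coeff_monomial]
  rw [Finset.sum_ite_eq']
  split_ifs with h
  · rfl
  · simpa using (show 0 = PowerSeries.coeff n (b i) by simpa [eq_comm] using h)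

theorem zc_finite (P : PowerSeries (Polynomial A)) (n : ℕ) :
    {i | PowerSeries.coeff n (zc i P) ≠ 0}.Finite := by
  refine (PowerSeries.coeff n P).support.finite_toSet.subset fun i hi => ?_
  simpa [zc] using hi

/-- division with remainder -/
theorem ps_wd [Nontrivial A] (H : PowerSeries (Polynomial A)) (hm : (PowerSeries.constantCoeff H).Monic)
    (F : PowerSeries (Polynomial A)) :
    ∃ Q r : PowerSeries (Polynomial A), F = Q * H + r ∧
      PowerSeries.constantCoeff Q = PowerSeries.constantCoeff F /ₘ PowerSeries.constantCoeff H ∧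
      ∀ n, (PowerSeries.coeff n r).degree < (PowerSeries.constantCoeff H).degree := by
  set h0 := PowerSeries.constantCoeff H with hh0
  have step : ∀ G : PowerSeries (Polynomial A), ∃ G' : PowerSeries (Polynomial A),
      G = PowerSeries.C (PowerSeries.constantCoeff G /ₘ h0) * H +
        PowerSeries.C (PowerSeries.constantCoeff G %ₘ h0) + PowerSeries.X * G' := by
    intro G
    have : PowerSeries.X ∣ G - (PowerSeries.C (PowerSeries.constantCoeff G /ₘ h0) * H +
        PowerSeries.C (PowerSeries.constantCoeff G %ₘ h0)) := by
      rw [PowerSeries.X_dvd_iff]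
      simp only [map_sub, map_add, map_mul, PowerSeries.constantCoeff_C, ← hh0]
      rw [sub_eq_zero]
      conv_lhs => rw [← Polynomial.modByMonic_add_div (PowerSeries.constantCoeff G) h0]
      ring
    obtain ⟨G', hG'⟩ := this
    exact ⟨G', by rw [← hG']; ring⟩
  choose nx hnx using step
  let G : ℕ → PowerSeries (Polynomial A) := fun n => nx^[n] F
  have hG : ∀ n, G n = PowerSeries.C (PowerSeries.constantCoeff (G n) /ₘ h0) * H +
        PowerSeries.C (PowerSeries.constantCoeff (G n) %ₘ h0) + PowerSeries.X * G (n + 1) := by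
    intro n
    have := hnx (G n)
    rwa [show nx (G n) = G (n + 1) from (Function.iterate_succ_apply' nx n F).symm] at this
  let Q : PowerSeries (Polynomial A) := PowerSeries.mk fun n => PowerSeries.constantCoeff (G n) /ₘ h0
  let r : PowerSeries (Polynomial A) := PowerSeries.mk fun n => PowerSeries.constantCoeff (G n) %ₘ h0
  have hF : ∀ N, F = (∑ i ∈ Finset.range N, PowerSeries.X ^ i * PowerSeries.C (PowerSeries.coeff i Q)) * H +
      (∑ i ∈ Finset.range N, PowerSeries.X ^ i * PowerSeries.C (PowerSeries.coeff i r)) +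
      PowerSeries.X ^ N * G N := by
    intro N
    induction N with
    | zero => simp [G]
    | succ N ih =>
      rw [hG N] at ih
      rw [Finset.sum_range_succ, Finset.sum_range_succ]
      simp only [Q, r, PowerSeries.coeff_mk] at ih ⊢
      rw [pow_succ]
      conv_lhs => rw [ih]
      ring
  refine ⟨Q, r, ?_, ?_, ?_⟩
  · apply ps_eq_of_dvd
    intro N
    have h1 := ps_trunc_dvd Q N
    have h2 := ps_trunc_dvd r N
    have h3 : PowerSeries.X ^ N ∣ PowerSeries.X ^ N * G N := dvd_mul_right _ _
    convert dvd_sub h3 (dvd_add (Dvd.dvd.mul_right h1 H) h2) using 1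
    conv_lhs => rw [hF N]
    ring
  · simp [Q, G]
  · intro n
    simp only [r, PowerSeries.coeff_mk]
    exact Polynomial.degree_modByMonic_lt _ hm

theorem ps_artin_rees [IsNoetherianRing A] (J : Ideal (PowerSeries A)) :
    ∃ k : ℕ, ∀ n ≥ k, ∀ a ∈ J, PowerSeries.X ^ n ∣ a → ∃ b ∈ J, a = PowerSeries.X ^ (n - k) * b := by
  obtain ⟨k, hk⟩ := Ideal.exists_pow_inf_eq_pow_smul (Ideal.span {(PowerSeries.X : PowerSeries A)})
    (M := PowerSeries A) J
  refine ⟨k, fun n hn a ha hi => ?_⟩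
  have h1 : a ∈ (Ideal.span {(PowerSeries.X : PowerSeries A)}) ^ n •
      (⊤ : Submodule (PowerSeries A) (PowerSeries A)) ⊓ J := by
    refine ⟨?_, ha⟩
    rw [Ideal.smul_eq_mul, Ideal.mul_top, Ideal.span_singleton_pow]
    exact Ideal.mem_span_singleton.2 hi
  rw [hk n hn, Ideal.span_singleton_pow, Ideal.smul_eq_mul, Ideal.mem_span_singleton_mul] at h1
  obtain ⟨b, hb, hb'⟩ := h1
  exact ⟨b, hb.2, hb'.symm⟩

theorem ps_coef [IsNoetherianRing A] (G : PowerSeries (Polynomial A)) :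
    ∃ (N : ℕ) (L : ℕ → PowerSeries (Polynomial A)),
      G = ∑ j ∈ Finset.range N, PowerSeries.map Polynomial.C (zc j G) *
        (PowerSeries.C (Polynomial.X ^ j) * (1 + PowerSeries.X * L j)) := by
  classical
  set a : ℕ → PowerSeries A := fun i => zc i G with ha
  let J : ℕ →o Ideal (PowerSeries A) := ⟨fun N => Ideal.span (a '' (Finset.range N : Set ℕ)), by
    intro N M h
    apply Ideal.span_mono
    apply Set.image_mono
    simpa using h⟩
  obtain ⟨N0, hN0⟩ := monotone_stabilizes_iff_noetherian.2
    (inferInstance : IsNoetherian (PowerSeries A) (PowerSeries A)) J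
  have hmem : ∀ i, a i ∈ J N0 := by
    intro i
    rw [hN0 (max N0 (i + 1)) (le_max_left _ _)]
    apply Ideal.subset_span
    exact ⟨i, by simp, rfl⟩
  obtain ⟨k, hk⟩ := ps_artin_rees (J N0)
  have hk' : ∀ n ≥ k, ∀ i, PowerSeries.X ^ n ∣ a i → ∃ b ∈ J N0, a i = PowerSeries.X ^ (n - k) * b :=
    fun n hn i hi => hk n hn (a i) (hmem i) hi
  have hfin : ∀ n, {i | ¬ PowerSeries.X ^ n ∣ a i}.Finite := by
    intro n
    refine ((Finset.range n).finite_toSet.biUnion fun j _ => zc_finite G j).subset ?_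
    intro i hi
    rw [Set.mem_ofPred_eq, PowerSeries.X_pow_dvd_iff] at hi
    push Not at hi
    obtain ⟨j, hj, h⟩ := hi
    exact Set.mem_biUnion (x := j) (by simpa using hj) h
  obtain ⟨N1, hN1⟩ := (hfin (k + 1)).bddAbove
  let N := max (max N0 (N1 + 1)) (k + 1)
  have hNk : ∀ i ≥ N, PowerSeries.X ^ (k + 1) ∣ a i := by
    intro i hi
    by_contra h
    have := hN1 h
    omega
  let ord : ℕ → ℕ := fun i => Nat.findGreatest (fun n => PowerSeries.X ^ n ∣ a i) i
  have hord : ∀ i ≥ N, k + 1 ≤ ord i ∧ PowerSeries.X ^ ord i ∣ a i := by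
    intro i hi
    have h1 : k + 1 ≤ i := by omega
    exact ⟨Nat.le_findGreatest h1 (hNk i hi), Nat.findGreatest_spec (P := fun n => PowerSeries.X ^ n ∣ a i) h1 (hNk i hi)⟩
  have hμ : ∀ i, ∃ μ : ℕ → PowerSeries A, i ≥ N →
      a i = PowerSeries.X ^ (ord i - k) * ∑ j ∈ Finset.range N, μ j * a j := by
    intro i
    by_cases hi : i ≥ N
    · obtain ⟨h1, h2⟩ := hord i hi
      obtain ⟨b, hb, hab⟩ := hk' (ord i) (by omega) i h2
      have hb' : b ∈ J N := J.monotone (show N0 ≤ N by omega) hb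
      obtain ⟨c, hc⟩ := (Submodule.mem_span_image_finset_iff_exists_fun (PowerSeries A)).1 hb'
      refine ⟨fun j => if h : j ∈ Finset.range N then c ⟨j, h⟩ else 0, fun _ => ?_⟩
      rw [hab, ← hc, ← Finset.sum_coe_sort (Finset.range N)]
      congr 1
      refine Finset.sum_congr rfl fun j _ => ?_
      show c j • a j = (if h : (j:ℕ) ∈ Finset.range N then c ⟨j, h⟩ else 0) * a j
      rw [dif_pos j.2]
      rfl
    · exact ⟨0, fun h => absurd h hi⟩
  choose μ hμ using hμ
  have hL : ∀ j, ∃ L : PowerSeries (Polynomial A), ∀ l, zc l L =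
      if N ≤ l + j then PowerSeries.X ^ (ord (l + j) - k - 1) * μ (l + j) j else 0 := by
    intro j
    apply zc_exists
    intro n
    have hf : {i | ord i ≤ n + k + 1}.Finite := by
      refine ((hfin (n + k + 2)).union (Finset.range (n + k + 2)).finite_toSet).subset ?_
      intro i hi
      by_contra hcon
      simp only [Set.mem_union, Set.mem_ofPred_eq, not_or, not_not, Finset.coe_range, Set.mem_Iio, not_lt] at hcon
      have : n + k + 2 ≤ ord i := Nat.le_findGreatest hcon.2 hcon.1
      simp only [Set.mem_ofPred_eq] at hi
      omega
    refine (hf.preimage (f := fun l => l + j) (fun x _ y _ h => by simpa using h)).subset ?_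
    intro l hl
    simp only [Set.mem_ofPred_eq, Set.mem_preimage] at hl ⊢
    by_contra hcon
    apply hl
    split_ifs with h
    · rw [PowerSeries.coeff_X_pow_mul', if_neg (by omega)]
    · simp
  choose L hL using hL
  refine ⟨N, L, zc_ext fun i => ?_⟩
  rw [zc_sum]
  simp only [zc_map_mul, zc_Y_mul, zc_add, zc_one, zc_T_mul, hL]
  change a i = ∑ j ∈ Finset.range N, a j * _
  by_cases hi : N ≤ i
  · conv_lhs => rw [hμ i hi, Finset.mul_sum]
    refine Finset.sum_congr rfl fun j hj => ?_
    have hj' : j < N := by simpa using hj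
    rw [if_pos (by omega), if_neg (by omega), if_pos (by omega), show i - j + j = i by omega]
    have h1 := (hord i hi).1
    rw [show ord i - k = (ord i - k - 1) + 1 by omega, pow_succ]
    simp only [Nat.add_sub_cancel]
    ring
  · rw [Finset.sum_eq_single i]
    · simp [hi]
    · intro j hj hji
      by_cases hj' : j ≤ i
      · rw [if_pos hj', if_neg (by omega), if_neg (by omega)]
        simp
      · simp [hj']
    · intro h
      exact absurd (Finset.mem_range.2 (by omega)) h

end ZC

section AnLemmas

variable {p : ℕ} [hp : Fact p.Prime] {σ : Type*}

theorem theta2_zc (x : σ → ℤ_[p]) (z : ℤ_[p]) (r : PowerSeries (Polynomial (MvPolynomial σ ℤ_[p]))) (d : ℕ)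
    (hr : ∀ n, (PowerSeries.coeff n r).degree < d) :
    theta2 x z r = ∑ j ∈ Finset.range d, theta x (zc j r) * z ^ j := by
  have h1 : r = ∑ j ∈ Finset.range d, PowerSeries.map Polynomial.C (zc j r) *
      (PowerSeries.C (Polynomial.X ^ j) * 1) := by
    apply zc_ext
    intro i
    rw [zc_sum]
    simp only [zc_map_mul, zc_Y_mul, zc_one]
    by_cases hi : i < d
    · rw [Finset.sum_eq_single i]
      · simp
      · intro j _ hji
        split_ifs <;> first | (exfalso; omega) | simp
      · intro h
        exact absurd (Finset.mem_range.2 hi) h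
    · rw [Finset.sum_eq_zero]
      · ext n : 1
        simp only [zc, PowerSeries.coeff_mk, map_zero]
        apply Polynomial.coeff_eq_zero_of_degree_lt
        refine (hr n).trans_le ?_
        exact_mod_cast not_lt.1 hi
      · intro j hj
        have := Finset.mem_range.1 hj
        split_ifs <;> first | (exfalso; omega) | simp
  conv_lhs => rw [h1]
  rw [map_sum]
  refine Finset.sum_congr rfl fun j _ => ?_
  rw [map_mul, theta2_map, mul_one, theta2_C]
  simp

theorem An.wd_aux {d : ℕ} {e : ℕ → (σ → ℤ_[p]) → ℤ_[p]} (he : ∀ j, An (e j))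
    {H' : (Option σ → ℤ_[p]) → ℤ_[p]} (hH' : An H') :
    ∃ H : PowerSeries (Polynomial (MvPolynomial σ ℤ_[p])), (PowerSeries.constantCoeff H).Monic ∧
      (PowerSeries.constantCoeff H).degree = ((d : ℕ) : WithBot ℕ) ∧
      ∀ x z, theta2 x z H = z ^ d + ∑ j ∈ Finset.range d, e j x * z ^ j + p * H' (oc z x) := by
  obtain ⟨h', hh'⟩ := hH'.exists2
  choose E hE using he
  have hdeg : (∑ j ∈ Finset.range d, Polynomial.C (PowerSeries.constantCoeff (E j)) * Polynomial.X ^ j).degree < ((d : ℕ) : WithBot ℕ) := by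
    rw [Polynomial.degree_lt_iff_coeff_zero]
    intro m hm
    rw [Polynomial.finsetSum_coeff]
    refine Finset.sum_eq_zero fun j hj => ?_
    have := Finset.mem_range.1 hj
    simp [Polynomial.coeff_X_pow, show m ≠ j by omega]
  let H := PowerSeries.C (Polynomial.X ^ d) + ∑ j ∈ Finset.range d,
    PowerSeries.map Polynomial.C (E j) * PowerSeries.C (Polynomial.X ^ j) + PowerSeries.X * h'
  have hc : PowerSeries.constantCoeff H = Polynomial.X ^ d + ∑ j ∈ Finset.range d,
      Polynomial.C (PowerSeries.constantCoeff (E j)) * Polynomial.X ^ j := by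
    have hm : ∀ j, PowerSeries.constantCoeff (PowerSeries.map Polynomial.C (E j)) =
      Polynomial.C (PowerSeries.constantCoeff (E j)) := fun j => by
        rw [← PowerSeries.coeff_zero_eq_constantCoeff_apply, PowerSeries.coeff_map,
          PowerSeries.coeff_zero_eq_constantCoeff_apply]
    simp only [H, map_add, map_sum, map_mul, PowerSeries.constantCoeff_C, hm,
      PowerSeries.constantCoeff_X, zero_mul, add_zero]
  refine ⟨H, ?_, ?_, ?_⟩
  · rw [hc]
    exact Polynomial.monic_X_pow_add hdeg
  · rw [hc, Polynomial.degree_add_eq_left_of_degree_lt, Polynomial.degree_X_pow]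
    rwa [Polynomial.degree_X_pow]
  · intro x z
    simp only [H, map_add, map_sum, map_mul, theta2_C, theta2_map, theta2_X, hh', hE]
    simp

/-- Weierstrass division -/
theorem An.wd {d : ℕ} {e : ℕ → (σ → ℤ_[p]) → ℤ_[p]} (he : ∀ j, An (e j))
    {H' : (Option σ → ℤ_[p]) → ℤ_[p]} (hH' : An H')
    {F : (Option σ → ℤ_[p]) → ℤ_[p]} (hF : An F) :
    ∃ (Q : (Option σ → ℤ_[p]) → ℤ_[p]) (r : ℕ → (σ → ℤ_[p]) → ℤ_[p]), An Q ∧ (∀ j, An (r j)) ∧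
      ∀ x z, F (oc z x) = Q (oc z x) *
        (z ^ d + ∑ j ∈ Finset.range d, e j x * z ^ j + p * H' (oc z x)) +
          ∑ j ∈ Finset.range d, r j x * z ^ j := by
  obtain ⟨H, hm, hd, hH⟩ := An.wd_aux (d := d) he hH'
  obtain ⟨f, hf⟩ := hF.exists2
  obtain ⟨Q, r, h1, -, h3⟩ := ps_wd H hm f
  refine ⟨_, fun j x => theta x (zc j r), An.of2 Q, fun j => ⟨_, fun _ => rfl⟩, fun x z => ?_⟩
  rw [hf, h1, map_add, map_mul, hH, theta2_zc x z r d (by rwa [hd] at h3)]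
  rfl

/-- Weierstrass preparation -/
theorem An.wp {d : ℕ} {e : ℕ → (σ → ℤ_[p]) → ℤ_[p]} (he : ∀ j, An (e j))
    {H' : (Option σ → ℤ_[p]) → ℤ_[p]} (hH' : An H') :
    ∃ (U : (Option σ → ℤ_[p]) → ℤ_[p]) (r : ℕ → (σ → ℤ_[p]) → ℤ_[p]), An U ∧ (∀ j, An (r j)) ∧
      ∀ x z, (z ^ d + ∑ j ∈ Finset.range d, e j x * z ^ j + p * H' (oc z x)) * (1 + p * U (oc z x)) =
          z ^ d + ∑ j ∈ Finset.range d, r j x * z ^ j := by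
  obtain ⟨H, hm, hd, hH⟩ := An.wd_aux (d := d) he hH'
  obtain ⟨Q, r, h1, h2, h3⟩ := ps_wd H hm (PowerSeries.C (Polynomial.X ^ d))
  have h4 : PowerSeries.constantCoeff Q = 1 := by
    rw [h2, PowerSeries.constantCoeff_C]
    refine (Polynomial.div_modByMonic_unique 1 (Polynomial.X ^ d - PowerSeries.constantCoeff H) hm ⟨by ring, ?_⟩).1
    have h5 : (Polynomial.X ^ d : Polynomial (MvPolynomial σ ℤ_[p])).degree =
      (PowerSeries.constantCoeff H).degree := by rw [Polynomial.degree_X_pow, hd]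
    rw [← h5]
    apply Polynomial.degree_sub_lt_left h5
    · exact pow_ne_zero _ Polynomial.X_ne_zero
    · rw [hm.leadingCoeff, Polynomial.leadingCoeff_X_pow]
  have h6 : PowerSeries.X ∣ Q - 1 := by
    rw [PowerSeries.X_dvd_iff, map_sub, h4, map_one, sub_self]
  obtain ⟨U, hU⟩ := h6
  have hU' : Q = 1 + PowerSeries.X * U := by rw [← hU]; ring
  refine ⟨fun y => theta2 (fun i => y (some i)) (y none) U, fun j x => - theta x (zc j r), An.of2 U, fun j => An.neg ⟨_, fun _ => rfl⟩, fun x z => ?_⟩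
  have h7 := congrArg (theta2 x z) h1
  rw [map_add, map_mul, hH, theta2_zc x z r d (by rwa [hd] at h3), hU', theta2_C] at h7
  simp only [map_add, map_mul, map_one, theta2_X, Polynomial.eval₂_pow, Polynomial.eval₂_X] at h7
  simp only [neg_mul, Finset.sum_neg_distrib, oc_none, oc_some]
  have h8 : (fun i => x i) = x := rfl
  linear_combination -h7

theorem one_add_p_ne_zero (u : ℤ_[p]) : (1 : ℤ_[p]) + p * u ≠ 0 := by
  intro h
  have h1 : (p : ℤ_[p]) * (-u) = 1 := by linear_combination -h
  exact PadicInt.irreducible_p.not_isUnit (IsUnit.of_mul_eq_one _ h1)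

/-- analytic Hensel lemma -/
theorem An.hensel {e : (σ → ℤ_[p]) → ℤ_[p]} (he : An e)
    {H' : (Option σ → ℤ_[p]) → ℤ_[p]} (hH' : An H') :
    ∃ ρ : (σ → ℤ_[p]) → ℤ_[p], An ρ ∧ ∀ x, ρ x + e x + p * H' (oc (ρ x) x) = 0 := by
  obtain ⟨U, r, hU, hr, h⟩ := An.wp (d := 1) (e := fun _ => e) (fun _ => he) hH'
  refine ⟨fun x => - r 0 x, (hr 0).neg, fun x => ?_⟩
  have := h x (- r 0 x)
  simp at this
  exact this.resolve_right (one_add_p_ne_zero _)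

theorem An.coef [Finite σ] {G : (Option σ → ℤ_[p]) → ℤ_[p]} (hG : An G) :
    ∃ (N : ℕ) (a : ℕ → (σ → ℤ_[p]) → ℤ_[p]) (L : ℕ → (Option σ → ℤ_[p]) → ℤ_[p]),
      (∀ j, An (a j)) ∧ (∀ j, An (L j)) ∧
      ∀ x z, G (oc z x) = ∑ j ∈ Finset.range N, a j x * z ^ j * (1 + p * L j (oc z x)) := by
  obtain ⟨g, hg⟩ := hG.exists2
  obtain ⟨N, L, h⟩ := ps_coef g
  refine ⟨N, fun j x => theta x (zc j g), fun j y => theta2 (fun i => y (some i)) (y none) (L j),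
    fun j => ⟨_, fun _ => rfl⟩, fun j => An.of2 _, fun x z => ?_⟩
  rw [hg]
  conv_lhs => rw [h]
  rw [map_sum]
  refine Finset.sum_congr rfl fun j _ => ?_
  simp only [map_mul, theta2_map, theta2_C, map_add, map_one, theta2_X]
  simp
  ring

theorem An.split {H : (Option (Option σ) → ℤ_[p]) → ℤ_[p]} (hH : An H) :
    ∃ H1 H2 : (Option (Option σ) → ℤ_[p]) → ℤ_[p], An H1 ∧ An H2 ∧ ∀ v w x,
      H (oc v (oc w x)) = H1 (oc v (oc (v * w) x)) + w * H2 (oc w (oc (v * w) x)) := by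
  classical
  obtain ⟨G, hG, h⟩ := An.lincomb (ι := Bool) (σ := Option (Option σ)) (τ := fun _ => Option (Option σ))
    (fun k x => if k then oc (x none) (oc (x none * x (some none)) (fun i => x (some (some i)))) else
      oc (x (some none)) (oc (x none * x (some none)) (fun i => x (some (some i)))))
    (fun k x => if k then 1 else x (some none)) (by
      intro s
      have hs : ∀ x : Option (Option σ) → ℤ_[p], (s.prod fun i e => x i ^ e) =
        x none ^ (s none) * x (some none) ^ (s (some none)) *
          MvPolynomial.eval x (MvPolynomial.rename (fun i => some (some i))
            (MvPolynomial.monomial (s.some.some) (1 : ℤ_[p]))) := by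
        intro x
        rw [MvPolynomial.eval_rename, MvPolynomial.eval_monomial]
        rw [Finsupp.prod_option_index _ _ (by simp) (by intros; rw [pow_add]),
          Finsupp.prod_option_index _ _ (by simp) (by intros; rw [pow_add])]
        simp [mul_assoc]
      by_cases hab : s (some none) ≤ s none
      · refine ⟨fun k => if k then MvPolynomial.X none ^ (s none - s (some none)) *
          MvPolynomial.X (some none) ^ (s (some none)) * MvPolynomial.rename (fun i => some (some i))
            (MvPolynomial.monomial (s.some.some) (1 : ℤ_[p])) else 0, fun x => ?_⟩
        rw [hs]
        simp [MvPolynomial.eval_rename]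
        have e1 : (oc (x none) (oc (x none * x (some none)) fun i => x (some (some i))) ∘ fun i => some (some i)) =
          (x ∘ fun i => some (some i)) := by
            funext i; simp
        rw [e1, mul_pow, ← mul_assoc, ← pow_add, Nat.sub_add_cancel hab]
      · refine ⟨fun k => if k then 0 else MvPolynomial.X none ^ (s (some none) - s none - 1) *
          MvPolynomial.X (some none) ^ (s none) * MvPolynomial.rename (fun i => some (some i))
            (MvPolynomial.monomial (s.some.some) (1 : ℤ_[p])), fun x => ?_⟩
        rw [hs]
        simp [MvPolynomial.eval_rename]
        rw [show s (some none) = s none + (s (some none) - s none - 1) + 1 by omega]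
        simp only [show s none + (s (some none) - s none - 1) + 1 - s none - 1 =
          (s (some none) - s none - 1) by omega]
        have e1 : (oc (x (some none)) (oc (x none * x (some none)) fun i => x (some (some i))) ∘ fun i => some (some i)) =
          (x ∘ fun i => some (some i)) := by
            funext i; simp
        rw [e1, mul_pow, pow_succ, pow_add]
        ring) hH
  refine ⟨G true, G false, hG _, hG _, fun v w x => ?_⟩
  have := h (oc v (oc w x))
  simpa using this

theorem An.modular [Finite σ] (l : ℕ) [NeZero l] {F : (σ → ℤ_[p]) → ℤ_[p]} (hF : An F) :
    ∃ G : (σ → Fin l) → (σ → ℤ_[p]) → ℤ_[p], (∀ k, An (G k)) ∧ ∀ x,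
      F x = letI := Fintype.ofFinite σ; letI := Classical.decEq σ
        ∑ k : σ → Fin l, (∏ i, x i ^ (k i : ℕ)) * G k (fun i => x i ^ l) := by
  classical
  let _ := Fintype.ofFinite σ
  obtain ⟨G, hG, h⟩ := An.lincomb (ι := σ → Fin l) (σ := σ) (τ := fun _ => σ)
    (fun _ x i => x i ^ l) (fun k x => ∏ i, x i ^ (k i : ℕ)) (by
      intro s
      refine ⟨fun k => if k = fun i => Fin.ofNat l (s i) then
        MvPolynomial.monomial (s.mapRange (fun n => n / l) (by simp)) 1 else 0, fun x => ?_⟩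
      rw [Finset.sum_eq_single (fun i => Fin.ofNat l (s i))]
      · beta_reduce
        rw [if_pos rfl, MvPolynomial.eval_monomial, one_mul, Finsupp.prod_fintype _ _ (by simp),
          Finsupp.prod_fintype _ _ (by simp), ← Finset.prod_mul_distrib]
        refine Finset.prod_congr rfl fun i _ => ?_
        simp only [Fin.val_ofNat, Finsupp.mapRange_apply]
        rw [← pow_mul, ← pow_add, Nat.mod_add_div]
      · intro k _ hk
        beta_reduce
        rw [if_neg hk, map_zero, mul_zero]
      · intro h
        exact absurd (Finset.mem_univ _) h) hF
  refine ⟨G, hG, fun x => ?_⟩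
  rw [h x]

end AnLemmas

end PadicSub

namespace PadicSub

section Ev

variable {p : ℕ} [hp : Fact p.Prime] {Z : Type*}

/-- evaluation of an analytic function at functions -/
noncomputable def anf {σ : Type*} (F : (σ → ℤ_[p]) → ℤ_[p]) (φ : σ → Z → ℚ_[p]) (z : Z) : ℚ_[p] :=
  ((F fun i => trc (φ i z) : ℤ_[p]) : ℚ_[p])

theorem anf_norm {σ : Type*} (F : (σ → ℤ_[p]) → ℤ_[p]) (φ : σ → Z → ℚ_[p]) (z : Z) :
    ‖anf F φ z‖ ≤ 1 := PadicInt.norm_le_one _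

theorem DClosed.mono_Dcl {𝒩 S : Set (Z → ℚ_[p])} (h : DClosed 𝒩) (hS : S ⊆ 𝒩) {f : Z → ℚ_[p]}
    (hf : Dcl S f) : f ∈ 𝒩 := by
  induction hf with
  | base f hf => exact hS hf
  | comp F hF g _ ih => exact h.comp F hF g ih

theorem DClosed.of_ev {𝒢 : Filter Z} {𝒩 : Set (Z → ℚ_[p])}
    (hev : ∀ f g : Z → ℚ_[p], f ∈ 𝒩 → f =ᶠ[𝒢] g → g ∈ 𝒩)
    (hconst : ∀ c : ℚ_[p], (fun _ => c) ∈ 𝒩)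
    (hadd : ∀ f g : Z → ℚ_[p], f ∈ 𝒩 → g ∈ 𝒩 → (fun z => f z + g z) ∈ 𝒩)
    (hmul : ∀ f g : Z → ℚ_[p], f ∈ 𝒩 → g ∈ 𝒩 → (fun z => f z * g z) ∈ 𝒩)
    (hinv : ∀ f : Z → ℚ_[p], f ∈ 𝒩 → (fun z => (f z)⁻¹) ∈ 𝒩)
    (hintg : ∀ f ∈ 𝒩, (∀ᶠ z in 𝒢, ‖f z‖ ≤ 1) ∨ (∀ᶠ z in 𝒢, ¬ ‖f z‖ ≤ 1))
    (han : ∀ (n : ℕ) (F : (Fin n → ℤ_[p]) → ℤ_[p]), An F → ∀ φ : Fin n → Z → ℚ_[p],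
      (∀ i, φ i ∈ 𝒩) → (∀ i, ∀ᶠ z in 𝒢, ‖φ i z‖ ≤ 1) → anf F φ ∈ 𝒩) : DClosed 𝒩 := by
  apply DClosed.of_basic
  · intro n q g hg
    induction q using MvPolynomial.induction_on with
    | C a => simpa using hconst a
    | add q1 q2 h1 h2 => simpa using hadd _ _ h1 h2
    | mul_X q i h => simpa using hmul _ _ h (hg i)
  · intro n a ha g hg
    obtain ⟨F, c, hF, h⟩ := an_of_ranal a ha
    by_cases hall : ∀ i, ∀ᶠ z in 𝒢, ‖g i z‖ ≤ 1
    · have h1 := hmul _ _ (hconst c) (han n F hF g hg hall)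
      refine hev _ _ h1 ?_
      filter_upwards [eventually_all.2 hall] with z hz
      rw [h, if_pos hz]
      rfl
    · push Not at hall
      obtain ⟨i, hi⟩ := hall
      have hi' := (hintg _ (hg i)).resolve_left (by simpa using hi)
      refine hev _ _ (hconst 0) ?_
      filter_upwards [hi'] with z hz
      rw [h, if_neg (fun h' => hz (h' i))]
  · exact fun g hg => hinv g hg

theorem ev_max {𝒢 : Filter Z} {ι : Type*} (s : Finset ι) (hs : s.Nonempty) (a : ι → Z → ℚ_[p])
    (h : ∀ i ∈ s, ∀ j ∈ s, (∀ᶠ z in 𝒢, ‖a i z‖ ≤ ‖a j z‖) ∨ (∀ᶠ z in 𝒢, ‖a j z‖ ≤ ‖a i z‖)) :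
    ∃ j ∈ s, ∀ i ∈ s, ∀ᶠ z in 𝒢, ‖a i z‖ ≤ ‖a j z‖ := by
  classical
  induction hs using Finset.Nonempty.cons_induction with
  | singleton b => exact ⟨b, by simp, by simp⟩
  | cons b s hb hs ih =>
    obtain ⟨j, hj, hj'⟩ := ih (fun i hi j hj => h i (by simp [hi]) j (by simp [hj]))
    rcases h b (by simp) j (by simp [hj]) with h1 | h1
    · refine ⟨j, by simp [hj], fun i hi => ?_⟩
      rcases Finset.mem_cons.1 hi with rfl | hi
      · exact h1
      · exact hj' i hi
    · refine ⟨b, by simp, fun i hi => ?_⟩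
      rcases Finset.mem_cons.1 hi with rfl | hi
      · exact Eventually.of_forall fun _ => le_rfl
      · filter_upwards [hj' i hi, h1] with z h2 h3 using h2.trans h3

/-- zero sets are decided -/
def ZDec (𝒢 : Filter Z) (𝔎 : Set (Z → ℚ_[p])) : Prop :=
  ∀ f ∈ 𝔎, (∀ᶠ z in 𝒢, f z = 0) ∨ (∀ᶠ z in 𝒢, f z ≠ 0)

theorem ZDec.le {𝒢 : Filter Z} {𝔎 : Set (Z → ℚ_[p])} (h : ZDec 𝒢 𝔎) (hd : DClosed 𝔎)
    {f g : Z → ℚ_[p]} (hf : f ∈ 𝔎) (hg : g ∈ 𝔎) :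
    (∀ᶠ z in 𝒢, ‖f z‖ ≤ ‖g z‖) ∨ (∀ᶠ z in 𝒢, ‖g z‖ < ‖f z‖) := by
  rcases h _ (hd.indLe hf hg) with h1 | h1
  · right
    filter_upwards [h1] with z hz
    by_contra hc
    rw [if_pos (not_lt.1 hc)] at hz
    exact one_ne_zero hz
  · left
    filter_upwards [h1] with z hz
    by_contra hc
    exact hz (if_neg hc)

/-- ℓ-th roots near one are analytic -/
theorem root_an (l : ℕ) (hl : 0 < l) (M0 : ℕ) : ∃ (M : ℕ) (ρ : (Unit → ℤ_[p]) → ℤ_[p]), M0 ≤ M ∧ An ρ ∧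
    ∀ x, (1 + (p : ℤ_[p]) ^ M * ρ x) ^ l = 1 + l * p ^ M * x () := by
  have hl0 : (l : ℚ_[p]) ≠ 0 := by exact_mod_cast hl.ne'
  obtain ⟨M1, hM1⟩ := exists_pow_lt (p := p) (norm_pos_iff.2 hl0)
  set M := max M0 (M1 + 1) with hM
  have hdiv : ∃ c : ℤ_[p], (p : ℤ_[p]) ^ M = l * p * c := by
    have h1 : ‖(p : ℚ_[p]) ^ (M - 1) / l‖ ≤ 1 := by
      rw [norm_div, norm_pow, div_le_one (norm_pos_iff.2 hl0)]
      refine le_trans ?_ hM1.le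
      exact pow_le_pow_of_le_one norm_p_pos.le norm_p_lt_one'.le (by omega)
    refine ⟨trc ((p : ℚ_[p]) ^ (M - 1) / l), ?_⟩
    apply PadicInt.ext
    push_cast
    rw [trc_coe h1]
    have : (p : ℚ_[p]) ^ M = p * p ^ (M - 1) := by
      rw [← pow_succ']; congr 1; omega
    rw [this]
    field_simp
  obtain ⟨c, hc⟩ := hdiv
  let H' : (Option Unit → ℤ_[p]) → ℤ_[p] := fun y => c * ∑ k ∈ Finset.range (l - 1),
    (l.choose (k + 2) : ℤ_[p]) * ((p : ℤ_[p]) ^ M) ^ k * (y none) ^ (k + 2)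
  have hH' : An H' := by
    refine (An.const c).mul (An.sum _ fun k _ => ?_)
    exact (An.const ((l.choose (k + 2) : ℤ_[p]) * ((p : ℤ_[p]) ^ M) ^ k)).mul ((An.proj none).pow (k + 2))
  obtain ⟨ρ, hρ, h⟩ := An.hensel (e := fun x : Unit → ℤ_[p] => - x ()) (An.proj ()).neg hH'
  refine ⟨M, ρ, le_max_left _ _, hρ, fun x => ?_⟩
  have h1 := h x
  simp only [H', oc_none] at h1
  rw [add_comm (1 : ℤ_[p]), add_pow]
  obtain ⟨l', rfl⟩ : ∃ l', l = l' + 1 := ⟨l - 1, by omega⟩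
  rw [Finset.sum_range_succ', Finset.sum_range_succ']
  have h2 : ∑ k ∈ Finset.range l', ((p : ℤ_[p]) ^ M * ρ x) ^ (k + 1 + 1) * 1 ^ (l' + 1 - (k + 1 + 1)) *
      ((l' + 1).choose (k + 1 + 1) : ℤ_[p]) = (p ^ M) ^ 2 * ∑ k ∈ Finset.range l',
        ((l' + 1).choose (k + 2) : ℤ_[p]) * ((p : ℤ_[p]) ^ M) ^ k * (ρ x) ^ (k + 2) := by
    rw [Finset.mul_sum]
    refine Finset.sum_congr rfl fun k _ => ?_
    rw [mul_pow]
    ring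
  rw [h2]
  simp only [Nat.add_sub_cancel] at h1
  set S := ∑ k ∈ Finset.range l',
        ((l' + 1).choose (k + 2) : ℤ_[p]) * ((p : ℤ_[p]) ^ M) ^ k * (ρ x) ^ (k + 2)
  simp
  have h3 : ((p:ℤ_[p]) ^ M) ^ 2 = p ^ M * (((l' + 1 : ℕ) : ℤ_[p]) * p * c) := by rw [← hc]; ring
  rw [h3]
  push_cast
  linear_combination ((l' : ℤ_[p]) + 1) * p ^ M * h1

end Ev

end PadicSub

namespace PadicSub

section Rt

variable {p : ℕ} [hp : Fact p.Prime]

variable (p) in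
open Classical in
noncomputable def rtN (l : ℕ) : ℕ :=
  if h : 0 < l then (exists_root_unique (p := p) l h).choose else 1

theorem rtN_pos (l : ℕ) (hl : 0 < l) : 0 < rtN p l := by
  rw [rtN, dif_pos hl]
  exact (exists_root_unique (p := p) l hl).choose_spec.1

theorem rtN_spec (l : ℕ) (hl : 0 < l) : ∀ y ∈ Pset p (rtN p l), y ^ l = 1 → y = 1 := by
  rw [rtN, dif_pos hl]
  exact (exists_root_unique (p := p) l hl).choose_spec.2

open Classical in
noncomputable def rt (l : ℕ) (z : ℚ_[p]) : ℚ_[p] :=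
  if h : ∃ y ∈ Pset p (rtN p l), y ^ l = z then h.choose else 0

theorem rt_of {l : ℕ} (hl : 0 < l) {y z : ℚ_[p]} (hy : y ∈ Pset p (rtN p l)) (h : y ^ l = z) :
    rt l z = y := by
  have h1 : ∃ y ∈ Pset p (rtN p l), y ^ l = z := ⟨y, hy, h⟩
  rw [rt, dif_pos h1]
  have h2 := h1.choose_spec
  have h3 := Pset_ne_zero hy
  have h4 := rtN_spec l hl (h1.choose * y⁻¹) (Pset_mul h2.1 (Pset_inv hy)) (by
    rw [mul_pow, h2.2, inv_pow, h, mul_inv_cancel₀]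
    rw [← h]; exact pow_ne_zero _ h3)
  field_simp at h4
  exact h4

theorem rt_zero {l : ℕ} {z : ℚ_[p]} (h : ¬ ∃ y ∈ Pset p (rtN p l), y ^ l = z) : rt l z = 0 := by
  rw [rt, dif_neg h]

theorem rt_pow {l : ℕ} {z : ℚ_[p]} (h : rt l z ≠ 0) : rt l z ^ l = z := by
  by_cases h1 : ∃ y ∈ Pset p (rtN p l), y ^ l = z
  · rw [rt, dif_pos h1]
    exact h1.choose_spec.2
  · exact absurd (rt_zero h1) h

theorem rt_dec {l : ℕ} (hl : 0 < l) (N : ℕ) (c : ℚ_[p]) : ∃ ν : ℚ_[p],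
    ∀ z ∈ cosetP p c (l * (N * rtN p l)), rt l z ∈ cosetP p ν N := by
  by_cases h : ∃ y ∈ Pset p (rtN p l), y ^ l = c
  · obtain ⟨y, hy, rfl⟩ := h
    refine ⟨y, ?_⟩
    rintro z ⟨w', ⟨w, hw, rfl⟩, rfl⟩
    rw [rt_of (y := y * w ^ (N * rtN p l)) hl]
    · refine ⟨_, ⟨w ^ rtN p l, pow_ne_zero _ hw, rfl⟩, ?_⟩
      rw [← pow_mul, mul_comm N]
    · exact Pset_mul hy ⟨w ^ N, pow_ne_zero _ hw, by rw [← pow_mul]⟩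
    · rw [mul_pow, ← pow_mul, mul_comm l]
  · refine ⟨0, ?_⟩
    rintro z ⟨w', ⟨w, hw, rfl⟩, rfl⟩
    rw [mem_cosetP_zero]
    apply rt_zero
    rintro ⟨y, hy, h1⟩
    refine h ⟨y * (w ^ (N * rtN p l))⁻¹, Pset_mul hy (Pset_inv ⟨w ^ N, pow_ne_zero _ hw, by rw [← pow_mul]⟩), ?_⟩
    rw [mul_pow, h1, inv_pow, ← pow_mul, mul_comm l, mul_assoc, mul_inv_cancel₀ (pow_ne_zero _ hw), mul_one]

end Rt

section Adj

variable {p : ℕ} [hp : Fact p.Prime] {Z : Type*}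

structure Good (𝒢 : Filter Z) (𝔇 𝔎 : Set (Z → ℚ_[p])) : Prop where
  dc : DClosed 𝔎
  dec : ∀ f ∈ 𝔎, ∀ N > 0, ∃ μ : ℚ_[p], ∀ᶠ z in 𝒢, f z ∈ cosetP p μ N
  hull : ∀ f ∈ 𝔎, ∃ e > 0, ∃ c ∈ 𝔇, ∀ᶠ z in 𝒢, ‖f z‖ ^ e = ‖c z‖

theorem Good.zdec {𝒢 : Filter Z} {𝔇 𝔎 : Set (Z → ℚ_[p])} (h : Good 𝒢 𝔇 𝔎) : ZDec 𝒢 𝔎 := by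
  intro f hf
  obtain ⟨μ, hμ⟩ := h.dec f hf 1 one_pos
  by_cases h0 : μ = 0
  · left
    filter_upwards [hμ] with z hz using (cosetP_eq_zero_iff hz).2 h0
  · right
    filter_upwards [hμ] with z hz using cosetP_ne_zero h0 hz

def Evc (𝒢 : Filter Z) (𝔎 : Set (Z → ℚ_[p])) : Set (Z → ℚ_[p]) := {f | ∃ g ∈ 𝔎, f =ᶠ[𝒢] g}

theorem Evc.subset (𝒢 : Filter Z) (𝔎 : Set (Z → ℚ_[p])) : 𝔎 ⊆ Evc 𝒢 𝔎 :=
  fun f hf => ⟨f, hf, EventuallyEq.rfl⟩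

theorem Evc.dclosed (𝒢 : Filter Z) {𝔎 : Set (Z → ℚ_[p])} (h : DClosed 𝔎) : DClosed (Evc 𝒢 𝔎) := by
  refine ⟨fun F hF g hg => ?_⟩
  choose g' hg' h1 using hg
  refine ⟨_, h.comp F hF g' hg', ?_⟩
  filter_upwards [eventually_all.2 h1] with z hz
  simp only [hz]

theorem Good.evc {𝒢 : Filter Z} {𝔇 𝔎 : Set (Z → ℚ_[p])} (h : Good 𝒢 𝔇 𝔎) : Good 𝒢 𝔇 (Evc 𝒢 𝔎) := by
  refine ⟨Evc.dclosed 𝒢 h.dc, ?_, ?_⟩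
  · rintro f ⟨g, hg, hfg⟩ N hN
    obtain ⟨μ, hμ⟩ := h.dec g hg N hN
    refine ⟨μ, ?_⟩
    filter_upwards [hμ, hfg] with z h1 h2
    rwa [h2]
  · rintro f ⟨g, hg, hfg⟩
    obtain ⟨e, he, c, hc, hμ⟩ := h.hull g hg
    refine ⟨e, he, c, hc, ?_⟩
    filter_upwards [hμ, hfg] with z h1 h2
    rwa [h2]

structure Adj (𝒢 : Filter Z) (𝔎 : Set (Z → ℚ_[p])) (y h : Z → ℚ_[p]) (l : ℕ) : Prop where
  pr : l.Prime
  dc : DClosed 𝔎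
  zd : ZDec 𝒢 𝔎
  hh : h ∈ 𝔎
  hy : ∀ᶠ z in 𝒢, y z ^ l = h z
  hy0 : ∀ᶠ z in 𝒢, y z ≠ 0
  nt : ∀ g ∈ 𝔎, ¬ ∀ᶠ z in 𝒢, ‖y z‖ = ‖g z‖

namespace Adj

variable {𝒢 : Filter Z} {𝔎 : Set (Z → ℚ_[p])} {y h : Z → ℚ_[p]} {l : ℕ}

theorem le_dec (A : Adj 𝒢 𝔎 y h l) {c d : Z → ℚ_[p]} (hc : c ∈ 𝔎) (hd : d ∈ 𝔎) (i j : ℕ) :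
    (∀ᶠ z in 𝒢, ‖c z * y z ^ i‖ ≤ ‖d z * y z ^ j‖) ∨ (∀ᶠ z in 𝒢, ‖d z * y z ^ j‖ < ‖c z * y z ^ i‖) := by
  have key : ∀ {c : Z → ℚ_[p]} {i : ℕ} {z : Z}, y z ^ l = h z → ‖c z ^ l * h z ^ i‖ = ‖c z * y z ^ i‖ ^ l := by
    intro c i z hz
    rw [← hz, ← norm_pow, mul_pow, ← pow_mul, ← pow_mul, mul_comm l]
  rcases A.zd.le A.dc (A.dc.mul (A.dc.pow hc l) (A.dc.pow A.hh i))
    (A.dc.mul (A.dc.pow hd l) (A.dc.pow A.hh j)) with h1 | h1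
  · left
    filter_upwards [h1, A.hy] with z hz hz2
    rw [key hz2, key hz2] at hz
    exact (pow_le_pow_iff_left₀ (norm_nonneg _) (norm_nonneg _) A.pr.ne_zero).1 hz
  · right
    filter_upwards [h1, A.hy] with z hz hz2
    rw [key hz2, key hz2] at hz
    exact (pow_lt_pow_iff_left₀ (norm_nonneg _) (norm_nonneg _) A.pr.ne_zero).1 hz

theorem no_tie (A : Adj 𝒢 𝔎 y h l) {c d : Z → ℚ_[p]} (hc : c ∈ 𝔎) (hd : d ∈ 𝔎) {i j : ℕ} (hi : i < l)
    (hj : j < l) (hij : i ≠ j) (hd0 : ∀ᶠ z in 𝒢, d z ≠ 0) :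
    ¬ ∀ᶠ z in 𝒢, ‖c z * y z ^ i‖ = ‖d z * y z ^ j‖ := by
  intro ht
  have hco : IsCoprime ((i : ℤ) - j) (l : ℤ) := by
    have : IsCoprime (l : ℤ) ((i : ℤ) - j) := by
      rw [(Nat.prime_iff_prime_int.1 A.pr).irreducible.coprime_iff_not_dvd]
      intro hdvd
      have := Int.eq_zero_of_abs_lt_dvd hdvd (by rw [abs_lt]; omega)
      omega
    exact this.symm
  obtain ⟨u, v, huv⟩ := hco
  apply A.nt _ (A.dc.mul (A.dc.zpow (A.dc.div hd hc) u) (A.dc.zpow A.hh v))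
  filter_upwards [ht, hd0, A.hy0, A.hy] with z h1 h2 h3 h4
  have hy : ‖y z‖ ≠ 0 := norm_ne_zero_iff.2 h3
  have hd : ‖d z‖ ≠ 0 := norm_ne_zero_iff.2 h2
  rw [norm_mul, norm_mul, norm_pow, norm_pow] at h1
  have hc : ‖c z‖ ≠ 0 := by
    intro h0
    rw [h0, zero_mul] at h1
    exact mul_ne_zero hd (pow_ne_zero _ hy) h1.symm
  have h5 : ‖d z‖ / ‖c z‖ = ‖y z‖ ^ ((i : ℤ) - j) := by
    rw [zpow_sub₀ hy, zpow_natCast, zpow_natCast, div_eq_div_iff hc (pow_ne_zero _ hy)]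
    linear_combination -h1
  rw [norm_mul, norm_zpow, norm_zpow, norm_div, h5, ← h4, norm_pow, ← zpow_natCast, ← zpow_mul, ← zpow_mul,
    ← zpow_add₀ hy, mul_comm _ u, mul_comm _ v, huv, zpow_one]

theorem strict (A : Adj 𝒢 𝔎 y h l) {c d : Z → ℚ_[p]} (hc : c ∈ 𝔎) (hd : d ∈ 𝔎) {i j : ℕ} (hi : i < l)
    (hj : j < l) (hij : i ≠ j) (hd0 : ∀ᶠ z in 𝒢, d z ≠ 0)
    (hle : ∀ᶠ z in 𝒢, ‖c z * y z ^ i‖ ≤ ‖d z * y z ^ j‖) (M : ℕ) :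
    ∀ᶠ z in 𝒢, ‖c z * y z ^ i‖ ≤ ‖(p : ℚ_[p])‖ ^ M * ‖d z * y z ^ j‖ := by
  induction M with
  | zero => simpa using hle
  | succ M ih =>
    have hd' : (fun z => (p : ℚ_[p]) ^ M * d z) ∈ 𝔎 := A.dc.mul (A.dc.const _) hd
    have hd0' : ∀ᶠ z in 𝒢, (p : ℚ_[p]) ^ M * d z ≠ 0 := by
      filter_upwards [hd0] with z hz using mul_ne_zero (pow_ne_zero _ p_ne_zero') hz
    rcases A.le_dec hd' hc j i with h1 | h1
    · exfalso
      refine A.no_tie hc hd' hi hj hij hd0' ?_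
      filter_upwards [h1, ih] with z h2 h3
      refine le_antisymm ?_ h2
      rw [mul_assoc, norm_mul (_ ^ M), norm_pow]
      exact h3
    · filter_upwards [h1] with z h2
      rw [norm_lt_iff_le_p_mul] at h2
      rw [pow_succ', mul_assoc]
      refine h2.2.trans_eq ?_
      rw [mul_assoc _ (d z), norm_mul (_ ^ M), norm_pow]

theorem dominant (A : Adj 𝒢 𝔎 y h l) {c : ℕ → Z → ℚ_[p]} (hc : ∀ j, c j ∈ 𝔎) :
    (∀ j < l, ∀ᶠ z in 𝒢, c j z = 0) ∨ ∃ j0 < l, (∀ᶠ z in 𝒢, c j0 z ≠ 0) ∧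
      ∀ M : ℕ, ∀ j < l, j ≠ j0 →
        ∀ᶠ z in 𝒢, ‖c j z * y z ^ j‖ ≤ ‖(p : ℚ_[p])‖ ^ M * ‖c j0 z * y z ^ j0‖ := by
  obtain ⟨j0, hj0, hm⟩ := ev_max (𝒢 := 𝒢) (Finset.range l) (Finset.nonempty_range_iff.2 A.pr.ne_zero)
    (fun j z => c j z * y z ^ j) (fun i _ j _ => (A.le_dec (hc i) (hc j) i j).imp id
      (fun h => h.mono fun z hz => hz.le))
  rw [Finset.mem_range] at hj0
  rcases A.zd _ (hc j0) with h0 | h0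
  · left
    intro j hj
    filter_upwards [h0, hm j (Finset.mem_range.2 hj), A.hy0] with z h1 h2 h3
    rw [h1, zero_mul, norm_zero, norm_le_zero_iff, mul_eq_zero] at h2
    exact h2.resolve_right (pow_ne_zero _ h3)
  · right
    exact ⟨j0, hj0, h0, fun M j hj hjj => A.strict (hc j) (hc j0) hj hj0 hjj h0 (hm j (Finset.mem_range.2 hj)) M⟩

end Adj

end Adj

end PadicSub

namespace PadicSub

section Adj2

variable {p : ℕ} [hp : Fact p.Prime] {Z : Type*}

theorem dom_sum {ι : Type*} [DecidableEq ι] {s : Finset ι} {a : ι → ℚ_[p]} {j0 : ι} (hj : j0 ∈ s) {C : ℝ} (hC : 0 ≤ C)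
    (h : ∀ j ∈ s, j ≠ j0 → ‖a j‖ ≤ C) : ‖∑ j ∈ s, a j - a j0‖ ≤ C := by
  rw [← Finset.add_sum_erase s a hj, add_sub_cancel_left]
  refine nsum_le hC fun i hi => ?_
  rw [Finset.mem_erase] at hi
  exact h i hi.2 hi.1

theorem norm_eq_of_sub_le {a b : ℚ_[p]} (hb : b ≠ 0) {M : ℕ} (hM : 0 < M)
    (h : ‖a - b‖ ≤ ‖(p : ℚ_[p])‖ ^ M * ‖b‖) : ‖a‖ = ‖b‖ := by
  have h1 : ‖a - b‖ < ‖b‖ := by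
    refine h.trans_lt ?_
    have := norm_pos_iff.2 hb
    have h2 : ‖(p : ℚ_[p])‖ ^ M < 1 := pow_lt_one₀ norm_p_pos.le norm_p_lt_one' hM.ne'
    nlinarith
  have := nadd_eq h1
  rwa [add_sub_cancel] at this

/-- closeness implies same coset -/
theorem coset_of_close {n : ℕ} {M : ℕ} (hM : ∀ x : ℚ_[p], ‖x - 1‖ ≤ ‖(p : ℚ_[p])‖ ^ M → x ∈ Pset p n)
    {a b μ : ℚ_[p]} (hb : b ∈ cosetP p μ n) (hb0 : b ≠ 0) (h : ‖a - b‖ ≤ ‖(p : ℚ_[p])‖ ^ M * ‖b‖) :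
    a ∈ cosetP p μ n := by
  have h1 : a / b ∈ Pset p n := by
    apply hM
    rw [div_sub_one hb0, norm_div, div_le_iff₀ (norm_pos_iff.2 hb0)]
    exact h
  refine cosetP_trans (ν := μ) (μ := b) ?_ hb
  rwa [mem_cosetP_iff hb0]

namespace Adj

variable {𝒢 : Filter Z} {𝔎 : Set (Z → ℚ_[p])} {y h : Z → ℚ_[p]} {l : ℕ}

def N (𝒢 : Filter Z) (𝔎 : Set (Z → ℚ_[p])) (y : Z → ℚ_[p]) (l : ℕ) : Set (Z → ℚ_[p]) :=
  {f | ∃ c : ℕ → Z → ℚ_[p], (∀ j, c j ∈ 𝔎) ∧ f =ᶠ[𝒢] fun z => ∑ j ∈ Finset.range l, c j z * y z ^ j}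

theorem N_ev {f g : Z → ℚ_[p]} (hf : f ∈ N 𝒢 𝔎 y l) (hfg : f =ᶠ[𝒢] g) : g ∈ N 𝒢 𝔎 y l := by
  obtain ⟨c, hc, h1⟩ := hf
  exact ⟨c, hc, hfg.symm.trans h1⟩

theorem N_mono (A : Adj 𝒢 𝔎 y h l) {c : Z → ℚ_[p]} (hc : c ∈ 𝔎) (k : ℕ) :
    (fun z => c z * y z ^ k) ∈ N 𝒢 𝔎 y l := by
  refine ⟨fun j => if j = k % l then fun z => c z * h z ^ (k / l) else fun _ => 0, fun j => ?_, ?_⟩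
  · beta_reduce
    split_ifs
    · exact A.dc.mul hc (A.dc.pow A.hh _)
    · exact A.dc.const 0
  · filter_upwards [A.hy] with z hz
    rw [Finset.sum_eq_single (k % l)]
    · rw [if_pos rfl, ← hz, ← pow_mul, mul_assoc, ← pow_add, Nat.div_add_mod]
    · intro j _ hj
      rw [if_neg hj, zero_mul]
    · intro hk
      exact absurd (Finset.mem_range.2 (Nat.mod_lt _ A.pr.pos)) hk

theorem N_zmono (A : Adj 𝒢 𝔎 y h l) {c : Z → ℚ_[p]} (hc : c ∈ 𝔎) (k : ℤ) :
    (fun z => c z * y z ^ k) ∈ N 𝒢 𝔎 y l := by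
  have hl := A.pr.pos
  obtain ⟨n, hn⟩ : ∃ n : ℕ, (n : ℤ) = k + l * k.natAbs := by
    refine ⟨(k + l * k.natAbs).toNat, Int.toNat_of_nonneg ?_⟩
    have : (k.natAbs : ℤ) ≤ l * k.natAbs := le_mul_of_one_le_left (by omega) (by exact_mod_cast hl)
    omega
  refine N_ev (A.N_mono (A.dc.mul hc (A.dc.zpow A.hh (-(k.natAbs : ℤ)))) n) ?_
  filter_upwards [A.hy, A.hy0] with z h1 h2
  rw [← h1, ← zpow_natCast, ← zpow_natCast, ← zpow_mul, mul_assoc, ← zpow_add₀ h2, hn]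
  congr 2
  ring

theorem N_add (A : Adj 𝒢 𝔎 y h l) {f g : Z → ℚ_[p]} (hf : f ∈ N 𝒢 𝔎 y l) (hg : g ∈ N 𝒢 𝔎 y l) :
    (fun z => f z + g z) ∈ N 𝒢 𝔎 y l := by
  obtain ⟨c, hc, h1⟩ := hf
  obtain ⟨d, hd, h2⟩ := hg
  refine ⟨fun j z => c j z + d j z, fun j => A.dc.add (hc j) (hd j), ?_⟩
  filter_upwards [h1, h2] with z h3 h4
  rw [h3, h4, ← Finset.sum_add_distrib]
  exact Finset.sum_congr rfl fun j _ => by ring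

theorem N_K (A : Adj 𝒢 𝔎 y h l) {f : Z → ℚ_[p]} (hf : f ∈ 𝔎) : f ∈ N 𝒢 𝔎 y l := by
  simpa using A.N_mono hf 0

theorem N_sum (A : Adj 𝒢 𝔎 y h l) {ι : Type*} (s : Finset ι) (f : ι → Z → ℚ_[p])
    (hf : ∀ i ∈ s, f i ∈ N 𝒢 𝔎 y l) : (fun z => ∑ i ∈ s, f i z) ∈ N 𝒢 𝔎 y l := by
  classical
  induction s using Finset.induction_on with
  | empty => simpa using A.N_K (A.dc.const 0)
  | insert a s ha ih =>
    simp only [Finset.sum_insert ha]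
    exact A.N_add (hf a (by simp)) (ih fun i hi => hf i (by simp [hi]))

theorem N_mul (A : Adj 𝒢 𝔎 y h l) {f g : Z → ℚ_[p]} (hf : f ∈ N 𝒢 𝔎 y l) (hg : g ∈ N 𝒢 𝔎 y l) :
    (fun z => f z * g z) ∈ N 𝒢 𝔎 y l := by
  obtain ⟨c, hc, h1⟩ := hf
  obtain ⟨d, hd, h2⟩ := hg
  refine N_ev (f := fun z => ∑ i ∈ Finset.range l, ∑ j ∈ Finset.range l, (c i z * d j z) * y z ^ (i + j)) ?_ ?_
  · exact A.N_sum _ _ fun i _ => A.N_sum _ (fun j z => (c i z * d j z) * y z ^ (i + j))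
      fun j _ => A.N_mono (A.dc.mul (hc i) (hd j)) _
  · filter_upwards [h1, h2] with z h3 h4
    rw [h3, h4, Finset.sum_mul_sum]
    exact Finset.sum_congr rfl fun i _ => Finset.sum_congr rfl fun j _ => by ring

/-- the normal form of an element -/
theorem N_form (A : Adj 𝒢 𝔎 y h l) {c : ℕ → Z → ℚ_[p]} (hc : ∀ j, c j ∈ 𝔎) :
    (∀ j < l, ∀ᶠ z in 𝒢, c j z = 0) ∨ ∃ j0 < l, (∀ᶠ z in 𝒢, c j0 z ≠ 0) ∧
      ∀ M : ℕ, ∀ᶠ z in 𝒢, (∀ j < l, j ≠ j0 → ‖c j z * y z ^ j‖ ≤ ‖(p : ℚ_[p])‖ ^ M * ‖c j0 z * y z ^ j0‖) ∧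
        ‖∑ j ∈ Finset.range l, c j z * y z ^ j - c j0 z * y z ^ j0‖ ≤ ‖(p : ℚ_[p])‖ ^ M * ‖c j0 z * y z ^ j0‖ := by
  refine (A.dominant hc).imp id ?_
  rintro ⟨j0, hj0, h0, h1⟩
  refine ⟨j0, hj0, h0, fun M => ?_⟩
  have h2 : ∀ᶠ z in 𝒢, ∀ j ∈ Finset.range l, j ≠ j0 → ‖c j z * y z ^ j‖ ≤ ‖(p : ℚ_[p])‖ ^ M * ‖c j0 z * y z ^ j0‖ := by
    rw [Filter.eventually_all_finset]
    intro j hj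
    by_cases hjj : j = j0
    · exact Eventually.of_forall fun _ h => absurd hjj h
    · exact (h1 M j (Finset.mem_range.1 hj) hjj).mono fun z hz _ => hz
  filter_upwards [h2] with z hz
  exact ⟨fun j hj => hz j (Finset.mem_range.2 hj), dom_sum (Finset.mem_range.2 hj0) (by positivity) hz⟩

theorem N_cases (A : Adj 𝒢 𝔎 y h l) {f : Z → ℚ_[p]} (hf : f ∈ N 𝒢 𝔎 y l) :
    (∀ᶠ z in 𝒢, f z = 0) ∨ ∃ c ∈ 𝔎, ∃ j : ℕ, (∀ᶠ z in 𝒢, c z ≠ 0) ∧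
      ∀ M : ℕ, ∀ᶠ z in 𝒢, ‖f z - c z * y z ^ j‖ ≤ ‖(p : ℚ_[p])‖ ^ M * ‖c z * y z ^ j‖ := by
  obtain ⟨c, hc, h1⟩ := hf
  rcases A.N_form hc with h2 | ⟨j0, hj0, h2, h3⟩
  · left
    have h3 : ∀ᶠ z in 𝒢, ∀ j ∈ Finset.range l, c j z = 0 := by
      rw [Filter.eventually_all_finset]
      intro j hj
      exact h2 j (Finset.mem_range.1 hj)
    filter_upwards [h1, h3] with z h4 h5
    rw [h4]
    exact Finset.sum_eq_zero fun j hj => by rw [h5 j hj, zero_mul]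
  · right
    refine ⟨c j0, hc j0, j0, h2, fun M => ?_⟩
    filter_upwards [h1, h3 M] with z h4 h5
    rw [h4]
    exact h5.2

theorem N_an (A : Adj 𝒢 𝔎 y h l) {σ : Type*} [Finite σ] {F : (σ → ℤ_[p]) → ℤ_[p]} (hF : An F)
    {φ : σ → Z → ℚ_[p]} (hφ : ∀ i, φ i ∈ N 𝒢 𝔎 y l) (hi : ∀ i, ∀ᶠ z in 𝒢, ‖φ i z‖ ≤ 1) :
    anf F φ ∈ N 𝒢 𝔎 y l := by
  classical
  let _ := Fintype.ofFinite σ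
  have : NeZero l := ⟨A.pr.ne_zero⟩
  choose c hc h1 using hφ
  have h2 : ∀ i, ∀ j < l, ∀ᶠ z in 𝒢, ‖c i j z * y z ^ j‖ ≤ 1 := by
    intro i j hj
    rcases A.N_form (hc i) with h3 | ⟨j0, hj0, h3, h4⟩
    · filter_upwards [h3 j hj] with z hz
      rw [hz]; simp
    · filter_upwards [h3, h4 1, A.hy0, hi i, h1 i] with z h5 h6 h7 h8 h9
      have h10 := norm_eq_of_sub_le (mul_ne_zero h5 (pow_ne_zero j0 h7)) one_pos h6.2
      rw [← h9] at h10
      by_cases hjj : j = j0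
      · rw [hjj, ← h10]; exact h8
      · refine (h6.1 j hj hjj).trans ?_
        rw [← h10, pow_one]
        exact mul_le_one₀ norm_p_lt_one'.le (norm_nonneg _) h8
  let F' : (σ × Fin l → ℤ_[p]) → ℤ_[p] := fun v => F (fun i => ∑ j, v (i, j))
  have hF' : An F' := hF.comp fun i => An.sum _ fun j _ => An.proj (i, j)
  obtain ⟨G, hG, h3⟩ := An.modular l hF'
  have h4 : ∀ k, ∃ f ∈ 𝔎, ∀ z, (∀ i : σ × Fin l, ‖c i.1 i.2 z ^ l * h z ^ (i.2 : ℕ)‖ ≤ 1) →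
      f z = (G k (fun i : σ × Fin l => trc (c i.1 i.2 z ^ l * h z ^ (i.2 : ℕ))) : ℚ_[p]) := fun k =>
    A.dc.an (hG k) (fun (i : σ × Fin l) z => c i.1 i.2 z ^ l * h z ^ (i.2 : ℕ))
      (fun i => A.dc.mul (A.dc.pow (hc _ _) _) (A.dc.pow A.hh _))
  choose g hg h5 using h4
  refine N_ev (f := fun z => ∑ k : σ × Fin l → Fin l,
    ((∏ i, c i.1 i.2 z ^ (k i : ℕ)) * g k z) * y z ^ (∑ i, (i.2 : ℕ) * (k i : ℕ))) ?_ ?_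
  · refine A.N_sum _ (fun k z => ((∏ i, c i.1 i.2 z ^ (k i : ℕ)) * g k z) * y z ^ (∑ i, (i.2 : ℕ) * (k i : ℕ)))
      fun k _ => A.N_mono (A.dc.mul (A.dc.prod _ _ fun i _ => A.dc.pow (hc _ _) _) (hg k)) _
  · have h6 : ∀ᶠ z in 𝒢, ∀ i : σ × Fin l, ‖c i.1 i.2 z * y z ^ (i.2 : ℕ)‖ ≤ 1 :=
      eventually_all.2 fun i => h2 i.1 i.2 i.2.2
    filter_upwards [h6, eventually_all.2 h1, A.hy] with z h7 h8 h9
    have h10 : ∀ i : σ × Fin l, c i.1 i.2 z ^ l * h z ^ (i.2 : ℕ) = (c i.1 i.2 z * y z ^ (i.2 : ℕ)) ^ l := by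
      intro i
      rw [← h9, mul_pow, ← pow_mul, ← pow_mul, mul_comm l]
    have h11 : (fun i => trc (φ i z)) = fun i => ∑ j : Fin l, trc (c i j z * y z ^ (j : ℕ)) := by
      funext i
      apply PadicInt.ext
      rw [coe_sum', h8 i, ← Fin.sum_univ_eq_sum_range (fun j => c i j z * y z ^ j) l]
      rw [trc_coe]
      · exact Finset.sum_congr rfl fun j _ => (trc_coe (h7 (i, j))).symm
      · exact nsum_le zero_le_one fun j _ => h7 (i, j)
    have h12 : anf F φ z = ((F' fun i => trc (c i.1 i.2 z * y z ^ (i.2 : ℕ)) : ℤ_[p]) : ℚ_[p]) := by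
      rw [anf, h11]
    have h12' := congrArg (fun x : ℤ_[p] => (x : ℚ_[p])) (h3 fun i => trc (c i.1 i.2 z * y z ^ (i.2 : ℕ)))
    refine Eq.trans ?_ (h12.trans h12').symm
    beta_reduce
    rw [coe_sum']
    have h13 : (∀ i : σ × Fin l, ‖c i.1 i.2 z ^ l * h z ^ (i.2 : ℕ)‖ ≤ 1) := by
      intro i
      rw [h10, norm_pow]
      exact pow_le_one₀ (norm_nonneg _) (h7 i)
    refine Finset.sum_congr ?_ fun k _ => ?_
    · congr!
    rw [h5 k z h13, PadicInt.coe_mul, coe_prod']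
    have h14 : (fun i : σ × Fin l => trc (c i.1 i.2 z ^ l * h z ^ (i.2 : ℕ))) =
      fun i => trc (c i.1 i.2 z * y z ^ (i.2 : ℕ)) ^ l := by
        funext i
        apply PadicInt.ext
        rw [trc_coe (h13 i), PadicInt.coe_pow, trc_coe (h7 i), h10]
    rw [h14, mul_right_comm]
    congr 1
    rw [← Finset.prod_pow_eq_pow_sum, ← Finset.prod_mul_distrib]
    refine Finset.prod_congr ?_ fun i _ => ?_
    · congr!
    rw [PadicInt.coe_pow, trc_coe (h7 i), mul_pow, ← pow_mul]

theorem N_inv (A : Adj 𝒢 𝔎 y h l) {f : Z → ℚ_[p]} (hf : f ∈ N 𝒢 𝔎 y l) :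
    (fun z => (f z)⁻¹) ∈ N 𝒢 𝔎 y l := by
  rcases A.N_cases hf with h1 | ⟨c, hc, j, h1, h2⟩
  · refine N_ev (A.N_K (A.dc.const 0)) ?_
    filter_upwards [h1] with z hz
    rw [hz, inv_zero]
  · have hd : (fun z => (c z * y z ^ j)⁻¹) ∈ N 𝒢 𝔎 y l := by
      refine N_ev (A.N_zmono (A.dc.inv hc) (-(j : ℤ))) (Eventually.of_forall fun z => ?_)
      simp only [zpow_neg, zpow_natCast, mul_inv]
    let u : Unit → Z → ℚ_[p] := fun _ z => (f z * (c z * y z ^ j)⁻¹ + (-1)) * (p : ℚ_[p])⁻¹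
    have hu : ∀ i, u i ∈ N 𝒢 𝔎 y l := fun _ =>
      A.N_mul (A.N_add (A.N_mul hf hd) (A.N_K (A.dc.const (-1)))) (A.N_K (A.dc.const _))
    have hu1 : ∀ i, ∀ᶠ z in 𝒢, ‖u i z‖ ≤ 1 := by
      intro i
      filter_upwards [h1, h2 1, A.hy0] with z h3 h4 h5
      have h6 : c z * y z ^ j ≠ 0 := mul_ne_zero h3 (pow_ne_zero _ h5)
      have h7 : u i z = (f z - c z * y z ^ j) / (p * (c z * y z ^ j)) := by
        have := p_ne_zero' (p := p)
        simp only [u]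
        field_simp
        ring
      rw [h7, norm_div, norm_mul (p : ℚ_[p])]
      apply div_le_one_of_le₀ _ (by positivity)
      simpa using h4
    obtain ⟨F', hF', h3⟩ := An.inv (An.proj (p := p) ())
    refine N_ev (A.N_mul hd (A.N_add (A.N_K (A.dc.const 1)) (A.N_mul (A.N_K (A.dc.const p)) (A.N_an hF' hu hu1)))) ?_
    filter_upwards [h1, A.hy0, hu1 ()] with z h4 h5 h6
    have h7 : c z * y z ^ j ≠ 0 := mul_ne_zero h4 (pow_ne_zero _ h5)
    have h8 := congrArg (fun x : ℤ_[p] => (x : ℚ_[p])) (h3 fun i => trc (u i z))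
    simp only [PadicInt.coe_mul, PadicInt.coe_add, PadicInt.coe_one, PadicInt.coe_natCast, trc_coe h6] at h8
    have h9 : f z = (c z * y z ^ j) * (1 + p * u () z) := by
      have := p_ne_zero' (p := p)
      simp only [u]
      field_simp
      ring
    rw [h9]
    refine Eq.trans ?_ (mul_inv (c z * y z ^ j) _).symm
    refine congrArg (fun x => (c z * y z ^ j)⁻¹ * x) ?_
    exact eq_inv_of_mul_eq_one_right h8

theorem N_norm_dec (A : Adj 𝒢 𝔎 y h l) {f : Z → ℚ_[p]} (hf : f ∈ N 𝒢 𝔎 y l) :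
    (∀ᶠ z in 𝒢, ‖f z‖ ≤ 1) ∨ (∀ᶠ z in 𝒢, ¬ ‖f z‖ ≤ 1) := by
  rcases A.N_cases hf with h1 | ⟨c, hc, j, h1, h2⟩
  · left
    filter_upwards [h1] with z hz
    rw [hz]; simp
  · refine (A.le_dec hc (A.dc.const 1) j 0).imp (fun h3 => ?_) (fun h3 => ?_)
    · filter_upwards [h1, h2 1, A.hy0, h3] with z h3 h4 h5 h6
      rw [norm_eq_of_sub_le (mul_ne_zero h3 (pow_ne_zero _ h5)) one_pos h4]
      simpa using h6
    · filter_upwards [h1, h2 1, A.hy0, h3] with z h3 h4 h5 h6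
      rw [norm_eq_of_sub_le (mul_ne_zero h3 (pow_ne_zero _ h5)) one_pos h4]
      simpa using h6

theorem N_good (A : Adj 𝒢 𝔎 y h l) {𝔇 : Set (Z → ℚ_[p])} (h𝔇 : DClosed 𝔇) (hG : Good 𝒢 𝔇 𝔎)
    (hy : ∀ N > 0, ∃ μ : ℚ_[p], ∀ᶠ z in 𝒢, y z ∈ cosetP p μ N) : Good 𝒢 𝔇 (N 𝒢 𝔎 y l) := by
  refine ⟨?_, ?_, ?_⟩
  · apply DClosed.of_ev (𝒢 := 𝒢)
    · exact fun f g hf hfg => N_ev hf hfg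
    · exact fun c => A.N_K (A.dc.const c)
    · exact fun f g hf hg => A.N_add hf hg
    · exact fun f g hf hg => A.N_mul hf hg
    · exact fun f hf => A.N_inv hf
    · exact fun f hf => A.N_norm_dec hf
    · exact fun n F hF φ hφ hi => A.N_an hF hφ hi
  · intro f hf n hn
    rcases A.N_cases hf with h1 | ⟨c, hc, j, h1, h2⟩
    · refine ⟨0, ?_⟩
      filter_upwards [h1] with z hz
      rw [hz]
      exact mem_cosetP_zero.2 rfl
    · obtain ⟨M, hM⟩ := exists_near_one_pow (p := p) n hn
      obtain ⟨μ, hμ⟩ := hG.dec c hc n hn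
      obtain ⟨ν, hν⟩ := hy n hn
      refine ⟨μ * ν ^ (j : ℤ), ?_⟩
      filter_upwards [h1, h2 M, A.hy0, hμ, hν] with z h3 h4 h5 h6 h7
      refine coset_of_close hM (b := c z * y z ^ j) ?_ (mul_ne_zero h3 (pow_ne_zero _ h5)) h4
      rw [← zpow_natCast]
      exact cosetP_mul h6 (cosetP_zpow _ h7)
  · intro f hf
    rcases A.N_cases hf with h1 | ⟨c, hc, j, h1, h2⟩
    · refine ⟨1, one_pos, fun _ => 0, h𝔇.const 0, ?_⟩
      filter_upwards [h1] with z hz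
      rw [hz]; simp
    · obtain ⟨e, he, d, hd, h3⟩ := hG.hull c hc
      obtain ⟨e', he', d', hd', h4⟩ := hG.hull h A.hh
      refine ⟨l * e * e', by have := A.pr.pos; positivity, _,
        h𝔇.mul (h𝔇.pow hd (l * e')) (h𝔇.pow hd' (e * j)), ?_⟩
      filter_upwards [h1, h2 1, A.hy0, h3, h4, A.hy] with z h5 h6 h7 h8 h9 h10
      rw [norm_eq_of_sub_le (mul_ne_zero h5 (pow_ne_zero _ h7)) one_pos h6, norm_mul, norm_mul, norm_pow, norm_pow,
        norm_pow, ← h8, ← h9, ← h10, norm_pow]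
      ring

end Adj

end Adj2

end PadicSub

namespace PadicSub

section DP

variable {p : ℕ} [hp : Fact p.Prime] {Z : Type*}

theorem norm_pow_sub_one_le {w : ℚ_[p]} (hw : ‖w‖ ≤ 1) (l : ℕ) : ‖w ^ l - 1‖ ≤ ‖w - 1‖ := by
  rw [← geom_sum_mul, norm_mul]
  refine mul_le_of_le_one_left (norm_nonneg _) (nsum_le zero_le_one fun i _ => ?_)
  rw [norm_pow]
  exact pow_le_one₀ (norm_nonneg _) hw

theorem Good.adj_tie {𝒢 : Filter Z} [𝒢.NeBot] {𝔇 𝔎 : Set (Z → ℚ_[p])} (hG : Good 𝒢 𝔇 𝔎)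
    {l : ℕ} (hl : 0 < l) {h g : Z → ℚ_[p]} (hh : h ∈ 𝔎) (hg : g ∈ 𝔎)
    (hy : ∀ N > 0, ∃ μ : ℚ_[p], ∀ᶠ z in 𝒢, rt l (h z) ∈ cosetP p μ N)
    (hy0 : ∀ᶠ z in 𝒢, rt l (h z) ≠ 0) (hyg : ∀ᶠ z in 𝒢, ‖rt l (h z)‖ = ‖g z‖) :
    (fun z => rt l (h z)) ∈ Evc 𝒢 𝔎 := by
  obtain ⟨M1, hM1⟩ := exists_near_one_pow (p := p) (rtN p l) (rtN_pos l hl)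
  obtain ⟨M, ρ, hMM, hρ, hρ2⟩ := root_an (p := p) l hl M1
  have hlM : (l : ℚ_[p]) * p ^ M ≠ 0 :=
    mul_ne_zero (by exact_mod_cast hl.ne') (pow_ne_zero _ p_ne_zero')
  obtain ⟨M2, hM2⟩ := exists_pow_lt (p := p) (norm_pos_iff.2 hlM)
  obtain ⟨N, hN, hN2⟩ := exists_pow_near_one (p := p) (max M1 M2)
  obtain ⟨κ1, h1⟩ := hy N hN
  obtain ⟨κ2, h2⟩ := hG.dec g hg N hN
  obtain ⟨z0, h3, h4, h5, h6⟩ := (h1.and (h2.and (hy0.and hyg))).exists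
  set κ : ℚ_[p] := rt l (h z0) / g z0 with hκ
  have hg0 : g z0 ≠ 0 := by rw [← norm_ne_zero_iff, ← h6, norm_ne_zero_iff]; exact h5
  have hκ0 : κ ≠ 0 := div_ne_zero h5 hg0
  have hκ1 : ‖κ‖ = 1 := by rw [hκ, norm_div, h6, div_self (norm_ne_zero_iff.2 hg0)]
  let x : Unit → Z → ℚ_[p] := fun _ z => (h z / (g z * κ) ^ l - 1) / (l * p ^ M)
  have hx : ∀ i, x i ∈ 𝔎 := fun _ => hG.dc.div (hG.dc.sub (hG.dc.div hh
    (hG.dc.pow (hG.dc.mul hg (hG.dc.const _)) _)) (hG.dc.const 1)) (hG.dc.const _)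
  obtain ⟨f, hf, hf2⟩ := hG.dc.an hρ x hx
  refine ⟨fun z => g z * κ * (1 + p ^ M * f z), hG.dc.mul (hG.dc.mul hg (hG.dc.const _))
    (hG.dc.add (hG.dc.const 1) (hG.dc.mul (hG.dc.const _) hf)), ?_⟩
  filter_upwards [h1, h2, hy0, hyg] with z h7 h8 h9 h10
  have hgz : g z ≠ 0 := by rw [← norm_ne_zero_iff, ← h10, norm_ne_zero_iff]; exact h9
  set w : ℚ_[p] := rt l (h z) / (g z * κ) with hw
  have hw1 : ‖w‖ = 1 := by
    rw [hw, norm_div, norm_mul, hκ1, h10, mul_one, div_self (norm_ne_zero_iff.2 hgz)]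
  have hwN : w ∈ Pset p N := by
    have h11 : rt l (h z) ∈ cosetP p (rt l (h z0)) N := cosetP_trans h7 (cosetP_symm h3)
    have h12 : g z ∈ cosetP p (g z0) N := cosetP_trans h8 (cosetP_symm h4)
    have h13 := Pset_mul ((mem_cosetP_iff h5).1 h11) (Pset_inv ((mem_cosetP_iff hg0).1 h12))
    convert h13 using 1
    rw [hw, hκ]
    field_simp
  have hw2 := hN2 w hwN hw1
  have hpM : ∀ a b : ℕ, a ≤ b → ‖(p : ℚ_[p])‖ ^ b ≤ ‖(p : ℚ_[p])‖ ^ a := fun a b hab =>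
    pow_le_pow_of_le_one norm_p_pos.le norm_p_lt_one'.le hab
  have hwr : w ∈ Pset p (rtN p l) := hM1 w (hw2.trans (hpM _ _ (le_max_left _ _)))
  have hwl : h z / (g z * κ) ^ l = w ^ l := by
    rw [hw, div_pow, rt_pow h9]
  have hxz : ∀ i, ‖x i z‖ ≤ 1 := by
    intro i
    simp only [x]
    rw [hwl, norm_div, div_le_one (norm_pos_iff.2 hlM)]
    refine (norm_pow_sub_one_le hw1.le l).trans (hw2.trans ((hpM _ _ (le_max_right _ _)).trans hM2.le))
  have h14 := congrArg (fun x : ℤ_[p] => (x : ℚ_[p])) (hρ2 fun i => trc (x i z))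
  have h15 := hf2 z hxz
  simp only [PadicInt.coe_mul, PadicInt.coe_add, PadicInt.coe_one, PadicInt.coe_pow, PadicInt.coe_natCast,
    trc_coe (hxz ())] at h14
  rw [← h15] at h14
  have h16 : (l : ℚ_[p]) * p ^ M * x () z = w ^ l - 1 := by
    simp only [x]
    rw [hwl, mul_div_cancel₀ _ hlM]
  rw [h16, add_sub_cancel] at h14
  have h17 : (1 + (p : ℚ_[p]) ^ M * f z) ∈ Pset p (rtN p l) := by
    apply hM1
    rw [add_sub_cancel_left, norm_mul, norm_pow]
    refine (mul_le_of_le_one_right (by positivity) ?_).trans (hpM _ _ hMM)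
    rw [h15]; exact PadicInt.norm_le_one _
  have hw0 : w ≠ 0 := Pset_ne_zero hwr
  have h18 : (1 + (p : ℚ_[p]) ^ M * f z) * w⁻¹ = 1 := by
    apply rtN_spec l hl _ (Pset_mul h17 (Pset_inv hwr))
    rw [mul_pow, h14, inv_pow, mul_inv_cancel₀ (pow_ne_zero _ hw0)]
  have h19 : (1 + (p : ℚ_[p]) ^ M * f z) = w := by
    rwa [mul_inv_eq_one₀ hw0] at h18
  show rt l (h z) = g z * κ * (1 + p ^ M * f z)
  rw [h19, hw, mul_div_cancel₀ _ (mul_ne_zero hgz hκ0)]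

theorem Good.adj {𝒢 : Filter Z} [𝒢.NeBot] {𝔇 𝔎 : Set (Z → ℚ_[p])} (h𝔇 : DClosed 𝔇) (hG : Good 𝒢 𝔇 𝔎)
    {l : ℕ} (hl : l.Prime) {h : Z → ℚ_[p]} (hh : h ∈ 𝔎) :
    ∃ 𝔎', 𝔎 ⊆ 𝔎' ∧ Good 𝒢 𝔇 𝔎' ∧ (fun z => rt l (h z)) ∈ 𝔎' := by
  have hy : ∀ N > 0, ∃ μ : ℚ_[p], ∀ᶠ z in 𝒢, rt l (h z) ∈ cosetP p μ N := by
    intro N hN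
    obtain ⟨c, hc⟩ := hG.dec h hh (l * (N * rtN p l)) (by have := rtN_pos (p := p) l hl.pos; have := hl.pos; positivity)
    obtain ⟨ν, hν⟩ := rt_dec (p := p) hl.pos N c
    exact ⟨ν, hc.mono fun z hz => hν _ hz⟩
  have h0 : (∀ᶠ z in 𝒢, rt l (h z) = 0) ∨ (∀ᶠ z in 𝒢, rt l (h z) ≠ 0) := by
    obtain ⟨μ, hμ⟩ := hy 1 one_pos
    by_cases h1 : μ = 0
    · left; exact hμ.mono fun z hz => (cosetP_eq_zero_iff hz).2 h1
    · right; exact hμ.mono fun z hz => cosetP_ne_zero h1 hz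
  rcases h0 with h0 | h0
  · exact ⟨_, Evc.subset 𝒢 𝔎, hG.evc, ⟨fun _ => 0, hG.dc.const 0, h0⟩⟩
  by_cases ht : ∃ g ∈ 𝔎, ∀ᶠ z in 𝒢, ‖rt l (h z)‖ = ‖g z‖
  · obtain ⟨g, hg, hg1⟩ := ht
    exact ⟨_, Evc.subset 𝒢 𝔎, hG.evc, hG.adj_tie hl.pos hh hg hy h0 hg1⟩
  · have A : Adj 𝒢 𝔎 (fun z => rt l (h z)) h l :=
      ⟨hl, hG.dc, hG.zdec, hh, h0.mono fun z hz => rt_pow hz, h0, fun g hg h1 => by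
        exact ht ⟨g, hg, h1⟩⟩
    refine ⟨_, fun f hf => A.N_K hf, A.N_good h𝔇 hG hy, ?_⟩
    simpa using A.N_mono (A.dc.const 1) 1

/-- `D`-functions with roots -/
inductive IsDP {m : ℕ} : ((Fin m → ℚ_[p]) → ℚ_[p]) → Prop where
  | comp {n : ℕ} (F : (Fin n → ℚ_[p]) → ℚ_[p]) (hF : IsDFunction p F) (g : Fin n → (Fin m → ℚ_[p]) → ℚ_[p])
      (hg : ∀ i, IsDP (g i)) : IsDP (fun z => F (fun i => g i z))
  | rt (l : ℕ) (hl : l.Prime) (h) (hh : IsDP h) : IsDP (fun z => rt l (h z))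
  | base (f) (hf : IsDFunction p f) : IsDP f

theorem Good.exists_dp {m : ℕ} {𝒢 : Filter (Fin m → ℚ_[p])} [𝒢.NeBot] {f : (Fin m → ℚ_[p]) → ℚ_[p]} (hf : IsDP f) :
    ∀ {𝔎}, Good 𝒢 {f | IsDFunction p f} 𝔎 → {f | IsDFunction p f} ⊆ 𝔎 →
    ∃ 𝔎', 𝔎 ⊆ 𝔎' ∧ Good 𝒢 {f | IsDFunction p f} 𝔎' ∧ f ∈ 𝔎' := by
  induction hf with
  | base f hf => exact fun {𝔎} hG h => ⟨𝔎, subset_rfl, hG, h hf⟩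
  | rt l hl h _ ih =>
    intro 𝔎 hG hs
    obtain ⟨𝔎1, h1, h2, h3⟩ := ih hG hs
    obtain ⟨𝔎2, h4, h5, h6⟩ := h2.adj (dclosed_D m) hl h3
    exact ⟨𝔎2, h1.trans h4, h5, h6⟩
  | @comp n F hF g _ ih =>
    intro 𝔎 hG hs
    have key : ∀ s : Finset (Fin n), ∃ 𝔎', 𝔎 ⊆ 𝔎' ∧ Good 𝒢 {f | IsDFunction p f} 𝔎' ∧ ∀ i ∈ s, g i ∈ 𝔎' := by
      intro s
      induction s using Finset.induction_on with
      | empty => exact ⟨𝔎, subset_rfl, hG, by simp⟩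
      | insert a s _ ih2 =>
        obtain ⟨𝔎1, h1, h2, h3⟩ := ih2
        obtain ⟨𝔎2, h4, h5, h6⟩ := ih a h2 (hs.trans h1)
        refine ⟨𝔎2, h1.trans h4, h5, fun i hi => ?_⟩
        rcases Finset.mem_insert.1 hi with rfl | hi
        · exact h6
        · exact h4 (h3 i hi)
    obtain ⟨𝔎', h1, h2, h3⟩ := key Finset.univ
    exact ⟨𝔎', h1, h2, h2.dc.comp F hF g fun i => h3 i (Finset.mem_univ _)⟩

/-- the filter generated by the subanalytic members of an ultrafilter -/
def subF {m : ℕ} (𝒰 : Ultrafilter (Fin m → ℚ_[p])) : Filter (Fin m → ℚ_[p]) where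
  sets := {A | ∃ S ∈ 𝒰, IsSubanalytic p S ∧ S ⊆ A}
  univ_sets := ⟨Set.univ, Filter.univ_mem, isSubanalytic_univ, subset_rfl⟩
  sets_of_superset := fun ⟨S, h1, h2, h3⟩ h => ⟨S, h1, h2, h3.trans h⟩
  inter_sets := fun ⟨S, h1, h2, h3⟩ ⟨T, h4, h5, h6⟩ =>
    ⟨S ∩ T, Filter.inter_mem h1 h4, h2.inter h5, Set.inter_subset_inter h3 h6⟩

theorem mem_subF {m : ℕ} {𝒰 : Ultrafilter (Fin m → ℚ_[p])} {A : Set (Fin m → ℚ_[p])} :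
    A ∈ subF 𝒰 ↔ ∃ S ∈ 𝒰, IsSubanalytic p S ∧ S ⊆ A := Iff.rfl

instance subF_neBot {m : ℕ} (𝒰 : Ultrafilter (Fin m → ℚ_[p])) : (subF 𝒰).NeBot := by
  refine Filter.neBot_iff.2 fun h => ?_
  have : (∅ : Set (Fin m → ℚ_[p])) ∈ subF 𝒰 := by rw [h]; exact Filter.mem_bot
  obtain ⟨S, h1, _, h3⟩ := this
  exact Ultrafilter.empty_notMem (Filter.mem_of_superset h1 h3)

theorem good_D {m : ℕ} (𝒰 : Ultrafilter (Fin m → ℚ_[p])) :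
    Good (subF 𝒰) {f | IsDFunction p f} {f | IsDFunction p f} := by
  refine ⟨dclosed_D m, fun f hf N hN => ?_, fun f hf => ⟨1, one_pos, f, hf, Eventually.of_forall fun z => by simp⟩⟩
  obtain ⟨S, hS⟩ := exists_finite_cosets (p := p) N hN
  have : (⋃ μ ∈ S, {x | f x ∈ cosetP p μ N}) ∈ 𝒰 := by
    refine Filter.mem_of_superset Filter.univ_mem fun x _ => ?_
    obtain ⟨μ, h1, h2⟩ := hS (f x)
    exact Set.mem_biUnion h1 h2
  obtain ⟨μ, _, h2⟩ := (Ultrafilter.finite_biUnion_mem_iff S.finite_toSet).1 this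
  exact ⟨μ, _, h2, isSubanalytic_coset hf hN μ, fun _ h => h⟩

variable {m : ℕ}

theorem IsDP.good {f : (Fin m → ℚ_[p]) → ℚ_[p]} (hf : IsDP f) (𝒰 : Ultrafilter (Fin m → ℚ_[p])) :
    ∃ 𝔎, Good (subF 𝒰) {f | IsDFunction p f} 𝔎 ∧ f ∈ 𝔎 := by
  obtain ⟨𝔎, _, h1, h2⟩ := Good.exists_dp hf (good_D 𝒰) subset_rfl
  exact ⟨𝔎, h1, h2⟩

theorem IsDP.coset {f : (Fin m → ℚ_[p]) → ℚ_[p]} (hf : IsDP f) (μ : ℚ_[p]) {N : ℕ} (hN : 0 < N) :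
    IsSubanalytic p {x | f x ∈ cosetP p μ N} := by
  apply subanalytic_of_decided
  intro 𝒰
  obtain ⟨𝔎, h1, h2⟩ := hf.good 𝒰
  obtain ⟨ν, S, h3, h4, h5⟩ := h1.dec f h2 N hN
  refine ⟨S, h3, h4, ?_⟩
  by_cases h : ν ∈ cosetP p μ N
  · left
    exact fun x hx => cosetP_trans (h5 hx) h
  · right
    exact fun x hx hx2 => h (cosetP_trans (cosetP_symm (h5 hx)) hx2)

theorem IsDP.eqZero {f : (Fin m → ℚ_[p]) → ℚ_[p]} (hf : IsDP f) : IsSubanalytic p {x | f x = 0} := by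
  have := hf.coset 0 one_pos
  simpa only [mem_cosetP_zero] using this

theorem IsDP.hull {f : (Fin m → ℚ_[p]) → ℚ_[p]} (hf : IsDP f) (𝒰 : Ultrafilter (Fin m → ℚ_[p])) :
    ∃ S ∈ 𝒰, IsSubanalytic p S ∧ ∃ e > 0, ∃ c, IsDFunction p c ∧ ∀ z ∈ S, ‖f z‖ ^ e = ‖c z‖ := by
  obtain ⟨𝔎, h1, h2⟩ := hf.good 𝒰
  obtain ⟨e, he, c, hc, S, h3, h4, h5⟩ := h1.hull f h2
  exact ⟨S, h3, h4, e, he, c, hc, fun z hz => h5 hz⟩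

theorem dclosed_DP (m : ℕ) : DClosed {f : (Fin m → ℚ_[p]) → ℚ_[p] | IsDP f} :=
  ⟨fun F hF g hg => IsDP.comp F hF g hg⟩

theorem IsDP.pull {n : ℕ} {f : (Fin m → ℚ_[p]) → ℚ_[p]} (hf : IsDP f) (g : Fin m → (Fin n → ℚ_[p]) → ℚ_[p])
    (hg : ∀ i, IsDFunction p (g i)) : IsDP (fun x => f (fun i => g i x)) := by
  induction hf with
  | base f hf => exact IsDP.base _ (IsDFunction.comp f g hf hg)
  | rt l hl h _ ih => exact IsDP.rt l hl _ ih
  | comp F hF k _ ih => exact IsDP.comp F hF _ ih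

theorem IsDP.le {f g : (Fin m → ℚ_[p]) → ℚ_[p]} (hf : IsDP f) (hg : IsDP g) :
    IsSubanalytic p {x | ‖f x‖ ≤ ‖g x‖} := by
  have h := (IsDP.eqZero ((dclosed_DP m).indLe hf hg)).compl
  convert h using 1
  ext x
  by_cases h1 : ‖f x‖ ≤ ‖g x‖ <;> simp [h1]

theorem IsDP.fn {f : (Fin m → ℚ_[p]) → ℚ_[p]} (hf : IsDP f) : IsSubanalyticFn p f := by
  have h1 := hf.pull (n := m + 1) (fun i x => x i.castSucc) (fun i => IsDFunction.proj _)
  have h2 := IsDP.eqZero ((dclosed_DP (m + 1)).sub h1 (IsDP.base _ (IsDFunction.proj (Fin.last m))))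
  unfold IsSubanalyticFn IsSubanalyticFnOn graphFun
  convert h2 using 1
  ext x
  simp [sub_eq_zero]

/-- every function is, locally, a constant times an `n`-th power -/
theorem IsDP.exists_root {n : ℕ} (hn : 0 < n) : ∀ {f : (Fin m → ℚ_[p]) → ℚ_[p]}, IsDP f →
    ∀ 𝒰 : Ultrafilter (Fin m → ℚ_[p]), ∃ S ∈ 𝒰, IsSubanalytic p S ∧ ((∀ x ∈ S, f x = 0) ∨
      ∃ (c : ℚ_[p]) (y : (Fin m → ℚ_[p]) → ℚ_[p]), c ≠ 0 ∧ IsDP y ∧ ∀ x ∈ S, y x ≠ 0 ∧ f x = c * y x ^ n) := by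
  induction n using Nat.recOnMul with
  | zero => exact absurd hn (lt_irrefl _)
  | one =>
    intro f hf 𝒰
    by_cases h : {x | f x = 0} ∈ 𝒰
    · exact ⟨_, h, hf.eqZero, Or.inl fun x hx => hx⟩
    · refine ⟨_, Ultrafilter.compl_mem_iff_notMem.2 h, hf.eqZero.compl, Or.inr ⟨1, f, one_ne_zero, hf, fun x hx => ⟨hx, by simp⟩⟩⟩
  | prime l hl =>
    intro f hf 𝒰
    obtain ⟨𝔎, h1, h2⟩ := hf.good 𝒰
    have hpos := Nat.mul_pos hl.pos (rtN_pos (p := p) l hl.pos)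
    obtain ⟨ν, S, h3, h4, h5⟩ := h1.dec f h2 (rtN p l * l) (by rwa [mul_comm])
    refine ⟨S, h3, h4, ?_⟩
    by_cases h0 : ν = 0
    · left
      intro x hx
      exact (cosetP_eq_zero_iff (h5 hx)).2 h0
    · right
      refine ⟨ν, fun x => PadicSub.rt l (f x * ν⁻¹), h0, IsDP.rt l hl _ ((dclosed_DP m).mul hf ((dclosed_DP m).const _)), fun x hx => ?_⟩
      obtain ⟨w, ⟨v, hv0, hv⟩, hw⟩ := h5 hx
      have h6 : PadicSub.rt l (f x * ν⁻¹) = v ^ rtN p l := by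
        apply rt_of hl.pos ⟨v, hv0, rfl⟩
        rw [← pow_mul, hv, hw]
        field_simp
      refine ⟨by beta_reduce; rw [h6]; exact pow_ne_zero _ hv0, ?_⟩
      beta_reduce
      rw [h6, ← pow_mul, hv, hw]
  | mul a b iha ihb =>
    intro f hf 𝒰
    have ha : 0 < a := Nat.pos_of_ne_zero fun h => by simp [h] at hn
    have hb : 0 < b := Nat.pos_of_ne_zero fun h => by simp [h] at hn
    obtain ⟨S, h1, h2, h3⟩ := iha ha hf 𝒰
    rcases h3 with h3 | ⟨c, y, hc, hy, h3⟩
    · exact ⟨S, h1, h2, Or.inl h3⟩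
    · obtain ⟨T, h4, h5, h6⟩ := ihb hb hy 𝒰
      refine ⟨S ∩ T, Filter.inter_mem h1 h4, h2.inter h5, Or.inr ?_⟩
      rcases h6 with h6 | ⟨d, w, hd, hw, h6⟩
      · obtain ⟨x, hx, hx2⟩ := Ultrafilter.nonempty_of_mem (Filter.inter_mem h1 h4)
        exact absurd (h6 x hx2) (h3 x hx).1
      · refine ⟨c * d ^ a, w, mul_ne_zero hc (pow_ne_zero _ hd), hw, fun x hx => ⟨(h6 x hx.2).1, ?_⟩⟩
        rw [(h3 x hx.1).2, (h6 x hx.2).2]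
        ring

end DP

end PadicSub

namespace PadicSub

section PrepBasic

variable {p : ℕ} [hp : Fact p.Prime] {Z : Type*}

theorem norm_zpow_le_iff (a b : ℤ) : ‖(p : ℚ_[p]) ^ a‖ ≤ ‖(p : ℚ_[p]) ^ b‖ ↔ b ≤ a := by
  rw [norm_zpow, norm_zpow]
  exact zpow_le_zpow_iff_right_of_lt_one₀ norm_p_pos norm_p_lt_one'

theorem const_pow_le {l : ℚ_[p]} (hl : l ≠ 0) {n : ℕ} (hn : 0 < n) :
    ∃ k : ℤ, ∀ w : ℚ_[p], ‖l * w ^ n‖ ≤ 1 ↔ ‖w‖ ≤ ‖(p : ℚ_[p]) ^ k‖ := by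
  obtain ⟨e, he⟩ := norm_eq_zpow l hl
  refine ⟨-(e / n), fun w => ?_⟩
  by_cases hw : w = 0
  · rw [hw, zero_pow hn.ne', mul_zero, norm_zero]
    exact iff_of_true zero_le_one (norm_nonneg _)
  obtain ⟨f, hf⟩ := norm_eq_zpow w hw
  have h1 : ‖l * w ^ n‖ = ‖(p : ℚ_[p]) ^ (e + f * n)‖ := by
    rw [norm_mul, norm_pow, he, hf, ← norm_pow, ← norm_mul, zpow_add₀ p_ne_zero', zpow_mul, zpow_natCast]
  have h2 : (1 : ℝ) = ‖(p : ℚ_[p]) ^ (0 : ℤ)‖ := by simp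
  rw [h1, h2, hf, norm_zpow_le_iff, norm_zpow_le_iff]
  have hn' : (0 : ℤ) < n := by exact_mod_cast hn
  constructor
  · intro h
    have : -f ≤ e / n := by
      rw [Int.le_ediv_iff_mul_le hn']; linarith
    linarith
  · intro h
    have : -f ≤ e / n := by linarith
    rw [Int.le_ediv_iff_mul_le hn'] at this
    linarith

/-- The preparation context: a D-closed set of base functions together with a function `t`
all of whose distances to base functions are decided by the filter. -/
structure Prep (𝒢 : Filter Z) (𝔎 : Set (Z → ℚ_[p])) (t : Z → ℚ_[p]) : Prop where
  dc : DClosed 𝔎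
  le : ∀ b ∈ 𝔎, ∀ c ∈ 𝔎, (∀ᶠ z in 𝒢, ‖b z‖ ≤ ‖c z‖) ∨ (∀ᶠ z in 𝒢, ‖c z‖ < ‖b z‖)
  dist : ∀ γ ∈ 𝔎, ∀ b ∈ 𝔎, (∀ᶠ z in 𝒢, ‖t z - γ z‖ ≤ ‖b z‖) ∨ (∀ᶠ z in 𝒢, ‖b z‖ < ‖t z - γ z‖)
  root : ∀ c ∈ 𝔎, ∀ n : ℕ, 0 < n → (∀ᶠ z in 𝒢, c z = 0) ∨
    ∃ l : ℚ_[p], l ≠ 0 ∧ ∃ y ∈ 𝔎, ∀ᶠ z in 𝒢, y z ≠ 0 ∧ c z = l * y z ^ n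
  nt : ∀ γ ∈ 𝔎, ∀ᶠ z in 𝒢, t z ≠ γ z
  nb : 𝒢.NeBot

/-- Finite choice for decided properties. -/
theorem ev_choose {𝒢 : Filter Z} [hN : 𝒢.NeBot] {ι : Type*} (s : Finset ι) (P : ι → Z → Prop)
    (hd : ∀ i ∈ s, (∀ᶠ z in 𝒢, P i z) ∨ (∀ᶠ z in 𝒢, ¬ P i z))
    (h : ∀ᶠ z in 𝒢, ∃ i ∈ s, P i z) : ∃ i ∈ s, ∀ᶠ z in 𝒢, P i z := by
  by_contra hc
  have h1 : ∀ i ∈ s, ∀ᶠ z in 𝒢, ¬ P i z := fun i hi => (hd i hi).resolve_left (fun h' => hc ⟨i, hi, h'⟩)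
  have h2 : ∀ᶠ z in 𝒢, ∀ i ∈ s, ¬ P i z := (Filter.eventually_all_finset s).2 h1
  obtain ⟨z, ⟨i, hi, hz⟩, hz2⟩ := (h.and h2).exists
  exact hz2 i hi hz

namespace Prep

variable {𝒢 : Filter Z} {𝔎 : Set (Z → ℚ_[p])} {t : Z → ℚ_[p]}

theorem zero_dec (H : Prep 𝒢 𝔎 t) {c : Z → ℚ_[p]} (hc : c ∈ 𝔎) :
    (∀ᶠ z in 𝒢, c z = 0) ∨ (∀ᶠ z in 𝒢, c z ≠ 0) := by
  rcases H.le c hc _ (H.dc.const 0) with h | h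
  · left; filter_upwards [h] with z hz; simpa using hz
  · right; filter_upwards [h] with z hz; simpa using hz

theorem tau_ne (H : Prep 𝒢 𝔎 t) {γ : Z → ℚ_[p]} (hγ : γ ∈ 𝔎) : ∀ᶠ z in 𝒢, t z - γ z ≠ 0 := by
  filter_upwards [H.nt γ hγ] with z hz
  exact sub_ne_zero.2 hz

theorem beta (H : Prep 𝒢 𝔎 t) {c : Z → ℚ_[p]} (hc : c ∈ 𝔎) {n : ℕ} (hn : 0 < n)
    (h0 : ∀ᶠ z in 𝒢, c z ≠ 0) :
    ∃ β ∈ 𝔎, ∀ᶠ z in 𝒢, β z ≠ 0 ∧ ∀ x : ℚ_[p], ‖c z * x ^ n‖ ≤ 1 ↔ ‖x‖ ≤ ‖β z‖ := by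
  have := H.nb
  rcases H.root c hc n hn with h | ⟨l, hl, y, hy, h⟩
  · obtain ⟨z, h1, h2⟩ := (h.and h0).exists
    exact absurd h1 h2
  obtain ⟨k, hk⟩ := const_pow_le hl hn
  refine ⟨_, H.dc.div (H.dc.const ((p : ℚ_[p]) ^ k)) hy, ?_⟩
  filter_upwards [h] with z ⟨hz1, hz2⟩
  refine ⟨div_ne_zero (zpow_ne_zero _ p_ne_zero') hz1, fun x => ?_⟩
  rw [hz2, mul_assoc, ← mul_pow, hk, norm_div, norm_mul, le_div_iff₀ (norm_pos_iff.2 hz1), mul_comm]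

theorem mono_dec (H : Prep 𝒢 𝔎 t) {c γ : Z → ℚ_[p]} (hc : c ∈ 𝔎) (hγ : γ ∈ 𝔎) (n : ℤ) :
    (∀ᶠ z in 𝒢, ‖c z * (t z - γ z) ^ n‖ ≤ 1) ∨ (∀ᶠ z in 𝒢, 1 < ‖c z * (t z - γ z) ^ n‖) := by
  rcases H.zero_dec hc with h0 | h0
  · left; filter_upwards [h0] with z hz; simp [hz]
  obtain ⟨k, rfl | rfl⟩ := n.eq_nat_or_neg
  · rcases Nat.eq_zero_or_pos k with rfl | hk
    · simpa using H.le c hc _ (H.dc.const 1)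
    · obtain ⟨β, hβ, h⟩ := H.beta hc hk h0
      rcases H.dist γ hγ β hβ with h1 | h1
      · left; filter_upwards [h, h1] with z hz hz1
        simpa using (hz.2 _).2 hz1
      · right; filter_upwards [h, h1] with z hz hz1
        rw [← not_le] at hz1 ⊢
        rwa [zpow_natCast, hz.2]
  · rcases Nat.eq_zero_or_pos k with rfl | hk
    · simpa using H.le c hc _ (H.dc.const 1)
    · have hpc := H.dc.inv (H.dc.mul (H.dc.const (p : ℚ_[p])) hc)
      obtain ⟨β, hβ, h⟩ := H.beta hpc hk (by
        filter_upwards [h0] with z hz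
        exact inv_ne_zero (mul_ne_zero p_ne_zero' hz))
      have key : ∀ᶠ z in 𝒢, (‖t z - γ z‖ ≤ ‖β z‖ ↔ 1 < ‖c z * (t z - γ z) ^ (-(k : ℤ))‖) := by
        filter_upwards [h, h0, H.tau_ne hγ] with z hz hz0 hz1
        rw [← hz.2, zpow_neg, zpow_natCast, norm_mul, norm_inv, norm_mul (c z), norm_inv]
        have e1 : 0 < ‖(t z - γ z) ^ k‖ := norm_pos_iff.2 (pow_ne_zero _ hz1)
        rw [inv_mul_le_iff₀ (norm_pos_iff.2 (mul_ne_zero p_ne_zero' hz0)), ← div_eq_mul_inv, lt_div_iff₀ e1,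
          mul_one, one_mul, norm_lt_iff_le_p_mul, norm_mul]
        exact ⟨fun h => ⟨hz0, h⟩, fun h => h.2⟩
      rcases H.dist γ hγ β hβ with h1 | h1
      · right; filter_upwards [key, h1] with z hz hz1 using hz.1 hz1
      · left; filter_upwards [key, h1] with z hz hz1
        rw [← not_lt, ← hz, not_le]; exact hz1

/-- Comparison of monomials in `t - γ` is decided. -/
theorem mono_le (H : Prep 𝒢 𝔎 t) {c d γ : Z → ℚ_[p]} (hc : c ∈ 𝔎) (hd : d ∈ 𝔎) (hγ : γ ∈ 𝔎) (a b : ℤ) :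
    (∀ᶠ z in 𝒢, ‖c z * (t z - γ z) ^ a‖ ≤ ‖d z * (t z - γ z) ^ b‖) ∨
    (∀ᶠ z in 𝒢, ‖d z * (t z - γ z) ^ b‖ < ‖c z * (t z - γ z) ^ a‖) := by
  rcases H.zero_dec hd with h0 | h0
  · rcases H.zero_dec hc with h1 | h1
    · left; filter_upwards [h0, h1] with z hz hz1; simp [hz, hz1]
    · right; filter_upwards [h0, h1, H.tau_ne hγ] with z hz hz1 hz2
      rw [hz, zero_mul, norm_zero, norm_pos_iff]
      exact mul_ne_zero hz1 (zpow_ne_zero _ hz2)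
  have key : ∀ᶠ z in 𝒢, ‖c z * (t z - γ z) ^ a‖ =
      ‖c z / d z * (t z - γ z) ^ (a - b)‖ * ‖d z * (t z - γ z) ^ b‖ ∧ 0 < ‖d z * (t z - γ z) ^ b‖ := by
    filter_upwards [h0, H.tau_ne hγ] with z hz hz2
    refine ⟨?_, norm_pos_iff.2 (mul_ne_zero hz (zpow_ne_zero _ hz2))⟩
    rw [← norm_mul, zpow_sub₀ hz2]
    congr 1
    field_simp [zpow_ne_zero b hz2]
  rcases H.mono_dec (H.dc.div hc hd) hγ (a - b) with h | h
  · left; filter_upwards [h, key] with z hz ⟨e1, e2⟩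
    rw [e1]; exact mul_le_of_le_one_left e2.le hz
  · right; filter_upwards [h, key] with z hz ⟨e1, e2⟩
    rw [e1]; exact (lt_mul_iff_one_lt_left e2).2 hz

/-- A tie between monomials of different degrees forces `|t-γ| = |h|`. -/
theorem tie (H : Prep 𝒢 𝔎 t) {c d γ : Z → ℚ_[p]} (hc : c ∈ 𝔎) (hd : d ∈ 𝔎) {n : ℕ}
    (hn : 0 < n) (h0 : ∀ᶠ z in 𝒢, d z ≠ 0) (he : ∀ᶠ z in 𝒢, ‖c z * (t z - γ z) ^ n‖ = ‖d z‖) :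
    ∃ h ∈ 𝔎, ∀ᶠ z in 𝒢, h z ≠ 0 ∧ ‖t z - γ z‖ = ‖h z‖ := by
  have := H.nb
  have hc0 : ∀ᶠ z in 𝒢, c z ≠ 0 := by
    filter_upwards [h0, he] with z h1 h2 h3
    rw [h3, zero_mul, norm_zero] at h2
    exact h1 (norm_eq_zero.1 h2.symm)
  obtain ⟨β, hβ, h⟩ := H.beta (H.dc.div hc hd) hn (by
    filter_upwards [h0, hc0] with z h1 h2 using div_ne_zero h2 h1)
  refine ⟨β, hβ, ?_⟩
  filter_upwards [h, h0, he, hc0] with z ⟨h1, h2⟩ h3 h4 h5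
  refine ⟨h1, ?_⟩
  have e1 : ∀ x : ℚ_[p], ‖c z / d z * x ^ n‖ = ‖c z * x ^ n‖ / ‖d z‖ := by
    intro x; rw [div_mul_eq_mul_div, norm_div]
  have e2 : ‖d z‖ ≠ 0 := norm_ne_zero_iff.2 h3
  refine le_antisymm ((h2 _).1 (by rw [e1, h4, div_self e2])) ?_
  have h6 := (h2 (β z)).2 le_rfl
  rw [e1, div_le_one (norm_pos_iff.2 h3), ← h4, norm_mul, norm_mul, norm_pow, norm_pow] at h6
  exact le_of_pow_le_pow_left₀ hn.ne' (norm_nonneg _) (le_of_mul_le_mul_left h6 (norm_pos_iff.2 h5))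

theorem near (H : Prep 𝒢 𝔎 t) {γ h : Z → ℚ_[p]} (hγ : γ ∈ 𝔎) (hh : h ∈ 𝔎)
    (he : ∀ᶠ z in 𝒢, h z ≠ 0 ∧ ‖t z - γ z‖ = ‖h z‖) (M : ℕ) :
    ∃ j : ℕ, ∀ᶠ z in 𝒢, ‖t z - γ z - h z * j‖ ≤ ‖(p : ℚ_[p])‖ ^ M * ‖h z‖ := by
  have := H.nb
  obtain ⟨j, hj, h1⟩ := ev_choose (𝒢 := 𝒢) (Finset.range (p ^ M))
    (fun j z => ‖t z - γ z - h z * j‖ ≤ ‖(p : ℚ_[p])‖ ^ M * ‖h z‖)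
    (by
      intro j hj
      have := H.dist _ (H.dc.add hγ (H.dc.mul hh (H.dc.const (j : ℚ_[p])))) _
        (H.dc.mul (H.dc.const ((p : ℚ_[p]) ^ M)) hh)
      simpa only [norm_mul, norm_pow, sub_sub, not_le] using this)
    (by
      filter_upwards [he] with z ⟨h1, h2⟩
      obtain ⟨j, hj, h3⟩ := exists_nat_near M ((t z - γ z) / h z) (by
        rw [norm_div, h2, div_self (norm_ne_zero_iff.2 h1)])
      refine ⟨j, Finset.mem_range.2 hj, ?_⟩
      have : t z - γ z - h z * j = ((t z - γ z) / h z - j) * h z := by field_simp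
      rw [this, norm_mul]
      exact mul_le_mul_of_nonneg_right h3 (norm_nonneg _))
  exact ⟨j, h1⟩

end Prep

end PrepBasic

section Poly

variable {p : ℕ} [hp : Fact p.Prime]
open Polynomial

theorem taylor_coeff_sum {f : ℚ_[p][X]} {d : ℕ} (hd : f.natDegree ≤ d) (r : ℚ_[p]) (j : ℕ) :
    (taylor r f).coeff j = ∑ n ∈ Finset.range (d + 1), ((n + j).choose j : ℚ_[p]) * f.coeff (n + j) * r ^ n := by
  rw [taylor_coeff, eval_eq_sum_range' (n := d + 1)
    (lt_of_le_of_lt (natDegree_hasseDeriv_le f j) (by omega))]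
  simp_rw [hasseDeriv_coeff]

theorem derivative_taylor' (r : ℚ_[p]) (f : ℚ_[p][X]) :
    derivative (taylor r f) = taylor r (derivative f) := by
  simp [taylor_apply, derivative_comp]

/-- The monomial of degree `a` dominates in `q` at `τ`, with precision `N`. -/
def DomP (N : ℕ) (q : ℚ_[p][X]) (τ : ℚ_[p]) (a : ℕ) : Prop :=
  ∀ j, j ≠ a → ‖q.coeff j * τ ^ j‖ ≤ ‖(p : ℚ_[p])‖ ^ N * ‖q.coeff a * τ ^ a‖

theorem p_pow_le_one (N : ℕ) : ‖(p : ℚ_[p])‖ ^ N ≤ 1 := pow_le_one₀ (norm_nonneg _) norm_p_lt_one'.le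

theorem p_pow_anti {M N : ℕ} (h : M ≤ N) : ‖(p : ℚ_[p])‖ ^ N ≤ ‖(p : ℚ_[p])‖ ^ M :=
  pow_le_pow_of_le_one (norm_nonneg _) norm_p_lt_one'.le h

theorem p_pow_pos (N : ℕ) : 0 < ‖(p : ℚ_[p])‖ ^ N := pow_pos norm_p_pos N

theorem DomP.mono {M N : ℕ} (h : M ≤ N) {q : ℚ_[p][X]} {τ : ℚ_[p]} {a : ℕ} (H : DomP N q τ a) :
    DomP M q τ a := fun j hj => (H j hj).trans (mul_le_mul_of_nonneg_right (p_pow_anti h) (norm_nonneg _))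

theorem DomP.le {N : ℕ} {q : ℚ_[p][X]} {τ : ℚ_[p]} {a : ℕ} (H : DomP N q τ a) (j : ℕ) :
    ‖q.coeff j * τ ^ j‖ ≤ ‖q.coeff a * τ ^ a‖ := by
  by_cases h : j = a
  · rw [h]
  · exact (H j h).trans (mul_le_of_le_one_left (norm_nonneg _) (p_pow_le_one N))

theorem DomP.eval {N : ℕ} {q : ℚ_[p][X]} {τ : ℚ_[p]} {a : ℕ} (H : DomP N q τ a) :
    ‖q.eval τ - q.coeff a * τ ^ a‖ ≤ ‖(p : ℚ_[p])‖ ^ N * ‖q.coeff a * τ ^ a‖ := by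
  rw [eval_eq_sum_range' (n := q.natDegree + a + 1) (by omega)]
  exact dom_sum (a := fun i => q.coeff i * τ ^ i) (Finset.mem_range.2 (by omega)) (by positivity) (fun j _ hj => H j hj)

theorem DomP.recentre {N : ℕ} (hN : 1 ≤ N) {q : ℚ_[p][X]} {τ g : ℚ_[p]} {a : ℕ} (H : DomP N q τ a)
    (hg : ‖g‖ = ‖τ‖) : ‖(taylor g q).coeff 0‖ = ‖q.coeff a * τ ^ a‖ ∧
      ∀ j, ‖(taylor g q).coeff j * τ ^ j‖ ≤ ‖q.coeff a * τ ^ a‖ := by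
  have e : ∀ j c : ℕ, ‖q.coeff j * g ^ c‖ = ‖q.coeff j * τ ^ c‖ := by
    intro j c; rw [norm_mul, norm_mul, norm_pow, norm_pow, hg]
  constructor
  · have H' : DomP N q g a := by
      intro j hj; rw [e, e]; exact H j hj
    rw [taylor_coeff_zero]
    by_cases h0 : q.coeff a * g ^ a = 0
    · have h1 := H'.eval
      rw [h0, norm_zero, mul_zero, sub_zero] at h1
      rw [← e, h0, norm_zero]
      exact le_antisymm h1 (norm_nonneg _)
    · rw [norm_eq_of_sub_le h0 hN H'.eval, e]
  · intro j
    rw [taylor_coeff_sum le_rfl, Finset.sum_mul]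
    refine nsum_le (norm_nonneg _) (fun n _ => ?_)
    have : ‖((n + j).choose j : ℚ_[p]) * q.coeff (n + j) * g ^ n * τ ^ j‖ =
        ‖((n + j).choose j : ℚ_[p])‖ * ‖q.coeff (n + j) * τ ^ (n + j)‖ := by
      rw [pow_add]; simp only [norm_mul, norm_pow, hg]; ring
    rw [this]
    exact (mul_le_of_le_one_left (norm_nonneg _) (norm_nat_le_one' _)).trans (H.le _)

theorem DomP.recentre' {N M : ℕ} (hN : 1 ≤ N) {q : ℚ_[p][X]} {τ g : ℚ_[p]} {a : ℕ} (H : DomP N q τ a)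
    (hg : ‖g‖ = ‖τ‖) (h : ‖τ - g‖ ≤ ‖(p : ℚ_[p])‖ ^ M * ‖τ‖) : DomP M (taylor g q) (τ - g) 0 := by
  intro j hj
  obtain ⟨h1, h2⟩ := H.recentre hN hg
  rw [pow_zero, mul_one, h1]
  calc ‖(taylor g q).coeff j * (τ - g) ^ j‖ ≤ ‖(taylor g q).coeff j‖ * (‖(p : ℚ_[p])‖ ^ M * ‖τ‖) ^ j := by
        rw [norm_mul, norm_pow]; gcongr
    _ = (‖(p : ℚ_[p])‖ ^ M) ^ j * ‖(taylor g q).coeff j * τ ^ j‖ := by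
        rw [norm_mul, norm_pow, mul_pow]; ring
    _ ≤ ‖(p : ℚ_[p])‖ ^ M * ‖q.coeff a * τ ^ a‖ := by
        refine mul_le_mul ?_ (h2 j) (norm_nonneg _) (by positivity)
        calc (‖(p : ℚ_[p])‖ ^ M) ^ j ≤ (‖(p : ℚ_[p])‖ ^ M) ^ 1 :=
              pow_le_pow_of_le_one (by positivity) (p_pow_le_one M) (by omega)
          _ = _ := pow_one _

theorem exists_V (p : ℕ) [hp : Fact p.Prime] (d : ℕ) : ∃ V : ℕ, ∀ j : ℕ, 1 ≤ j → j ≤ d → ‖(p : ℚ_[p])‖ ^ V ≤ ‖(j : ℚ_[p])‖ := by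
  induction d with
  | zero => exact ⟨0, fun j h1 h2 => by omega⟩
  | succ d ih =>
    obtain ⟨V, hV⟩ := ih
    obtain ⟨W, hW⟩ := exists_pow_lt (p := p) (ε := ‖((d + 1 : ℕ) : ℚ_[p])‖) (by
      rw [norm_pos_iff]; exact Nat.cast_ne_zero.2 (by omega))
    refine ⟨V + W, fun j h1 h2 => ?_⟩
    rcases Nat.lt_or_ge d j with h | h
    · obtain rfl : j = d + 1 := by omega
      exact (p_pow_anti (by omega)).trans hW.le
    · exact (p_pow_anti (by omega)).trans (hV j h1 h)

end Poly

end PadicSub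

namespace PadicSub

section PolyPt

variable {p : ℕ} [hp : Fact p.Prime]
open Polynomial

theorem pw1 {d V N N1 a : ℕ} (hV : ∀ j : ℕ, 1 ≤ j → j ≤ d → ‖(p : ℚ_[p])‖ ^ V ≤ ‖(j : ℚ_[p])‖)
    {q : ℚ_[p][X]} (hq : q.natDegree ≤ d) {τ : ℚ_[p]} (hN : N + V ≤ N1)
    (H : DomP N1 (derivative q) τ a) (j : ℕ) (hj : j ≠ 0) (hja : j ≠ a + 1) :
    ‖q.coeff j * τ ^ j‖ ≤ ‖(p : ℚ_[p])‖ ^ N * ‖q.coeff (a + 1) * τ ^ (a + 1)‖ := by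
  obtain ⟨i, rfl⟩ := Nat.exists_eq_succ_of_ne_zero hj
  rcases Nat.lt_or_ge d (i + 1) with h | h
  · rw [Nat.succ_eq_add_one, coeff_eq_zero_of_natDegree_lt (by omega), zero_mul, norm_zero]; positivity
  have h1 := H i (by omega)
  rw [coeff_derivative, coeff_derivative] at h1
  have h2 := hV (i + 1) (by omega) h
  have h3 : ‖(((a : ℕ) : ℚ_[p]) + 1)‖ ≤ 1 := by exact_mod_cast norm_nat_le_one' (p := p) (a + 1)
  push_cast at h2
  simp only [norm_mul, norm_pow] at h1 ⊢
  have h4 : ‖(p : ℚ_[p])‖ ^ V * (‖q.coeff (i + 1)‖ * ‖τ‖ ^ i) ≤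
      ‖(p : ℚ_[p])‖ ^ V * (‖(p : ℚ_[p])‖ ^ N * (‖q.coeff (a + 1)‖ * ‖τ‖ ^ a)) := by
    calc ‖(p : ℚ_[p])‖ ^ V * (‖q.coeff (i + 1)‖ * ‖τ‖ ^ i) ≤ ‖(i : ℚ_[p]) + 1‖ * (‖q.coeff (i + 1)‖ * ‖τ‖ ^ i) := by
          gcongr
      _ = ‖q.coeff (i + 1)‖ * ‖(i : ℚ_[p]) + 1‖ * ‖τ‖ ^ i := by ring
      _ ≤ _ := h1
      _ ≤ ‖(p : ℚ_[p])‖ ^ (N + V) * (‖q.coeff (a + 1)‖ * 1 * ‖τ‖ ^ a) := by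
          have := p_pow_anti (p := p) hN
          gcongr
      _ = _ := by ring
  have h5 := le_of_mul_le_mul_left h4 (p_pow_pos V)
  calc ‖q.coeff (i + 1)‖ * ‖τ‖ ^ (i + 1) = ‖q.coeff (i + 1)‖ * ‖τ‖ ^ i * ‖τ‖ := by ring
    _ ≤ (‖(p : ℚ_[p])‖ ^ N * (‖q.coeff (a + 1)‖ * ‖τ‖ ^ a)) * ‖τ‖ := by gcongr
    _ = _ := by ring

theorem pw2 {d V N1 a : ℕ} (hV : ∀ j : ℕ, 1 ≤ j → j ≤ d → ‖(p : ℚ_[p])‖ ^ V ≤ ‖(j : ℚ_[p])‖)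
    {q : ℚ_[p][X]} (hq : q.natDegree ≤ d) {τ g : ℚ_[p]} (hN : 1 ≤ N1)
    (H : DomP N1 (derivative q) τ a) (hg : ‖g‖ = ‖τ‖) (i : ℕ) :
    ‖(p : ℚ_[p])‖ ^ V * ‖(taylor g q).coeff (i + 1) * τ ^ i‖ ≤ ‖(taylor g q).coeff 1‖ := by
  rcases Nat.lt_or_ge d (i + 1) with h | h
  · rw [coeff_eq_zero_of_natDegree_lt (by rw [natDegree_taylor]; omega), zero_mul, norm_zero, mul_zero]
    positivity
  obtain ⟨h1, h2⟩ := H.recentre hN hg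
  have h3 := h2 i
  rw [← h1, ← derivative_taylor', coeff_derivative, coeff_derivative] at h3
  simp only [Nat.cast_zero, zero_add, mul_one] at h3
  refine le_trans ?_ h3
  have h4 := hV (i + 1) (by omega) h
  push_cast at h4
  simp only [norm_mul]
  calc ‖(p : ℚ_[p])‖ ^ V * (‖(taylor g q).coeff (i + 1)‖ * ‖τ ^ i‖)
      ≤ ‖(i : ℚ_[p]) + 1‖ * (‖(taylor g q).coeff (i + 1)‖ * ‖τ ^ i‖) := by gcongr
    _ = _ := by ring

theorem pw3 {V N M0 : ℕ} {r : ℚ_[p][X]} {h τ : ℚ_[p]} (hM : N + V ≤ M0)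
    (H : ∀ i, ‖(p : ℚ_[p])‖ ^ V * ‖r.coeff (i + 1) * h ^ i‖ ≤ ‖r.coeff 1‖)
    (hτ : ‖τ‖ ≤ ‖(p : ℚ_[p])‖ ^ M0 * ‖h‖) (j : ℕ) (hj0 : j ≠ 0) (hj : j ≠ 1) :
    ‖r.coeff j * τ ^ j‖ ≤ ‖(p : ℚ_[p])‖ ^ N * ‖r.coeff 1 * τ ^ 1‖ := by
  obtain ⟨i, rfl⟩ := Nat.exists_eq_succ_of_ne_zero hj0
  have hi : 1 ≤ i := by omega
  have h1 : ‖r.coeff (i + 1)‖ * ‖τ‖ ^ i ≤ ‖(p : ℚ_[p])‖ ^ N * ‖r.coeff 1‖ := by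
    calc ‖r.coeff (i + 1)‖ * ‖τ‖ ^ i ≤ ‖r.coeff (i + 1)‖ * (‖(p : ℚ_[p])‖ ^ M0 * ‖h‖) ^ i := by gcongr
      _ = (‖(p : ℚ_[p])‖ ^ M0) ^ i * ‖r.coeff (i + 1) * h ^ i‖ := by
          rw [norm_mul, norm_pow]; ring
      _ ≤ ‖(p : ℚ_[p])‖ ^ (N + V) * ‖r.coeff (i + 1) * h ^ i‖ := by
          gcongr
          calc (‖(p : ℚ_[p])‖ ^ M0) ^ i = ‖(p : ℚ_[p])‖ ^ (M0 * i) := by rw [pow_mul]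
            _ ≤ _ := p_pow_anti (by nlinarith)
      _ = ‖(p : ℚ_[p])‖ ^ N * (‖(p : ℚ_[p])‖ ^ V * ‖r.coeff (i + 1) * h ^ i‖) := by ring
      _ ≤ _ := by gcongr; exact H i
  simp only [norm_mul, norm_pow, Nat.succ_eq_add_one, pow_one]
  calc ‖r.coeff (i + 1)‖ * ‖τ‖ ^ (i + 1) = ‖r.coeff (i + 1)‖ * ‖τ‖ ^ i * ‖τ‖ := by ring
    _ ≤ (‖(p : ℚ_[p])‖ ^ N * ‖r.coeff 1‖) * ‖τ‖ := by gcongr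
    _ = _ := by ring

theorem pw4 {V : ℕ} {r : ℚ_[p][X]} {h : ℚ_[p]} (h1 : r.coeff 1 ≠ 0)
    (H : ∀ i, ‖(p : ℚ_[p])‖ ^ V * ‖r.coeff (i + 1) * h ^ i‖ ≤ ‖r.coeff 1‖)
    (h0 : ‖r.coeff 0‖ ≤ ‖(p : ℚ_[p])‖ ^ (V + 1) * ‖r.coeff 1 * h‖) (i : ℕ) (hi : 1 ≤ i) :
    ‖r.coeff (i + 1) * r.coeff 0 ^ i / r.coeff 1 ^ (i + 1)‖ ≤ ‖(p : ℚ_[p])‖ := by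
  rw [norm_div, div_le_iff₀ (norm_pos_iff.2 (pow_ne_zero _ h1))]
  rw [norm_mul, norm_pow]
  calc ‖r.coeff (i + 1)‖ * ‖r.coeff 0‖ ^ i ≤ ‖r.coeff (i + 1)‖ * (‖(p : ℚ_[p])‖ ^ (V + 1) * ‖r.coeff 1 * h‖) ^ i := by
        gcongr
    _ = (‖(p : ℚ_[p])‖ ^ (V + 1)) ^ i * ‖r.coeff (i + 1) * h ^ i‖ * ‖r.coeff 1‖ ^ i := by
        simp only [norm_mul, norm_pow]; ring
    _ ≤ ‖(p : ℚ_[p])‖ ^ (V + 1) * ‖r.coeff (i + 1) * h ^ i‖ * ‖r.coeff 1‖ ^ i := by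
        gcongr
        rw [← pow_mul]; exact p_pow_anti (by nlinarith)
    _ = ‖(p : ℚ_[p])‖ * (‖(p : ℚ_[p])‖ ^ V * ‖r.coeff (i + 1) * h ^ i‖) * ‖r.coeff 1‖ ^ i := by ring
    _ ≤ ‖(p : ℚ_[p])‖ * ‖r.coeff 1‖ * ‖r.coeff 1‖ ^ i := by gcongr; exact H i
    _ = _ := by rw [norm_pow]; ring

end PolyPt

section LemD

variable {p : ℕ} [hp : Fact p.Prime] {Z : Type*}
open Polynomial

/-- Polynomials in one variable with coefficients in `𝔎`. -/
def PolK (𝔎 : Set (Z → ℚ_[p])) (d : ℕ) (P : Z → ℚ_[p][X]) : Prop :=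
  (∀ z, (P z).natDegree ≤ d) ∧ ∀ j, (fun z => (P z).coeff j) ∈ 𝔎

variable {𝒢 : Filter Z} {𝔎 : Set (Z → ℚ_[p])} {t : Z → ℚ_[p]}

theorem PolK.taylor (h : DClosed 𝔎) {d : ℕ} {P : Z → ℚ_[p][X]} (hP : PolK 𝔎 d P) {γ : Z → ℚ_[p]}
    (hγ : γ ∈ 𝔎) : PolK 𝔎 d (fun z => Polynomial.taylor (γ z) (P z)) := by
  refine ⟨fun z => by rw [natDegree_taylor]; exact hP.1 z, fun j => ?_⟩
  have : (fun z => (Polynomial.taylor (γ z) (P z)).coeff j) = fun z =>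
      ∑ n ∈ Finset.range (d + 1), ((n + j).choose j : ℚ_[p]) * (P z).coeff (n + j) * γ z ^ n := by
    funext z; rw [taylor_coeff_sum (hP.1 z)]
  rw [this]
  exact h.sum _ _ (fun n _ => h.mul (h.mul (h.const _) (hP.2 _)) (h.pow hγ n))

theorem PolK.deriv (h : DClosed 𝔎) {d : ℕ} {P : Z → ℚ_[p][X]} (hP : PolK 𝔎 (d + 1) P) :
    PolK 𝔎 d (fun z => derivative (P z)) := by
  refine ⟨fun z => (natDegree_derivative_le _).trans (by have := hP.1 z; omega), fun j => ?_⟩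
  simp_rw [coeff_derivative]
  exact h.mul (hP.2 _) (h.const _)

theorem PolK.mono {d e : ℕ} (hde : d ≤ e) {P : Z → ℚ_[p][X]} (hP : PolK 𝔎 d P) : PolK 𝔎 e P :=
  ⟨fun z => (hP.1 z).trans hde, hP.2⟩

/-- `P` is dominated by one monomial at the center `γ`. -/
def Dm (𝒢 : Filter Z) (t : Z → ℚ_[p]) (N : ℕ) (γ : Z → ℚ_[p]) (P : Z → ℚ_[p][X]) : Prop :=
  ∃ a, ∀ᶠ z in 𝒢, DomP N (Polynomial.taylor (γ z) (P z)) (t z - γ z) a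

/-- `γ'` is much closer to `t` than `γ`. -/
def Closer (𝒢 : Filter Z) (t : Z → ℚ_[p]) (M : ℕ) (γ γ' : Z → ℚ_[p]) : Prop :=
  γ' = γ ∨ ∀ᶠ z in 𝒢, ‖γ' z - γ z‖ = ‖t z - γ z‖ ∧ ‖t z - γ' z‖ ≤ ‖(p : ℚ_[p])‖ ^ M * ‖t z - γ z‖

theorem Dm.closer {N M : ℕ} (hN : 1 ≤ N) (hM : N ≤ M) {γ γ' : Z → ℚ_[p]} {P : Z → ℚ_[p][X]}
    (H : Dm 𝒢 t N γ P) (h : Closer 𝒢 t M γ γ') : Dm 𝒢 t N γ' P := by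
  rcases h with rfl | h
  · exact H
  obtain ⟨a, ha⟩ := H
  refine ⟨0, ?_⟩
  filter_upwards [ha, h] with z h1 ⟨h2, h3⟩
  have e1 : t z - γ z - (γ' z - γ z) = t z - γ' z := by ring
  have := h1.recentre' (M := N) hN h2 (by
    rw [e1]; exact h3.trans (mul_le_mul_of_nonneg_right (p_pow_anti hM) (norm_nonneg _)))
  rwa [e1, taylor_taylor, sub_add_cancel] at this

theorem hens (h : DClosed 𝔎) {d : ℕ} (e : Fin d → Z → ℚ_[p]) (he : ∀ i, e i ∈ 𝔎)
    (hi : ∀ᶠ z in 𝒢, ∀ i, ‖e i z‖ ≤ ‖(p : ℚ_[p])‖) :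
    ∃ f ∈ 𝔎, ∀ᶠ z in 𝒢, ‖f z‖ ≤ 1 ∧ f z + 1 + ∑ i, e i z * f z ^ ((i : ℕ) + 2) = 0 := by
  obtain ⟨ρ, hρ, hρ2⟩ := An.hensel (p := p) (σ := Fin d) (An.const 1)
    (H' := fun y => ∑ i : Fin d, y (some i) * y none ^ ((i : ℕ) + 2))
    (An.sum _ (fun i _ => (An.proj _).mul ((An.proj _).pow _)))
  obtain ⟨f, hf, hf2⟩ := h.an hρ (fun i z => e i z / p) (fun i => h.div (he i) (h.const _))
  refine ⟨f, hf, ?_⟩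
  filter_upwards [hi] with z hz
  have h1 : ∀ i, ‖e i z / p‖ ≤ 1 := by
    intro i; rw [norm_div, div_le_one norm_p_pos]; exact hz i
  have h2 := hf2 z h1
  rw [h2]
  refine ⟨PadicInt.norm_le_one _, ?_⟩
  have h3 := congrArg (fun x : ℤ_[p] => (x : ℚ_[p])) (hρ2 (fun i => trc (e i z / p)))
  simp only [PadicInt.coe_mul, PadicInt.coe_add, PadicInt.coe_one, PadicInt.coe_zero, coe_sum', PadicInt.coe_pow,
    PadicInt.coe_natCast, oc_none, oc_some] at h3
  rw [← h3, Finset.mul_sum]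
  congr 1
  refine Finset.sum_congr rfl (fun i _ => ?_)
  rw [trc_coe (h1 i), ← mul_assoc, mul_div_cancel₀ _ p_ne_zero']

theorem Prep.step (H : Prep 𝒢 𝔎 t) {d V : ℕ}
    (hV : ∀ j : ℕ, 1 ≤ j → j ≤ d → ‖(p : ℚ_[p])‖ ^ V ≤ ‖(j : ℚ_[p])‖) {N N1 M : ℕ} (hN : 1 ≤ N)
    (hN1 : N + V ≤ N1) {γ : Z → ℚ_[p]} (hγ : γ ∈ 𝔎) {P : Z → ℚ_[p][X]} (hP : PolK 𝔎 d P)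
    (hD : Dm 𝒢 t N1 γ (fun z => derivative (P z))) :
    ∃ γ' ∈ 𝔎, Dm 𝒢 t N γ' P ∧ Closer 𝒢 t M γ γ' := by
  have := H.nb
  obtain ⟨a, ha⟩ := hD
  have hT := hP.taylor H.dc hγ
  set q : Z → ℚ_[p][X] := fun z => Polynomial.taylor (γ z) (P z) with hq
  simp_rw [← derivative_taylor'] at ha
  have ha : ∀ᶠ z in 𝒢, DomP N1 (derivative (q z)) (t z - γ z) a := ha
  have hb : ∀ᶠ z in 𝒢, ∀ j, j ≠ 0 → j ≠ a + 1 → ‖(q z).coeff j * (t z - γ z) ^ j‖ ≤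
      ‖(p : ℚ_[p])‖ ^ N * ‖(q z).coeff (a + 1) * (t z - γ z) ^ (a + 1)‖ := by
    filter_upwards [ha] with z hz j hj hja
    exact pw1 hV (hT.1 z) hN1 hz j hj hja
  have hpN : ‖(p : ℚ_[p]) ^ N‖ = ‖(p : ℚ_[p])‖ ^ N := norm_pow _ _
  -- case A
  rcases H.mono_le (hT.2 0) (H.dc.mul (H.dc.const ((p : ℚ_[p]) ^ N)) (hT.2 (a + 1))) hγ 0 ((a + 1 : ℕ) : ℤ) with hA | hA
  · refine ⟨γ, hγ, ⟨a + 1, ?_⟩, Or.inl rfl⟩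
    filter_upwards [hb, hA] with z hz hz1 j hj
    by_cases hj0 : j = 0
    · subst hj0
      rw [zpow_natCast, mul_assoc, norm_mul _ (_ * _), hpN, zpow_zero] at hz1
      rw [pow_zero]; exact hz1
    · exact hz j hj0 hj
  rcases H.mono_le (hT.2 (a + 1)) (H.dc.mul (H.dc.const ((p : ℚ_[p]) ^ N)) (hT.2 0)) hγ ((a + 1 : ℕ) : ℤ) 0 with hB | hB
  · refine ⟨γ, hγ, ⟨0, ?_⟩, Or.inl rfl⟩
    filter_upwards [hb, hB] with z hz hz1 j hj
    rw [zpow_natCast, zpow_zero, mul_one, norm_mul _ ((q z).coeff 0), hpN] at hz1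
    rw [pow_zero, mul_one]
    by_cases hja : j = a + 1
    · rw [hja]; exact hz1
    · exact (hz j hj hja).trans ((mul_le_of_le_one_left (norm_nonneg _) (p_pow_le_one N)).trans hz1)
  simp only [zpow_natCast, zpow_zero, mul_one] at hA hB
  have hq0 : ∀ᶠ z in 𝒢, (q z).coeff 0 ≠ 0 := by
    filter_upwards [hA] with z hz h0
    rw [h0, norm_zero] at hz
    exact absurd hz (not_lt.2 (norm_nonneg _))
  -- the tie
  obtain ⟨h, hh, hht⟩ : ∃ h ∈ 𝔎, ∀ᶠ z in 𝒢, h z ≠ 0 ∧ ‖t z - γ z‖ = ‖h z‖ := by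
    obtain ⟨k, hk, hk2⟩ := ev_choose (𝒢 := 𝒢) (Finset.Icc (-(N : ℤ)) N)
      (fun k z => ‖(q z).coeff (a + 1) * (t z - γ z) ^ (a + 1)‖ = ‖(p : ℚ_[p]) ^ k * (q z).coeff 0‖)
      (by
        intro k hk
        have hk0 := H.dc.mul (H.dc.const ((p : ℚ_[p]) ^ k)) (hT.2 0)
        rcases H.mono_le (hT.2 (a + 1)) hk0 hγ ((a + 1 : ℕ) : ℤ) 0 with h1 | h1
        · rcases H.mono_le hk0 (hT.2 (a + 1)) hγ 0 ((a + 1 : ℕ) : ℤ) with h2 | h2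
          · left; filter_upwards [h1, h2] with z h1 h2
            simp only [zpow_natCast, zpow_zero, mul_one] at h1 h2
            exact le_antisymm h1 h2
          · right; filter_upwards [h2] with z h2
            simp only [zpow_natCast, zpow_zero, mul_one] at h2
            exact h2.ne
        · right; filter_upwards [h1] with z h1
          simp only [zpow_natCast, zpow_zero, mul_one] at h1
          exact h1.ne')
      (by
        filter_upwards [hA, hB, hq0] with z h1 h2 h3
        have h4 : (q z).coeff (a + 1) * (t z - γ z) ^ (a + 1) ≠ 0 := by
          intro h0; rw [h0, norm_zero] at h2; exact absurd h2 (not_lt.2 (norm_nonneg _))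
        obtain ⟨k, hk⟩ := norm_eq_zpow _ (div_ne_zero h4 h3)
        have h5 : ‖(q z).coeff (a + 1) * (t z - γ z) ^ (a + 1)‖ = ‖(p : ℚ_[p]) ^ k‖ * ‖(q z).coeff 0‖ := by
          rw [← hk, norm_div, div_mul_cancel₀ _ (norm_ne_zero_iff.2 h3)]
        refine ⟨k, Finset.mem_Icc.2 ⟨?_, ?_⟩, by rw [h5, norm_mul]⟩
        · by_contra hlt
          rw [mul_assoc, norm_mul, h5, ← mul_assoc, ← norm_mul, ← zpow_natCast, ← zpow_add₀ p_ne_zero'] at h1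
          have : ‖(p : ℚ_[p]) ^ (0 : ℤ)‖ ≤ ‖(p : ℚ_[p]) ^ ((N : ℤ) + k)‖ := (norm_zpow_le_iff _ _).2 (by omega)
          rw [zpow_zero, norm_one] at this
          nlinarith [norm_pos_iff.2 h3]
        · by_contra hlt
          rw [h5, norm_mul, ← zpow_natCast] at h2
          have : ‖(p : ℚ_[p]) ^ k‖ ≤ ‖(p : ℚ_[p]) ^ (N : ℤ)‖ := (norm_zpow_le_iff _ _).2 (by omega)
          nlinarith [norm_pos_iff.2 h3])
    exact H.tie (hT.2 (a + 1)) (H.dc.mul (H.dc.const ((p : ℚ_[p]) ^ k)) (hT.2 0)) (Nat.succ_pos a)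
      (by filter_upwards [hq0] with z hz using mul_ne_zero (zpow_ne_zero _ p_ne_zero') hz) hk2
  obtain ⟨x, hx⟩ := H.near hγ hh hht (2 * N + V + M + 1)
  have hg0 := H.dc.mul hh (H.dc.const (x : ℚ_[p]))
  set g0 : Z → ℚ_[p] := fun z => h z * (x : ℚ_[p]) with hg0def
  have hγ1 := H.dc.add hγ hg0
  have hgn : ∀ᶠ z in 𝒢, ‖g0 z‖ = ‖t z - γ z‖ := by
    filter_upwards [hx, hht] with z h1 ⟨h2, h3⟩
    have h4 : t z - γ z ≠ 0 := by rw [← norm_ne_zero_iff, h3]; exact norm_ne_zero_iff.2 h2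
    refine norm_eq_of_sub_le (M := 2 * N + V + M + 1) h4 (by omega) ?_
    rw [norm_sub_rev, h3]; exact h1
  have hT1 := hT.taylor H.dc hg0
  have hcomp : ∀ (g : Z → ℚ_[p]) z, Polynomial.taylor (γ z + g z) (P z) = Polynomial.taylor (g z) (q z) := by
    intro g z; rw [hq]; simp only; rw [taylor_taylor, add_comm]
  have hr : ∀ (g : Z → ℚ_[p]), (∀ᶠ z in 𝒢, ‖g z‖ = ‖t z - γ z‖) → ∀ᶠ z in 𝒢, ∀ i,
      ‖(p : ℚ_[p])‖ ^ V * ‖(Polynomial.taylor (g z) (q z)).coeff (i + 1) * h z ^ i‖ ≤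
        ‖(Polynomial.taylor (g z) (q z)).coeff 1‖ := by
    intro g hg
    filter_upwards [hg, ha, hht] with z h1 h2 ⟨_, h3⟩ i
    have := pw2 hV (hT.1 z) (by omega) h2 h1 i
    rwa [norm_mul, norm_pow (t z - γ z), h3, ← norm_pow (h z), ← norm_mul] at this
  set r : Z → ℚ_[p][X] := fun z => Polynomial.taylor (g0 z) (q z) with hrdef
  have hr0 := hr g0 hgn
  rcases H.mono_le (hT1.2 1) (H.dc.mul (H.dc.const ((p : ℚ_[p]) ^ N)) (hT1.2 0)) hγ1 1 0 with hC | hC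
  · refine ⟨_, hγ1, ⟨0, ?_⟩, Or.inr ?_⟩
    · filter_upwards [hC, hx, hr0] with z h1 h2 h3 j hj
      rw [hcomp]
      rw [zpow_one, zpow_zero, mul_one, norm_mul _ ((Polynomial.taylor (g0 z) (q z)).coeff 0), hpN] at h1
      rw [pow_zero, mul_one]
      by_cases hj1 : j = 1
      · rw [hj1, pow_one]; exact h1
      · have h2' : ‖t z - (γ z + g0 z)‖ ≤ ‖(p : ℚ_[p])‖ ^ (2 * N + V + M + 1) * ‖h z‖ := by
          rw [← sub_sub]; exact h2
        have := pw3 (N := N) (by omega) h3 h2' j hj hj1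
        rw [pow_one] at this
        exact this.trans ((mul_le_of_le_one_left (norm_nonneg _) (p_pow_le_one N)).trans h1)
    · filter_upwards [hgn, hx, hht] with z h1 h2 ⟨_, h3⟩
      rw [add_sub_cancel_left]
      refine ⟨h1, ?_⟩
      rw [← sub_sub, h3]
      exact h2.trans (mul_le_mul_of_nonneg_right (p_pow_anti (by omega)) (norm_nonneg _))
  -- Hensel case
  simp only [zpow_one, zpow_zero, mul_one] at hC
  have hr1 : ∀ᶠ z in 𝒢, (r z).coeff 1 ≠ 0 := by
    filter_upwards [hC] with z hz h0
    have h0 : (Polynomial.taylor (g0 z) (q z)).coeff 1 = 0 := h0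
    rw [h0, zero_mul, norm_zero] at hz
    exact absurd hz (not_lt.2 (norm_nonneg _))
  have hrb : ∀ᶠ z in 𝒢, ‖(r z).coeff 0‖ ≤ ‖(p : ℚ_[p])‖ ^ (N + V + M + 1) * ‖(r z).coeff 1 * h z‖ := by
    filter_upwards [hC, hx] with z h1 h2
    have h3 : ‖(p : ℚ_[p])‖ ^ N * ‖(r z).coeff 0‖ ≤ ‖(p : ℚ_[p])‖ ^ N * (‖(p : ℚ_[p])‖ ^ (N + V + M + 1) * ‖(r z).coeff 1 * h z‖) := by
      calc ‖(p : ℚ_[p])‖ ^ N * ‖(r z).coeff 0‖ = ‖(p : ℚ_[p]) ^ N * (r z).coeff 0‖ := by rw [norm_mul, hpN]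
        _ ≤ _ := h1.le
        _ ≤ ‖(r z).coeff 1‖ * (‖(p : ℚ_[p])‖ ^ (2 * N + V + M + 1) * ‖h z‖) := by
            rw [norm_mul, ← sub_sub]; gcongr
        _ = _ := by rw [norm_mul]; ring
    exact le_of_mul_le_mul_left h3 (p_pow_pos N)
  obtain ⟨f, hf, hf2⟩ := hens (𝒢 := 𝒢) H.dc (d := d)
    (fun (i : Fin d) z => (r z).coeff ((i : ℕ) + 2) * (r z).coeff 0 ^ ((i : ℕ) + 1) / (r z).coeff 1 ^ ((i : ℕ) + 2))
    (fun i => H.dc.div (H.dc.mul (hT1.2 _) (H.dc.pow (hT1.2 0) _)) (H.dc.pow (hT1.2 1) _))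
    (by
      filter_upwards [hr1, hr0, hrb] with z h1 h2 h3 i
      exact pw4 h1 h2 (h3.trans (mul_le_mul_of_nonneg_right (p_pow_anti (by omega)) (norm_nonneg _)))
        ((i : ℕ) + 1) (by omega))
  have hs := H.dc.mul (H.dc.div (hT1.2 0) (hT1.2 1)) hf
  set s : Z → ℚ_[p] := fun z => (r z).coeff 0 / (r z).coeff 1 * f z with hsdef
  have hsn : ∀ᶠ z in 𝒢, ‖s z‖ ≤ ‖(p : ℚ_[p])‖ ^ (N + V + M + 1) * ‖h z‖ := by
    filter_upwards [hrb, hf2, hr1] with z h1 ⟨h2, _⟩ h3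
    rw [hsdef]; simp only
    rw [norm_mul]
    refine (mul_le_of_le_one_right (norm_nonneg _) h2).trans ?_
    rw [norm_div, div_le_iff₀ (norm_pos_iff.2 h3)]
    rw [norm_mul] at h1
    linarith
  have hg := H.dc.add hg0 hs
  have hτ2 : ∀ᶠ z in 𝒢, ‖t z - γ z - (g0 z + s z)‖ ≤ ‖(p : ℚ_[p])‖ ^ (N + V + M + 1) * ‖h z‖ := by
    filter_upwards [hx, hsn] with z h1 h2
    rw [← sub_sub]
    exact nsub_le (h1.trans (mul_le_mul_of_nonneg_right (p_pow_anti (by omega)) (norm_nonneg _))) h2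
  have hgn2 : ∀ᶠ z in 𝒢, ‖g0 z + s z‖ = ‖t z - γ z‖ := by
    filter_upwards [hτ2, hht] with z h1 ⟨h2, h3⟩
    have h4 : t z - γ z ≠ 0 := by rw [← norm_ne_zero_iff, h3]; exact norm_ne_zero_iff.2 h2
    refine norm_eq_of_sub_le (M := N + V + M + 1) h4 (by omega) ?_
    rw [norm_sub_rev, h3]; exact h1
  have hroot : ∀ᶠ z in 𝒢, (Polynomial.taylor (g0 z + s z) (q z)).coeff 0 = 0 := by
    filter_upwards [hf2, hr1] with z ⟨_, h2⟩ h3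
    have e1 : Polynomial.taylor (g0 z + s z) (q z) = Polynomial.taylor (s z) (r z) := by
      change _ = Polynomial.taylor (s z) (Polynomial.taylor (g0 z) (q z))
      rw [Polynomial.taylor_taylor (q z), add_comm]
    rw [e1, taylor_coeff_zero, eval_eq_sum_range' (n := d + 2) (lt_of_le_of_lt (hT1.1 z) (by omega)),
      Finset.sum_range_succ', Finset.sum_range_succ', ← Fin.sum_univ_eq_sum_range
        (fun k => (r z).coeff (k + 1 + 1) * s z ^ (k + 1 + 1))]
    have e2 : ∀ i : Fin d, (r z).coeff ((i : ℕ) + 1 + 1) * s z ^ ((i : ℕ) + 1 + 1) = (r z).coeff 0 *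
        ((r z).coeff ((i : ℕ) + 2) * (r z).coeff 0 ^ ((i : ℕ) + 1) / (r z).coeff 1 ^ ((i : ℕ) + 2) * f z ^ ((i : ℕ) + 2)) := by
      intro i
      rw [hsdef]; simp only
      rw [mul_pow, div_pow]
      field_simp
      ring
    rw [Finset.sum_congr rfl (fun i _ => e2 i), ← Finset.mul_sum]
    have e3 : (r z).coeff (0 + 1) * s z ^ (0 + 1) = (r z).coeff 0 * f z := by
      rw [hsdef]; simp only [zero_add, pow_one]
      field_simp
    rw [e3, pow_zero, mul_one]
    linear_combination (r z).coeff 0 * h2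
  refine ⟨_, H.dc.add hγ hg, ⟨1, ?_⟩, Or.inr ?_⟩
  · filter_upwards [hroot, hτ2, hr _ hgn2] with z h1 h2 h3 j hj
    have e1 := hcomp (fun z => g0 z + s z) z
    rw [e1, ← sub_sub]
    by_cases hj0 : j = 0
    · rw [hj0, h1, zero_mul, norm_zero]; positivity
    · exact pw3 (N := N) (by omega) h3 h2 j hj0 hj
  · filter_upwards [hgn2, hτ2, hht] with z h1 h2 ⟨_, h3⟩
    rw [add_sub_cancel_left]
    refine ⟨h1, ?_⟩
    rw [← sub_sub, h3]
    exact h2.trans (mul_le_mul_of_nonneg_right (p_pow_anti (by omega)) (norm_nonneg _))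

end LemD

end PadicSub

namespace PadicSub

section LemD2

variable {p : ℕ} [hp : Fact p.Prime] {Z : Type*}
open Polynomial

variable {𝒢 : Filter Z} {𝔎 : Set (Z → ℚ_[p])} {t : Z → ℚ_[p]}

theorem Prep.lemD (H : Prep 𝒢 𝔎 t) (d : ℕ) : ∀ L : List (Z → ℚ_[p][X]), (∀ P ∈ L, PolK 𝔎 d P) →
    ∀ N, 1 ≤ N → ∃ γ ∈ 𝔎, ∀ P ∈ L, Dm 𝒢 t N γ P := by
  induction d with
  | zero =>
    intro L hL N hN
    refine ⟨_, H.dc.const 0, fun P hP => ⟨0, Eventually.of_forall fun z j hj => ?_⟩⟩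
    rw [coeff_eq_zero_of_natDegree_lt (by rw [natDegree_taylor]; have := (hL P hP).1 z; omega), zero_mul, norm_zero]
    positivity
  | succ d ih =>
    intro L hL N hN
    obtain ⟨V, hV⟩ := exists_V p (d + 1)
    obtain ⟨γ0, hγ0, h0⟩ := ih (L.map fun P z => derivative (P z)) (by
      intro P hP
      obtain ⟨Q, hQ, rfl⟩ := List.mem_map.1 hP
      exact (hL Q hQ).deriv H.dc) (N + V) (by omega)
    have key : ∀ L1 : List (Z → ℚ_[p][X]), (∀ P ∈ L1, P ∈ L) → ∃ γ ∈ 𝔎,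
        (∀ P ∈ L, Dm 𝒢 t (N + V) γ (fun z => derivative (P z))) ∧ ∀ P ∈ L1, Dm 𝒢 t N γ P := by
      intro L1
      induction L1 with
      | nil =>
        intro _
        refine ⟨γ0, hγ0, fun P hP => h0 _ (List.mem_map.2 ⟨P, hP, rfl⟩), fun P hP => by simp at hP⟩
      | cons P L1 ih1 =>
        intro h1
        obtain ⟨γ, hγ, h2, h3⟩ := ih1 (fun Q hQ => h1 Q (List.mem_cons_of_mem _ hQ))
        have hPL := h1 P List.mem_cons_self
        obtain ⟨γ', hγ', h4, h5⟩ := H.step (M := N + V) hV hN le_rfl hγ (hL P hPL) (h2 P hPL)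
        refine ⟨γ', hγ', fun Q hQ => (h2 Q hQ).closer (by omega) le_rfl h5, fun Q hQ => ?_⟩
        rcases List.mem_cons.1 hQ with rfl | hQ
        · exact h4
        · exact (h3 Q hQ).closer hN (by omega) h5
    obtain ⟨γ, hγ, _, h⟩ := key L (fun P hP => hP)
    exact ⟨γ, hγ, h⟩

theorem PolK.mul (h : DClosed 𝔎) {d e : ℕ} {P Q : Z → ℚ_[p][X]} (hP : PolK 𝔎 d P) (hQ : PolK 𝔎 e Q) :
    PolK 𝔎 (d + e) (fun z => P z * Q z) := by
  refine ⟨fun z => natDegree_mul_le_of_le (hP.1 z) (hQ.1 z), fun j => ?_⟩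
  simp_rw [coeff_mul]
  exact h.sum _ _ (fun x _ => h.mul (hP.2 _) (hQ.2 _))

theorem PolK.add (h : DClosed 𝔎) {d : ℕ} {P Q : Z → ℚ_[p][X]} (hP : PolK 𝔎 d P) (hQ : PolK 𝔎 d Q) :
    PolK 𝔎 d (fun z => P z + Q z) := by
  refine ⟨fun z => natDegree_add_le_of_degree_le (hP.1 z) (hQ.1 z), fun j => ?_⟩
  simp_rw [coeff_add]
  exact h.add (hP.2 _) (hQ.2 _)

theorem PolK.C (h : DClosed 𝔎) {c : Z → ℚ_[p]} (hc : c ∈ 𝔎) : PolK 𝔎 0 (fun z => Polynomial.C (c z)) := by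
  refine ⟨fun z => (natDegree_C _).le, fun j => ?_⟩
  rcases j with _ | j
  · simpa using hc
  · simpa [coeff_C] using h.const 0

theorem PolK.X (h : DClosed 𝔎) : PolK 𝔎 1 (fun _ : Z => (Polynomial.X : ℚ_[p][X])) := by
  refine ⟨fun z => natDegree_X_le, fun j => h.const _⟩

/-- Rational functions of `t` over `𝔎`. -/
def Rat' (𝒢 : Filter Z) (𝔎 : Set (Z → ℚ_[p])) (t : Z → ℚ_[p]) : Set (Z → ℚ_[p]) :=
  {f | ∃ (d : ℕ) (P Q : Z → ℚ_[p][X]), PolK 𝔎 d P ∧ PolK 𝔎 d Q ∧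
    ∀ᶠ z in 𝒢, f z = (P z).eval (t z) / (Q z).eval (t z)}

theorem Rat'.ev {f g : Z → ℚ_[p]} (hf : f ∈ Rat' 𝒢 𝔎 t) (h : f =ᶠ[𝒢] g) : g ∈ Rat' 𝒢 𝔎 t := by
  obtain ⟨d, P, Q, hP, hQ, hf⟩ := hf
  exact ⟨d, P, Q, hP, hQ, by filter_upwards [hf, h] with z h1 h2; rw [← h2, h1]⟩

theorem Rat'.base (H : DClosed 𝔎) {c : Z → ℚ_[p]} (hc : c ∈ 𝔎) : c ∈ Rat' 𝒢 𝔎 t :=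
  ⟨0, _, _, PolK.C H hc, PolK.C H (H.const 1), Eventually.of_forall fun z => by simp⟩

theorem Rat'.self (H : DClosed 𝔎) : t ∈ Rat' 𝒢 𝔎 t :=
  ⟨1, _, _, PolK.X H, (PolK.C H (H.const 1)).mono (by omega), Eventually.of_forall fun z => by simp⟩

theorem Rat'.mul (H : DClosed 𝔎) {f g : Z → ℚ_[p]} (hf : f ∈ Rat' 𝒢 𝔎 t) (hg : g ∈ Rat' 𝒢 𝔎 t) :
    (fun z => f z * g z) ∈ Rat' 𝒢 𝔎 t := by
  obtain ⟨d, P, Q, hP, hQ, hf⟩ := hf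
  obtain ⟨d', P', Q', hP', hQ', hg⟩ := hg
  refine ⟨d + d', _, _, hP.mul H hP', hQ.mul H hQ', ?_⟩
  filter_upwards [hf, hg] with z h1 h2
  rw [h1, h2, eval_mul, eval_mul, div_mul_div_comm]

theorem Rat'.inv {f : Z → ℚ_[p]} (hf : f ∈ Rat' 𝒢 𝔎 t) : (fun z => (f z)⁻¹) ∈ Rat' 𝒢 𝔎 t := by
  obtain ⟨d, P, Q, hP, hQ, hf⟩ := hf
  refine ⟨d, Q, P, hQ, hP, ?_⟩
  filter_upwards [hf] with z h1
  rw [h1, inv_div]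

theorem Rat'.div (H : DClosed 𝔎) {f g : Z → ℚ_[p]} (hf : f ∈ Rat' 𝒢 𝔎 t) (hg : g ∈ Rat' 𝒢 𝔎 t) :
    (fun z => f z / g z) ∈ Rat' 𝒢 𝔎 t := by
  simp_rw [div_eq_mul_inv]
  exact Rat'.mul H hf (Rat'.inv hg)

def Cl (N : ℕ) (a b : ℚ_[p]) : Prop := ‖a - b‖ ≤ ‖(p : ℚ_[p])‖ ^ N * ‖b‖

theorem Cl.refl (N : ℕ) (a : ℚ_[p]) : Cl N a a := by
  unfold Cl; rw [sub_self, norm_zero]; positivity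

theorem Cl.norm {N : ℕ} (hN : 1 ≤ N) {a b : ℚ_[p]} (h : Cl N a b) : ‖a‖ = ‖b‖ := by
  by_cases hb : b = 0
  · unfold Cl at h
    rw [hb, norm_zero, mul_zero, sub_zero] at h
    rw [hb, norm_zero]; exact le_antisymm h (norm_nonneg _)
  · exact norm_eq_of_sub_le hb hN h

theorem Cl.zero_iff {N : ℕ} (hN : 1 ≤ N) {a b : ℚ_[p]} (h : Cl N a b) : a = 0 ↔ b = 0 := by
  rw [← norm_eq_zero, h.norm hN, norm_eq_zero]

theorem Cl.mul {N : ℕ} (hN : 1 ≤ N) {a b c d : ℚ_[p]} (h : Cl N a b) (h' : Cl N c d) : Cl N (a * c) (b * d) := by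
  unfold Cl
  have : a * c - b * d = (a - b) * c + b * (c - d) := by ring
  rw [this]
  refine nadd_le ?_ ?_
  · rw [norm_mul, norm_mul, h'.norm hN, ← mul_assoc]
    exact mul_le_mul_of_nonneg_right h (norm_nonneg _)
  · rw [norm_mul, norm_mul, mul_left_comm]
    exact mul_le_mul_of_nonneg_left h' (norm_nonneg _)

theorem Cl.inv {N : ℕ} (hN : 1 ≤ N) {a b : ℚ_[p]} (h : Cl N a b) : Cl N a⁻¹ b⁻¹ := by
  by_cases hb : b = 0
  · rw [(h.zero_iff hN).2 hb, hb]; exact Cl.refl _ _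
  have ha : a ≠ 0 := fun h0 => hb ((h.zero_iff hN).1 h0)
  unfold Cl at h ⊢
  have e : a⁻¹ - b⁻¹ = -(a - b) * a⁻¹ * b⁻¹ := by field_simp; ring
  rw [e, norm_mul, norm_mul, norm_neg, norm_inv a, Cl.norm hN h]
  refine mul_le_mul_of_nonneg_right ?_ (norm_nonneg _)
  rw [mul_inv_le_iff₀ (norm_pos_iff.2 hb)]; exact h

theorem Cl.trans {N : ℕ} (hN : 1 ≤ N) {a b c : ℚ_[p]} (h : Cl N a b) (h' : Cl N b c) : Cl N a c := by
  unfold Cl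
  have : a - c = (a - b) + (b - c) := by ring
  rw [this]
  refine nadd_le ?_ h'
  rw [← h'.norm hN]; exact h

theorem Cl.mono {M N : ℕ} (h : M ≤ N) {a b : ℚ_[p]} (H : Cl N a b) : Cl M a b :=
  le_trans H (mul_le_mul_of_nonneg_right (p_pow_anti h) (norm_nonneg _))

theorem Dm.cl (H : Prep 𝒢 𝔎 t) {N d : ℕ} {γ : Z → ℚ_[p]} (hγ : γ ∈ 𝔎) {P : Z → ℚ_[p][X]} (hP : PolK 𝔎 d P)
    (h : Dm 𝒢 t N γ P) : ∃ c ∈ 𝔎, ∃ a : ℕ, ∀ᶠ z in 𝒢, Cl N ((P z).eval (t z)) (c z * (t z - γ z) ^ a) := by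
  obtain ⟨a, ha⟩ := h
  refine ⟨_, (hP.taylor H.dc hγ).2 a, a, ?_⟩
  filter_upwards [ha] with z hz
  have := hz.eval
  rw [taylor_eval, sub_add_cancel] at this
  exact this

theorem Prep.rat_prep (H : Prep 𝒢 𝔎 t) {ι : Type*} [Finite ι] (f : ι → Z → ℚ_[p])
    (hf : ∀ i, f i ∈ Rat' 𝒢 𝔎 t) {N : ℕ} (hN : 1 ≤ N) : ∃ γ ∈ 𝔎, ∀ i, ∃ δ ∈ 𝔎, ∃ a : ℤ,
      ∀ᶠ z in 𝒢, Cl N (f i z) (δ z * (t z - γ z) ^ a) := by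
  classical
  have := Fintype.ofFinite ι
  choose d P Q hP hQ h using hf
  obtain ⟨γ, hγ, hD⟩ := H.lemD (∑ i, d i) ((Finset.univ.toList.map P) ++ (Finset.univ.toList.map Q)) (by
    intro R hR
    have hle : ∀ i, d i ≤ ∑ i, d i := fun i => Finset.single_le_sum (f := d) (fun _ _ => Nat.zero_le _) (Finset.mem_univ i)
    rcases List.mem_append.1 hR with hR | hR
    · obtain ⟨i, _, rfl⟩ := List.mem_map.1 hR
      exact (hP i).mono (hle i)
    · obtain ⟨i, _, rfl⟩ := List.mem_map.1 hR
      exact (hQ i).mono (hle i)) N hN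
  refine ⟨γ, hγ, fun i => ?_⟩
  obtain ⟨c, hc, a, ha⟩ := (hD (P i) (List.mem_append_left _ (List.mem_map.2 ⟨i, by simp, rfl⟩))).cl H hγ (hP i)
  obtain ⟨e, he, b, hb⟩ := (hD (Q i) (List.mem_append_right _ (List.mem_map.2 ⟨i, by simp, rfl⟩))).cl H hγ (hQ i)
  refine ⟨_, H.dc.div hc he, (a : ℤ) - b, ?_⟩
  filter_upwards [ha, hb, h i, H.tau_ne hγ] with z h1 h2 h3 h4
  rw [h3, div_eq_mul_inv]
  convert h1.mul hN (h2.inv hN) using 1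
  rw [zpow_sub₀ h4, zpow_natCast, zpow_natCast, mul_inv]
  ring

theorem Prep.rat_le (H : Prep 𝒢 𝔎 t) {f g : Z → ℚ_[p]} (hf : f ∈ Rat' 𝒢 𝔎 t) (hg : g ∈ Rat' 𝒢 𝔎 t) :
    (∀ᶠ z in 𝒢, ‖f z‖ ≤ ‖g z‖) ∨ (∀ᶠ z in 𝒢, ‖g z‖ < ‖f z‖) := by
  obtain ⟨γ, hγ, h⟩ := H.rat_prep (fun b : Bool => if b then f else g) (fun b => by cases b <;> simpa) (N := 1) le_rfl
  obtain ⟨c, hc, a, h1⟩ := h true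
  obtain ⟨d, hd, b, h2⟩ := h false
  simp only [if_true, Bool.false_eq_true, if_false] at h1 h2
  rcases H.mono_le hc hd hγ a b with h3 | h3
  · left; filter_upwards [h1, h2, h3] with z h1 h2 h3
    rwa [h1.norm le_rfl, h2.norm le_rfl]
  · right; filter_upwards [h1, h2, h3] with z h1 h2 h3
    rwa [h1.norm le_rfl, h2.norm le_rfl]

theorem Prep.rat_zero (H : Prep 𝒢 𝔎 t) {f : Z → ℚ_[p]} (hf : f ∈ Rat' 𝒢 𝔎 t) :
    (∀ᶠ z in 𝒢, f z = 0) ∨ (∀ᶠ z in 𝒢, f z ≠ 0) := by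
  rcases H.rat_le hf (Rat'.base H.dc (H.dc.const 0)) with h | h
  · left; filter_upwards [h] with z hz; simpa using hz
  · right; filter_upwards [h] with z hz; simpa using hz

theorem Rat'.add (H : Prep 𝒢 𝔎 t) {f g : Z → ℚ_[p]} (hf : f ∈ Rat' 𝒢 𝔎 t) (hg : g ∈ Rat' 𝒢 𝔎 t) :
    (fun z => f z + g z) ∈ Rat' 𝒢 𝔎 t := by
  rcases H.rat_zero hf with h | h0
  · exact Rat'.ev hg (by filter_upwards [h] with z hz; rw [hz, zero_add])
  rcases H.rat_zero hg with h | h0'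
  · exact Rat'.ev hf (by filter_upwards [h] with z hz; rw [hz, add_zero])
  obtain ⟨d, P, Q, hP, hQ, hf⟩ := hf
  obtain ⟨d', P', Q', hP', hQ', hg⟩ := hg
  refine ⟨d + d', _, _, (hP.mul H.dc hQ').add H.dc ((hQ.mul H.dc hP')), hQ.mul H.dc hQ', ?_⟩
  filter_upwards [hf, hg, h0, h0'] with z h1 h2 h3 h4
  rw [h1] at h3; rw [h2] at h4
  have e1 : (Q z).eval (t z) ≠ 0 := fun h => h3 (by rw [h, div_zero])
  have e2 : (Q' z).eval (t z) ≠ 0 := fun h => h4 (by rw [h, div_zero])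
  rw [h1, h2, eval_add, eval_mul, eval_mul, eval_mul, div_add_div _ _ e1 e2]

end LemD2

end PadicSub

namespace PadicSub

section AGsec

variable {p : ℕ} [hp : Fact p.Prime] {Z : Type*}
open Polynomial

/-- Analytic expressions in integral elements of `S`. -/
def AG (𝒢 : Filter Z) (S : Set (Z → ℚ_[p])) : Set (Z → ℚ_[p]) :=
  {u | ∃ (σ : Type) (_ : Finite σ) (F : (σ → ℤ_[p]) → ℤ_[p]) (φ : σ → Z → ℚ_[p]), An F ∧
    (∀ i, φ i ∈ S) ∧ (∀ i, ∀ᶠ z in 𝒢, ‖φ i z‖ ≤ 1) ∧ ∀ᶠ z in 𝒢, u z = anf F φ z}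

variable {𝒢 : Filter Z} {S : Set (Z → ℚ_[p])}

theorem AG.of {f : Z → ℚ_[p]} (hf : f ∈ S) (h : ∀ᶠ z in 𝒢, ‖f z‖ ≤ 1) : f ∈ AG 𝒢 S := by
  refine ⟨Unit, inferInstance, fun x => x (), fun _ => f, An.proj (), fun _ => hf, fun _ => h, ?_⟩
  filter_upwards [h] with z hz
  exact (trc_coe hz).symm

theorem AG.norm {f : Z → ℚ_[p]} (hf : f ∈ AG 𝒢 S) : ∀ᶠ z in 𝒢, ‖f z‖ ≤ 1 := by
  obtain ⟨σ, _, F, φ, _, _, _, h⟩ := hf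
  filter_upwards [h] with z hz
  rw [hz]; exact anf_norm _ _ _

theorem AG.ev {f g : Z → ℚ_[p]} (hf : f ∈ AG 𝒢 S) (h : ∀ᶠ z in 𝒢, g z = f z) : g ∈ AG 𝒢 S := by
  obtain ⟨σ, hσ, F, φ, hF, h1, h2, h3⟩ := hf
  exact ⟨σ, hσ, F, φ, hF, h1, h2, by filter_upwards [h, h3] with z h4 h5; rw [h4, h5]⟩

theorem AG.mono {S' : Set (Z → ℚ_[p])} (hS : S ⊆ S') {f : Z → ℚ_[p]} (hf : f ∈ AG 𝒢 S) : f ∈ AG 𝒢 S' := by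
  obtain ⟨σ, hσ, F, φ, hF, h1, h2, h3⟩ := hf
  exact ⟨σ, hσ, F, φ, hF, fun i => hS (h1 i), h2, h3⟩

theorem AG.comp {ι : Type} [Finite ι] {F : (ι → ℤ_[p]) → ℤ_[p]} (hF : An F) {g : ι → Z → ℚ_[p]}
    (hg : ∀ i, g i ∈ AG 𝒢 S) : anf F g ∈ AG 𝒢 S := by
  choose σ hσ G φ hG h1 h2 h3 using hg
  refine ⟨Σ i, σ i, inferInstance, fun y => F fun i => G i fun k => y ⟨i, k⟩, fun s => φ s.1 s.2,
    hF.comp fun i => (hG i).comp fun k => An.proj _, fun s => h1 _ _, fun s => h2 _ _, ?_⟩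
  filter_upwards [eventually_all.2 h3] with z hz
  unfold anf
  have : (fun i => trc (g i z)) = fun i => G i fun k => trc (φ i k z) := by
    funext i
    rw [hz i]; exact trc_of_coe _
  rw [this]

theorem AG.const (c : ℤ_[p]) : (fun _ => (c : ℚ_[p])) ∈ AG 𝒢 S :=
  ⟨Empty, inferInstance, fun _ => c, fun i => i.elim, An.const c, fun i => i.elim, fun i => i.elim,
    Eventually.of_forall fun _ => rfl⟩

theorem AG.zero : (fun _ => (0 : ℚ_[p])) ∈ AG 𝒢 S := by simpa using AG.const (𝒢 := 𝒢) (S := S) 0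

theorem AG.mul {f g : Z → ℚ_[p]} (hf : f ∈ AG 𝒢 S) (hg : g ∈ AG 𝒢 S) : (fun z => f z * g z) ∈ AG 𝒢 S := by
  refine AG.ev (AG.comp (ι := Bool) ((An.proj true).mul (An.proj false)) (g := fun b => if b then f else g)
    (fun b => by cases b <;> simpa)) ?_
  filter_upwards [(AG.norm hf), (AG.norm hg)] with z h1 h2
  simp only [anf, PadicInt.coe_mul, if_true, Bool.false_eq_true, if_false, trc_coe h1, trc_coe h2]

theorem AG.add {f g : Z → ℚ_[p]} (hf : f ∈ AG 𝒢 S) (hg : g ∈ AG 𝒢 S) : (fun z => f z + g z) ∈ AG 𝒢 S := by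
  refine AG.ev (AG.comp (ι := Bool) ((An.proj true).add (An.proj false)) (g := fun b => if b then f else g)
    (fun b => by cases b <;> simpa)) ?_
  filter_upwards [(AG.norm hf), (AG.norm hg)] with z h1 h2
  simp only [anf, PadicInt.coe_add, if_true, Bool.false_eq_true, if_false, trc_coe h1, trc_coe h2]

theorem AG.one_add {f : Z → ℚ_[p]} (hf : f ∈ AG 𝒢 S) : (fun z => 1 + p * f z) ∈ AG 𝒢 S := by
  have := AG.add (AG.const (𝒢 := 𝒢) (S := S) 1) (AG.mul (AG.const (𝒢 := 𝒢) (S := S) p) hf)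
  simpa using this

theorem AG.sum {ι : Type*} (s : Finset ι) {f : ι → Z → ℚ_[p]} (hf : ∀ i ∈ s, f i ∈ AG 𝒢 S) :
    (fun z => ∑ i ∈ s, f i z) ∈ AG 𝒢 S := by
  classical
  induction s using Finset.induction_on with
  | empty => simpa using AG.zero
  | insert a s ha ih =>
    simp_rw [Finset.sum_insert ha]
    exact AG.add (hf a (Finset.mem_insert_self _ _)) (ih fun i hi => hf i (Finset.mem_insert_of_mem hi))

theorem AG.inv1 {f : Z → ℚ_[p]} (hf : f ∈ AG 𝒢 S) :
    ∃ g ∈ AG 𝒢 S, ∀ᶠ z in 𝒢, (1 + p * f z) * (1 + p * g z) = 1 := by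
  obtain ⟨F', hF', h⟩ := (An.proj (p := p) ()).inv
  refine ⟨_, AG.comp hF' (g := fun _ => f) (fun _ => hf), ?_⟩
  filter_upwards [(AG.norm hf)] with z hz
  have := congrArg (fun x : ℤ_[p] => (x : ℚ_[p])) (h fun _ => trc (f z))
  simp only [PadicInt.coe_mul, PadicInt.coe_add, PadicInt.coe_one, PadicInt.coe_natCast, trc_coe hz] at this
  exact this

theorem norm_one_add_p {u : ℚ_[p]} (h : ‖u‖ ≤ 1) : ‖1 + p * u‖ = 1 := by
  have : ‖(p : ℚ_[p]) * u‖ < 1 := by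
    rw [norm_mul]
    calc _ ≤ ‖(p : ℚ_[p])‖ * 1 := by gcongr
      _ < 1 := by rw [mul_one]; exact norm_p_lt_one'
  rw [nadd_eq (by rwa [norm_one]), norm_one]

theorem one_add_p_mul (u v : ℚ_[p]) : (1 + p * u) * (1 + p * v) = 1 + p * (u + v * (1 + p * u)) := by ring

variable {𝔎 : Set (Z → ℚ_[p])} {t : Z → ℚ_[p]}

/-- Monomials in `t - γ`. -/
def Mon (𝔎 : Set (Z → ℚ_[p])) (t γ : Z → ℚ_[p]) : Set (Z → ℚ_[p]) :=
  {f | ∃ c ∈ 𝔎, ∃ e : ℤ, f = fun z => c z * (t z - γ z) ^ e}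

theorem Mon.mk {γ c : Z → ℚ_[p]} (hc : c ∈ 𝔎) (e : ℤ) : (fun z => c z * (t z - γ z) ^ e) ∈ Mon 𝔎 t γ :=
  ⟨c, hc, e, rfl⟩

theorem Rat'.pow (H : DClosed 𝔎) {f : Z → ℚ_[p]} (hf : f ∈ Rat' 𝒢 𝔎 t) (n : ℕ) :
    (fun z => f z ^ n) ∈ Rat' 𝒢 𝔎 t := by
  induction n with
  | zero => simpa using Rat'.base H (H.const 1)
  | succ n ih => simp_rw [pow_succ]; exact Rat'.mul H ih hf

theorem Rat'.zpow (H : DClosed 𝔎) {f : Z → ℚ_[p]} (hf : f ∈ Rat' 𝒢 𝔎 t) (n : ℤ) :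
    (fun z => f z ^ n) ∈ Rat' 𝒢 𝔎 t := by
  cases n with
  | ofNat n => simpa using Rat'.pow H hf n
  | negSucc n => simp_rw [zpow_negSucc]; exact Rat'.inv (Rat'.pow H hf _)

theorem Rat'.tau (H : Prep 𝒢 𝔎 t) {γ : Z → ℚ_[p]} (hγ : γ ∈ 𝔎) : (fun z => t z - γ z) ∈ Rat' 𝒢 𝔎 t := by
  have := Rat'.add H (Rat'.self H.dc) (Rat'.base H.dc (H.dc.neg hγ))
  simpa [sub_eq_add_neg] using this

theorem Rat'.sum (H : Prep 𝒢 𝔎 t) {ι : Type*} (s : Finset ι) {f : ι → Z → ℚ_[p]}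
    (hf : ∀ i ∈ s, f i ∈ Rat' 𝒢 𝔎 t) : (fun z => ∑ i ∈ s, f i z) ∈ Rat' 𝒢 𝔎 t := by
  classical
  induction s using Finset.induction_on with
  | empty => simpa using Rat'.base H.dc (H.dc.const 0)
  | insert a s ha ih =>
    simp_rw [Finset.sum_insert ha]
    exact Rat'.add H (hf a (Finset.mem_insert_self _ _)) (ih fun i hi => hf i (Finset.mem_insert_of_mem hi))

theorem Mon.rat (H : Prep 𝒢 𝔎 t) {γ : Z → ℚ_[p]} (hγ : γ ∈ 𝔎) : Mon 𝔎 t γ ⊆ Rat' 𝒢 𝔎 t := by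
  rintro _ ⟨c, hc, e, rfl⟩
  exact Rat'.mul H.dc (Rat'.base H.dc hc) (Rat'.zpow H.dc (Rat'.tau H hγ) e)

theorem Dm.form (H : Prep 𝒢 𝔎 t) {d : ℕ} {γ : Z → ℚ_[p]} (hγ : γ ∈ 𝔎) {P : Z → ℚ_[p][X]} (hP : PolK 𝔎 d P)
    (h : Dm 𝒢 t 1 γ P) : ∃ c ∈ 𝔎, ∃ a : ℕ, ∃ u ∈ AG 𝒢 (Mon 𝔎 t γ), ∀ᶠ z in 𝒢,
      (P z).eval (t z) = c z * (t z - γ z) ^ a * (1 + p * u z) := by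
  obtain ⟨a, ha⟩ := h
  have hT := hP.taylor H.dc hγ
  set q : ℕ → Z → ℚ_[p] := fun j z => (Polynomial.taylor (γ z) (P z)).coeff j with hq
  have hqK : ∀ j, q j ∈ 𝔎 := hT.2
  have heval : ∀ z, (P z).eval (t z) = (Polynomial.taylor (γ z) (P z)).eval (t z - γ z) := by
    intro z; rw [taylor_eval, sub_add_cancel]
  rcases H.zero_dec (hqK a) with h0 | h0
  · refine ⟨_, hqK a, a, _, AG.zero, ?_⟩
    filter_upwards [ha, h0] with z hz h0
    have := hz.eval
    change ‖_ - q a z * _‖ ≤ _ * ‖q a z * _‖ at this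
    rw [h0] at this
    rw [heval, h0]
    simpa using this
  · refine ⟨_, hqK a, a, fun z => ∑ j ∈ (Finset.range (d + a + 1)).erase a,
      (q j z / (p * q a z)) * (t z - γ z) ^ ((j : ℤ) - a), AG.sum _ fun j hj => AG.of (Mon.mk (H.dc.div (hqK j)
        (H.dc.mul (H.dc.const (p : ℚ_[p])) (hqK a))) _) ?_, ?_⟩
    · filter_upwards [ha, h0, H.tau_ne hγ] with z hz h0 h1
      have := hz j (Finset.ne_of_mem_erase hj)
      change ‖q j z * _‖ ≤ _ * ‖q a z * _‖ at this
      have hp0 : (p : ℚ_[p]) ≠ 0 := p_ne_zero'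
      have e : q j z / (p * q a z) * (t z - γ z) ^ ((j : ℤ) - a) = (q j z * (t z - γ z) ^ j) / (p * (q a z * (t z - γ z) ^ a)) := by
        rw [zpow_sub₀ h1, zpow_natCast, zpow_natCast]; field_simp
      rw [e, norm_div]
      refine div_le_one_of_le₀ ?_ (norm_nonneg _)
      rw [norm_mul (p : ℚ_[p])]; simpa using this
    · filter_upwards [h0, H.tau_ne hγ] with z h0 h1
      have hp0 : (p : ℚ_[p]) ≠ 0 := p_ne_zero'
      rw [heval, eval_eq_sum_range' (n := d + a + 1) (by have := hT.1 z; beta_reduce at this; omega),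
        ← Finset.add_sum_erase _ _ (Finset.mem_range.2 (show a < d + a + 1 by omega)), mul_add, mul_one,
        Finset.mul_sum, Finset.mul_sum]
      congr 1
      refine Finset.sum_congr rfl fun j _ => ?_
      change q j z * _ = _
      rw [zpow_sub₀ h1, zpow_natCast, zpow_natCast]; field_simp

theorem Prep.rat_mon (H : Prep 𝒢 𝔎 t) {ι : Type*} [Finite ι] (f : ι → Z → ℚ_[p])
    (hf : ∀ i, f i ∈ Rat' 𝒢 𝔎 t) (hi : ∀ i, ∀ᶠ z in 𝒢, ‖f i z‖ ≤ 1) :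
    ∃ γ ∈ 𝔎, ∀ i, f i ∈ AG 𝒢 (Mon 𝔎 t γ) := by
  classical
  have := Fintype.ofFinite ι
  choose d P Q hP hQ h using hf
  obtain ⟨γ, hγ, hD⟩ := H.lemD (∑ i, d i) ((Finset.univ.toList.map P) ++ (Finset.univ.toList.map Q)) (by
    intro R hR
    have hle : ∀ i, d i ≤ ∑ i, d i := fun i => Finset.single_le_sum (f := d) (fun _ _ => Nat.zero_le _) (Finset.mem_univ i)
    rcases List.mem_append.1 hR with hR | hR
    · obtain ⟨i, _, rfl⟩ := List.mem_map.1 hR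
      exact (hP i).mono (hle i)
    · obtain ⟨i, _, rfl⟩ := List.mem_map.1 hR
      exact (hQ i).mono (hle i)) 1 le_rfl
  refine ⟨γ, hγ, fun i => ?_⟩
  obtain ⟨c, hc, a, u, hu, h1⟩ := (hD (P i) (List.mem_append_left _ (List.mem_map.2 ⟨i, by simp, rfl⟩))).form H hγ (hP i)
  obtain ⟨e, he, b, v, hv, h2⟩ := (hD (Q i) (List.mem_append_right _ (List.mem_map.2 ⟨i, by simp, rfl⟩))).form H hγ (hQ i)
  obtain ⟨w, hw, h3⟩ := AG.inv1 hv
  have key : ∀ᶠ z in 𝒢, f i z = (c z / e z * (t z - γ z) ^ ((a : ℤ) - b)) * ((1 + p * u z) * (1 + p * w z)) := by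
    filter_upwards [h1, h2, h3, h i, H.tau_ne hγ] with z h1 h2 h3 h4 h5
    rw [h4, h1, h2, zpow_sub₀ h5, zpow_natCast, zpow_natCast, div_eq_mul_inv, mul_inv, ← eq_inv_of_mul_eq_one_right h3, mul_inv]
    ring
  refine AG.ev (AG.mul (AG.of (Mon.mk (H.dc.div hc he) _) ?_) (AG.mul (AG.one_add hu) (AG.one_add hw))) key
  filter_upwards [key, hi i, (AG.norm hu), (AG.norm hw)] with z h1 h2 h3 h4
  rw [h1, norm_mul, norm_mul (1 + _), norm_one_add_p h3, norm_one_add_p h4, mul_one, mul_one] at h2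
  exact h2

end AGsec

end PadicSub

namespace PadicSub

section KEY

variable {p : ℕ} [hp : Fact p.Prime] {Z : Type*}
variable {𝒢 : Filter Z} {𝔎 : Set (Z → ℚ_[p])} {t : Z → ℚ_[p]}

/-- Functions of the form (rational in `t`) times (analytic unit). -/
def Ef (𝒢 : Filter Z) (𝔎 : Set (Z → ℚ_[p])) (t : Z → ℚ_[p]) : Set (Z → ℚ_[p]) :=
  {f | ∃ R ∈ Rat' 𝒢 𝔎 t, ∃ u ∈ AG 𝒢 (Rat' 𝒢 𝔎 t), ∀ᶠ z in 𝒢, f z = R z * (1 + p * u z)}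

theorem Ef.zero (H : Prep 𝒢 𝔎 t) {f : Z → ℚ_[p]} (hf : ∀ᶠ z in 𝒢, f z = 0) : f ∈ Ef 𝒢 𝔎 t :=
  ⟨_, Rat'.base H.dc (H.dc.const 0), _, AG.zero, by filter_upwards [hf] with z hz; simp [hz]⟩

theorem Ef.ev {f g : Z → ℚ_[p]} (hf : f ∈ Ef 𝒢 𝔎 t) (h : ∀ᶠ z in 𝒢, g z = f z) : g ∈ Ef 𝒢 𝔎 t := by
  obtain ⟨R, hR, u, hu, h1⟩ := hf
  exact ⟨R, hR, u, hu, by filter_upwards [h, h1] with z h2 h3; rw [h2, h3]⟩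

/-- evaluation of analytic functions of base functions, in the base -/
theorem Prep.an_base (H : Prep 𝒢 𝔎 t) {σ : Type} [Finite σ] {F : (σ → ℤ_[p]) → ℤ_[p]} (hF : An F)
    {x : σ → Z → ℚ_[p]} (hx : ∀ i, x i ∈ 𝔎) (hi : ∀ i, ∀ᶠ z in 𝒢, ‖x i z‖ ≤ 1) :
    ∃ f ∈ 𝔎, ∀ᶠ z in 𝒢, f z = anf F x z := by
  obtain ⟨f, hf, h⟩ := H.dc.an hF x hx
  exact ⟨f, hf, by filter_upwards [eventually_all.2 hi] with z hz; exact h z hz⟩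

theorem oc_trc {σ : Type*} (v : Z → ℚ_[p]) (x : σ → Z → ℚ_[p]) (z : Z) :
    (fun i => trc (oc v x i z)) = oc (trc (v z)) (fun i => trc (x i z)) := by
  funext i; cases i <;> rfl

theorem Prep.key_alpha (H : Prep 𝒢 𝔎 t) {σ : Type} [Finite σ] {G : (Option σ → ℤ_[p]) → ℤ_[p]} (hG : An G)
    {x : σ → Z → ℚ_[p]} (hx : ∀ i, x i ∈ 𝔎) (hi : ∀ i, ∀ᶠ z in 𝒢, ‖x i z‖ ≤ 1)
    {ζ : Z → ℚ_[p]} (hζ : ζ ∈ Rat' 𝒢 𝔎 t) (hζi : ∀ᶠ z in 𝒢, ‖ζ z‖ ≤ 1) :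
    anf G (oc ζ x) ∈ Ef 𝒢 𝔎 t := by
  classical
  obtain ⟨N, a, L, ha, hL, hGe⟩ := hG.coef
  choose a' ha' haa using fun j => H.an_base (ha j) hx hi
  have hmax : ∀ j0 < N, ∃ d < N, (∀ j < N, ∀ᶠ z in 𝒢, ‖a' j z‖ ≤ ‖a' d z‖) ∧
      ∀ j, d < j → j < N → ∀ᶠ z in 𝒢, ‖a' j z‖ < ‖a' d z‖ := by
    intro j0 hj0
    obtain ⟨d0, hd0, hm⟩ := ev_max (𝒢 := 𝒢) (Finset.range N) ⟨j0, Finset.mem_range.2 hj0⟩ a' (fun i _ j _ => by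
      rcases H.le _ (ha' i) _ (ha' j) with h | h
      · exact Or.inl h
      · exact Or.inr (h.mono fun z hz => hz.le))
    set S := (Finset.range N).filter (fun d => ∀ j < N, ∀ᶠ z in 𝒢, ‖a' j z‖ ≤ ‖a' d z‖) with hS
    have hne : S.Nonempty := ⟨d0, Finset.mem_filter.2 ⟨hd0, fun j hj => hm j (Finset.mem_range.2 hj)⟩⟩
    have hd := S.max'_mem hne
    have hd' := Finset.mem_filter.1 hd
    refine ⟨S.max' hne, Finset.mem_range.1 hd'.1, hd'.2, fun j hj hjN => ?_⟩
    rcases H.le _ (ha' (S.max' hne)) _ (ha' j) with h | h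
    · exfalso
      have : j ∈ S := Finset.mem_filter.2 ⟨Finset.mem_range.2 hjN, fun i hi => by
        filter_upwards [h, hd'.2 i hi] with z h1 h2; exact h2.trans h1⟩
      exact absurd (S.le_max' j this) (by omega)
    · exact h
  rcases Nat.eq_zero_or_pos N with hN | hN
  · refine Ef.zero H (Eventually.of_forall fun z => ?_)
    unfold anf
    rw [oc_trc, hGe, hN]; simp
  obtain ⟨d, hdN, hd1, hd2⟩ := hmax 0 hN
  -- the expansion over ℚ_p
  have hexp : ∀ᶠ z in 𝒢, anf G (oc ζ x) z = ∑ j ∈ Finset.range N, a' j z * ζ z ^ j * (1 + p * anf (L j) (oc ζ x) z) := by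
    filter_upwards [(Filter.eventually_all_finset (Finset.range N)).2 fun j _ => haa j, hζi] with z h1 h2
    unfold anf
    rw [oc_trc, hGe, coe_sum']
    refine Finset.sum_congr rfl fun j hj => ?_
    rw [h1 j hj]
    simp only [PadicInt.coe_mul, PadicInt.coe_add, PadicInt.coe_one, PadicInt.coe_natCast, PadicInt.coe_pow, trc_coe h2]
    rfl
  rcases H.zero_dec (ha' d) with h0 | h0
  · refine Ef.zero H ?_
    filter_upwards [hexp, h0, (Filter.eventually_all_finset (Finset.range N)).2 fun j hj => hd1 j (Finset.mem_range.1 hj)] with z h1 h2 h3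
    rw [h1]
    refine Finset.sum_eq_zero fun j hj => ?_
    have := h3 j hj
    rw [h2, norm_zero] at this
    rw [norm_le_zero_iff.1 this]; ring
  have hp0 : (p : ℚ_[p]) ≠ 0 := p_ne_zero'
  -- extra variables
  let e : Fin N → Z → ℚ_[p] := fun j z => if (j : ℕ) < d then a' j z / a' d z else if d < j then a' j z / (p * a' d z) else 0
  have heK : ∀ j, e j ∈ 𝔎 := by
    intro j
    by_cases h1 : (j : ℕ) < d
    · simp only [e, h1, if_true]; exact H.dc.div (ha' _) (ha' _)
    · by_cases h2 : d < (j : ℕ)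
      · simp only [e, h1, h2, if_true, if_false]; exact H.dc.div (ha' _) (H.dc.mul (H.dc.const (p : ℚ_[p])) (ha' _))
      · simp only [e, h1, h2, if_false]; exact H.dc.const 0
  have hei : ∀ j, ∀ᶠ z in 𝒢, ‖e j z‖ ≤ 1 := by
    intro j
    by_cases h1 : (j : ℕ) < d
    · filter_upwards [hd1 j j.2] with z hz
      simp only [e, h1, if_true]; rw [norm_div]; exact div_le_one_of_le₀ hz (norm_nonneg _)
    · by_cases h2 : d < (j : ℕ)
      · filter_upwards [hd2 j h2 j.2] with z hz
        simp only [e, h1, h2, if_true, if_false]; rw [norm_div, norm_mul]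
        exact div_le_one_of_le₀ ((norm_lt_iff_le_p_mul _ _).1 hz).2 (by positivity)
      · simp [e, h1, h2]
  let x' : σ ⊕ Fin N → Z → ℚ_[p] := Sum.elim x e
  have hx' : ∀ i, x' i ∈ 𝔎 := by rintro (i | i); exacts [hx i, heK i]
  have hi' : ∀ i, ∀ᶠ z in 𝒢, ‖x' i z‖ ≤ 1 := by rintro (i | i); exacts [hi i, hei i]
  let E : ℕ → (σ ⊕ Fin N → ℤ_[p]) → ℤ_[p] := fun j y => if h : j < N then y (Sum.inr ⟨j, h⟩) else 0
  have hE : ∀ j, An (E j) := by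
    intro j
    by_cases h : j < N
    · simp only [E, h, dif_pos]; exact An.proj _
    · simp only [E, h, dif_neg, not_false_eq_true]; exact An.const 0
  let E' : ℕ → (Option (σ ⊕ Fin N) → ℤ_[p]) → ℤ_[p] := fun j y => E j fun i => y (some i)
  have hE' : ∀ j, An (E' j) := fun j => (hE j).comp fun i => An.proj _
  let L' : ℕ → (Option (σ ⊕ Fin N) → ℤ_[p]) → ℤ_[p] := fun j y => L j (fun i => y (i.map Sum.inl))
  have hL' : ∀ j, An (L' j) := fun j => (hL j).comp fun i => An.proj _
  let H' : (Option (σ ⊕ Fin N) → ℤ_[p]) → ℤ_[p] := fun y =>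
    (L' d y * y none ^ d + ∑ j ∈ Finset.range d, E' j y * y none ^ j * L' j y) +
      ∑ j ∈ Finset.Ico (d + 1) N, E' j y * y none ^ j * (1 + p * L' j y)
  have hH' : An H' := (((hL' d).mul ((An.proj none).pow d)).add (An.sum _ fun j _ => ((hE' j).mul ((An.proj none).pow j)).mul (hL' j))).add
    (An.sum _ fun j _ => ((hE' j).mul ((An.proj none).pow j)).mul ((An.const 1).add ((An.const (p : ℤ_[p])).mul (hL' j))))
  obtain ⟨U, r, hU, hr, hUr⟩ := An.wp (d := d) hE hH'
  choose r' hr' hrr using fun j => H.an_base (hr j) hx' hi'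
  obtain ⟨U', hU', hUU⟩ := hU.inv
  refine ⟨fun z => a' d z * (ζ z ^ d + ∑ j ∈ Finset.range d, r' j z * ζ z ^ j),
    Rat'.mul H.dc (Rat'.base H.dc (ha' d)) (Rat'.add H (Rat'.pow H.dc hζ d) (Rat'.sum H _ fun j _ =>
      Rat'.mul H.dc (Rat'.base H.dc (hr' j)) (Rat'.pow H.dc hζ j))), anf U' (oc ζ x'), AG.comp hU' ?_, ?_⟩
  · rintro (_ | i)
    · exact AG.of hζ hζi
    · exact AG.of (Rat'.base H.dc (hx' i)) (hi' i)
  filter_upwards [hexp, h0, hζi, (Filter.eventually_all_finset (Finset.range d)).2 fun j _ => hrr j, eventually_all.2 hei] with z h1 h2 h3 h4 h5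
  have k1 := congrArg (fun x : ℤ_[p] => (x : ℚ_[p])) (hUr (fun i => trc (x' i z)) (trc (ζ z)))
  have k2 := congrArg (fun x : ℤ_[p] => (x : ℚ_[p])) (hUU (oc (trc (ζ z)) fun i => trc (x' i z)))
  have q1 : ∀ j : ℕ, ∀ h : j < N, E j (fun i => trc (x' i z)) = trc (e ⟨j, h⟩ z) := by
    intro j h; simp only [E, h, dif_pos]; rfl
  have q2 : ∀ j : ℕ, ((L' j (oc (trc (ζ z)) fun i => trc (x' i z)) : ℤ_[p]) : ℚ_[p]) = anf (L j) (oc ζ x) z := by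
    intro j
    unfold anf
    simp only [L']
    congr 2
    funext i; cases i <;> rfl
  have q3 : ∀ j, E' j (oc (trc (ζ z)) fun i => trc (x' i z)) = E j (fun i => trc (x' i z)) := fun j => rfl
  simp only [PadicInt.coe_mul, PadicInt.coe_add, PadicInt.coe_one, PadicInt.coe_natCast, PadicInt.coe_pow, coe_sum', H', oc_none, trc_coe h3, q2, q3] at k1 k2
  have q4 : ∑ j ∈ Finset.range d, ((r j fun i => trc (x' i z) : ℤ_[p]) : ℚ_[p]) * ζ z ^ j = ∑ j ∈ Finset.range d, r' j z * ζ z ^ j :=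
    Finset.sum_congr rfl fun j hj => by rw [h4 j hj]; rfl
  rw [q4] at k1
  have q5 : anf U' (oc ζ x') z = ((U' (oc (trc (ζ z)) fun i => trc (x' i z)) : ℤ_[p]) : ℚ_[p]) := by
    unfold anf; rw [oc_trc]
  rw [q5, h1, ← k1, mul_assoc, mul_assoc, k2, mul_one]
  have hsplit : ∀ g : ℕ → ℚ_[p], ∑ j ∈ Finset.range N, g j = ∑ j ∈ Finset.range d, g j + (g d + ∑ j ∈ Finset.Ico (d + 1) N, g j) := by
    intro g
    rw [← Finset.sum_eq_sum_Ico_succ_bot hdN, Finset.sum_range_add_sum_Ico _ hdN.le]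
  rw [hsplit]
  have s1 : ∀ j ∈ Finset.range d, a' j z = a' d z * ((E j fun i => trc (x' i z) : ℤ_[p]) : ℚ_[p]) := by
    intro j hj
    have hjd := Finset.mem_range.1 hj
    rw [q1 j (hjd.trans hdN), trc_coe (h5 _)]
    simp only [e, hjd, if_true]; field_simp
  have s2 : ∀ j ∈ Finset.Ico (d + 1) N, a' j z = a' d z * (p * ((E j fun i => trc (x' i z) : ℤ_[p]) : ℚ_[p])) := by
    intro j hj
    have hjd := Finset.mem_Ico.1 hj
    rw [q1 j hjd.2, trc_coe (h5 _)]
    have n1 : ¬ j < d := by omega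
    have n2 : d < j := by omega
    simp only [e, n1, n2, if_true, if_false]; field_simp
  have t1 : ∑ j ∈ Finset.range d, a' j z * ζ z ^ j * (1 + p * anf (L j) (oc ζ x) z) =
      a' d z * (∑ j ∈ Finset.range d, ((E j fun i => trc (x' i z) : ℤ_[p]) : ℚ_[p]) * ζ z ^ j +
        p * ∑ j ∈ Finset.range d, ((E j fun i => trc (x' i z) : ℤ_[p]) : ℚ_[p]) * ζ z ^ j * anf (L j) (oc ζ x) z) := by
    rw [Finset.mul_sum _ _ (p : ℚ_[p]), ← Finset.sum_add_distrib, Finset.mul_sum]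
    exact Finset.sum_congr rfl fun j hj => by rw [s1 j hj]; ring
  have t2 : ∑ j ∈ Finset.Ico (d + 1) N, a' j z * ζ z ^ j * (1 + p * anf (L j) (oc ζ x) z) =
      a' d z * (p * ∑ j ∈ Finset.Ico (d + 1) N, ((E j fun i => trc (x' i z) : ℤ_[p]) : ℚ_[p]) * ζ z ^ j *
        (1 + p * anf (L j) (oc ζ x) z)) := by
    rw [Finset.mul_sum _ _ (p : ℚ_[p]), Finset.mul_sum]
    exact Finset.sum_congr rfl fun j hj => by rw [s2 j hj]; ring
  rw [t1, t2]
  ring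

end KEY

end PadicSub

namespace PadicSub

section KEY2

variable {p : ℕ} [hp : Fact p.Prime] {Z : Type*}
variable {𝒢 : Filter Z} {𝔎 : Set (Z → ℚ_[p])} {t : Z → ℚ_[p]}

theorem An.zpow1 {σ : Type*} {F : (σ → ℤ_[p]) → ℤ_[p]} (hF : An F) (e : ℤ) :
    ∃ B : (σ → ℤ_[p]) → ℤ_[p], An B ∧ ∀ y, (B y : ℚ_[p]) = (1 + p * (F y : ℚ_[p])) ^ e := by
  cases e with
  | ofNat n =>
    exact ⟨_, ((An.const 1).add ((An.const (p : ℤ_[p])).mul hF)).pow n, fun y => by simp⟩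
  | negSucc n =>
    obtain ⟨F', hF', h⟩ := hF.inv
    refine ⟨_, ((An.const 1).add ((An.const (p : ℤ_[p])).mul hF')).pow (n + 1), fun y => ?_⟩
    have := congrArg (fun x : ℤ_[p] => (x : ℚ_[p])) (h y)
    simp only [PadicInt.coe_mul, PadicInt.coe_add, PadicInt.coe_one, PadicInt.coe_natCast] at this
    rw [zpow_negSucc]
    simp only [PadicInt.coe_mul, PadicInt.coe_add, PadicInt.coe_one, PadicInt.coe_natCast, PadicInt.coe_pow]
    rw [← inv_pow, eq_inv_of_mul_eq_one_right this]

theorem Prep.key_tie (H : Prep 𝒢 𝔎 t) {γ h : Z → ℚ_[p]} (hγ : γ ∈ 𝔎) (hh : h ∈ 𝔎)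
    (he : ∀ᶠ z in 𝒢, h z ≠ 0 ∧ ‖t z - γ z‖ = ‖h z‖) {f : Z → ℚ_[p]} (hf : f ∈ AG 𝒢 (Mon 𝔎 t γ)) :
    f ∈ Ef 𝒢 𝔎 t := by
  obtain ⟨σ, hσ, F, φ, hF, hφ, hi, hfe⟩ := hf
  choose c hc e hce using hφ
  obtain ⟨j, hj⟩ := H.near hγ hh he 1
  have hp0 : (p : ℚ_[p]) ≠ 0 := p_ne_zero'
  set h' : Z → ℚ_[p] := fun z => h z * j with hh'
  have hh'K : h' ∈ 𝔎 := H.dc.mul hh (H.dc.const (j : ℚ_[p]))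
  set ζ : Z → ℚ_[p] := fun z => (t z - γ z - h' z) / (p * h' z) with hζ
  have hh'n : ∀ᶠ z in 𝒢, h' z ≠ 0 ∧ ‖t z - γ z‖ = ‖h' z‖ ∧ ‖ζ z‖ ≤ 1 ∧ t z - γ z = h' z * (1 + p * ζ z) := by
    filter_upwards [hj, he] with z h1 h2
    change ‖t z - γ z - h' z‖ ≤ _ at h1
    rw [pow_one] at h1
    have h3 : ‖t z - γ z - h' z‖ < ‖t z - γ z‖ := by
      rw [h2.2]; exact (norm_lt_iff_le_p_mul _ _).2 ⟨h2.1, h1⟩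
    have h4 : ‖h' z‖ = ‖t z - γ z‖ := by
      have := nsub_eq (p := p) h3
      simpa using this
    have h5 : h' z ≠ 0 := by
      rw [← norm_ne_zero_iff, h4, h2.2, norm_ne_zero_iff]; exact h2.1
    refine ⟨h5, h4.symm, ?_, ?_⟩
    · simp only [hζ]; rw [norm_div, norm_mul]
      refine div_le_one_of_le₀ ?_ (by positivity)
      rw [h4, h2.2]; exact h1
    · simp only [hζ]; field_simp; ring
  choose B hB hBe using fun k => An.zpow1 (An.proj (p := p) (none : Option σ)) (e k)
  have hζR : ζ ∈ Rat' 𝒢 𝔎 t := by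
    refine Rat'.div H.dc ?_ (Rat'.mul H.dc (Rat'.base H.dc (H.dc.const (p : ℚ_[p]))) (Rat'.base H.dc hh'K))
    have := Rat'.add H (Rat'.tau H hγ) (Rat'.base H.dc (H.dc.neg hh'K))
    simpa [sub_eq_add_neg] using this
  refine Ef.ev (H.key_alpha (G := fun y => F fun k => y (some k) * B k y)
    (hF.comp fun k => (An.proj _).mul (hB k)) (x := fun k z => c k z * h' z ^ (e k))
    (fun k => H.dc.mul (hc k) (H.dc.zpow hh'K (e k))) (fun k => ?_) hζR (hh'n.mono fun z hz => hz.2.2.1)) ?_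
  · filter_upwards [hi k, hh'n] with z h1 h2
    rw [hce k, norm_mul, norm_zpow, h2.2.1] at h1
    rwa [norm_mul, norm_zpow]
  · filter_upwards [eventually_all.2 hi, hh'n, hfe] with z h1 h2 h3
    rw [h3]
    unfold anf
    congr 2
    funext k
    refine PadicInt.ext ?_
    have hx : ‖c k z * h' z ^ (e k)‖ ≤ 1 := by
      have := h1 k
      rw [hce k, norm_mul, norm_zpow, h2.2.1] at this
      rwa [norm_mul, norm_zpow]
    rw [trc_coe (h1 k), PadicInt.coe_mul, hBe]
    simp only [oc_none, oc_some, trc_coe hx, trc_coe h2.2.2.1]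
    rw [hce k]
    show c k z * (t z - γ z) ^ e k = _
    conv_lhs => rw [h2.2.2.2, mul_zpow]
    ring

theorem Prep.hull_s (H : Prep 𝒢 𝔎 t) (s : Z → ℚ_[p]) {σ : Type} [Finite σ] (c : σ → Z → ℚ_[p])
    (hc : ∀ k, c k ∈ 𝔎) (n : σ → ℕ) (hi : ∀ k, ∀ᶠ z in 𝒢, ‖c k z * s z ^ n k‖ ≤ 1) :
    ∃ b ∈ 𝔎, (∀ᶠ z in 𝒢, ‖b z * s z‖ ≤ 1) ∧ ∀ k, ∃ x ∈ 𝔎, ∀ᶠ z in 𝒢, ‖x z‖ ≤ 1 ∧ c k z = x z * b z ^ n k := by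
  classical
  have hk : ∀ k, ∃ b ∈ 𝔎, (∀ᶠ z in 𝒢, ‖b z * s z‖ ≤ 1) ∧ ∀ᶠ z in 𝒢, ‖c k z‖ ≤ ‖b z‖ ^ n k := by
    intro k
    rcases Nat.eq_zero_or_pos (n k) with h0 | h0
    · refine ⟨_, H.dc.const 0, by simp, ?_⟩
      filter_upwards [hi k] with z hz
      rw [h0] at hz ⊢; simpa using hz
    rcases H.zero_dec (hc k) with h1 | h1
    · refine ⟨_, H.dc.const 0, by simp, ?_⟩
      filter_upwards [h1] with z hz
      rw [hz, norm_zero]; positivity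
    · obtain ⟨β, hβ, h2⟩ := H.beta (hc k) h0 h1
      refine ⟨_, H.dc.inv hβ, ?_, ?_⟩
      · filter_upwards [h2, hi k] with z hz h3
        have := (hz.2 (s z)).1 h3
        rw [norm_mul, norm_inv]
        exact inv_mul_le_one_of_le₀ this (norm_nonneg _)
      · filter_upwards [h2] with z hz
        have := (hz.2 (β z)).2 le_rfl
        rw [norm_inv, inv_pow, ← norm_pow]
        rw [norm_mul] at this
        have hpos : 0 < ‖β z ^ n k‖ := norm_pos_iff.2 (pow_ne_zero _ hz.1)
        rw [← one_div, le_div_iff₀ hpos]; exact this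
  choose b hb hb1 hb2 using hk
  have := Fintype.ofFinite σ
  rcases isEmpty_or_nonempty σ with hσ | hσ
  · exact ⟨_, H.dc.const 0, by simp, fun k => (hσ.false k).elim⟩
  obtain ⟨k0, _, hk0⟩ := ev_max (𝒢 := 𝒢) (Finset.univ : Finset σ) Finset.univ_nonempty b (fun i _ j _ => by
      rcases H.le _ (hb i) _ (hb j) with h | h
      · exact Or.inl h
      · exact Or.inr (h.mono fun z hz => hz.le))
  refine ⟨b k0, hb k0, hb1 k0, fun k => ⟨_, H.dc.div (hc k) (H.dc.pow (hb k0) (n k)), ?_⟩⟩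
  filter_upwards [hb2 k, hk0 k (Finset.mem_univ _)] with z h1 h2
  have h3 : ‖c k z‖ ≤ ‖b k0 z‖ ^ n k := h1.trans (by gcongr)
  constructor
  · rw [norm_div, norm_pow]; exact div_le_one_of_le₀ h3 (by positivity)
  · by_cases h0 : b k0 z ^ n k = 0
    · rw [← norm_pow, h0, norm_zero] at h3
      rw [norm_le_zero_iff.1 h3]; simp
    · field_simp

theorem Prep.key_sum (H : Prep 𝒢 𝔎 t) {γ : Z → ℚ_[p]} (hγ : γ ∈ 𝔎)
    (hno : ¬ ∃ h ∈ 𝔎, ∀ᶠ z in 𝒢, h z ≠ 0 ∧ ‖t z - γ z‖ = ‖h z‖) {ι : Type} [Fintype ι]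
    (d : ι → Z → ℚ_[p]) (hd : ∀ i, d i ∈ 𝔎) (ε : ι → ℤ) (hε : Function.Injective ε)
    (l : ι → Z → ℚ_[p]) (hl : ∀ i, l i ∈ AG 𝒢 (Rat' 𝒢 𝔎 t)) {f : Z → ℚ_[p]}
    (hf : ∀ᶠ z in 𝒢, f z = ∑ i, d i z * (t z - γ z) ^ ε i * (1 + p * l i z)) : f ∈ Ef 𝒢 𝔎 t := by
  classical
  have hp0 : (p : ℚ_[p]) ≠ 0 := p_ne_zero'
  rcases isEmpty_or_nonempty ι with hσ | hσ
  · refine Ef.zero H ?_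
    filter_upwards [hf] with z hz
    rw [hz]; simp
  set m : ι → Z → ℚ_[p] := fun i z => d i z * (t z - γ z) ^ ε i with hm
  have hmR : ∀ i, m i ∈ Rat' 𝒢 𝔎 t := fun i => Mon.rat H hγ (Mon.mk (hd i) _)
  obtain ⟨k, _, hk⟩ := ev_max (𝒢 := 𝒢) (Finset.univ : Finset ι) Finset.univ_nonempty m (fun i _ j _ => by
      rcases H.mono_le (hd i) (hd j) hγ (ε i) (ε j) with h | h
      · exact Or.inl h
      · exact Or.inr (h.mono fun z hz => hz.le))
  have hk' := eventually_all.2 fun i => hk i (Finset.mem_univ _)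
  rcases H.zero_dec (hd k) with h0 | h0
  · refine Ef.zero H ?_
    filter_upwards [hf, hk', h0] with z h1 h2 h3
    rw [h1]
    refine Finset.sum_eq_zero fun i _ => ?_
    have := h2 i
    change ‖d i z * _‖ ≤ ‖d k z * _‖ at this
    rw [h3, zero_mul, norm_zero] at this
    rw [norm_le_zero_iff.1 this]; ring
  have hlt : ∀ i, i ≠ k → ∀ᶠ z in 𝒢, ‖m i z‖ < ‖m k z‖ := by
    intro i hik
    rcases H.mono_le (hd k) (hd i) hγ (ε k) (ε i) with h | h
    · exfalso
      apply hno
      have heq : ∀ᶠ z in 𝒢, ‖m i z‖ = ‖m k z‖ := by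
        filter_upwards [h, hk'] with z h1 h2; exact le_antisymm (h2 i) h1
      rcases lt_or_gt_of_ne (fun h => hik (hε h) : ε i ≠ ε k) with hlt | hlt
      · refine H.tie (γ := γ) (hd k) (hd i) (n := (ε k - ε i).toNat) (by omega) ?_ ?_
        · filter_upwards [heq, h0, H.tau_ne hγ] with z h1 h2 h3 h4
          change ‖d i z * _‖ = ‖d k z * _‖ at h1
          rw [h4, zero_mul, norm_zero, eq_comm, norm_eq_zero] at h1
          exact mul_ne_zero h2 (zpow_ne_zero _ h3) h1
        · filter_upwards [heq, H.tau_ne hγ] with z h1 h3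
          change ‖d i z * _‖ = ‖d k z * _‖ at h1
          rw [← zpow_natCast, Int.toNat_of_nonneg (by omega), zpow_sub₀ h3]
          rw [norm_mul, norm_mul] at h1
          have : ‖(t z - γ z) ^ ε i‖ ≠ 0 := norm_ne_zero_iff.2 (zpow_ne_zero _ h3)
          rw [norm_mul, norm_div]
          field_simp
          linarith [h1]
      · refine H.tie (γ := γ) (hd i) (hd k) (n := (ε i - ε k).toNat) (by omega) h0 ?_
        · filter_upwards [heq, H.tau_ne hγ] with z h1 h3
          change ‖d i z * _‖ = ‖d k z * _‖ at h1
          rw [← zpow_natCast, Int.toNat_of_nonneg (by omega), zpow_sub₀ h3]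
          rw [norm_mul, norm_mul] at h1
          have : ‖(t z - γ z) ^ ε k‖ ≠ 0 := norm_ne_zero_iff.2 (zpow_ne_zero _ h3)
          rw [norm_mul, norm_div]
          field_simp
          linarith [h1]
    · exact h
  refine ⟨m k, hmR k, fun z => l k z + ∑ i ∈ Finset.univ.erase k, m i z / (p * m k z) * (1 + p * l i z),
    AG.add (hl k) (AG.sum _ fun i hi => AG.mul (AG.of (Rat'.div H.dc (hmR i)
      (Rat'.mul H.dc (Rat'.base H.dc (H.dc.const (p : ℚ_[p]))) (hmR k))) ?_) (AG.one_add (hl i))), ?_⟩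
  · filter_upwards [hlt i (Finset.ne_of_mem_erase hi)] with z hz
    rw [norm_div, norm_mul (p : ℚ_[p])]
    exact div_le_one_of_le₀ ((norm_lt_iff_le_p_mul _ _).1 hz).2 (by positivity)
  · filter_upwards [hf, h0, H.tau_ne hγ] with z h1 h2 h3
    have hmk : m k z ≠ 0 := mul_ne_zero h2 (zpow_ne_zero _ h3)
    rw [h1]
    change ∑ i, m i z * _ = _
    rw [← Finset.add_sum_erase _ _ (Finset.mem_univ k), mul_add (p : ℚ_[p]), Finset.mul_sum, ← add_assoc, mul_add (m k z) (1 + p * l k z), Finset.mul_sum]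
    congr 1
    refine Finset.sum_congr rfl fun i _ => ?_
    field_simp

theorem Prep.key_notie (H : Prep 𝒢 𝔎 t) {γ : Z → ℚ_[p]} (hγ : γ ∈ 𝔎)
    (hno : ¬ ∃ h ∈ 𝔎, ∀ᶠ z in 𝒢, h z ≠ 0 ∧ ‖t z - γ z‖ = ‖h z‖)
    {f : Z → ℚ_[p]} (hf : f ∈ AG 𝒢 (Mon 𝔎 t γ)) :
    f ∈ Ef 𝒢 𝔎 t := by
  classical
  obtain ⟨σ, hσ, F, φ, hF, hφ, hi, hfe⟩ := hf
  choose c hc e hce using hφ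
  set τ : Z → ℚ_[p] := fun z => t z - γ z with hτ
  have hce' : ∀ k z, φ k z = c k z * τ z ^ e k := fun k z => by rw [hce k]
  obtain ⟨b, hb, hb1, hb2⟩ := H.hull_s τ (fun k z => if 0 ≤ e k then c k z else 0)
    (fun k => by by_cases h : 0 ≤ e k <;> simp only [h, if_true, if_false]; exacts [hc k, H.dc.const 0]) (fun k => (e k).toNat)
    (fun k => by
      by_cases h : 0 ≤ e k <;> simp only [h, if_true, if_false]
      · filter_upwards [hi k] with z hz
        rw [hce'] at hz
        rwa [← zpow_natCast, Int.toNat_of_nonneg h]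
      · simp)
  obtain ⟨a, ha, ha1, ha2⟩ := H.hull_s (fun z => (τ z)⁻¹) (fun k z => if 0 ≤ e k then 0 else c k z)
    (fun k => by by_cases h : 0 ≤ e k <;> simp only [h, if_true, if_false]; exacts [H.dc.const 0, hc k]) (fun k => (-e k).toNat)
    (fun k => by
      by_cases h : 0 ≤ e k <;> simp only [h, if_true, if_false]
      · simp
      · filter_upwards [hi k] with z hz
        rw [hce'] at hz
        rwa [← zpow_natCast, Int.toNat_of_nonneg (by omega), inv_zpow', neg_neg])
  choose x1 hx1 hx1' using hb2
  choose x2 hx2 hx2' using ha2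
  set x : σ → Z → ℚ_[p] := fun k => if 0 ≤ e k then x1 k else x2 k with hx
  have hxK : ∀ k, x k ∈ 𝔎 := fun k => by by_cases h : 0 ≤ e k <;> simp only [hx, h, if_true, if_false]; exacts [hx1 k, hx2 k]
  set v : Z → ℚ_[p] := fun z => b z * τ z with hv
  set w : Z → ℚ_[p] := fun z => a z * (τ z)⁻¹ with hw
  have hxp : ∀ k, ∀ᶠ z in 𝒢, ‖x k z‖ ≤ 1 ∧ φ k z = x k z * (v z ^ (e k).toNat * w z ^ (-e k).toNat) := by
    intro k
    by_cases h : 0 ≤ e k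
    · filter_upwards [hx1' k] with z hz
      simp only [h, if_true] at hz
      simp only [hx, h, if_true]
      refine ⟨hz.1, ?_⟩
      rw [hce', hz.2, show (-e k).toNat = 0 by omega, pow_zero, mul_one]
      simp only [hv]
      rw [mul_pow, ← zpow_natCast (τ z), Int.toNat_of_nonneg h]; ring
    · filter_upwards [hx2' k] with z hz
      simp only [h, if_false] at hz
      simp only [hx, h, if_false]
      refine ⟨hz.1, ?_⟩
      rw [hce', hz.2, show (e k).toNat = 0 by omega, pow_zero, one_mul]
      simp only [hw]
      rw [mul_pow, ← zpow_natCast (τ z)⁻¹, Int.toNat_of_nonneg (by omega), inv_zpow', neg_neg]; ring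
  set u : Z → ℚ_[p] := fun z => a z * b z with hu
  have huK : u ∈ 𝔎 := H.dc.mul ha hb
  have hvw : ∀ᶠ z in 𝒢, v z * w z = u z := by
    filter_upwards [H.tau_ne hγ] with z hz
    change τ z ≠ 0 at hz
    simp only [hv, hw, hu]; field_simp
  let G : (Option (Option σ) → ℤ_[p]) → ℤ_[p] := fun y => F fun k => y (some (some k)) * (y none ^ (e k).toNat * y (some none) ^ (-e k).toNat)
  have hG : An G := hF.comp fun k => (An.proj _).mul (((An.proj _).pow _).mul ((An.proj _).pow _))
  obtain ⟨H1, H2, hH1, hH2, hsp⟩ := hG.split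
  obtain ⟨N1, A1, L1, hA1, hL1, e1⟩ := hH1.coef
  obtain ⟨N2, A2, L2, hA2, hL2, e2⟩ := hH2.coef
  set y : Option σ → Z → ℚ_[p] := oc u x with hy
  have hyK : ∀ k, y k ∈ 𝔎 := by rintro (_ | k); exacts [huK, hxK k]
  have hyi : ∀ k, ∀ᶠ z in 𝒢, ‖y k z‖ ≤ 1 := by
    rintro (_ | k)
    · filter_upwards [hvw, hb1, ha1] with z h1 h2 h3
      change ‖u z‖ ≤ 1
      rw [← h1, norm_mul]; exact mul_le_one₀ h2 (norm_nonneg _) h3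
    · exact (hxp k).mono fun z hz => hz.1
  choose B1 hB1 hBe1 using fun j => H.an_base (hA1 j) hyK hyi
  choose B2 hB2 hBe2 using fun j => H.an_base (hA2 j) hyK hyi
  have hvR : v ∈ AG 𝒢 (Rat' 𝒢 𝔎 t) := AG.of (Rat'.mul H.dc (Rat'.base H.dc hb) (Rat'.tau H hγ)) hb1
  have hwR : w ∈ AG 𝒢 (Rat' 𝒢 𝔎 t) := AG.of (Rat'.mul H.dc (Rat'.base H.dc ha) (Rat'.inv (Rat'.tau H hγ))) ha1
  have hyR : ∀ k, y k ∈ AG 𝒢 (Rat' 𝒢 𝔎 t) := fun k => AG.of (Rat'.base H.dc (hyK k)) (hyi k)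
  refine H.key_sum hγ hno (ι := Fin N1 ⊕ Fin N2)
    (Sum.elim (fun j z => B1 j z * b z ^ (j : ℕ)) (fun j z => B2 j z * a z ^ ((j : ℕ) + 1))) ?_
    (Sum.elim (fun j => (j : ℕ)) (fun j => -((j : ℕ) + 1 : ℤ))) ?_
    (Sum.elim (fun j => anf (L1 j) (oc v y)) (fun j => anf (L2 j) (oc w y))) ?_ ?_
  · rintro (j | j)
    · exact H.dc.mul (hB1 j) (H.dc.pow hb _)
    · exact H.dc.mul (hB2 j) (H.dc.pow ha _)
  · rintro (i | i) (j | j) hij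
    · simp only [Sum.elim_inl] at hij; congr 1; ext; omega
    · simp only [Sum.elim_inl, Sum.elim_inr] at hij; omega
    · simp only [Sum.elim_inl, Sum.elim_inr] at hij; omega
    · simp only [Sum.elim_inr] at hij; congr 1; ext; omega
  · rintro (j | j)
    · exact AG.comp (hL1 j) (by rintro (_ | k); exacts [hvR, hyR k])
    · exact AG.comp (hL2 j) (by rintro (_ | k); exacts [hwR, hyR k])
  · filter_upwards [hfe, eventually_all.2 hxp, eventually_all.2 hi, hvw, hb1, ha1, eventually_all.2 hyi, H.tau_ne hγ,
      eventually_all.2 fun j : Fin N1 => hBe1 j, eventually_all.2 fun j : Fin N2 => hBe2 j] with z h1 h2 h3 h4 h5 h6 h7 h8 h9 h10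
    change ‖v z‖ ≤ 1 at h5
    change ‖w z‖ ≤ 1 at h6
    have hyz : oc (trc (v z) * trc (w z)) (fun k => trc (x k z)) = fun k => trc (y k z) := by
      funext k
      cases k with
      | none =>
        refine PadicInt.ext ?_
        simp only [oc_none, PadicInt.coe_mul]
        rw [trc_coe h5, trc_coe h6, trc_coe (h7 none), h4]; rfl
      | some k => rfl
    have hG1 : f z = ((G (oc (trc (v z)) (oc (trc (w z)) fun k => trc (x k z))) : ℤ_[p]) : ℚ_[p]) := by
      rw [h1]
      unfold anf
      simp only [G]
      congr 2
      funext k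
      refine PadicInt.ext ?_
      simp only [oc_none, oc_some, PadicInt.coe_mul, PadicInt.coe_pow]
      rw [trc_coe (h3 k), trc_coe h5, trc_coe h6, trc_coe (h2 k).1, (h2 k).2]
    rw [hG1, hsp, hyz, e1, e2]
    simp only [PadicInt.coe_mul, PadicInt.coe_add, PadicInt.coe_one, PadicInt.coe_natCast, PadicInt.coe_pow, coe_sum', trc_coe h5, trc_coe h6]
    rw [Fintype.sum_sum_type, Finset.sum_range, Finset.sum_range, Finset.mul_sum]
    congr 1
    · refine Finset.sum_congr rfl fun j _ => ?_
      simp only [Sum.elim_inl]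
      rw [h9 j, zpow_natCast]
      unfold anf
      rw [oc_trc v y z]
      generalize L1 (j : ℕ) _ = q
      simp only [hv, hτ, mul_pow]; ring
    · refine Finset.sum_congr rfl fun j _ => ?_
      simp only [Sum.elim_inr]
      rw [h10 j]
      unfold anf
      rw [oc_trc w y z]
      generalize L2 (j : ℕ) _ = q
      have : (t z - γ z) ^ (-((j : ℕ) + 1 : ℤ)) = ((τ z)⁻¹) ^ ((j : ℕ) + 1) := by
        rw [zpow_neg, inv_pow]; norm_cast
      rw [this]
      simp only [hw, mul_pow]; ring

theorem Prep.key (H : Prep 𝒢 𝔎 t) {f : Z → ℚ_[p]} (hf : f ∈ AG 𝒢 (Rat' 𝒢 𝔎 t)) : f ∈ Ef 𝒢 𝔎 t := by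
  obtain ⟨σ, hσ, F, φ, hF, hφ, hi, hfe⟩ := hf
  obtain ⟨γ, hγ, h⟩ := H.rat_mon φ hφ hi
  have hf' : f ∈ AG 𝒢 (Mon 𝔎 t γ) := AG.ev (AG.comp hF h) hfe
  by_cases hno : ∃ h ∈ 𝔎, ∀ᶠ z in 𝒢, h z ≠ 0 ∧ ‖t z - γ z‖ = ‖h z‖
  · obtain ⟨h, hh, he⟩ := hno
    exact H.key_tie hγ hh he hf'
  · exact H.key_notie hγ hno hf'

end KEY2

end PadicSub

namespace PadicSub
section EfClosed
variable {p : ℕ} [hp : Fact p.Prime] {Z : Type*}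
variable {𝒢 : Filter Z} {𝔎 : Set (Z → ℚ_[p])} {t : Z → ℚ_[p]}

theorem Ef.rat {f : Z → ℚ_[p]} (hf : f ∈ Rat' 𝒢 𝔎 t) : f ∈ Ef 𝒢 𝔎 t :=
  ⟨f, hf, fun _ => 0, AG.zero, Eventually.of_forall fun z => by simp⟩

theorem Ef.mul (H : Prep 𝒢 𝔎 t) {f g : Z → ℚ_[p]} (hf : f ∈ Ef 𝒢 𝔎 t) (hg : g ∈ Ef 𝒢 𝔎 t) :
    (fun z => f z * g z) ∈ Ef 𝒢 𝔎 t := by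
  obtain ⟨R, hR, u, hu, h⟩ := hf
  obtain ⟨R', hR', u', hu', h'⟩ := hg
  refine ⟨_, Rat'.mul H.dc hR hR', _, AG.add hu (AG.mul hu' (AG.one_add hu)), ?_⟩
  filter_upwards [h, h'] with z h1 h2
  rw [h1, h2]; ring

theorem Ef.inv {f : Z → ℚ_[p]} (hf : f ∈ Ef 𝒢 𝔎 t) :
    (fun z => (f z)⁻¹) ∈ Ef 𝒢 𝔎 t := by
  obtain ⟨R, hR, u, hu, h⟩ := hf
  obtain ⟨g, hg, hg1⟩ := AG.inv1 hu
  refine ⟨_, Rat'.inv hR, g, hg, ?_⟩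
  filter_upwards [h, hg1] with z h1 h2
  rw [h1, mul_inv]
  congr 1
  exact inv_eq_of_mul_eq_one_right h2

theorem Ef.add_aux (H : Prep 𝒢 𝔎 t) {f g R R' u u' : Z → ℚ_[p]} (hR : R ∈ Rat' 𝒢 𝔎 t)
    (hR' : R' ∈ Rat' 𝒢 𝔎 t) (hu : u ∈ AG 𝒢 (Rat' 𝒢 𝔎 t)) (hu' : u' ∈ AG 𝒢 (Rat' 𝒢 𝔎 t))
    (h : ∀ᶠ z in 𝒢, f z = R z * (1 + p * u z)) (h' : ∀ᶠ z in 𝒢, g z = R' z * (1 + p * u' z))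
    (hle : ∀ᶠ z in 𝒢, ‖R z‖ ≤ ‖R' z‖) : (fun z => f z + g z) ∈ Ef 𝒢 𝔎 t := by
  have hq : (fun z => R z / R' z) ∈ AG 𝒢 (Rat' 𝒢 𝔎 t) := by
    refine AG.of (Rat'.div H.dc hR hR') ?_
    filter_upwards [hle] with z hz
    rw [norm_div]; exact div_le_one_of_le₀ hz (norm_nonneg _)
  have hk := H.key (AG.add (AG.mul hq (AG.one_add hu)) (AG.one_add hu'))
  refine Ef.ev (Ef.mul H (Ef.rat hR') hk) ?_
  filter_upwards [h, h', hle] with z h1 h2 h3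
  rw [h1, h2]
  by_cases h0 : R' z = 0
  · rw [h0, norm_zero] at h3
    rw [h0, norm_le_zero_iff.1 h3]; ring
  · field_simp

theorem Ef.add (H : Prep 𝒢 𝔎 t) {f g : Z → ℚ_[p]} (hf : f ∈ Ef 𝒢 𝔎 t) (hg : g ∈ Ef 𝒢 𝔎 t) :
    (fun z => f z + g z) ∈ Ef 𝒢 𝔎 t := by
  obtain ⟨R, hR, u, hu, h⟩ := hf
  obtain ⟨R', hR', u', hu', h'⟩ := hg
  rcases H.rat_le hR hR' with hl | hl
  · exact Ef.add_aux H hR hR' hu hu' h h' hl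
  · refine Ef.ev (Ef.add_aux H hR' hR hu' hu h' h (hl.mono fun z hz => hz.le)) ?_
    exact Eventually.of_forall fun z => add_comm _ _

theorem Ef.norm {f R u : Z → ℚ_[p]} (hu : u ∈ AG 𝒢 (Rat' 𝒢 𝔎 t))
    (h : ∀ᶠ z in 𝒢, f z = R z * (1 + p * u z)) : ∀ᶠ z in 𝒢, ‖f z‖ = ‖R z‖ := by
  filter_upwards [h, AG.norm hu] with z h1 h2
  rw [h1, norm_mul, norm_one_add_p h2, mul_one]

theorem Ef.int (H : Prep 𝒢 𝔎 t) {f : Z → ℚ_[p]} (hf : f ∈ Ef 𝒢 𝔎 t) :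
    (∀ᶠ z in 𝒢, ‖f z‖ ≤ 1) ∨ (∀ᶠ z in 𝒢, ¬ ‖f z‖ ≤ 1) := by
  obtain ⟨R, hR, u, hu, h⟩ := hf
  have hn := Ef.norm hu h
  rcases H.rat_le hR (Rat'.base H.dc (H.dc.const 1)) with hl | hl
  · left; filter_upwards [hn, hl] with z h1 h2
    rw [h1]; simpa using h2
  · right; filter_upwards [hn, hl] with z h1 h2
    rw [h1, not_le]; simpa using h2

theorem Ef.ag (H : Prep 𝒢 𝔎 t) {f : Z → ℚ_[p]} (hf : f ∈ Ef 𝒢 𝔎 t) (hi : ∀ᶠ z in 𝒢, ‖f z‖ ≤ 1) :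
    f ∈ AG 𝒢 (Rat' 𝒢 𝔎 t) := by
  obtain ⟨R, hR, u, hu, h⟩ := hf
  refine AG.ev (AG.mul (AG.of hR ?_) (AG.one_add hu)) h
  filter_upwards [Ef.norm hu h, hi] with z h1 h2
  rwa [← h1]

theorem Ef.dclosed (H : Prep 𝒢 𝔎 t) : DClosed (Ef 𝒢 𝔎 t) := by
  refine DClosed.of_ev (𝒢 := 𝒢) (fun f g hf h => Ef.ev hf (h.mono fun z hz => hz.symm))
    (fun c => Ef.rat (Rat'.base H.dc (H.dc.const c))) (fun f g hf hg => Ef.add H hf hg)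
    (fun f g hf hg => Ef.mul H hf hg) (fun f hf => Ef.inv hf) (fun f hf => Ef.int H hf) ?_
  intro n F hF φ hφ hi
  exact H.key (AG.comp hF fun i => Ef.ag H (hφ i) (hi i))

theorem Prep.dcl_ef (H : Prep 𝒢 𝔎 t) {f : Z → ℚ_[p]} (hf : Dcl (𝔎 ∪ {t}) f) : f ∈ Ef 𝒢 𝔎 t := by
  refine (Ef.dclosed H).mono_Dcl ?_ hf
  rintro g (hg | rfl)
  · exact Ef.rat (Rat'.base H.dc hg)
  · exact Ef.rat (Rat'.self H.dc)

/-- The preparation theorem along a filter. -/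
theorem Prep.main (H : Prep 𝒢 𝔎 t) {ι : Type*} [Finite ι] (f : ι → Z → ℚ_[p])
    (hf : ∀ i, Dcl (𝔎 ∪ {t}) (f i)) {M : ℕ} (hM : 1 ≤ M) : ∃ γ ∈ 𝔎, ∀ i, ∃ δ ∈ 𝔎, ∃ a : ℤ,
      ∀ᶠ z in 𝒢, Cl M (f i z) (δ z * (t z - γ z) ^ a) := by
  have := H.nb
  have hp0 : (p : ℚ_[p]) ≠ 0 := p_ne_zero'
  have key : ∀ i, ∃ R ∈ Rat' 𝒢 𝔎 t, ∀ᶠ z in 𝒢, Cl M (f i z) (R z) := by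
    intro i
    have hfE := H.dcl_ef (hf i)
    obtain ⟨R, hR, u, hu, h⟩ := H.dcl_ef (hf i)
    rcases H.rat_zero hR with h0 | h0
    · refine ⟨R, hR, ?_⟩
      filter_upwards [h, h0] with z h1 h2
      rw [h1, h2, zero_mul]; exact Cl.refl _ _
    obtain ⟨ξ, _, hξ⟩ := ev_choose (𝒢 := 𝒢) (Finset.range (p ^ M))
      (fun ξ z => ‖(f i z - ξ * R z) / (p ^ M * R z)‖ ≤ 1) (fun ξ _ => by
        refine Ef.int H ?_
        have d := Ef.dclosed H
        exact d.div (d.sub hfE (d.mul (d.const _) (Ef.rat hR))) (d.mul (d.const _) (Ef.rat hR))) (by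
        filter_upwards [h, h0, AG.norm hu] with z h1 h2 h3
        obtain ⟨j, hj, hj'⟩ := exists_nat_near (p := p) M (1 + p * u z) (norm_one_add_p h3).le
        refine ⟨j, Finset.mem_range.2 hj, ?_⟩
        rw [h1, show (R z * (1 + p * u z) - j * R z) / (p ^ M * R z) = (1 + p * u z - j) / p ^ M by field_simp,
          norm_div, norm_pow]
        exact div_le_one_of_le₀ hj' (by positivity))
    refine ⟨fun z => ξ * R z, Rat'.mul H.dc (Rat'.base H.dc (H.dc.const _)) hR, ?_⟩
    filter_upwards [hξ, h, h0, AG.norm hu] with z h1 h2 h3 h4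
    have hR0 : 0 < ‖R z‖ := norm_pos_iff.2 h3
    rw [norm_div, norm_mul, norm_pow, div_le_one (by have := p_pow_pos (p := p) M; positivity)] at h1
    have hfn : ‖f i z‖ = ‖R z‖ := by rw [h2, norm_mul, norm_one_add_p h4, mul_one]
    have hlt : ‖f i z - ξ * R z‖ < ‖f i z‖ := by
      rw [hfn]
      refine h1.trans_lt ?_
      have : ‖(p : ℚ_[p])‖ ^ M < 1 := pow_lt_one₀ (norm_nonneg _) norm_p_lt_one' (by omega)
      nlinarith
    have hn := nsub_eq (p := p) hlt
    rw [sub_sub_cancel] at hn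
    unfold Cl
    rw [hn, hfn]; exact h1
  choose R hR hRe using key
  obtain ⟨γ, hγ, h⟩ := H.rat_prep R hR hM
  refine ⟨γ, hγ, fun i => ?_⟩
  obtain ⟨δ, hδ, a, ha⟩ := h i
  refine ⟨δ, hδ, a, ?_⟩
  filter_upwards [ha, hRe i] with z h1 h2
  exact Cl.trans hM h2 h1

end EfClosed
end PadicSub

namespace PadicSub
section Tame
variable {p : ℕ} [hp : Fact p.Prime] {m : ℕ}

def prj (z : Fin (m + 1) → ℚ_[p]) : Fin m → ℚ_[p] := fun i => z i.castSucc
def lst (z : Fin (m + 1) → ℚ_[p]) : ℚ_[p] := z (Fin.last m)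

structure Agr (Γ B : Finset ((Fin m → ℚ_[p]) → ℚ_[p])) (W : Finset (Set (Fin m → ℚ_[p]))) (N : ℕ)
    (z z' : Fin (m + 1) → ℚ_[p]) : Prop where
  x : ∀ S ∈ W, prj z ∈ S ↔ prj z' ∈ S
  c : ∀ γ ∈ Γ, lst z' - γ (prj z') ∈ cosetP p (lst z - γ (prj z)) N
  l : ∀ γ ∈ Γ, ∀ b ∈ B, ‖lst z - γ (prj z)‖ ≤ ‖b (prj z)‖ ↔ ‖lst z' - γ (prj z')‖ ≤ ‖b (prj z')‖

structure TameD (Γ B : Finset ((Fin m → ℚ_[p]) → ℚ_[p])) (W : Finset (Set (Fin m → ℚ_[p]))) : Prop where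
  c : ∀ γ ∈ Γ, IsDP γ
  b : ∀ b ∈ B, IsDP b
  x : ∀ S ∈ W, IsSubanalytic p S

def Dec (Γ B : Finset ((Fin m → ℚ_[p]) → ℚ_[p])) (W : Finset (Set (Fin m → ℚ_[p]))) (N : ℕ)
    (I : Set (Fin (m + 1) → ℚ_[p])) : Prop := ∀ z z', Agr Γ B W N z z' → z ∈ I → z' ∈ I

def Tame (I : Set (Fin (m + 1) → ℚ_[p])) : Prop :=
  ∃ Γ B W N, 0 < N ∧ TameD Γ B W ∧ Dec Γ B W N I

variable {Γ Γ' B B' : Finset ((Fin m → ℚ_[p]) → ℚ_[p])} {W W' : Finset (Set (Fin m → ℚ_[p]))} {N N' : ℕ}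
  {I J : Set (Fin (m + 1) → ℚ_[p])}

theorem Agr.symm {z z' : Fin (m + 1) → ℚ_[p]} (h : Agr Γ B W N z z') : Agr Γ B W N z' z :=
  ⟨fun S hS => (h.x S hS).symm, fun γ hγ => cosetP_symm (h.c γ hγ), fun γ hγ b hb => (h.l γ hγ b hb).symm⟩

theorem Agr.mono {z z' : Fin (m + 1) → ℚ_[p]} (h : Agr Γ B W N z z') (h1 : Γ' ⊆ Γ) (h2 : B' ⊆ B)
    (h3 : W' ⊆ W) (h4 : N' ∣ N) : Agr Γ' B' W' N' z z' :=
  ⟨fun S hS => h.x S (h3 hS), fun γ hγ => cosetP_dvd h4 (h.c γ (h1 hγ)),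
    fun γ hγ b hb => h.l γ (h1 hγ) b (h2 hb)⟩

theorem Dec.mono (h : Dec Γ' B' W' N' I) (h1 : Γ' ⊆ Γ) (h2 : B' ⊆ B)
    (h3 : W' ⊆ W) (h4 : N' ∣ N) : Dec Γ B W N I := fun z z' hz => h z z' (hz.mono h1 h2 h3 h4)

theorem Dec.compl (h : Dec Γ B W N I) : Dec Γ B W N Iᶜ := fun z z' hz h1 h2 => h1 (h z' z hz.symm h2)

theorem Dec.inter (h : Dec Γ B W N I) (h' : Dec Γ B W N J) : Dec Γ B W N (I ∩ J) :=
  fun z z' hz h1 => ⟨h z z' hz h1.1, h' z z' hz h1.2⟩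

theorem Tame.common (s : Finset (Set (Fin (m + 1) → ℚ_[p]))) (h : ∀ I ∈ s, Tame I) :
    ∃ Γ B W N, 0 < N ∧ TameD Γ B W ∧ ∀ I ∈ s, Dec Γ B W N I := by
  classical
  induction s using Finset.induction_on with
  | empty => exact ⟨∅, ∅, ∅, 1, one_pos, ⟨by simp, by simp, by simp⟩, by simp⟩
  | insert a s ha ih =>
    obtain ⟨Γ, B, W, N, hN, hT, hD⟩ := ih fun I hI => h I (Finset.mem_insert_of_mem hI)
    obtain ⟨Γ', B', W', N', hN', hT', hD'⟩ := h a (Finset.mem_insert_self _ _)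
    refine ⟨Γ ∪ Γ', B ∪ B', W ∪ W', N * N', Nat.mul_pos hN hN', ⟨?_, ?_, ?_⟩, ?_⟩
    · intro γ hγ; rcases Finset.mem_union.1 hγ with h | h
      exacts [hT.c _ h, hT'.c _ h]
    · intro γ hγ; rcases Finset.mem_union.1 hγ with h | h
      exacts [hT.b _ h, hT'.b _ h]
    · intro γ hγ; rcases Finset.mem_union.1 hγ with h | h
      exacts [hT.x _ h, hT'.x _ h]
    · intro I hI
      rcases Finset.mem_insert.1 hI with rfl | hI
      · exact hD'.mono Finset.subset_union_right Finset.subset_union_right Finset.subset_union_right (Nat.dvd_mul_left _ _)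
      · exact (hD I hI).mono Finset.subset_union_left Finset.subset_union_left Finset.subset_union_left (Nat.dvd_mul_right _ _)

theorem Tame.compl (h : Tame I) : Tame Iᶜ := by
  obtain ⟨Γ, B, W, N, h1, h2, h3⟩ := h
  exact ⟨Γ, B, W, N, h1, h2, h3.compl⟩

theorem Tame.inter (h : Tame I) (h' : Tame J) : Tame (I ∩ J) := by
  classical
  obtain ⟨Γ, B, W, N, h1, h2, h3⟩ := Tame.common {I, J} (by
    intro K hK; rcases Finset.mem_insert.1 hK with rfl | hK
    · exact h
    · rw [Finset.mem_singleton.1 hK]; exact h')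
  exact ⟨Γ, B, W, N, h1, h2, (h3 I (by simp)).inter (h3 J (by simp))⟩

theorem Tame.union (h : Tame I) (h' : Tame J) : Tame (I ∪ J) := by
  have := (h.compl.inter h'.compl).compl
  rwa [← Set.compl_union, compl_compl] at this

theorem tame_univ : Tame (p := p) (Set.univ : Set (Fin (m + 1) → ℚ_[p])) :=
  ⟨∅, ∅, ∅, 1, one_pos, ⟨by simp, by simp, by simp⟩, fun _ _ _ _ => trivial⟩

theorem Tame.biUnion (s : Finset (Set (Fin (m + 1) → ℚ_[p]))) (h : ∀ I ∈ s, Tame I) : Tame (⋃ I ∈ s, I) := by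
  obtain ⟨Γ, B, W, N, h1, h2, h3⟩ := Tame.common s h
  refine ⟨Γ, B, W, N, h1, h2, fun z z' hz hI => ?_⟩
  simp only [Set.mem_iUnion] at hI ⊢
  obtain ⟨I, hI, hzI⟩ := hI
  exact ⟨I, hI, h3 I hI z z' hz hzI⟩

theorem tame_x {S : Set (Fin m → ℚ_[p])} (h : IsSubanalytic p S) : Tame {z : Fin (m + 1) → ℚ_[p] | prj z ∈ S} :=
  ⟨∅, ∅, {S}, 1, one_pos, ⟨by simp, by simp, by simpa using h⟩, fun _ _ hz h1 => (hz.x S (by simp)).1 h1⟩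

theorem tame_c {γ : (Fin m → ℚ_[p]) → ℚ_[p]} (h : IsDP γ) (μ : ℚ_[p]) {N : ℕ} (hN : 0 < N) :
    Tame {z : Fin (m + 1) → ℚ_[p] | lst z - γ (prj z) ∈ cosetP p μ N} :=
  ⟨{γ}, ∅, ∅, N, hN, ⟨by simpa using h, by simp, by simp⟩,
    fun _ _ hz h1 => cosetP_trans (hz.c γ (by simp)) h1⟩

theorem tame_l {γ b : (Fin m → ℚ_[p]) → ℚ_[p]} (h : IsDP γ) (hb : IsDP b) :
    Tame {z : Fin (m + 1) → ℚ_[p] | ‖lst z - γ (prj z)‖ ≤ ‖b (prj z)‖} :=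
  ⟨{γ}, {b}, ∅, 1, one_pos, ⟨by simpa using h, by simpa using hb, by simp⟩,
    fun _ _ hz h1 => (hz.l γ (by simp) b (by simp)).1 h1⟩

def tameF (𝒰 : Ultrafilter (Fin (m + 1) → ℚ_[p])) : Filter (Fin (m + 1) → ℚ_[p]) where
  sets := {A | ∃ I ∈ 𝒰, Tame I ∧ I ⊆ A}
  univ_sets := ⟨Set.univ, Filter.univ_mem, tame_univ, subset_rfl⟩
  sets_of_superset := by
    rintro A C ⟨I, h1, h2, h3⟩ hAC
    exact ⟨I, h1, h2, h3.trans hAC⟩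
  inter_sets := by
    rintro A C ⟨I, h1, h2, h3⟩ ⟨J, h4, h5, h6⟩
    exact ⟨I ∩ J, Filter.inter_mem h1 h4, h2.inter h5, Set.inter_subset_inter h3 h6⟩

theorem mem_tameF {𝒰 : Ultrafilter (Fin (m + 1) → ℚ_[p])} {A : Set (Fin (m + 1) → ℚ_[p])} :
    A ∈ tameF 𝒰 ↔ ∃ I ∈ 𝒰, Tame I ∧ I ⊆ A := Iff.rfl

theorem tameF_nb (𝒰 : Ultrafilter (Fin (m + 1) → ℚ_[p])) : (tameF 𝒰).NeBot := by
  refine Filter.neBot_iff.2 fun h => ?_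
  have : (∅ : Set (Fin (m + 1) → ℚ_[p])) ∈ tameF 𝒰 := by rw [h]; trivial
  obtain ⟨I, h1, _, h3⟩ := mem_tameF.1 this
  exact 𝒰.empty_notMem (Filter.mem_of_superset h1 h3)

theorem Tame.dec (h : Tame I) (𝒰 : Ultrafilter (Fin (m + 1) → ℚ_[p])) :
    (∀ᶠ z in tameF 𝒰, z ∈ I) ∨ (∀ᶠ z in tameF 𝒰, z ∉ I) := by
  rcases 𝒰.mem_or_compl_mem I with h1 | h1
  · exact Or.inl (mem_tameF.2 ⟨I, h1, h, subset_rfl⟩)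
  · exact Or.inr (mem_tameF.2 ⟨Iᶜ, h1, h.compl, subset_rfl⟩)

variable (p m) in
def baseK : Set ((Fin (m + 1) → ℚ_[p]) → ℚ_[p]) := {f | ∃ g, IsDP g ∧ f = fun z => g (prj z)}

theorem baseK_dc : DClosed (baseK p m) := by
  constructor
  intro n F hF g hg
  choose h hh hhe using hg
  refine ⟨fun x => F fun i => h i x, (dclosed_DP m).comp F hF h hh, ?_⟩
  funext z
  congr 1; funext i; rw [hhe i]

theorem tame_prep (𝒰 : Ultrafilter (Fin (m + 1) → ℚ_[p]))
    (hnt : ∀ γ : (Fin m → ℚ_[p]) → ℚ_[p], IsDP γ → ∀ᶠ z in tameF 𝒰, lst z ≠ γ (prj z)) :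
    Prep (tameF 𝒰) (baseK p m) lst where
  dc := baseK_dc
  le := by
    rintro _ ⟨b, hb, rfl⟩ _ ⟨c, hc, rfl⟩
    rcases (tame_x (hb.le hc)).dec 𝒰 with h | h
    · exact Or.inl h
    · exact Or.inr (h.mono fun z hz => not_le.1 hz)
  dist := by
    rintro _ ⟨γ, hγ, rfl⟩ _ ⟨b, hb, rfl⟩
    rcases (tame_l hγ hb).dec 𝒰 with h | h
    · exact Or.inl h
    · exact Or.inr (h.mono fun z hz => not_le.1 hz)
  root := by
    rintro _ ⟨c, hc, rfl⟩ n hn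
    obtain ⟨S, hS, hSs, h⟩ := IsDP.exists_root hn hc (𝒰.map prj)
    have hS' : ∀ᶠ z in tameF 𝒰, prj z ∈ S := mem_tameF.2 ⟨_, hS, tame_x hSs, subset_rfl⟩
    rcases h with h | ⟨l, y, hl, hy, h⟩
    · exact Or.inl (hS'.mono fun z hz => h _ hz)
    · exact Or.inr ⟨l, hl, _, ⟨y, hy, rfl⟩, hS'.mono fun z hz => h _ hz⟩
  nt := by
    rintro _ ⟨γ, hγ, rfl⟩
    exact hnt γ hγ
  nb := tameF_nb 𝒰

theorem dfun_dcl {f : (Fin (m + 1) → ℚ_[p]) → ℚ_[p]} (hf : IsDFunction p f) : Dcl (baseK p m ∪ {lst}) f := by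
  refine Dcl.comp f hf (fun (i : Fin (m + 1)) (z : Fin (m + 1) → ℚ_[p]) => z i) fun i => ?_
  induction i using Fin.lastCases with
  | last => exact Dcl.base _ (Or.inr rfl)
  | cast i => exact Dcl.base _ (Or.inl ⟨fun x => x i, .base _ (.proj i), rfl⟩)

/-- Preparation of finitely many `D`-functions at an ultrafilter. -/
theorem tame_main (𝒰 : Ultrafilter (Fin (m + 1) → ℚ_[p])) {ι : Type*} [Finite ι]
    (f : ι → (Fin (m + 1) → ℚ_[p]) → ℚ_[p]) (hf : ∀ i, IsDFunction p (f i)) {M : ℕ} (hM : 1 ≤ M) :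
    ∃ γ : (Fin m → ℚ_[p]) → ℚ_[p], IsDP γ ∧ ∀ i, ∃ δ : (Fin m → ℚ_[p]) → ℚ_[p], IsDP δ ∧ ∃ a : ℤ,
      ∀ᶠ z in tameF 𝒰, Cl M (f i z) (δ (prj z) * (lst z - γ (prj z)) ^ a) := by
  by_cases hnt : ∀ γ : (Fin m → ℚ_[p]) → ℚ_[p], IsDP γ → ∀ᶠ z in tameF 𝒰, lst z ≠ γ (prj z)
  · obtain ⟨γ', ⟨γ, hγ, rfl⟩, h⟩ := (tame_prep 𝒰 hnt).main f (fun i => dfun_dcl (hf i)) hM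
    refine ⟨γ, hγ, fun i => ?_⟩
    obtain ⟨δ', ⟨δ, hδ, rfl⟩, a, ha⟩ := h i
    exact ⟨δ, hδ, a, ha⟩
  · push Not at hnt
    obtain ⟨γ, hγ, h⟩ := hnt
    have h1 : ∀ᶠ z in tameF 𝒰, lst z = γ (prj z) := by
      rcases (tame_c hγ 0 one_pos).dec 𝒰 with h2 | h2
      · exact h2.mono fun z hz => sub_eq_zero.1 (mem_cosetP_zero.1 hz)
      · exfalso
        apply h
        filter_upwards [h2] with z hz h3
        exact hz (mem_cosetP_zero.2 (sub_eq_zero.2 h3))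
    have hE : DClosed (Evc (tameF 𝒰) (baseK p m)) := Evc.dclosed _ baseK_dc
    refine ⟨γ, hγ, fun i => ?_⟩
    have h2 : f i ∈ Evc (tameF 𝒰) (baseK p m) := by
      refine hE.mono_Dcl ?_ (dfun_dcl (hf i))
      rintro g (hg | rfl)
      · exact Evc.subset _ _ hg
      · exact ⟨_, ⟨γ, hγ, rfl⟩, h1⟩
    obtain ⟨_, ⟨δ, hδ, rfl⟩, h3⟩ := h2
    refine ⟨δ, hδ, 0, ?_⟩
    filter_upwards [h3] with z hz
    rw [hz, zpow_zero, mul_one]; exact Cl.refl _ _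

end Tame
end PadicSub

namespace PadicSub
section Tame2
variable {p : ℕ} [hp : Fact p.Prime] {m : ℕ}

/-- A set decided by finitely many subanalytic tests is subanalytic. -/
theorem sub_of_det (T : Finset (Set (Fin m → ℚ_[p]))) (hT : ∀ S ∈ T, IsSubanalytic p S)
    (A : Set (Fin m → ℚ_[p])) (h : ∀ x x', (∀ S ∈ T, x ∈ S ↔ x' ∈ S) → x ∈ A → x' ∈ A) :
    IsSubanalytic p A := by
  apply subanalytic_of_decided
  intro 𝒰
  classical
  let F : Set (Fin m → ℚ_[p]) → Set (Fin m → ℚ_[p]) := fun S => if S ∈ 𝒰 then S else Sᶜ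
  have hF : ∀ S, F S ∈ 𝒰 := by
    intro S
    by_cases hS : S ∈ 𝒰
    · simp only [F, if_pos hS]; exact hS
    · simp only [F, if_neg hS]; exact Ultrafilter.compl_mem_iff_notMem.2 hS
  have hI : (⋂ S ∈ T, F S) ∈ 𝒰 := (Filter.biInter_finset_mem T).2 fun S _ => hF S
  refine ⟨_, hI, IsSubanalytic.biInter T F fun S hS => ?_, ?_⟩
  · by_cases h1 : S ∈ 𝒰
    · simp only [F, if_pos h1]; exact hT S hS
    · simp only [F, if_neg h1]; exact (hT S hS).compl
  · by_cases h1 : ∃ x ∈ ⋂ S ∈ T, F S, x ∈ A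
    · obtain ⟨x, hx, hxA⟩ := h1
      left
      intro x' hx'
      refine h x x' (fun S hS => ?_) hxA
      have a1 := Set.mem_iInter₂.1 hx S hS
      have a2 := Set.mem_iInter₂.1 hx' S hS
      by_cases h1 : S ∈ 𝒰
      · simp only [F, if_pos h1] at a1 a2; exact ⟨fun _ => a2, fun _ => a1⟩
      · simp only [F, if_neg h1] at a1 a2; exact ⟨fun h => absurd h a1, fun h => absurd h a2⟩
    · right
      intro x hx hxA
      exact h1 ⟨x, hx, hxA⟩

theorem cl_coset {n M : ℕ} (hM : ∀ x : ℚ_[p], ‖x - 1‖ ≤ ‖(p : ℚ_[p])‖ ^ M → x ∈ Pset p n) {a b : ℚ_[p]}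
    (h : Cl M a b) : a ∈ cosetP p b n := by
  by_cases hb : b = 0
  · subst hb
    have : ‖a - 0‖ ≤ ‖(p : ℚ_[p])‖ ^ M * ‖(0 : ℚ_[p])‖ := h
    rw [norm_zero, mul_zero, sub_zero, norm_le_zero_iff] at this
    exact mem_cosetP_zero.2 this
  · refine (mem_cosetP_iff hb).2 (hM _ ?_)
    have h : ‖a - b‖ ≤ ‖(p : ℚ_[p])‖ ^ M * ‖b‖ := h
    rw [div_sub_one hb, norm_div, div_le_iff₀ (norm_pos_iff.2 hb)]
    exact h

theorem exists_near_one_pow' (n : ℕ) (hn : 0 < n) :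
    ∃ M : ℕ, 1 ≤ M ∧ ∀ x : ℚ_[p], ‖x - 1‖ ≤ ‖(p : ℚ_[p])‖ ^ M → x ∈ Pset p n := by
  obtain ⟨M, hM⟩ := exists_near_one_pow (p := p) n hn
  refine ⟨M + 1, by omega, fun x hx => hM x (hx.trans ?_)⟩
  exact pow_le_pow_of_le_one (norm_nonneg _) norm_p_lt_one'.le (by omega)

/-- coset decided along an ultrafilter, by a tame set -/
theorem tame_coset_dec (𝒰 : Ultrafilter (Fin (m + 1) → ℚ_[p])) {f : (Fin (m + 1) → ℚ_[p]) → ℚ_[p]}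
    (hf : IsDFunction p f) {n : ℕ} (hn : 0 < n) :
    ∃ μ : ℚ_[p], ∀ᶠ z in tameF 𝒰, f z ∈ cosetP p μ n := by
  obtain ⟨M, hM1, hM⟩ := exists_near_one_pow' (p := p) n hn
  obtain ⟨γ, hγ, h⟩ := tame_main 𝒰 (fun _ : Unit => f) (fun _ => hf) hM1
  obtain ⟨δ, hδ, a, ha⟩ := h ()
  obtain ⟨S, hS⟩ := exists_finite_cosets (p := p) n hn
  have key : ∀ J : ℚ_[p] → Set (Fin (m + 1) → ℚ_[p]), (∀ μ, Tame (J μ)) → (∀ z, ∃ μ ∈ S, z ∈ J μ) →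
      ∃ μ, ∀ᶠ z in tameF 𝒰, z ∈ J μ := by
    intro J hJ hz
    have : (⋃ μ ∈ S, J μ) ∈ 𝒰 := by
      refine Filter.mem_of_superset Filter.univ_mem fun z _ => ?_
      obtain ⟨μ, h1, h2⟩ := hz z
      exact Set.mem_iUnion₂.2 ⟨μ, h1, h2⟩
    obtain ⟨μ, -, h2⟩ := (Ultrafilter.finite_biUnion_mem_iff S.finite_toSet).1 this
    exact ⟨μ, mem_tameF.2 ⟨_, h2, hJ μ, subset_rfl⟩⟩
  obtain ⟨μ1, h1⟩ := key (fun μ => {z | prj z ∈ {x | δ x ∈ cosetP p μ n}})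
    (fun μ => tame_x (hδ.coset μ hn)) (fun z => hS (δ (prj z)))
  obtain ⟨μ2, h2⟩ := key (fun μ => {z | lst z - γ (prj z) ∈ cosetP p μ n})
    (fun μ => tame_c hγ μ hn) (fun z => hS _)
  refine ⟨μ1 * μ2 ^ a, ?_⟩
  filter_upwards [ha, h1, h2] with z h3 h4 h5
  exact cosetP_trans (cl_coset hM h3) (cosetP_mul h4 (cosetP_zpow a h5))

theorem tame_of_decided (S : Set (Fin (m + 1) → ℚ_[p]))
    (h : ∀ 𝒰 : Ultrafilter (Fin (m + 1) → ℚ_[p]), ∃ I ∈ 𝒰, Tame I ∧ (I ⊆ S ∨ I ⊆ Sᶜ)) : Tame S := by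
  obtain ⟨s, hs, hc⟩ := compact_cover S {I | Tame I ∧ I ⊆ S} (by
    intro 𝒰 hS
    obtain ⟨I, hI, hT, h1 | h1⟩ := h 𝒰
    · exact ⟨I, ⟨hT, h1⟩, hI⟩
    · exfalso
      refine 𝒰.empty_notMem (Filter.mem_of_superset (Filter.inter_mem hS hI) ?_)
      rintro x ⟨hx, hx'⟩
      exact h1 hx' hx)
  have : S = ⋃ I ∈ s, I := subset_antisymm hc (Set.iUnion₂_subset fun I hI => (hs I hI).2)
  rw [this]
  exact Tame.biUnion s fun I hI => (hs I hI).1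

theorem tame_Pset {f : (Fin (m + 1) → ℚ_[p]) → ℚ_[p]} (hf : IsDFunction p f) {n : ℕ} (hn : 0 < n) (ν : ℚ_[p]) :
    Tame {z | f z ∈ cosetP p ν n} := by
  apply tame_of_decided
  intro 𝒰
  obtain ⟨μ, hμ⟩ := tame_coset_dec 𝒰 hf hn
  obtain ⟨I, hI, hT, h⟩ := mem_tameF.1 hμ
  refine ⟨I, hI, hT, ?_⟩
  by_cases hν : μ ∈ cosetP p ν n
  · exact Or.inl fun z hz => cosetP_trans (h hz) hν
  · refine Or.inr fun z hz hz' => hν (cosetP_trans (cosetP_symm (h hz)) hz')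

theorem IsSubanalytic.tame {X : Set (Fin (m + 1) → ℚ_[p])} (hX : IsSubanalytic p X) : Tame X := by
  obtain ⟨r, s, F, hF, rfl⟩ := hX
  have hT : ∀ i j, Tame (F i j) := by
    intro i j
    rcases hF i j with ⟨f, hf, h⟩ | ⟨f, n, hf, hn, h⟩
    · rw [h]
      convert tame_Pset hf one_pos 0 using 1
      ext z; exact (mem_cosetP_zero (p := p)).symm
    · rw [h]
      convert tame_Pset hf hn 1 using 1
      ext z; exact (mem_cosetP_one (p := p)).symm
  classical
  have h1 : ∀ i, Tame (⋂ j, F i j) := by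
    intro i
    have := (Tame.biUnion (Finset.univ.image fun j => (F i j)ᶜ) (by
      intro I hI
      obtain ⟨j, -, rfl⟩ := Finset.mem_image.1 hI
      exact (hT i j).compl)).compl
    convert this using 1
    ext z; simp
  have := Tame.biUnion (Finset.univ.image fun i => ⋂ j, F i j) (by
      intro I hI
      obtain ⟨j, -, rfl⟩ := Finset.mem_image.1 hI
      exact h1 j)
  convert this using 1
  ext z; simp

def snc (x : Fin m → ℚ_[p]) (t : ℚ_[p]) : Fin (m + 1) → ℚ_[p] := Fin.snoc (α := fun _ => ℚ_[p]) x t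
@[simp] theorem prj_snc (x : Fin m → ℚ_[p]) (t : ℚ_[p]) : prj (snc x t) = x := by
  funext i; simp [prj, snc]
@[simp] theorem lst_snc (x : Fin m → ℚ_[p]) (t : ℚ_[p]) : lst (snc x t) = t := by
  simp [lst, snc]
theorem snc_prj (z : Fin (m + 1) → ℚ_[p]) : snc (prj z) (lst z) = z := by
  funext i
  induction i using Fin.lastCases with
  | last => simp [snc, lst]
  | cast i => simp [snc, prj]

theorem mem_graphFun {X : Set (Fin m → ℚ_[p])} {f : (Fin m → ℚ_[p]) → ℚ_[p]} {z : Fin (m + 1) → ℚ_[p]} :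
    z ∈ graphFun p X f ↔ prj z ∈ X ∧ f (prj z) = lst z := Iff.rfl

theorem coset_small {n M : ℕ} (hM1 : 1 ≤ M) (hM : ∀ x : ℚ_[p], ‖x - 1‖ ≤ ‖(p : ℚ_[p])‖ ^ M → x ∈ Pset p n)
    {a e : ℚ_[p]} (h : ‖e‖ ≤ ‖(p : ℚ_[p])‖ ^ M * ‖a‖) : a + e ∈ cosetP p a n ∧ ‖a + e‖ = ‖a‖ := by
  have : Cl M (a + e) a := by
    show ‖a + e - a‖ ≤ _
    rwa [add_sub_cancel_left]
  exact ⟨cl_coset hM this, this.norm hM1⟩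

/-- A subanalytic function is piecewise (pointwise) equal to one of finitely many `DP`-functions. -/
theorem fn_mem {X : Set (Fin m → ℚ_[p])} {f : (Fin m → ℚ_[p]) → ℚ_[p]} {Γ B : Finset ((Fin m → ℚ_[p]) → ℚ_[p])}
    {W : Finset (Set (Fin m → ℚ_[p]))} {N : ℕ} (hN : 0 < N) (hD : Dec Γ B W N (graphFun p X f)) (x : Fin m → ℚ_[p])
    (hx : x ∈ X) : ∃ γ ∈ Γ, f x = γ x := by
  by_contra hne
  push Not at hne
  obtain ⟨M, hM1, hM⟩ := exists_near_one_pow' (p := p) N hN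
  have ev : ∀ᶠ j : ℕ in atTop, ∀ γ ∈ Γ, ‖(p : ℚ_[p]) ^ j‖ ≤ ‖(p : ℚ_[p])‖ ^ M * ‖f x - γ x‖ := by
    refine (Filter.eventually_all_finset Γ).2 fun γ hγ => ?_
    have hpos : 0 < ‖(p : ℚ_[p])‖ ^ M * ‖f x - γ x‖ :=
      mul_pos (pow_pos norm_p_pos _) (norm_pos_iff.2 (sub_ne_zero.2 (hne γ hγ)))
    have := (tendsto_pow_atTop_nhds_zero_of_lt_one (norm_nonneg _) (norm_p_lt_one' (p := p))).eventually_le_const hpos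
    filter_upwards [this] with j hj
    rwa [norm_pow]
  obtain ⟨j, hj⟩ := ev.exists
  have hA : Agr Γ B W N (snc x (f x)) (snc x (f x + (p : ℚ_[p]) ^ j)) := by
    refine ⟨fun S _ => by simp, fun γ hγ => ?_, fun γ hγ b hb => ?_⟩
    · simp only [prj_snc, lst_snc]
      rw [add_sub_right_comm]
      exact (coset_small hM1 hM (hj γ hγ)).1
    · simp only [prj_snc, lst_snc]
      rw [add_sub_right_comm, (coset_small hM1 hM (hj γ hγ)).2]
  have := hD _ _ hA (mem_graphFun.2 (by simp [hx]))
  have h2 := (mem_graphFun.1 this).2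
  simp only [prj_snc, lst_snc] at h2
  exact pow_ne_zero j p_ne_zero' (by linear_combination -h2)

theorem fn_hull {X : Set (Fin m → ℚ_[p])} {f : (Fin m → ℚ_[p]) → ℚ_[p]} (hf : IsSubanalyticFnOn p X f)
    (𝒰 : Ultrafilter (Fin m → ℚ_[p])) (hX : X ∈ 𝒰) :
    ∃ S ∈ 𝒰, IsSubanalytic p S ∧ S ⊆ X ∧ ∃ e > 0, ∃ c, IsDFunction p c ∧ ∀ z ∈ S, ‖f z‖ ^ e = ‖c z‖ := by
  classical
  obtain ⟨Γ, B, W, N, hN, hT, hD⟩ := IsSubanalytic.tame hf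
  have hu : (⋃ γ ∈ Γ, {x | x ∈ X ∧ f x = γ x}) ∈ 𝒰 := by
    refine Filter.mem_of_superset hX fun x hx => ?_
    obtain ⟨γ, h1, h2⟩ := fn_mem hN hD x hx
    exact Set.mem_iUnion₂.2 ⟨γ, h1, hx, h2⟩
  obtain ⟨γ, hγ, hY⟩ := (Ultrafilter.finite_biUnion_mem_iff Γ.finite_toSet).1 hu
  obtain ⟨R, hR⟩ := exists_finite_cosets (p := p) N hN
  have hYs : IsSubanalytic p {x | x ∈ X ∧ f x = γ x} := by
    refine sub_of_det (W ∪ (Γ ×ˢ R).image (fun q => {x | γ x - q.1 x ∈ cosetP p q.2 N}) ∪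
      (Γ ×ˢ B).image (fun q => {x | ‖γ x - q.1 x‖ ≤ ‖q.2 x‖})) ?_ _ ?_
    · intro S hS
      rcases Finset.mem_union.1 hS with hS | hS
      · rcases Finset.mem_union.1 hS with hS | hS
        · exact hT.x S hS
        · obtain ⟨q, hq, rfl⟩ := Finset.mem_image.1 hS
          rw [Finset.mem_product] at hq
          exact IsDP.coset (f := fun x => γ x - q.1 x) ((dclosed_DP m).sub (hT.c γ hγ) (hT.c _ hq.1)) _ hN
      · obtain ⟨q, hq, rfl⟩ := Finset.mem_image.1 hS
        rw [Finset.mem_product] at hq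
        exact IsDP.le (f := fun x => γ x - q.1 x) ((dclosed_DP m).sub (hT.c γ hγ) (hT.c _ hq.1)) (hT.b _ hq.2)
    · intro x x' hxx' hx
      have hA : Agr Γ B W N (snc x (γ x)) (snc x' (γ x')) := by
        refine ⟨fun S hS => ?_, fun γ' hγ' => ?_, fun γ' hγ' b hb => ?_⟩
        · simp only [prj_snc]
          exact hxx' S (Finset.mem_union_left _ (Finset.mem_union_left _ hS))
        · simp only [prj_snc, lst_snc]
          obtain ⟨μ, hμ, h1⟩ := hR (γ x - γ' x)
          have := (hxx' {x | γ x - γ' x ∈ cosetP p μ N} (Finset.mem_union_left _ (Finset.mem_union_right _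
            (Finset.mem_image.2 ⟨(γ', μ), Finset.mem_product.2 ⟨hγ', hμ⟩, rfl⟩)))).1 h1
          exact cosetP_trans this (cosetP_symm h1)
        · simp only [prj_snc, lst_snc]
          exact hxx' {x | ‖γ x - γ' x‖ ≤ ‖b x‖} (Finset.mem_union_right _
            (Finset.mem_image.2 ⟨(γ', b), Finset.mem_product.2 ⟨hγ', hb⟩, rfl⟩))
      have := hD _ _ hA (mem_graphFun.2 (by simpa using hx))
      have := mem_graphFun.1 this
      simpa using this
  obtain ⟨S, hS, hSs, e, he, c, hc, h⟩ := (hT.c γ hγ).hull 𝒰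
  refine ⟨_, Filter.inter_mem hS hY, hSs.inter hYs, fun x hx => hx.2.1, e, he, c, hc, fun z hz => ?_⟩
  rw [hz.2.2]; exact h z hz.1

/-- Local form of the theorem. -/
theorem local_main {r : ℕ} {X : Set (Fin (m + 1) → ℚ_[p])} (hX : IsSubanalytic p X)
    {f : Fin r → (Fin (m + 1) → ℚ_[p]) → ℚ_[p]} (hf : ∀ j, IsSubanalyticFnOn p X (f j))
    (𝒰 : Ultrafilter (Fin (m + 1) → ℚ_[p])) (h𝒰 : X ∈ 𝒰) :
    ∃ I ∈ 𝒰, Tame I ∧ I ⊆ X ∧ ∃ γ : (Fin m → ℚ_[p]) → ℚ_[p], IsDP γ ∧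
      ∃ e > 0, ∀ j, ∃ δ : (Fin m → ℚ_[p]) → ℚ_[p], IsDP δ ∧ ∃ a : ℤ,
      ∀ z ∈ I, ‖f j z‖ ^ e = ‖δ (prj z) * (lst z - γ (prj z)) ^ a‖ := by
  have := fun j => fn_hull (hf j) 𝒰 h𝒰
  choose S hS hSs hSX e he c hc h using this
  obtain ⟨γ, hγ, h1⟩ := tame_main 𝒰 c hc le_rfl
  choose δ hδ a ha using h1
  have ev : ∀ᶠ z in tameF 𝒰, z ∈ X ∧ ∀ j, z ∈ S j ∧ Cl 1 (c j z) (δ j (prj z) * (lst z - γ (prj z)) ^ a j) := by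
    refine Filter.Eventually.and (mem_tameF.2 ⟨X, h𝒰, hX.tame, subset_rfl⟩) (eventually_all.2 fun j => ?_)
    exact Filter.Eventually.and (mem_tameF.2 ⟨S j, hS j, (hSs j).tame, subset_rfl⟩) (ha j)
  obtain ⟨I, hI, hIt, hII⟩ := mem_tameF.1 ev
  refine ⟨I, hI, hIt, fun z hz => (hII hz).1, γ, hγ, ∏ j, e j, Finset.prod_pos fun j _ => he j, fun j => ?_⟩
  obtain ⟨k, hk⟩ : e j ∣ ∏ j, e j := Finset.dvd_prod_of_mem e (Finset.mem_univ j)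
  refine ⟨fun x => δ j x ^ k, (dclosed_DP m).pow (hδ j) k, a j * k, fun z hz => ?_⟩
  obtain ⟨-, h2⟩ := hII hz
  rw [hk, pow_mul, h j z (h2 j).1, (h2 j).2.norm le_rfl, ← norm_pow, mul_pow, zpow_mul, zpow_natCast]

theorem global_cover {r : ℕ} {X : Set (Fin (m + 1) → ℚ_[p])} (hX : IsSubanalytic p X)
    {f : Fin r → (Fin (m + 1) → ℚ_[p]) → ℚ_[p]} (hf : ∀ j, IsSubanalyticFnOn p X (f j)) :
    ∃ s : Finset (Set (Fin (m + 1) → ℚ_[p])), (∀ I ∈ s, Tame I ∧ I ⊆ X) ∧ X ⊆ ⋃ I ∈ s, I ∧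
      ∃ E > 0, ∀ I ∈ s, ∃ γ : (Fin m → ℚ_[p]) → ℚ_[p], IsDP γ ∧
      ∀ j, ∃ δ : (Fin m → ℚ_[p]) → ℚ_[p], IsDP δ ∧ ∃ a : ℤ,
      ∀ z ∈ I, ‖f j z‖ ^ E = ‖δ (prj z) * (lst z - γ (prj z)) ^ a‖ := by
  obtain ⟨s, hs, hc⟩ := compact_cover X {I | Tame I ∧ I ⊆ X ∧ ∃ γ : (Fin m → ℚ_[p]) → ℚ_[p], IsDP γ ∧
      ∃ e > 0, ∀ j, ∃ δ : (Fin m → ℚ_[p]) → ℚ_[p], IsDP δ ∧ ∃ a : ℤ,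
      ∀ z ∈ I, ‖f j z‖ ^ e = ‖δ (prj z) * (lst z - γ (prj z)) ^ a‖} (by
    intro 𝒰 h𝒰
    obtain ⟨I, h1, h2⟩ := local_main hX hf 𝒰 h𝒰
    exact ⟨I, h2, h1⟩)
  choose! h1 h2 γ hγ e he δ hδ a ha using hs
  refine ⟨s, fun I hI => ⟨h1 I hI, h2 I hI⟩, hc, ∏ I ∈ s, e I, Finset.prod_pos fun I hI => he I hI, fun I hI => ?_⟩
  refine ⟨γ I, hγ I hI, fun j => ?_⟩
  obtain ⟨k, hk⟩ : e I ∣ ∏ I ∈ s, e I := Finset.dvd_prod_of_mem e hI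
  refine ⟨fun x => δ I j x ^ k, (dclosed_DP m).pow (hδ I hI j) k, a I j * k, fun z hz => ?_⟩
  rw [hk, pow_mul, ha I hI j z hz, ← norm_pow, mul_pow, zpow_mul, zpow_natCast]

theorem IsDP.root_global' {e : ℕ} : 0 < e → ∀ N > 0, ∃ N' > 0, ∀ {m : ℕ} {h : (Fin m → ℚ_[p]) → ℚ_[p]}, IsDP h →
    ∃ w : (Fin m → ℚ_[p]) → ℚ_[p], IsDP w ∧ ∀ x, h x ∈ Pset p N' → w x ^ e = h x ∧ w x ∈ Pset p N := by
  induction e using Nat.recOnMul with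
  | zero => intro h; omega
  | one => exact fun _ N hN => ⟨N, hN, fun {m h} hh => ⟨h, hh, fun x hx => ⟨pow_one _, hx⟩⟩⟩
  | prime l hl =>
    intro _ N hN
    refine ⟨rtN p l * N * l, Nat.mul_pos (Nat.mul_pos (rtN_pos l hl.pos) hN) hl.pos,
      fun {m h} hh => ⟨_, .rt l hl h hh, fun x hx => ?_⟩⟩
    obtain ⟨y, hy0, hy⟩ := hx
    have := rt_of (p := p) hl.pos (y := y ^ (rtN p l * N))
      ⟨y ^ N, pow_ne_zero _ hy0, by rw [← pow_mul, mul_comm]⟩ (by rw [← pow_mul, hy])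
    rw [this, ← pow_mul, hy]
    exact ⟨rfl, y ^ rtN p l, pow_ne_zero _ hy0, by rw [← pow_mul]⟩
  | mul a b iha ihb =>
    intro he N hN
    obtain ⟨Nb, hNb, hb⟩ := ihb (Nat.pos_of_mul_pos_left he) N hN
    obtain ⟨Na, hNa, ha⟩ := iha (Nat.pos_of_mul_pos_right he) Nb hNb
    refine ⟨Na, hNa, fun {m h} hh => ?_⟩
    obtain ⟨w, hw, h1⟩ := ha hh
    obtain ⟨v, hv, h2⟩ := hb hw
    refine ⟨v, hv, fun x hx => ⟨?_, (h2 x (h1 x hx).2).2⟩⟩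
    rw [mul_comm, pow_mul, (h2 x (h1 x hx).2).1, (h1 x hx).1]

theorem IsDP.root_global {e : ℕ} (he : 0 < e) : ∃ N' > 0, ∀ {m : ℕ} {h : (Fin m → ℚ_[p]) → ℚ_[p]}, IsDP h →
    ∃ w : (Fin m → ℚ_[p]) → ℚ_[p], IsDP w ∧ ∀ x, h x ∈ Pset p N' → w x ^ e = h x := by
  obtain ⟨N', h1, h2⟩ := IsDP.root_global' (p := p) he 1 one_pos
  refine ⟨N', h1, fun {m h} hh => ?_⟩
  obtain ⟨w, hw, h⟩ := h2 hh
  exact ⟨w, hw, fun x hx => (h x hx).1⟩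

end Tame2
end PadicSub

namespace PadicSub
section Part
variable {p : ℕ} [hp : Fact p.Prime] {m : ℕ}

theorem norm_p_zpow_lt {k l : ℤ} : ‖(p : ℚ_[p]) ^ k‖ ≤ ‖(p : ℚ_[p]) ^ l‖ ↔ l ≤ k := by
  rw [norm_zpow, norm_zpow]
  exact zpow_le_zpow_iff_right_of_lt_one₀ norm_p_pos norm_p_lt_one'

/-- Comparison data for the moduli. -/
structure Mods (p : ℕ) [Fact p.Prime] (M N0 N : ℕ) : Prop where
  M1 : 1 ≤ M
  near : ∀ x : ℚ_[p], ‖x - 1‖ ≤ ‖(p : ℚ_[p])‖ ^ M → x ∈ Pset p N0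
  dvd : N0 ∣ N
  pos : 0 < N
  unit : ∀ x ∈ Pset p N, ‖x‖ = 1 → ‖x - 1‖ ≤ ‖(p : ℚ_[p])‖ ^ M

theorem exists_mods {N0 : ℕ} (h0 : 0 < N0) (K : ℕ) (hK : 0 < K) : ∃ M N, Mods p M N0 N ∧ K ∣ N := by
  obtain ⟨M, hM1, hM⟩ := exists_near_one_pow' (p := p) N0 h0
  obtain ⟨N1, h1, hN1⟩ := exists_pow_near_one (p := p) M
  refine ⟨M, N0 * N1 * K, ⟨hM1, hM, (Nat.dvd_mul_right _ _).mul_right _, by positivity, fun x hx => ?_⟩,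
    Nat.dvd_mul_left _ _⟩
  exact hN1 x (Pset_dvd ((Nat.dvd_mul_left _ _).mul_right _) hx)

theorem lemL0 {M N0 N : ℕ} (H : Mods p M N0 N) {τ τ' g g' : ℚ_[p]} (hτ : τ' ∈ cosetP p τ N) (hg : g' ∈ cosetP p g N)
    (hle : ∀ e : ℤ, -M ≤ e → e ≤ M → (‖τ‖ ≤ ‖(p : ℚ_[p]) ^ e * g‖ ↔ ‖τ'‖ ≤ ‖(p : ℚ_[p]) ^ e * g'‖))
    (hge : ∀ e : ℤ, -M ≤ e → e ≤ M → (‖(p : ℚ_[p]) ^ e * g‖ ≤ ‖τ‖ ↔ ‖(p : ℚ_[p]) ^ e * g'‖ ≤ ‖τ'‖))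
    (h : ‖τ‖ ≤ ‖τ + g‖) :
    ((‖τ + g‖ = ‖τ‖ ∧ ‖τ' + g'‖ = ‖τ'‖) ∨ (‖τ + g‖ = ‖g‖ ∧ ‖τ' + g'‖ = ‖g'‖)) ∧ τ' + g' ∈ cosetP p (τ + g) N0 := by
  by_cases hg0 : g = 0
  · have hg1 : g' = 0 := (cosetP_eq_zero_iff hg).2 hg0
    subst hg0 hg1
    exact ⟨Or.inl ⟨by simp, by simp⟩, by simpa using cosetP_dvd H.dvd hτ⟩
  by_cases hτ0 : τ = 0
  · have hτ1 : τ' = 0 := (cosetP_eq_zero_iff hτ).2 hτ0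
    subst hτ0 hτ1
    exact ⟨Or.inr ⟨by simp, by simp⟩, by simpa using cosetP_dvd H.dvd hg⟩
  have hg1 : g' ≠ 0 := fun h => hg0 ((cosetP_eq_zero_iff hg).1 h)
  have hτ1 : τ' ≠ 0 := fun h => hτ0 ((cosetP_eq_zero_iff hτ).1 h)
  have hp0 : (p : ℚ_[p]) ≠ 0 := p_ne_zero'
  by_cases c1 : ‖τ‖ ≤ ‖(p : ℚ_[p]) ^ (M : ℤ) * g‖
  · have c1' := (hle M (by omega) le_rfl).1 c1
    rw [norm_mul, zpow_natCast, norm_pow] at c1 c1'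
    obtain ⟨a1, a2⟩ := coset_small H.M1 H.near c1
    obtain ⟨a3, a4⟩ := coset_small H.M1 H.near c1'
    rw [add_comm] at a1 a2 a3 a4
    exact ⟨Or.inr ⟨a2, a4⟩, cosetP_trans a3 (cosetP_trans (cosetP_dvd H.dvd hg) (cosetP_symm a1))⟩
  by_cases c2 : ‖(p : ℚ_[p]) ^ (-M : ℤ) * g‖ ≤ ‖τ‖
  · have c2' := (hge (-M) le_rfl (by omega)).1 c2
    have key : ∀ a b : ℚ_[p], ‖(p : ℚ_[p]) ^ (-M : ℤ) * a‖ ≤ ‖b‖ → ‖a‖ ≤ ‖(p : ℚ_[p])‖ ^ M * ‖b‖ := by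
      intro a b hab
      have : ‖(p : ℚ_[p])‖ ^ M * ‖(p : ℚ_[p]) ^ (-M : ℤ) * a‖ = ‖a‖ := by
        rw [← norm_pow, ← norm_mul, ← zpow_natCast, ← mul_assoc, ← zpow_add₀ hp0]; simp
      rw [← this]; gcongr
    obtain ⟨a1, a2⟩ := coset_small H.M1 H.near (key _ _ c2)
    obtain ⟨a3, a4⟩ := coset_small H.M1 H.near (key _ _ c2')
    exact ⟨Or.inl ⟨a2, a4⟩, cosetP_trans a3 (cosetP_trans (cosetP_dvd H.dvd hτ) (cosetP_symm a1))⟩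
  obtain ⟨k, hk⟩ := norm_eq_zpow (τ / g) (div_ne_zero hτ0 hg0)
  have hk' : ‖τ‖ = ‖(p : ℚ_[p]) ^ k * g‖ := by
    rw [norm_mul, ← hk, ← norm_mul, div_mul_cancel₀ _ hg0]
  have hgp : 0 < ‖g‖ := norm_pos_iff.2 hg0
  have k1 : k ≤ M := by
    rw [hk', norm_mul, norm_mul, mul_le_mul_iff_left₀ hgp, norm_p_zpow_lt] at c1; omega
  have k2 : -M ≤ k := by
    rw [hk', norm_mul, norm_mul, mul_le_mul_iff_left₀ hgp, norm_p_zpow_lt] at c2; omega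
  have hk'' : ‖τ'‖ = ‖(p : ℚ_[p]) ^ k * g'‖ := le_antisymm ((hle k k2 k1).1 hk'.le) ((hge k k2 k1).1 hk'.ge)
  have u1 : τ' / τ ∈ Pset p N := (mem_cosetP_iff hτ0).1 hτ
  have u2 : g' / g ∈ Pset p N := (mem_cosetP_iff hg0).1 hg
  set u := (τ' / τ) / (g' / g) with hu
  have u3 : u ∈ Pset p N := by rw [hu, div_eq_mul_inv]; exact Pset_mul u1 (Pset_inv u2)
  have hkp : ‖(p : ℚ_[p]) ^ k‖ ≠ 0 := norm_ne_zero_iff.2 (zpow_ne_zero _ hp0)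
  have hg'n : ‖g'‖ ≠ 0 := norm_ne_zero_iff.2 hg1
  have u4 : ‖u‖ = 1 := by
    rw [hu, norm_div, norm_div, norm_div, hk', hk'', norm_mul, norm_mul]
    have := hgp.ne'
    field_simp
  have u5 := H.unit u u3 u4
  have e1 : τ' + g' = (g' / g) * (τ + g + τ * (u - 1)) := by
    rw [hu]; field_simp; ring
  have b1 : ‖τ * (u - 1)‖ ≤ ‖(p : ℚ_[p])‖ ^ M * ‖τ + g‖ := by
    rw [norm_mul, mul_comm]
    exact mul_le_mul u5 h (norm_nonneg _) (by positivity)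
  obtain ⟨a1, a2⟩ := coset_small H.M1 H.near b1
  have n1 : ‖τ' + g'‖ = ‖g' / g‖ * ‖τ + g‖ := by rw [e1, norm_mul, a2]
  constructor
  · by_cases c3 : ‖τ + g‖ = ‖τ‖
    · left
      refine ⟨c3, ?_⟩
      rw [n1, c3, hk', hk'', norm_div, norm_mul, norm_mul]
      have := hgp.ne'
      field_simp
    · right
      have c4 : ‖τ + g‖ = ‖g‖ := by
        have := nsub_eq (lt_of_le_of_ne h (Ne.symm c3))
        rw [add_sub_cancel_left] at this; exact this.symm
      refine ⟨c4, ?_⟩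
      rw [n1, c4, norm_div, div_mul_cancel₀ _ hgp.ne']
  · rw [e1]
    have := cosetP_mul (mem_cosetP_one.2 (Pset_dvd H.dvd u2)) a1
    rwa [one_mul] at this

theorem lemL {M N0 N : ℕ} (H : Mods p M N0 N) {τ τ' g g' : ℚ_[p]} (hτ : τ' ∈ cosetP p τ N) (hg : g' ∈ cosetP p g N)
    (hle : ∀ e : ℤ, -M ≤ e → e ≤ M → (‖τ‖ ≤ ‖(p : ℚ_[p]) ^ e * g‖ ↔ ‖τ'‖ ≤ ‖(p : ℚ_[p]) ^ e * g'‖))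
    (hge : ∀ e : ℤ, -M ≤ e → e ≤ M → (‖(p : ℚ_[p]) ^ e * g‖ ≤ ‖τ‖ ↔ ‖(p : ℚ_[p]) ^ e * g'‖ ≤ ‖τ'‖))
    (h : ‖τ‖ ≤ ‖τ + g‖) :
    ‖τ'‖ ≤ ‖τ' + g'‖ ∧ (‖τ + g‖ ≤ ‖τ‖ ↔ ‖τ' + g'‖ ≤ ‖τ'‖) ∧
    ((‖τ + g‖ = ‖τ‖ ∧ ‖τ' + g'‖ = ‖τ'‖) ∨ (‖τ' + g'‖ ≠ ‖τ'‖ ∧ ‖τ + g‖ ≠ ‖τ‖ ∧ ‖τ + g‖ = ‖g‖ ∧ ‖τ' + g'‖ = ‖g'‖)) ∧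
      τ' + g' ∈ cosetP p (τ + g) N0 := by
  obtain ⟨h1, h2⟩ := lemL0 H hτ hg hle hge h
  have t1 := hle 0 (by omega) (by omega)
  have t2 := hge 0 (by omega) (by omega)
  rw [zpow_zero, one_mul, one_mul] at t1 t2
  rcases h1 with ⟨a, b⟩ | ⟨a, b⟩
  · exact ⟨b.ge, ⟨fun _ => b.le, fun _ => a.le⟩, Or.inl ⟨a, b⟩, h2⟩
  · rw [a] at h
    refine ⟨b ▸ t1.1 h, by rw [a, b]; exact t2, ?_, h2⟩
    by_cases hc : ‖g‖ = ‖τ‖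
    · left
      exact ⟨a.trans hc, b.trans (le_antisymm (t2.1 hc.le) (t1.1 hc.ge))⟩
    · right
      refine ⟨?_, a ▸ hc, a, b⟩
      rw [b]; intro h'
      exact hc (le_antisymm (t2.2 h'.le) h)

abbrev Sx (W : Finset (Set (Fin m → ℚ_[p]))) (x x' : Fin m → ℚ_[p]) : Prop := ∀ S ∈ W, x ∈ S ↔ x' ∈ S

structure Ext (Γ B : Finset ((Fin m → ℚ_[p]) → ℚ_[p])) (W : Finset (Set (Fin m → ℚ_[p]))) (M N : ℕ)
    (Bx : Finset ((Fin m → ℚ_[p]) → ℚ_[p])) (Wx : Finset (Set (Fin m → ℚ_[p]))) : Prop where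
  tame : TameD Γ Bx Wx
  BB : B ⊆ Bx
  WW : W ⊆ Wx
  zero : (fun _ => 0) ∈ Bx
  diff : ∀ γ ∈ Γ, ∀ γ' ∈ Γ, ∀ e : ℤ, -M ≤ e → e ≤ M → (fun x => (p : ℚ_[p]) ^ e * (γ x - γ' x)) ∈ Bx
  cos : ∀ γ ∈ Γ, ∀ γ' ∈ Γ, ∀ x x', Sx Wx x x' → γ x' - γ' x' ∈ cosetP p (γ x - γ' x) N
  cmp : ∀ b ∈ Bx, ∀ b' ∈ Bx, ∀ x x', Sx Wx x x' → (‖b x‖ ≤ ‖b' x‖ ↔ ‖b x'‖ ≤ ‖b' x'‖)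

theorem exists_ext {Γ B : Finset ((Fin m → ℚ_[p]) → ℚ_[p])} {W : Finset (Set (Fin m → ℚ_[p]))} (hT : TameD Γ B W)
    (M : ℕ) {N : ℕ} (hN : 0 < N) : ∃ Bx Wx, Ext Γ B W M N Bx Wx := by
  classical
  obtain ⟨R, hR⟩ := exists_finite_cosets (p := p) N hN
  let Bx : Finset ((Fin m → ℚ_[p]) → ℚ_[p]) := B ∪ {fun _ => 0} ∪
    (Γ ×ˢ Γ ×ˢ Finset.Icc (-M : ℤ) M).image fun q => fun x => (p : ℚ_[p]) ^ q.2.2 * (q.1 x - q.2.1 x)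
  have hBx : ∀ b ∈ Bx, IsDP b := by
    intro b hb
    simp only [Bx, Finset.mem_union, Finset.mem_singleton, Finset.mem_image, Finset.mem_product] at hb
    rcases hb with (hb | rfl) | ⟨q, hq, rfl⟩
    · exact hT.b b hb
    · exact (dclosed_DP m).const 0
    · exact (dclosed_DP m).mul ((dclosed_DP m).const _) ((dclosed_DP m).sub (hT.c _ hq.1) (hT.c _ hq.2.1))
  let Wx : Finset (Set (Fin m → ℚ_[p])) := W ∪
    (Γ ×ˢ Γ ×ˢ R).image (fun q => {x | q.1 x - q.2.1 x ∈ cosetP p q.2.2 N}) ∪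
    (Bx ×ˢ Bx).image (fun q => {x | ‖q.1 x‖ ≤ ‖q.2 x‖})
  refine ⟨Bx, Wx, ⟨hT.c, hBx, ?_⟩, ?_, ?_, ?_, ?_, ?_, ?_⟩
  · intro S hS
    simp only [Wx, Finset.mem_union, Finset.mem_image, Finset.mem_product] at hS
    rcases hS with (hS | ⟨q, hq, rfl⟩) | ⟨q, hq, rfl⟩
    · exact hT.x S hS
    · exact IsDP.coset (f := fun x => q.1 x - q.2.1 x) ((dclosed_DP m).sub (hT.c _ hq.1) (hT.c _ hq.2.1)) _ hN
    · exact (hBx _ hq.1).le (hBx _ hq.2)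
  · exact fun b hb => Finset.mem_union_left _ (Finset.mem_union_left _ hb)
  · exact fun b hb => Finset.mem_union_left _ (Finset.mem_union_left _ hb)
  · exact Finset.mem_union_left _ (Finset.mem_union_right _ (Finset.mem_singleton_self _))
  · intro γ hγ γ' hγ' e h1 h2
    exact Finset.mem_union_right _ (Finset.mem_image.2 ⟨(γ, γ', e), by simp [hγ, hγ', h1, h2], rfl⟩)
  · intro γ hγ γ' hγ' x x' hx
    obtain ⟨μ, hμ, h1⟩ := hR (γ x - γ' x)
    have := (hx {x | γ x - γ' x ∈ cosetP p μ N} (Finset.mem_union_left _ (Finset.mem_union_right _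
      (Finset.mem_image.2 ⟨(γ, γ', μ), by simp [hγ, hγ', hμ], rfl⟩)))).1 h1
    exact cosetP_trans this (cosetP_symm h1)
  · intro b hb b' hb' x x' hx
    exact hx {x | ‖b x‖ ≤ ‖b' x‖} (Finset.mem_union_right _
      (Finset.mem_image.2 ⟨(b, b'), by simp [hb, hb'], rfl⟩))

/-- `z'` passes the same tests as `z`, relative to center `γ`. -/
structure Sim (Bx : Finset ((Fin m → ℚ_[p]) → ℚ_[p])) (Wx : Finset (Set (Fin m → ℚ_[p]))) (N : ℕ)
    (γ : (Fin m → ℚ_[p]) → ℚ_[p]) (z z' : Fin (m + 1) → ℚ_[p]) : Prop where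
  x : Sx Wx (prj z) (prj z')
  c : lst z' - γ (prj z') ∈ cosetP p (lst z - γ (prj z)) N
  l : ∀ b ∈ Bx, (‖lst z - γ (prj z)‖ ≤ ‖b (prj z)‖ ↔ ‖lst z' - γ (prj z')‖ ≤ ‖b (prj z')‖)
  g : ∀ b ∈ Bx, (‖b (prj z)‖ ≤ ‖lst z - γ (prj z)‖ ↔ ‖b (prj z')‖ ≤ ‖lst z' - γ (prj z')‖)

def Near (Γ : Finset ((Fin m → ℚ_[p]) → ℚ_[p])) (γ : (Fin m → ℚ_[p]) → ℚ_[p]) (z : Fin (m + 1) → ℚ_[p]) : Prop :=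
  ∀ γ' ∈ Γ, ‖lst z - γ (prj z)‖ ≤ ‖lst z - γ' (prj z)‖

variable {Γ B Bx : Finset ((Fin m → ℚ_[p]) → ℚ_[p])} {W Wx : Finset (Set (Fin m → ℚ_[p]))} {M N N0 : ℕ}
  {γ γ' : (Fin m → ℚ_[p]) → ℚ_[p]} {z z' : Fin (m + 1) → ℚ_[p]}

theorem Sim.key (H : Mods p M N0 N) (E : Ext Γ B W M N Bx Wx) (hγ : γ ∈ Γ) (hγ' : γ' ∈ Γ) (hs : Sim Bx Wx N γ z z')
    (hn : Near Γ γ z) :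
    ‖lst z' - γ (prj z')‖ ≤ ‖lst z' - γ' (prj z')‖ ∧
    (‖lst z - γ' (prj z)‖ ≤ ‖lst z - γ (prj z)‖ ↔ ‖lst z' - γ' (prj z')‖ ≤ ‖lst z' - γ (prj z')‖) ∧
    ((‖lst z - γ' (prj z)‖ = ‖lst z - γ (prj z)‖ ∧ ‖lst z' - γ' (prj z')‖ = ‖lst z' - γ (prj z')‖) ∨
      (‖lst z' - γ' (prj z')‖ ≠ ‖lst z' - γ (prj z')‖ ∧ ‖lst z - γ' (prj z)‖ ≠ ‖lst z - γ (prj z)‖ ∧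
       ‖lst z - γ' (prj z)‖ = ‖γ (prj z) - γ' (prj z)‖ ∧ ‖lst z' - γ' (prj z')‖ = ‖γ (prj z') - γ' (prj z')‖)) ∧
    lst z' - γ' (prj z') ∈ cosetP p (lst z - γ' (prj z)) N0 := by
  have := lemL H hs.c (E.cos γ hγ γ' hγ' _ _ hs.x) (fun e h1 h2 => hs.l _ (E.diff γ hγ γ' hγ' e h1 h2))
    (fun e h1 h2 => hs.g _ (E.diff γ hγ γ' hγ' e h1 h2)) (by
      rw [sub_add_sub_cancel]; exact hn γ' hγ')
  simpa only [sub_add_sub_cancel] using this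

theorem Sim.agr (H : Mods p M N0 N) (E : Ext Γ B W M N Bx Wx) (hγ : γ ∈ Γ) (hs : Sim Bx Wx N γ z z')
    (hn : Near Γ γ z) : Agr Γ B W N0 z z' := by
  refine ⟨fun S hS => hs.x S (E.WW hS), fun γ' hγ' => (hs.key H E hγ hγ' hn).2.2.2, fun γ' hγ' b hb => ?_⟩
  rcases (hs.key H E hγ hγ' hn).2.2.1 with ⟨h1, h2⟩ | ⟨-, -, h1, h2⟩
  · rw [h1, h2]; exact hs.l b (E.BB hb)
  · rw [h1, h2]
    have := E.cmp _ (E.diff γ hγ γ' hγ' 0 (by omega) (by omega)) b (E.BB hb) _ _ hs.x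
    simpa using this

end Part
end PadicSub

namespace PadicSub
section Part2
variable {p : ℕ} [hp : Fact p.Prime] {m : ℕ}

variable {Γ B Bx : Finset ((Fin m → ℚ_[p]) → ℚ_[p])} {W Wx : Finset (Set (Fin m → ℚ_[p]))} {M N N0 : ℕ}
  {γ γ' : (Fin m → ℚ_[p]) → ℚ_[p]} {z z' : Fin (m + 1) → ℚ_[p]}

theorem exists_least (hΓ : Γ.Nonempty) (rk : ((Fin m → ℚ_[p]) → ℚ_[p]) → ℕ) (z : Fin (m + 1) → ℚ_[p]) :
    ∃ γ ∈ Γ, Near Γ γ z ∧ ∀ γ' ∈ Γ, ‖lst z - γ' (prj z)‖ ≤ ‖lst z - γ (prj z)‖ → rk γ ≤ rk γ' := by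
  classical
  obtain ⟨γ0, h0, h1⟩ := Γ.exists_min_image (fun γ => ‖lst z - γ (prj z)‖) hΓ
  obtain ⟨γ, h2, h3⟩ := (Γ.filter fun γ => ‖lst z - γ (prj z)‖ ≤ ‖lst z - γ0 (prj z)‖).exists_min_image rk
    ⟨γ0, by simp [h0]⟩
  rw [Finset.mem_filter] at h2
  refine ⟨γ, h2.1, fun γ' hγ' => h2.2.trans (h1 γ' hγ'), fun γ' hγ' hle => ?_⟩
  exact h3 γ' (Finset.mem_filter.2 ⟨hγ', hle.trans h2.2⟩)

/-- The pieces: a finite-valued key whose fibres are the sets `Sim γ z₀`. -/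
theorem exists_key (H : Mods p M N0 N) (E : Ext Γ B W M N Bx Wx) (hΓ : Γ.Nonempty) :
    ∃ (K : Type) (key : (Fin (m + 1) → ℚ_[p]) → K), (Set.range key).Finite ∧
      ∀ z0, ∃ γ ∈ Γ, Near Γ γ z0 ∧ ∀ z, key z = key z0 ↔ Sim Bx Wx N γ z0 z := by
  classical
  let rk : ((Fin m → ℚ_[p]) → ℚ_[p]) → ℕ := fun γ => if h : γ ∈ Γ then (Γ.equivFin ⟨γ, h⟩ : ℕ) else 0
  have rk_inj : ∀ γ ∈ Γ, ∀ γ' ∈ Γ, rk γ = rk γ' → γ = γ' := by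
    intro γ h γ' h' he
    simp only [rk, dif_pos h, dif_pos h'] at he
    have := Γ.equivFin.injective (Fin.ext he)
    exact congrArg Subtype.val this
  choose c hcΓ hcn hcl using exists_least hΓ rk
  have huniq : ∀ z, ∀ γ ∈ Γ, Near Γ γ z → (∀ γ' ∈ Γ, ‖lst z - γ' (prj z)‖ ≤ ‖lst z - γ (prj z)‖ → rk γ ≤ rk γ') →
      c z = γ := by
    intro z γ hγ hn hl
    exact rk_inj _ (hcΓ z) _ hγ (le_antisymm (hcl z γ hγ (hn _ (hcΓ z))) (hl _ (hcΓ z) (hcn z γ hγ)))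
  let τ : (Fin (m + 1) → ℚ_[p]) → ℚ_[p] := fun z => lst z - c z (prj z)
  let key : (Fin (m + 1) → ℚ_[p]) → ((Fin m → ℚ_[p]) → ℚ_[p]) × Finset (Set (Fin m → ℚ_[p])) × Set ℚ_[p] ×
      Finset ((Fin m → ℚ_[p]) → ℚ_[p]) × Finset ((Fin m → ℚ_[p]) → ℚ_[p]) := fun z =>
    (c z, Wx.filter (fun S => prj z ∈ S), cosetP p (τ z) N, Bx.filter (fun b => ‖τ z‖ ≤ ‖b (prj z)‖),
      Bx.filter (fun b => ‖b (prj z)‖ ≤ ‖τ z‖))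
  obtain ⟨R, hR⟩ := exists_finite_cosets (p := p) N H.pos
  refine ⟨_, key, ?_, fun z0 => ⟨c z0, hcΓ z0, hcn z0, fun z => ?_⟩⟩
  · refine Set.Finite.subset (Finset.finite_toSet (Γ ×ˢ Wx.powerset ×ˢ (R.image fun μ => cosetP p μ N) ×ˢ
      Bx.powerset ×ˢ Bx.powerset)) ?_
    rintro _ ⟨z, rfl⟩
    simp only [Finset.mem_coe, Finset.mem_product, key, Finset.mem_powerset, Finset.filter_subset, and_true,
      Finset.mem_image, true_and]
    refine ⟨hcΓ z, ?_⟩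
    obtain ⟨μ, hμ, h⟩ := hR (τ z)
    refine ⟨μ, hμ, ?_⟩
    ext y
    exact ⟨fun hy => cosetP_trans hy (cosetP_symm h), fun hy => cosetP_trans hy h⟩
  · constructor
    · intro h
      simp only [key, Prod.mk.injEq] at h
      obtain ⟨h1, h2, h3, h4, h5⟩ := h
      have hτ : τ z = lst z - c z0 (prj z) := by simp only [τ, h1]
      rw [hτ] at h3 h4 h5
      refine ⟨fun S hS => ?_, ?_, fun b hb => ?_, fun b hb => ?_⟩
      · have := Finset.ext_iff.1 h2 S
        simpa [hS] using this.symm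
      · show _ ∈ cosetP p (τ z0) N
        rw [← h3]; exact mem_cosetP_self _ _
      · have := Finset.ext_iff.1 h4 b
        simpa [hb] using this.symm
      · have := Finset.ext_iff.1 h5 b
        simpa [hb] using this.symm
    · intro hs
      have hc : c z = c z0 := by
        refine huniq z _ (hcΓ z0) (fun γ' hγ' => (hs.key H E (hcΓ z0) hγ' (hcn z0)).1) fun γ' hγ' hle => ?_
        exact hcl z0 γ' hγ' ((hs.key H E (hcΓ z0) hγ' (hcn z0)).2.1.2 hle)
      have hτ : τ z = lst z - c z0 (prj z) := by simp only [τ, hc]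
      simp only [key, Prod.mk.injEq]
      rw [hτ]
      refine ⟨hc, ?_, ?_, ?_, ?_⟩
      · exact Finset.filter_congr fun S hS => (hs.x S hS).symm
      · ext y
        exact ⟨fun hy => cosetP_trans hy hs.c, fun hy => cosetP_trans hy (cosetP_symm hs.c)⟩
      · exact Finset.filter_congr fun b hb => (hs.l b hb).symm
      · exact Finset.filter_congr fun b hb => (hs.g b hb).symm

/-- Precells: cells whose base is only a subanalytic set. -/
def preC (D : Set (Fin m → ℚ_[p])) (γ α β : (Fin m → ℚ_[p]) → ℚ_[p]) (b₁ b₂ : Bool) (μ : ℚ_[p]) (n : ℕ) :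
    Set (Fin (m + 1) → ℚ_[p]) :=
  {z | prj z ∈ D ∧ sqRel b₁ ‖α (prj z)‖ ‖lst z - γ (prj z)‖ ∧ sqRel b₂ ‖lst z - γ (prj z)‖ ‖β (prj z)‖ ∧
    lst z - γ (prj z) ∈ cosetP p μ n}

theorem IsDP.nz {b : (Fin m → ℚ_[p]) → ℚ_[p]} (hb : IsDP b) : ∃ b', IsDP b' ∧ (∀ x, b' x ≠ 0) ∧ ∀ x, b x ≠ 0 → b' x = b x := by
  classical
  refine ⟨fun x => b x + if b x = 0 then 1 else 0, (dclosed_DP m).add hb ((dclosed_DP m).indEq hb), fun x => ?_, fun x hx => ?_⟩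
  · by_cases h : b x = 0 <;> simp [h]
  · simp [hx]

theorem sim_pre (E : Ext Γ B W M N Bx Wx) (γ : (Fin m → ℚ_[p]) → ℚ_[p]) (z0 : Fin (m + 1) → ℚ_[p]) :
    ∃ (D : Set (Fin m → ℚ_[p])) (α β : (Fin m → ℚ_[p]) → ℚ_[p]) (b₁ b₂ : Bool), IsSubanalytic p D ∧ IsDP α ∧ IsDP β ∧
      (∀ x, α x ≠ 0) ∧ (∀ x, β x ≠ 0) ∧
      {z | Sim Bx Wx N γ z0 z} = preC D γ α β b₁ b₂ (lst z0 - γ (prj z0)) N := by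
  classical
  set τ0 := lst z0 - γ (prj z0) with hτ0
  set x0 := prj z0 with hx0
  have hDs : IsSubanalytic p {x | Sx Wx x0 x} := by
    refine sub_of_det Wx E.tame.x _ fun x x' h h' S hS => (h' S hS).trans (h S hS)
  have h1DP : IsDP (fun _ : Fin m → ℚ_[p] => (1 : ℚ_[p])) := (dclosed_DP m).const 1
  have hz : ∀ b ∈ Bx, ∀ x, Sx Wx x0 x → (b x0 = 0 ↔ b x = 0) := by
    intro b hb x hx
    have := E.cmp b hb _ E.zero _ _ hx
    simpa using this
  -- strict lower and upper bounds
  have hlow : ∃ (α : (Fin m → ℚ_[p]) → ℚ_[p]) (b₁ : Bool), IsDP α ∧ (∀ x, α x ≠ 0) ∧ ∀ x, Sx Wx x0 x → ∀ t : ℚ_[p], t ≠ 0 →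
      (sqRel b₁ ‖α x‖ ‖t‖ ↔ ∀ b ∈ Bx, ‖b x0‖ < ‖τ0‖ → ‖b x‖ < ‖t‖) := by
    by_cases hL : (Bx.filter fun b => b x0 ≠ 0 ∧ ‖b x0‖ < ‖τ0‖).Nonempty
    · obtain ⟨a, ha, hmax⟩ := Finset.exists_max_image _ (fun b => ‖b x0‖) hL
      rw [Finset.mem_filter] at ha
      obtain ⟨a', ha', hnz, heq⟩ := (E.tame.b a ha.1).nz
      refine ⟨a', true, ha', hnz, fun x hx t ht => ?_⟩
      have hax : a x ≠ 0 := fun h => ha.2.1 ((hz a ha.1 x hx).2 h)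
      rw [heq x hax]
      constructor
      · intro h b hb hlt
        have h : ‖a x‖ < ‖t‖ := h rfl
        by_cases hb0 : b x0 = 0
        · rw [(hz b hb x hx).1 hb0, norm_zero]; exact norm_pos_iff.2 ht
        · exact ((E.cmp b hb a ha.1 _ _ hx).1 (hmax b (Finset.mem_filter.2 ⟨hb, hb0, hlt⟩))).trans_lt h
      · intro h _
        exact h a ha.1 ha.2.2
    · refine ⟨fun _ => 1, false, h1DP, fun _ => one_ne_zero, fun x hx t ht => ?_⟩
      refine ⟨fun _ b hb hlt => ?_, fun _ h => absurd h (by simp)⟩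
      by_cases hb0 : b x0 = 0
      · rw [(hz b hb x hx).1 hb0, norm_zero]; exact norm_pos_iff.2 ht
      · exact absurd ⟨b, Finset.mem_filter.2 ⟨hb, hb0, hlt⟩⟩ hL
  have hupp : ∃ (β : (Fin m → ℚ_[p]) → ℚ_[p]) (b₂ : Bool), IsDP β ∧ (∀ x, β x ≠ 0) ∧ ∀ x, Sx Wx x0 x → ∀ t : ℚ_[p],
      (sqRel b₂ ‖t‖ ‖β x‖ ↔ ∀ b ∈ Bx, ‖τ0‖ < ‖b x0‖ → ‖t‖ < ‖b x‖) := by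
    by_cases hL : (Bx.filter fun b => ‖τ0‖ < ‖b x0‖).Nonempty
    · obtain ⟨a, ha, hmax⟩ := Finset.exists_min_image _ (fun b => ‖b x0‖) hL
      rw [Finset.mem_filter] at ha
      obtain ⟨a', ha', hnz, heq⟩ := (E.tame.b a ha.1).nz
      refine ⟨a', true, ha', hnz, fun x hx t => ?_⟩
      have hax : a x ≠ 0 := fun h => by
        have := (hz a ha.1 x hx).2 h
        have h2 := ha.2
        rw [this, norm_zero] at h2
        exact absurd h2 (not_lt.2 (norm_nonneg _))
      rw [heq x hax]
      constructor
      · intro h b hb hlt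
        have h : ‖t‖ < ‖a x‖ := h rfl
        exact h.trans_le ((E.cmp a ha.1 b hb _ _ hx).1 (hmax b (Finset.mem_filter.2 ⟨hb, hlt⟩)))
      · intro h _
        exact h a ha.1 ha.2
    · refine ⟨fun _ => 1, false, h1DP, fun _ => one_ne_zero, fun x hx t => ?_⟩
      refine ⟨fun _ b hb hlt => ?_, fun _ h => absurd h (by simp)⟩
      exact absurd ⟨b, Finset.mem_filter.2 ⟨hb, hlt⟩⟩ hL
  by_cases ht0 : τ0 = 0
  · refine ⟨_, fun _ => 1, fun _ => 1, false, false, hDs, h1DP, h1DP, fun _ => one_ne_zero, fun _ => one_ne_zero, ?_⟩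
    ext z
    constructor
    · intro hs
      exact ⟨hs.x, fun h => absurd h (by simp), fun h => absurd h (by simp), hs.c⟩
    · rintro ⟨h1, -, -, h2⟩
      have h3 : lst z - γ (prj z) = 0 := (cosetP_eq_zero_iff h2).2 ht0
      refine ⟨h1, h2, fun b hb => ?_, fun b hb => ?_⟩
      · rw [h3, ← hτ0, ht0]; simp
      · rw [h3, ← hτ0, ht0]
        simpa using hz b hb _ h1
  by_cases heq : ∃ b ∈ Bx, ‖b x0‖ = ‖τ0‖
  · obtain ⟨b, hb, hbe⟩ := heq
    have hb0 : b x0 ≠ 0 := by rw [← norm_pos_iff, hbe, norm_pos_iff]; exact ht0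
    obtain ⟨b', hb', hnz, hbb⟩ := (E.tame.b b hb).nz
    have hp0 : (p : ℚ_[p]) ≠ 0 := p_ne_zero'
    refine ⟨_, fun x => (p : ℚ_[p]) * b' x, fun x => (p : ℚ_[p])⁻¹ * b' x, true, true, hDs,
      (dclosed_DP m).mul ((dclosed_DP m).const _) hb', (dclosed_DP m).mul ((dclosed_DP m).const _) hb',
      fun x => mul_ne_zero hp0 (hnz x), fun x => mul_ne_zero (inv_ne_zero hp0) (hnz x), ?_⟩
    have hnorm : ∀ t s : ℚ_[p], s ≠ 0 → ((‖(p : ℚ_[p]) * s‖ < ‖t‖ ∧ ‖t‖ < ‖(p : ℚ_[p])⁻¹ * s‖) ↔ ‖s‖ = ‖t‖) := by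
      intro t s hs
      have hsp : 0 < ‖s‖ := norm_pos_iff.2 hs
      have hpp := norm_p_pos (p := p)
      rw [norm_mul, norm_mul, norm_inv]
      constructor
      · rintro ⟨h1, h2⟩
        apply le_antisymm
        · by_contra hlt
          exact absurd ((norm_lt_iff_le_p_mul t s).1 (not_le.1 hlt)).2 (not_le.2 h1)
        · by_contra hlt
          have := ((norm_lt_iff_le_p_mul s t).1 (not_le.1 hlt)).2
          rw [inv_mul_eq_div, lt_div_iff₀ hpp] at h2
          linarith
      · intro h
        rw [← h, inv_mul_eq_div, lt_div_iff₀ hpp]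
        have := norm_p_lt_one' (p := p)
        constructor <;> nlinarith
    ext z
    constructor
    · intro hs
      have hbx : b (prj z) ≠ 0 := fun h => hb0 ((hz b hb _ hs.x).2 h)
      have h1 : ‖b (prj z)‖ = ‖lst z - γ (prj z)‖ :=
        le_antisymm ((hs.g b hb).1 hbe.le) ((hs.l b hb).1 hbe.ge)
      have h2 := (hnorm _ _ hbx).2 h1
      refine ⟨hs.x, fun _ => ?_, fun _ => ?_, hs.c⟩
      · beta_reduce; rw [hbb _ hbx]; exact h2.1
      · beta_reduce; rw [hbb _ hbx]; exact h2.2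
    · rintro ⟨h1, h2, h3, h4⟩
      have hbx : b (prj z) ≠ 0 := fun h => hb0 ((hz b hb _ h1).2 h)
      have h2 := h2 rfl
      have h3 := h3 rfl
      beta_reduce at h2 h3
      rw [hbb _ hbx] at h2 h3
      have h5 := (hnorm _ _ hbx).1 ⟨h2, h3⟩
      refine ⟨h1, h4, fun c hc => ?_, fun c hc => ?_⟩
      · rw [← h5, ← hτ0, ← hbe]; exact E.cmp _ hb _ hc _ _ h1
      · rw [← h5, ← hτ0, ← hbe]; exact E.cmp _ hc _ hb _ _ h1
  · obtain ⟨α, b₁, hα, hα0, hA⟩ := hlow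
    obtain ⟨β, b₂, hβ, hβ0, hB⟩ := hupp
    refine ⟨_, α, β, b₁, b₂, hDs, hα, hβ, hα0, hβ0, ?_⟩
    ext z
    constructor
    · intro hs
      have htz : lst z - γ (prj z) ≠ 0 := fun h => ht0 ((cosetP_eq_zero_iff hs.c).1 h)
      refine ⟨hs.x, (hA _ hs.x _ htz).2 fun b hb hlt => ?_, (hB _ hs.x _).2 fun b hb hlt => ?_, hs.c⟩
      · exact not_le.1 fun h => not_le.2 hlt ((hs.l b hb).2 h)
      · exact not_le.1 fun h => not_le.2 hlt ((hs.g b hb).2 h)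
    · rintro ⟨h1, h2, h3, h4⟩
      have htz : lst z - γ (prj z) ≠ 0 := fun h => ht0 ((cosetP_eq_zero_iff h4).1 h)
      have h2 := (hA _ h1 _ htz).1 h2
      have h3 := (hB _ h1 _).1 h3
      have key : ∀ b ∈ Bx, (‖b x0‖ < ‖τ0‖ ∧ ‖b (prj z)‖ < ‖lst z - γ (prj z)‖) ∨
          (‖τ0‖ < ‖b x0‖ ∧ ‖lst z - γ (prj z)‖ < ‖b (prj z)‖) := by
        intro b hb
        rcases lt_trichotomy ‖b x0‖ ‖τ0‖ with h | h | h
        · exact Or.inl ⟨h, h2 b hb h⟩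
        · exact absurd ⟨b, hb, h⟩ heq
        · exact Or.inr ⟨h, h3 b hb h⟩
      refine ⟨h1, h4, fun b hb => ?_, fun b hb => ?_⟩
      · rcases key b hb with ⟨a1, a2⟩ | ⟨a1, a2⟩
        · exact ⟨fun h => absurd h (not_le.2 a1), fun h => absurd h (not_le.2 a2)⟩
        · exact ⟨fun _ => a2.le, fun _ => a1.le⟩
      · rcases key b hb with ⟨a1, a2⟩ | ⟨a1, a2⟩
        · exact ⟨fun _ => a2.le, fun _ => a1.le⟩
        · exact ⟨fun h => absurd h (not_le.2 a1), fun h => absurd h (not_le.2 a2)⟩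

end Part2
end PadicSub

namespace PadicSub
section Pre
variable {p : ℕ} [hp : Fact p.Prime] {m : ℕ}

theorem coset_factor {μ τ : ℚ_[p]} {N E n' : ℕ} (hN : 0 < N) (hNE : N = E * n') {a : ℤ} (h0 : μ = 0 → a = 0)
    (h : τ ∈ cosetP p μ N) :
    ∃ y : ℚ_[p], ‖τ ^ a‖ = ‖μ ^ a‖ * ‖y‖ ^ E ∧ ‖τ ^ (a * n') * μ ^ (-(a * n'))‖ ^ ((N : ℝ)⁻¹) = ‖y‖ := by
  by_cases hμ : μ = 0
  · refine ⟨1, ?_, ?_⟩ <;> simp [h0 hμ]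
  · obtain ⟨y, hy0, hy⟩ := (mem_cosetP_iff hμ).1 h
    have hτ : τ = μ * y ^ N := by rw [hy, mul_div_cancel₀ _ hμ]
    refine ⟨y ^ (a * n'), ?_, ?_⟩
    · rw [hτ, mul_zpow, norm_mul, ← norm_pow]
      congr 2
      rw [← zpow_natCast, ← zpow_natCast, ← zpow_mul, ← zpow_mul, hNE]; push_cast; congr 1; ring
    · have : τ ^ (a * n') * μ ^ (-(a * n')) = (y ^ (a * n')) ^ N := by
        rw [hτ, mul_zpow, zpow_neg, mul_right_comm, mul_inv_cancel₀ (zpow_ne_zero _ hμ), one_mul,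
          ← zpow_natCast, ← zpow_natCast, ← zpow_mul, ← zpow_mul, mul_comm]
      rw [this, norm_pow, Real.pow_rpow_inv_natCast (norm_nonneg _) hN.ne']

theorem root_formula {E N' N : ℕ} (hE : 0 < E) (hN : 0 < N) (hEN : E ∣ N)
    (hroot : ∀ {m : ℕ} {h : (Fin m → ℚ_[p]) → ℚ_[p]}, IsDP h →
      ∃ w : (Fin m → ℚ_[p]) → ℚ_[p], IsDP w ∧ ∀ x, h x ∈ Pset p N' → w x ^ E = h x)
    {A : Set (Fin (m + 1) → ℚ_[p])} {z0 : Fin (m + 1) → ℚ_[p]} (hz0 : z0 ∈ A) {γ h : (Fin m → ℚ_[p]) → ℚ_[p]} (hh : IsDP h)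
    {F : (Fin (m + 1) → ℚ_[p]) → ℚ_[p]} {a : ℤ} (ha : lst z0 - γ (prj z0) = 0 → a = 0)
    (hc : ∀ z ∈ A, h (prj z) ∈ cosetP p (h (prj z0)) N')
    (hτ : ∀ z ∈ A, lst z - γ (prj z) ∈ cosetP p (lst z0 - γ (prj z0)) N)
    (hF : ∀ z ∈ A, ‖F z‖ ^ E = ‖h (prj z) * (lst z - γ (prj z)) ^ a‖) :
    ∃ (δ : (Fin m → ℚ_[p]) → ℚ_[p]) (a' : ℤ), IsDP δ ∧ (lst z0 - γ (prj z0) = 0 → a' = 0) ∧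
      ∀ z ∈ A, ‖F z‖ = ‖δ (prj z)‖ * ‖(lst z - γ (prj z)) ^ a' * (lst z0 - γ (prj z0)) ^ (-a')‖ ^ ((N : ℝ)⁻¹) := by
  obtain ⟨n', hn'⟩ := hEN
  set μ := lst z0 - γ (prj z0) with hμ
  set ν := h (prj z0) with hν
  obtain ⟨w, hw, hwE⟩ := hroot (h := fun x => h x * ν⁻¹) ((dclosed_DP m).mul hh ((dclosed_DP m).const _))
  refine ⟨fun x => F z0 * w x, a * n', (dclosed_DP m).mul ((dclosed_DP m).const _) hw, fun h => by rw [ha h, zero_mul], ?_⟩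
  intro z hz
  obtain ⟨y, hy1, hy2⟩ := coset_factor hN hn' ha (hτ z hz)
  have h0 := hF z0 hz0
  have h1 := hF z hz
  rw [← hμ, ← hν] at h0
  rw [hy2]
  by_cases hν0 : ν = 0
  · have e1 : F z0 = 0 := by
      rw [hν0, zero_mul, norm_zero] at h0
      exact norm_eq_zero.1 (pow_eq_zero_iff hE.ne' |>.1 h0)
    have e2 : h (prj z) = 0 := (cosetP_eq_zero_iff (hc z hz)).2 hν0
    rw [e2, zero_mul, norm_zero] at h1
    have e3 := (pow_eq_zero_iff hE.ne').1 h1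
    rw [e3, e1]
    simp
  · have e1 : h (prj z) / ν ∈ Pset p N' := (mem_cosetP_iff hν0).1 (hc z hz)
    have e2 := hwE (prj z) (by beta_reduce; rw [← div_eq_mul_inv]; exact e1)
    have e3 : h (prj z) = ν * w (prj z) ^ E := by
      rw [e2]; field_simp
    apply (pow_left_inj₀ (norm_nonneg _) (by positivity) hE.ne').1
    beta_reduce
    rw [h1, e3, norm_mul, hy1, norm_mul, norm_mul, mul_pow, mul_pow, h0, norm_mul, norm_pow]
    ring

/-- A precell adapted to `f`. -/
def PreGood {r : ℕ} (f : Fin r → (Fin (m + 1) → ℚ_[p]) → ℚ_[p]) (A : Set (Fin (m + 1) → ℚ_[p])) : Prop :=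
  ∃ (D : Set (Fin m → ℚ_[p])) (γ α β : (Fin m → ℚ_[p]) → ℚ_[p]) (b₁ b₂ : Bool) (μ : ℚ_[p]) (n : ℕ)
    (a : Fin r → ℤ) (δ : Fin r → (Fin m → ℚ_[p]) → ℚ_[p]),
    0 < n ∧ IsSubanalytic p D ∧ IsDP γ ∧ IsDP α ∧ IsDP β ∧ (∀ x, α x ≠ 0) ∧ (∀ x, β x ≠ 0) ∧
    A = preC D γ α β b₁ b₂ μ n ∧ (∀ j, IsDP (δ j)) ∧ (∀ j, μ = 0 → a j = 0) ∧
    ∀ z ∈ A, ∀ j, ‖f j z‖ = ‖δ j (prj z)‖ * ‖(lst z - γ (prj z)) ^ a j * μ ^ (-(a j))‖ ^ ((n : ℝ)⁻¹)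

theorem pre_decomp {r : ℕ} {X : Set (Fin (m + 1) → ℚ_[p])} (hX : IsSubanalytic p X)
    {f : Fin r → (Fin (m + 1) → ℚ_[p]) → ℚ_[p]} (hf : ∀ j, IsSubanalyticFnOn p X (f j)) :
    ∃ 𝒜 : Set (Set (Fin (m + 1) → ℚ_[p])), 𝒜.Finite ∧ 𝒜.PairwiseDisjoint id ∧ ⋃₀ 𝒜 = X ∧
      ∀ A ∈ 𝒜, A.Nonempty ∧ PreGood f A := by
  classical
  obtain ⟨s, hs, hc, E, hE, h⟩ := global_cover hX hf
  choose! γ hγ δ hδ a ha using h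
  obtain ⟨Γ0, B, W0, N0, hN0, hT0, hD0⟩ := Tame.common s fun I hI => (hs I hI).1
  obtain ⟨N', hN', hroot⟩ := IsDP.root_global (p := p) hE
  obtain ⟨R, hR⟩ := exists_finite_cosets (p := p) N' hN'
  set Γ := insert (fun _ => 0) (Γ0 ∪ s.image γ) with hΓdef
  set W := W0 ∪ (s ×ˢ (Finset.univ : Finset (Fin r)) ×ˢ R).image
    (fun q => {x | δ q.1 q.2.1 x ∈ cosetP p q.2.2 N'}) with hWdef
  have hT : TameD Γ B W := by
    refine ⟨?_, hT0.b, ?_⟩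
    · intro g hg
      rcases Finset.mem_insert.1 hg with rfl | hg
      · exact (dclosed_DP m).const 0
      rcases Finset.mem_union.1 hg with hg | hg
      · exact hT0.c g hg
      · obtain ⟨I, hI, rfl⟩ := Finset.mem_image.1 hg
        exact hγ I hI
    · intro S hS
      rcases Finset.mem_union.1 hS with hS | hS
      · exact hT0.x S hS
      · obtain ⟨q, hq, rfl⟩ := Finset.mem_image.1 hS
        rw [Finset.mem_product] at hq
        exact (hδ q.1 hq.1 q.2.1).coset _ hN'
  obtain ⟨M, N, H, hK⟩ := exists_mods (p := p) hN0 (E * N') (Nat.mul_pos hE hN')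
  obtain ⟨Bx, Wx, Ex⟩ := exists_ext hT M H.pos
  obtain ⟨K, key, hfin, hkey⟩ := exists_key H Ex ⟨_, Finset.mem_insert_self _ _⟩
  refine ⟨(fun k => key ⁻¹' {k}) '' (key '' X), ((hfin.subset (Set.image_subset_range _ _)).image _), ?_, ?_, ?_⟩
  · rintro _ ⟨k, -, rfl⟩ _ ⟨k', -, rfl⟩ hne
    refine Set.disjoint_left.2 fun z hz hz' => hne ?_
    have hz : key z = k := hz
    have hz' : key z = k' := hz'
    rw [← hz, ← hz']
  · ext z
    constructor
    · rintro ⟨_, ⟨_, ⟨z0, hz0, rfl⟩, rfl⟩, hz⟩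
      obtain ⟨g, hg, hn, hsim⟩ := hkey z0
      have hs' := (hsim z).1 hz
      obtain ⟨I, hI, hzI⟩ := Set.mem_iUnion₂.1 (hc hz0)
      have hagr := hs'.agr H Ex hg hn
      exact (hs I hI).2 ((hD0 I hI).mono (Finset.subset_union_left.trans (Finset.subset_insert _ _)) subset_rfl
        Finset.subset_union_left dvd_rfl z0 z hagr hzI)
    · intro hz
      exact ⟨_, ⟨_, ⟨z, hz, rfl⟩, rfl⟩, rfl⟩
  · rintro _ ⟨_, ⟨z0, hz0, rfl⟩, rfl⟩
    refine ⟨⟨z0, rfl⟩, ?_⟩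
    obtain ⟨g, hg, hn, hsim⟩ := hkey z0
    obtain ⟨I, hI, hzI⟩ := Set.mem_iUnion₂.1 (hc hz0)
    have hA : key ⁻¹' {key z0} = {z | Sim Bx Wx N g z0 z} := by
      ext z; exact hsim z
    have hz0A : z0 ∈ {z | Sim Bx Wx N g z0 z} := (hsim z0).1 rfl
    rw [show (fun k => key ⁻¹' {k}) (key z0) = {z | Sim Bx Wx N g z0 z} from hA]
    have hAI : ∀ z ∈ {z | Sim Bx Wx N g z0 z}, z ∈ I := fun z hz =>
      (hD0 I hI).mono (Finset.subset_union_left.trans (Finset.subset_insert _ _)) subset_rfl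
        Finset.subset_union_left dvd_rfl z0 z (hz.agr H Ex hg hn) hzI
    have hγI : γ I ∈ Γ := Finset.mem_insert_of_mem (Finset.mem_union_right _ (Finset.mem_image_of_mem _ hI))
    have hδc : ∀ j, ∀ z ∈ {z | Sim Bx Wx N g z0 z}, δ I j (prj z) ∈ cosetP p (δ I j (prj z0)) N' := by
      intro j z hz
      obtain ⟨ν, hν, h1⟩ := hR (δ I j (prj z0))
      have := (hz.x {x | δ I j x ∈ cosetP p ν N'} (Ex.WW (Finset.mem_union_right _
        (Finset.mem_image.2 ⟨(I, j, ν), by simp [hI, hν], rfl⟩)))).1 h1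
      exact cosetP_trans this (cosetP_symm h1)
    have hEN : E ∣ N := (Nat.dvd_mul_right _ _).trans hK
    have hN'N : N' ∣ N := (Nat.dvd_mul_left _ _).trans hK
    obtain ⟨D, α, β, b₁, b₂, hD, hα, hβ, hα0, hβ0, heq⟩ := sim_pre Ex g z0
    have main : ∀ j, ∃ (δ : (Fin m → ℚ_[p]) → ℚ_[p]) (a' : ℤ), IsDP δ ∧ (lst z0 - g (prj z0) = 0 → a' = 0) ∧
      ∀ z ∈ {z | Sim Bx Wx N g z0 z},
        ‖f j z‖ = ‖δ (prj z)‖ * ‖(lst z - g (prj z)) ^ a' * (lst z0 - g (prj z0)) ^ (-a')‖ ^ ((N : ℝ)⁻¹) := by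
      intro j
      have hkk := fun z (hz : Sim Bx Wx N g z0 z) => (hz.key H Ex hg hγI hn).2.2.1
      by_cases hcase : ‖lst z0 - γ I (prj z0)‖ = ‖lst z0 - g (prj z0)‖
      · have hall : ∀ z ∈ {z | Sim Bx Wx N g z0 z}, ‖lst z - γ I (prj z)‖ = ‖lst z - g (prj z)‖ := by
          intro z hz
          rcases hkk z hz with ⟨_, h2⟩ | ⟨_, h2, _⟩
          · exact h2
          · exact absurd hcase h2
        by_cases h00 : lst z0 - g (prj z0) = 0
        · refine root_formula hE H.pos hEN hroot hz0A (h := fun x => δ I j x * 0 ^ (a I j))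
            ((dclosed_DP m).mul (hδ I hI j) ((dclosed_DP m).const _)) (a := 0) (fun _ => rfl)
            (fun z hz => cosetP_mul (hδc j z hz) (mem_cosetP_self _ _)) (fun z hz => hz.c) fun z hz => ?_
          have e1 : lst z - g (prj z) = 0 := (cosetP_eq_zero_iff hz.c).2 h00
          have e2 : lst z - γ I (prj z) = 0 := by rw [← norm_eq_zero, hall z hz, e1, norm_zero]
          rw [ha I hI j z (hAI z hz), e2, zpow_zero, mul_one]
        · refine root_formula hE H.pos hEN hroot hz0A (hδ I hI j) (a := a I j) (fun h => absurd h h00)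
            (hδc j) (fun z hz => hz.c) fun z hz => ?_
          rw [ha I hI j z (hAI z hz), norm_mul, norm_mul, norm_zpow, norm_zpow, hall z hz]
      · refine root_formula hE H.pos hEN hroot hz0A (h := fun x => δ I j x * (g x - γ I x) ^ (a I j))
            ((dclosed_DP m).mul (hδ I hI j) ((dclosed_DP m).zpow ((dclosed_DP m).sub (hT.c g hg) (hT.c _ hγI)) _))
            (a := 0) (fun _ => rfl)
            (fun z hz => cosetP_mul (hδc j z hz) (cosetP_zpow _ (cosetP_dvd hN'N (Ex.cos g hg _ hγI _ _ hz.x))))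
            (fun z hz => hz.c) fun z hz => ?_
        rcases hkk z hz with ⟨h2, _⟩ | ⟨_, _, _, h2⟩
        · exact absurd h2 hcase
        · rw [ha I hI j z (hAI z hz), norm_mul, norm_zpow, h2, zpow_zero, mul_one, norm_mul, norm_zpow]
    choose δ' a' h1 h2 h3 using main
    exact ⟨D, g, α, β, b₁, b₂, lst z0 - g (prj z0), N, a', δ', H.pos, hD, hT.c g hg, hα, hβ, hα0, hβ0, heq, h1, h2,
      fun z hz j => h3 j z hz⟩

end Pre
end PadicSub

namespace PadicSub
section Part4
variable {p : ℕ} [hp : Fact p.Prime] {m : ℕ}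

theorem mem_prj_preC {D : Set (Fin m → ℚ_[p])} {γ α β : (Fin m → ℚ_[p]) → ℚ_[p]} {b₁ b₂ : Bool} {μ : ℚ_[p]} {n : ℕ}
    {x : Fin m → ℚ_[p]} :
    x ∈ prj '' preC D γ α β b₁ b₂ μ n ↔ x ∈ D ∧ ∃ τ ∈ cosetP p μ n, sqRel b₁ ‖α x‖ ‖τ‖ ∧ sqRel b₂ ‖τ‖ ‖β x‖ := by
  constructor
  · rintro ⟨z, hz, rfl⟩
    exact ⟨hz.1, _, hz.2.2.2, hz.2.1, hz.2.2.1⟩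
  · rintro ⟨hx, τ, h1, h2, h3⟩
    refine ⟨snc x (τ + γ x), ?_, prj_snc _ _⟩
    have e : lst (snc x (τ + γ x)) - γ (prj (snc x (τ + γ x))) = τ := by
      rw [prj_snc, lst_snc, add_sub_cancel_right]
    refine ⟨?_, ?_, ?_, ?_⟩
    · rw [prj_snc]; exact hx
    · rw [e, prj_snc]; exact h2
    · rw [e, prj_snc]; exact h3
    · rw [e]; exact h1

theorem pow_mem_Pset (c : ℤ) (n : ℕ) : ((p : ℚ_[p]) ^ c) ^ n ∈ Pset p n :=
  ⟨_, zpow_ne_zero _ p_ne_zero', rfl⟩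

theorem exists_small {μ : ℚ_[p]} (n : ℕ) (hn : 0 < n) {c : ℝ} (hc : 0 < c) :
    ∃ τ ∈ cosetP p μ n, ‖τ‖ < c := by
  have h1 : ‖(p : ℚ_[p])‖ ^ n < 1 := pow_lt_one₀ (norm_nonneg _) norm_p_lt_one' hn.ne'
  have ht : Tendsto (fun k : ℕ => ‖μ‖ * (‖(p : ℚ_[p])‖ ^ n) ^ k) atTop (nhds (‖μ‖ * 0)) :=
    (tendsto_pow_atTop_nhds_zero_of_lt_one (by positivity) h1).const_mul _
  rw [mul_zero] at ht
  obtain ⟨k, hk⟩ := (ht.eventually (gt_mem_nhds hc)).exists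
  refine ⟨μ * ((p : ℚ_[p]) ^ (k : ℤ)) ^ n, ⟨_, pow_mem_Pset _ _, rfl⟩, ?_⟩
  rw [norm_mul, norm_pow, zpow_natCast, norm_pow, pow_right_comm]
  exact hk

theorem exists_large {μ : ℚ_[p]} (hμ : μ ≠ 0) (n : ℕ) (hn : 0 < n) {c : ℝ} (hc : 0 < c) :
    ∃ τ ∈ cosetP p μ n, c < ‖τ‖ := by
  obtain ⟨τ, h1, h2⟩ := exists_small (μ := μ⁻¹) n hn (inv_pos.2 hc)
  have h3 := cosetP_inv h1
  rw [inv_inv] at h3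
  refine ⟨τ⁻¹, h3, ?_⟩
  rw [norm_inv]
  have : 0 < ‖τ‖ := norm_pos_iff.2 (cosetP_ne_zero (inv_ne_zero hμ) h1)
  exact (lt_inv_comm₀ hc this).2 h2

theorem prj_preC {D : Set (Fin m → ℚ_[p])} {γ α β : (Fin m → ℚ_[p]) → ℚ_[p]} {b₁ b₂ : Bool} {μ : ℚ_[p]} {n : ℕ}
    (hn : 0 < n) (hD : IsSubanalytic p D) (hα : IsDP α) (hβ : IsDP β) (hα0 : ∀ x, α x ≠ 0) (hβ0 : ∀ x, β x ≠ 0) :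
    IsSubanalytic p (prj '' preC D γ α β b₁ b₂ μ n) := by
  classical
  obtain ⟨R, hR⟩ := exists_finite_cosets (p := p) n hn
  apply sub_of_det (insert D ((R.image fun ν => {x | β x ∈ cosetP p ν n}) ∪
    (Finset.range (n + 1)).image fun e => {x | ‖(p : ℚ_[p]) ^ e * β x‖ ≤ ‖α x‖}))
  · intro S hS
    rcases Finset.mem_insert.1 hS with rfl | hS
    · exact hD
    rcases Finset.mem_union.1 hS with hS | hS
    · obtain ⟨ν, -, rfl⟩ := Finset.mem_image.1 hS
      exact hβ.coset _ hn
    · obtain ⟨e, -, rfl⟩ := Finset.mem_image.1 hS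
      exact ((dclosed_DP m).mul ((dclosed_DP m).const _) hβ).le hα
  · intro x x' hT hx
    rw [mem_prj_preC] at hx ⊢
    obtain ⟨hxD, τ, h1, h2, h3⟩ := hx
    refine ⟨(hT D (Finset.mem_insert_self _ _)).1 hxD, ?_⟩
    have pα : ∀ x, 0 < ‖α x‖ := fun x => norm_pos_iff.2 (hα0 x)
    have pβ : ∀ x, 0 < ‖β x‖ := fun x => norm_pos_iff.2 (hβ0 x)
    by_cases hμ : μ = 0
    · subst hμ
      have : τ = 0 := mem_cosetP_zero.1 h1
      subst this
      refine ⟨0, h1, fun hb => ?_, fun _ => by rw [norm_zero]; exact pβ x'⟩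
      have := h2 hb
      rw [norm_zero] at this
      exact absurd this (not_lt.2 (norm_nonneg _))
    cases b₂
    · obtain ⟨τ', ht, hlt⟩ := exists_large hμ n hn (pα x')
      exact ⟨τ', ht, fun _ => hlt, fun h => absurd h (by simp)⟩
    cases b₁
    · obtain ⟨τ', ht, hlt⟩ := exists_small (μ := μ) n hn (pβ x')
      exact ⟨τ', ht, fun h => absurd h (by simp), fun _ => hlt⟩
    have h2 := h2 rfl
    have h3 := h3 rfl
    have hτ0 : τ ≠ 0 := cosetP_ne_zero hμ h1
    obtain ⟨k, hk⟩ := norm_eq_zpow (τ / β x) (div_ne_zero hτ0 (hβ0 x))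
    have hk' : ‖τ‖ = ‖(p : ℚ_[p]) ^ k * β x‖ := by
      rw [norm_mul, ← hk, ← norm_mul, div_mul_cancel₀ _ (hβ0 x)]
    have hk1 : 1 ≤ k := by
      by_contra hlt
      have h0 : ‖(p : ℚ_[p]) ^ (0 : ℤ)‖ ≤ ‖(p : ℚ_[p]) ^ k‖ := norm_p_zpow_lt.2 (by omega)
      rw [zpow_zero, norm_one, ← hk, norm_div, one_le_div (pβ x)] at h0
      exact absurd h3 (not_lt.2 h0)
    obtain ⟨e, q, he1, hen, hq, rfl⟩ : ∃ (e : ℕ) (q : ℤ), 1 ≤ e ∧ e ≤ n ∧ 0 ≤ q ∧ k = e + n * q := by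
      have hn' : (0 : ℤ) < n := by exact_mod_cast hn
      refine ⟨((k - 1) % n + 1).toNat, (k - 1) / n, ?_, ?_, ?_, ?_⟩
      · have := Int.emod_nonneg (k - 1) hn'.ne'; omega
      · have := Int.emod_lt_of_pos (k - 1) hn'; omega
      · exact Int.ediv_nonneg (by omega) hn'.le
      · have := Int.emod_nonneg (k - 1) hn'.ne'
        have := Int.emod_add_mul_ediv (k - 1) n
        rw [Int.toNat_of_nonneg (by omega)]; omega
    have hkn : ‖τ * ((p : ℚ_[p]) ^ (-q)) ^ n‖ = ‖(p : ℚ_[p]) ^ e * β x‖ := by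
      rw [norm_mul, hk', ← norm_mul, mul_right_comm, zpow_add₀ p_ne_zero', zpow_mul, zpow_neg, inv_pow,
        ← zpow_natCast (p ^ q : ℚ_[p]), zpow_comm, mul_assoc ((p : ℚ_[p]) ^ (e : ℤ)), mul_inv_cancel₀, mul_one, zpow_natCast]
      exact zpow_ne_zero _ (zpow_ne_zero _ p_ne_zero')
    have hle : ‖τ‖ ≤ ‖(p : ℚ_[p]) ^ e * β x‖ := by
      rw [hk', norm_mul, norm_mul]
      refine mul_le_mul_of_nonneg_right ?_ (norm_nonneg _)
      rw [← zpow_natCast]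
      exact norm_p_zpow_lt.2 (by nlinarith)
    have hmem := hT {x | ‖(p : ℚ_[p]) ^ e * β x‖ ≤ ‖α x‖} (Finset.mem_insert_of_mem (Finset.mem_union_right _
      (Finset.mem_image.2 ⟨e, by simp; omega, rfl⟩)))
    have h4 : ‖α x'‖ < ‖(p : ℚ_[p]) ^ e * β x'‖ := by
      by_contra hcon
      have : ‖(p : ℚ_[p]) ^ e * β x‖ ≤ ‖α x‖ := hmem.2 (not_lt.1 hcon)
      exact absurd (h2.trans_le hle) (not_lt.2 this)
    obtain ⟨ν, hν, hxν⟩ := hR (β x)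
    have hmem2 : β x' ∈ cosetP p ν n := (hT {x | β x ∈ cosetP p ν n} (Finset.mem_insert_of_mem (Finset.mem_union_left _
      (Finset.mem_image.2 ⟨ν, hν, rfl⟩)))).1 hxν
    have h5 : β x' / β x ∈ Pset p n := (mem_cosetP_iff (hβ0 x)).1 (cosetP_trans hmem2 (cosetP_symm hxν))
    have h6 : ‖τ * ((p : ℚ_[p]) ^ (-q)) ^ n * (β x' / β x)‖ = ‖(p : ℚ_[p]) ^ e * β x'‖ := by
      rw [norm_mul, hkn, ← norm_mul, mul_assoc, mul_div_cancel₀ _ (hβ0 x)]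
    refine ⟨τ * ((p : ℚ_[p]) ^ (-q)) ^ n * (β x' / β x), ?_, fun _ => by rw [h6]; exact h4, fun _ => ?_⟩
    · obtain ⟨y, hy, rfl⟩ := h1
      exact ⟨_, Pset_mul (Pset_mul hy (pow_mem_Pset (-q) n)) h5, by ring⟩
    · rw [h6, norm_mul, norm_pow]
      exact mul_lt_of_lt_one_left (pβ x') (pow_lt_one₀ (norm_nonneg _) norm_p_lt_one' (by omega))

end Part4
end PadicSub

namespace PadicSub
section Part5
variable {p : ℕ} [hp : Fact p.Prime]

/-- A cell adapted to `f`. -/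
def CellGood {m r : ℕ} (f : Fin r → (Fin (m + 1) → ℚ_[p]) → ℚ_[p]) (A : Set (Fin (m + 1) → ℚ_[p])) : Prop :=
  ∃ (γ : (Fin m → ℚ_[p]) → ℚ_[p]) (μ : ℚ_[p]) (n : ℕ)
    (a : Fin r → ℤ) (δ : Fin r → (Fin m → ℚ_[p]) → ℚ_[p]),
    IsCell p A γ μ n ∧ (∀ j, IsSubanalyticFn p (δ j)) ∧ (∀ j, μ = 0 → a j = 0) ∧
    ∀ z ∈ A, ∀ j, ‖f j z‖ = ‖δ j (prj z)‖ * ‖(lst z - γ (prj z)) ^ a j * μ ^ (-(a j))‖ ^ ((n : ℝ)⁻¹)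

/-- A finite partition of `X` into adapted cells. -/
def HasDecomp {m r : ℕ} (f : Fin r → (Fin (m + 1) → ℚ_[p]) → ℚ_[p]) (X : Set (Fin (m + 1) → ℚ_[p])) : Prop :=
  ∃ 𝒜 : Set (Set (Fin (m + 1) → ℚ_[p])), 𝒜.Finite ∧ 𝒜.PairwiseDisjoint id ∧ ⋃₀ 𝒜 = X ∧ ∀ A ∈ 𝒜, CellGood f A

theorem good_zero {r : ℕ} {f : Fin r → (Fin 1 → ℚ_[p]) → ℚ_[p]} {A : Set (Fin 1 → ℚ_[p])} (hne : A.Nonempty)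
    (h : PreGood f A) : CellGood f A := by
  obtain ⟨D, γ, α, β, b₁, b₂, μ, n, a, δ, hn, hD, hγ, hα, hβ, hα0, hβ0, hA, hδ, ha, hF⟩ := h
  refine ⟨γ, μ, n, a, δ, ?_, fun j => (hδ j).fn, ha, hF⟩
  have e : γ = fun _ => γ default := funext fun x => congrArg γ (Subsingleton.elim _ _)
  rw [e]
  refine IsCell.base n hn μ (γ default) (α default) (β default) (hα0 _) (hβ0 _) b₁ b₂ A hne ?_
  rw [hA] at hne ⊢
  obtain ⟨z0, hz0⟩ := hne
  ext z
  have e1 : prj z = default := Subsingleton.elim _ _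
  have e2 : prj z0 = default := Subsingleton.elim _ _
  have h1 : (default : Fin 0 → ℚ_[p]) ∈ D := by rw [← e2]; exact hz0.1
  constructor
  · rintro ⟨-, h2, h3, h4⟩
    rw [e1] at h2 h3 h4
    exact ⟨h2, h3, h4⟩
  · rintro ⟨h2, h3, h4⟩
    refine ⟨by rw [e1]; exact h1, ?_, ?_, ?_⟩ <;> rw [e1]
    · exact h2
    · exact h3
    · exact h4

theorem good_succ {m r : ℕ} {f : Fin r → (Fin (m + 2) → ℚ_[p]) → ℚ_[p]} {A : Set (Fin (m + 2) → ℚ_[p])}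
    (h : PreGood f A) (ih : ∀ X : Set (Fin (m + 1) → ℚ_[p]), IsSubanalytic p X →
      HasDecomp (fun j : Fin 0 => j.elim0) X) : HasDecomp f A := by
  obtain ⟨D, γ, α, β, b₁, b₂, μ, n, a, δ, hn, hD, hγ, hα, hβ, hα0, hβ0, hA, hδ, ha, hF⟩ := h
  have hP : IsSubanalytic p (prj '' A) := by
    rw [hA]; exact prj_preC hn hD hα hβ hα0 hβ0
  obtain ⟨ℬ, hfin, hdis, hun, hg⟩ := ih _ hP
  refine ⟨(fun C => A ∩ prj ⁻¹' C) '' ℬ, hfin.image _, ?_, ?_, ?_⟩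
  · rintro _ ⟨C, hC, rfl⟩ _ ⟨C', hC', rfl⟩ hne
    have hCC : C ≠ C' := fun h => hne (by rw [h])
    have := hdis hC hC' hCC
    refine Set.disjoint_left.2 fun z hz hz' => ?_
    exact Set.disjoint_left.1 this hz.2 hz'.2
  · ext z
    constructor
    · rintro ⟨_, ⟨C, hC, rfl⟩, hz⟩
      exact hz.1
    · intro hz
      have : prj z ∈ ⋃₀ ℬ := by rw [hun]; exact ⟨z, hz, rfl⟩
      obtain ⟨C, hC, hzC⟩ := this
      exact ⟨_, ⟨C, hC, rfl⟩, hz, hzC⟩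
  · rintro _ ⟨C, hC, rfl⟩
    obtain ⟨γ', μ', n', -, -, hcell, -⟩ := hg C hC
    have hCs : C ⊆ prj '' A := by rw [← hun]; exact Set.subset_sUnion_of_mem hC
    refine ⟨γ, μ, n, a, δ, ?_, fun j => (hδ j).fn, ha, fun z hz => hF z hz.1⟩
    refine IsCell.succ hcell n hn μ α β γ hα.fn hβ.fn hγ.fn hα0 hβ0 b₁ b₂ _ ?_ ?_
    · ext z
      constructor
      · rintro ⟨h1, h2⟩
        rw [hA] at h1
        exact ⟨h2, h1.2⟩
      · rintro ⟨h1, h2⟩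
        refine ⟨?_, h1⟩
        obtain ⟨z', hz', he⟩ := hCs h1
        rw [hA] at hz' ⊢
        have h3 : prj z ∈ D := by
          have := hz'.1
          rw [he] at this
          exact this
        exact ⟨h3, h2⟩
    · ext x
      constructor
      · rintro ⟨z, hz, rfl⟩
        exact hz.2
      · intro hx
        obtain ⟨z, hz, rfl⟩ := hCs hx
        exact ⟨z, ⟨hz, hx⟩, rfl⟩

theorem decomp_union {m r : ℕ} {f : Fin r → (Fin (m + 1) → ℚ_[p]) → ℚ_[p]} {𝒜 : Set (Set (Fin (m + 1) → ℚ_[p]))}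
    (hfin : 𝒜.Finite) (hdis : 𝒜.PairwiseDisjoint id) (h : ∀ A ∈ 𝒜, HasDecomp f A) : HasDecomp f (⋃₀ 𝒜) := by
  choose! ℬ h1 h2 h3 h4 using h
  refine ⟨⋃ A ∈ 𝒜, ℬ A, hfin.biUnion h1, ?_, ?_, ?_⟩
  · intro C hC C' hC' hne
    simp only [Set.mem_iUnion] at hC hC'
    obtain ⟨A, hA, hC⟩ := hC
    obtain ⟨A', hA', hC'⟩ := hC'
    by_cases hAA : A = A'
    · subst hAA
      exact h2 A hA hC hC' hne
    · have hd : Disjoint A A' := hdis hA hA' hAA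
      refine hd.mono ?_ ?_
      · rw [← h3 A hA]; exact Set.subset_sUnion_of_mem hC
      · rw [← h3 A' hA']; exact Set.subset_sUnion_of_mem hC'
  · ext z
    constructor
    · rintro ⟨C, hC, hz⟩
      simp only [Set.mem_iUnion] at hC
      obtain ⟨A, hA, hC⟩ := hC
      refine ⟨A, hA, ?_⟩
      rw [← h3 A hA]
      exact ⟨C, hC, hz⟩
    · rintro ⟨A, hA, hz⟩
      rw [← h3 A hA] at hz
      obtain ⟨C, hC, hz⟩ := hz
      exact ⟨C, Set.mem_biUnion hA hC, hz⟩
  · intro C hC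
    simp only [Set.mem_iUnion] at hC
    obtain ⟨A, hA, hC⟩ := hC
    exact h4 A hA C hC

theorem decomp_all (m : ℕ) : ∀ (r : ℕ) (X : Set (Fin (m + 1) → ℚ_[p])), IsSubanalytic p X →
    ∀ f : Fin r → (Fin (m + 1) → ℚ_[p]) → ℚ_[p], (∀ j, IsSubanalyticFnOn p X (f j)) → HasDecomp f X := by
  induction m with
  | zero =>
    intro r X hX f hf
    obtain ⟨𝒜, h1, h2, h3, h4⟩ := pre_decomp hX hf
    exact ⟨𝒜, h1, h2, h3, fun A hA => good_zero (h4 A hA).1 (h4 A hA).2⟩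
  | succ m ih =>
    intro r X hX f hf
    obtain ⟨𝒜, h1, h2, h3, h4⟩ := pre_decomp hX hf
    rw [← h3]
    exact decomp_union h1 h2 fun A hA => good_succ (h4 A hA).2 fun Y hY => ih 0 Y hY _ fun j => j.elim0

end Part5
end PadicSub

open PadicSub in
/-- **Subanalytic cell decomposition** (Theorem 2.8 of the paper, over `ℚ_p`).  Given a
subanalytic set `X ⊆ ℚ_p^{m+1}` and subanalytic functions `f₁, …, f_r : X → ℚ_p`, there is
a finite partition of `X` into subanalytic cells `A` with center `γ : ℚ_p^m → ℚ_p` and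
coset `μ P_n` such that on `A`,
`|f_j(x,t)| = |δ_j(x)| · |(t - γ(x))^{a_j} μ^{-a_j}|^{1/n}` with `a_j ∈ ℤ` and
`δ_j : ℚ_p^m → ℚ_p` subanalytic (with the conventions `a_j = 0` and `0^0 = 1` when
`μ = 0`). -/
theorem subanalytic_cell_decomposition
    (p : ℕ) [Fact p.Prime] (m r : ℕ) (X : Set (Fin (m + 1) → ℚ_[p]))
    (hX : IsSubanalytic p X)
    (f : Fin r → (Fin (m + 1) → ℚ_[p]) → ℚ_[p])
    (hf : ∀ j, IsSubanalyticFnOn p X (f j)) :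
    ∃ (k : ℕ) (A : Fin k → Set (Fin (m + 1) → ℚ_[p]))
      (γ : Fin k → (Fin m → ℚ_[p]) → ℚ_[p]) (μ : Fin k → ℚ_[p]) (n : Fin k → ℕ)
      (a : Fin k → Fin r → ℤ) (δ : Fin k → Fin r → (Fin m → ℚ_[p]) → ℚ_[p]),
      (∀ c c', c ≠ c' → Disjoint (A c) (A c')) ∧ (⋃ c, A c) = X ∧
      (∀ c, IsCell p (A c) (γ c) (μ c) (n c)) ∧
      (∀ c j, IsSubanalyticFn p (δ c j)) ∧
      (∀ c j, μ c = 0 → a c j = 0) ∧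
      ∀ c, ∀ z ∈ A c, ∀ j,
        ‖f j z‖ = ‖δ c j (fun i : Fin m => z i.castSucc)‖ *
          ‖(z (Fin.last m) - γ c (fun i : Fin m => z i.castSucc)) ^ (a c j) *
            μ c ^ (-(a c j))‖ ^ ((n c : ℝ)⁻¹) := by
  obtain ⟨𝒜, hfin, hdis, hun, hg⟩ := decomp_all m r X hX f hf
  obtain ⟨k, ⟨e⟩⟩ := Finite.exists_equiv_fin (h := hfin.to_subtype) 𝒜
  choose γ μ n a δ h1 h2 h3 h4 using fun c : Fin k => hg (e.symm c).1 (e.symm c).2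
  refine ⟨k, fun c => (e.symm c).1, γ, μ, n, a, δ, ?_, ?_, h1, h2, h3, h4⟩
  · intro c c' hne
    exact hdis (e.symm c).2 (e.symm c').2 fun h => hne (e.symm.injective (Subtype.ext h))
  · rw [← hun]
    ext z
    constructor
    · intro hz
      obtain ⟨c, hc⟩ := Set.mem_iUnion.1 hz
      exact ⟨_, (e.symm c).2, hc⟩
    · rintro ⟨A, hA, hz⟩
      refine Set.mem_iUnion.2 ⟨e ⟨A, hA⟩, ?_⟩
      rw [Equiv.symm_apply_apply]
      exact hz
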